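/- (Iskovskikh–Manin: non-rationality of smooth sextic double solids, field version.) Let F ∈ ℂ[X₀,X₁,X₂,X₃] be a homogeneous polynomial of degree 6 such that the only common zero in ℂ⁴ of the partial derivatives ∂F/∂X₀,…,∂F/∂X₃ is the origin (the sextic surface F = 0 in P³ is smooth). Then the field of fractions K of the integral domain ℂ[x₁,x₂,x₃,w]/(w² − F(1,x₁,x₂,x₃)) is not purely transcendental over ℂ. -/

import Mathlib

open MvPolynomial

/-- The rational function field `ℂ(t₁,…,tₘ)`, realized as the field of fractions of the
polynomial ring over `ℂ` in `m` variables. -/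
abbrev CRatFunc (m : ℕ) : Type := FractionRing (MvPolynomial (Fin m) ℂ)

/-- A `ℂ`-algebra `K` is purely transcendental over `ℂ` if it is isomorphic as a `ℂ`-algebra
to `ℂ(t₁,…,tₘ)` for some `m ≥ 0`. -/
def IsPurelyTranscendental (K : Type*) [CommRing K] [Algebra ℂ K] : Prop :=
  ∃ m : ℕ, Nonempty (K ≃ₐ[ℂ] CRatFunc m)

/-- A `ℂ`-algebra `K` is unirational over `ℂ` if it admits a `ℂ`-algebra embedding into
`ℂ(t₁,…,tₘ)` for some `m`. -/
def IsUnirational (K : Type*) [CommRing K] [Algebra ℂ K] : Prop :=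
  ∃ (m : ℕ) (f : K →ₐ[ℂ] CRatFunc m), Function.Injective f

/-- A field `K` over `ℂ` is stably rational over `ℂ` if `K(u₁,…,uₙ)` is purely transcendental
over `ℂ` for some `n ≥ 0`. -/
def IsStablyRational (K : Type*) [Field K] [Algebra ℂ K] : Prop :=
  ∃ n : ℕ, IsPurelyTranscendental (FractionRing (MvPolynomial (Fin n) K))

/-- Dehomogenization at `X₀ = 1`: the image of `F ∈ ℂ[X₀,…,Xₙ]` under `X₀ ↦ 1`,
`X_{i+1} ↦ xᵢ`. -/
noncomputable def dehom {n : ℕ} (F : MvPolynomial (Fin (n + 1)) ℂ) : MvPolynomial (Fin n) ℂ :=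
  aeval (Fin.cases 1 X) F

/-! ### Divisorial ideals in regular local rings of dimension three are principal -/

section McCoy
variable {B : Type*} [CommRing B]

/-- McCoy: if `A` is injective on columns then no nonzero scalar kills all its minors. -/
theorem McCoy.minors_kill {r s : ℕ} (A : Matrix (Fin r) (Fin s) B)
    (hA : ∀ u : Fin s → B, A.mulVec u = 0 → u = 0) (a : B)
    (ha : ∀ f : Fin s → Fin r, a * (A.submatrix f id).det = 0) : a = 0 := by
  have key : ∀ k, k ≤ s → ∀ t, t + k = s → ∀ (f : Fin t → Fin r) (g : Fin t → Fin s),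
      a * (A.submatrix f g).det = 0 := by
    intro k
    induction k with
    | zero =>
      intro _ t ht f g
      obtain rfl : t = s := by omega
      by_cases hg : Function.Injective g
      · let e : Equiv.Perm (Fin t) := Equiv.ofBijective g (Finite.injective_iff_bijective.1 hg)
        have h1 : (A.submatrix f g) = (A.submatrix f id).submatrix id e := by
          ext i j; simp [e]
        rw [h1, Matrix.det_permute', mul_left_comm, ha, mul_zero]
      · have : ∃ i j, g i = g j ∧ i ≠ j := by
          simpa [Function.Injective] using hg
        obtain ⟨i, j, hij, hne⟩ := this
        rw [Matrix.det_zero_of_column_eq hne (by intro k; simp [hij]), mul_zero]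
    | succ k ih =>
      intro hk t ht f g
      by_cases hg : Function.Injective g
      · have : ∃ c, c ∉ Set.range g := by
          by_contra hcon
          push Not at hcon
          have := Fintype.card_le_of_surjective g (fun c => hcon c)
          simp at this
          omega
        obtain ⟨c, hc⟩ := this
        let g' : Fin (t + 1) → Fin s := Fin.cons c g
        have hg' : Function.Injective g' := by
          apply Fin.cons_injective_iff.2
          exact ⟨hc, hg⟩
        let cof : Fin (t + 1) → B := fun j =>
          a * ((-1) ^ (j : ℕ) * (A.submatrix f (g' ∘ j.succAbove)).det)
        let u : Fin s → B := fun q => ∑ j, if g' j = q then cof j else 0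
        have hu : A.mulVec u = 0 := by
          ext i
          have h := ih (by omega) (t + 1) (by omega) (Fin.cons i f) g'
          rw [Matrix.det_succ_row_zero] at h
          simp only [Matrix.mulVec, dotProduct, u, Finset.mul_sum, Pi.zero_apply]
          rw [Finset.sum_comm]
          rw [Finset.mul_sum] at h
          refine Eq.trans ?_ h
          refine Finset.sum_congr rfl fun j _ => ?_
          rw [Finset.sum_eq_single (g' j)]
          · simp only [if_true, cof, Matrix.submatrix_apply, Fin.cons_zero, Matrix.submatrix_submatrix]
            have : (Fin.cons i f : Fin (t+1) → Fin r) ∘ Fin.succ = f := by ext; simp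
            rw [this]; ring
          · intro q _ hq; rw [if_neg (Ne.symm hq), mul_zero]
          · simp
        have h0 := congrFun (hA u hu) c
        simp only [u, Pi.zero_apply] at h0
        rw [Finset.sum_eq_single 0] at h0
        · have h1 : g' ∘ Fin.succ = g := by ext; simp [g']
          simpa [g', cof, h1] using h0
        · intro j _ hj
          rw [if_neg]
          intro h
          exact hj (hg' (by simpa [g'] using h))
        · simp
      · have : ∃ i j, g i = g j ∧ i ≠ j := by
          simpa [Function.Injective] using hg
        obtain ⟨i, j, hij, hne⟩ := this
        rw [Matrix.det_zero_of_column_eq hne (by intro k; simp [hij]), mul_zero]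
  simpa using key s le_rfl 0 (by simp) Fin.elim0 Fin.elim0

/-- The linear functional `v ↦ det [v | A]` attached to a matrix with one more row than columns. -/
def Matrix.borderDet {s : ℕ} (A : Matrix (Fin (s + 1)) (Fin s) B) : (Fin (s + 1) → B) →ₗ[B] B where
  toFun v := (Matrix.of fun i => (Fin.cons (v i) (A i) : Fin (s + 1) → B)).det
  map_add' v w := by
    have h := Matrix.det_updateCol_add (Matrix.of fun i => (Fin.cons (v i) (A i) : Fin (s + 1) → B)) 0 v w
    convert h using 2
    · congr 1; ext i j; refine Fin.cases ?_ (fun j => ?_) j <;> simp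
    · congr 1; ext i j; refine Fin.cases ?_ (fun j => ?_) j <;> simp
    · congr 1; ext i j; refine Fin.cases ?_ (fun j => ?_) j <;> simp
  map_smul' c v := by
    have h := Matrix.det_updateCol_smul (Matrix.of fun i => (Fin.cons (v i) (A i) : Fin (s + 1) → B)) 0 c v
    convert h using 2
    · congr 1; ext i j; refine Fin.cases ?_ (fun j => ?_) j <;> simp
    · simp only [RingHom.id_apply, smul_eq_mul]; congr 2; ext i j; refine Fin.cases ?_ (fun j => ?_) j <;> simp

theorem Matrix.borderDet_col {s : ℕ} (A : Matrix (Fin (s + 1)) (Fin s) B) (j : Fin s) :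
    A.borderDet (fun i => A i j) = 0 := by
  show Matrix.det _ = 0
  exact Matrix.det_zero_of_column_eq (Fin.succ_ne_zero j) (by intro k; simp)

theorem McCoy.borderDet_kill {s : ℕ} (A : Matrix (Fin (s + 1)) (Fin s) B)
    (hA : ∀ u : Fin s → B, A.mulVec u = 0 → u = 0) (a : B)
    (ha : ∀ v, a * A.borderDet v = 0) : a = 0 := by
  apply McCoy.minors_kill A hA a
  intro f
  by_cases hf : Function.Injective f
  · have : ∃ c, c ∉ Set.range f := by
      by_contra hcon
      push Not at hcon
      have := Fintype.card_le_of_surjective f (fun c => hcon c)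
      simp at this
    obtain ⟨c, hc⟩ := this
    have hinj : Function.Injective (Fin.cons c f : Fin (s + 1) → Fin (s + 1)) :=
      Fin.cons_injective_iff.2 ⟨hc, hf⟩
    let e : Equiv.Perm (Fin (s + 1)) := Equiv.ofBijective _ (Finite.injective_iff_bijective.1 hinj)
    have h := ha (Pi.single c 1)
    have h2 : (Matrix.of fun i => (Fin.cons ((Pi.single c 1 : Fin (s+1) → B) i) (A i) : Fin (s + 1) → B)).submatrix e id
        = Matrix.of fun i => (Fin.cons ((Pi.single c 1 : Fin (s+1) → B) (e i)) (A (e i)) : Fin (s + 1) → B) := by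
      ext i j; simp
    have h3 : ((Matrix.of fun i => (Fin.cons ((Pi.single c 1 : Fin (s+1) → B) i) (A i) : Fin (s + 1) → B)).submatrix e id).det
        = (A.submatrix f id).det := by
      rw [h2, Matrix.det_succ_column_zero, Finset.sum_eq_single 0]
      · simp only [e, Matrix.of_apply, Fin.cons_zero, Equiv.ofBijective_apply, Pi.single_eq_same]
        simp only [Fin.val_zero, pow_zero, one_mul]
        congr 1
      · intro i _ hi
        obtain ⟨k, rfl⟩ := Fin.exists_succ_eq.2 hi
        have : f k ≠ c := fun h => hc ⟨k, h⟩
        simp [e, Pi.single_apply, this]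
      · simp
    rw [Matrix.det_permute] at h3
    rw [← h3, mul_left_comm]
    exact mul_eq_zero_of_right _ h
  · have : ∃ i j, f i = f j ∧ i ≠ j := by
      simpa [Function.Injective] using hf
    obtain ⟨i, j, hij, hne⟩ := this
    rw [Matrix.det_zero_of_row_eq hne (by ext k; simp [hij]), mul_zero]

end McCoy

section Koszul
variable {O : Type*} [CommRing O]

/-- Exactness of the Koszul complex of `(x, y, z)` on a submodule, in degree one. -/
def KoszulExact {N : Type*} [AddCommGroup N] [Module O N] (x y z : O) (K : Submodule O N) : Prop :=
  ∀ a ∈ K, ∀ b ∈ K, ∀ c ∈ K, x • a + y • b + z • c = 0 →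
    ∃ p ∈ K, ∃ q ∈ K, ∃ s ∈ K, a = y • p + z • q ∧ b = -(x • p) + z • s ∧ c = -(x • q) - y • s

/-- A minimal presentation of a finitely generated submodule over a local ring. -/
theorem exists_minimal_surjection [IsLocalRing O] {N : Type*} [AddCommGroup N] [Module O N]
    (K : Submodule O N) (hK : K.FG) :
    ∃ (r : ℕ) (j : (Fin r → O) →ₗ[O] N), LinearMap.range j = K ∧
      ∀ v, j v = 0 → ∀ i, v i ∈ IsLocalRing.maximalIdeal O := by
  classical
  have hex : ∃ (r : ℕ), ∃ (j : (Fin r → O) →ₗ[O] N), LinearMap.range j = K := by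
    obtain ⟨r, s, hs⟩ := Submodule.fg_iff_exists_fin_generating_family.1 hK
    exact ⟨r, Fintype.linearCombination O s, by rw [Fintype.range_linearCombination, hs]⟩
  obtain ⟨j, hj⟩ := Nat.find_spec hex
  refine ⟨Nat.find hex, j, hj, fun v hv i => ?_⟩
  by_contra hi
  have hu : IsUnit (v i) := by simpa using hi
  obtain ⟨k, hk⟩ : ∃ k, Nat.find hex = k + 1 := ⟨Nat.find hex - 1, by have := i.2; omega⟩
  have hmin : ¬ ∃ (j : (Fin k → O) →ₗ[O] N), LinearMap.range j = K :=
    Nat.find_min hex (by omega)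
  revert j hj v i
  rw [hk]
  intro j hj v hv i hi hu
  obtain ⟨u, hu⟩ := hu
  apply hmin
  let s : Fin (k + 1) → N := fun q => j (Pi.single q 1)
  have hjs : ∀ w, j w = ∑ q, w q • s q := by
    intro w
    conv_lhs => rw [← Finset.univ_sum_single w]
    rw [map_sum]
    refine Finset.sum_congr rfl fun q _ => ?_
    rw [← map_smul, ← Pi.single_smul]; simp
  refine ⟨Fintype.linearCombination O (s ∘ i.succAbove), le_antisymm ?_ ?_⟩
  · rw [Fintype.range_linearCombination, Submodule.span_le]
    rintro _ ⟨q, rfl⟩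
    rw [← hj]; exact ⟨_, rfl⟩
  · rw [← hj]
    rintro _ ⟨w, rfl⟩
    let w' : Fin (k + 1) → O := w - (w i * (↑u⁻¹ : O)) • v
    have h1 : j w' = j w := by simp [w', hv]
    have h2 : w' i = 0 := by simp [w', ← hu]
    refine ⟨w' ∘ i.succAbove, ?_⟩
    rw [← h1, hjs w', Fin.sum_univ_succAbove _ i, h2, zero_smul, zero_add]
    simp [Fintype.linearCombination_apply]

/-- Over a noetherian local ring with maximal ideal `(x, y, z)`, Koszul exactness gives freeness. -/
theorem KoszulExact.exists_basis [IsLocalRing O] [IsNoetherianRing O] {x y z : O}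
    (hm : IsLocalRing.maximalIdeal O = Ideal.span {x, y, z}) {N : Type*} [AddCommGroup N]
    [Module O N] (K : Submodule O N) (hK : K.FG) (hex : KoszulExact x y z K) :
    ∃ (s : ℕ) (l : (Fin s → O) →ₗ[O] N), LinearMap.range l = K ∧ Function.Injective l := by
  obtain ⟨s, l, hl, hmin⟩ := exists_minimal_surjection K hK
  refine ⟨s, l, hl, ?_⟩
  rw [← LinearMap.ker_eq_bot]
  apply Submodule.eq_bot_of_le_smul_of_le_jacobson_bot (IsLocalRing.maximalIdeal O) _
    (IsNoetherian.noetherian _) ?_ (IsLocalRing.maximalIdeal_le_jacobson _)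
  intro v hv
  have hv0 : l v = 0 := hv
  have hv1 := hmin v hv0
  have hdec : ∀ i, ∃ a b c, v i = x * a + y * b + z * c := by
    intro i
    have := hv1 i
    rw [hm, Ideal.mem_span_insert'] at this
    obtain ⟨a, ha⟩ := this
    obtain ⟨b, c, hbc⟩ := Ideal.mem_span_pair.1 ha
    exact ⟨-a, b, c, by linear_combination -hbc⟩
  choose a b c habc using hdec
  have hvabc : v = x • a + y • b + z • c := by ext i; simp [habc]
  have hmem : ∀ w, l w ∈ K := fun w => hl ▸ ⟨w, rfl⟩
  obtain ⟨p, hp, q, hq, t, ht, h1, h2, h3⟩ := hex _ (hmem a) _ (hmem b) _ (hmem c) (by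
    rw [hvabc] at hv0; simpa using hv0)
  rw [← hl] at hp hq ht
  obtain ⟨p, rfl⟩ := hp
  obtain ⟨q, rfl⟩ := hq
  obtain ⟨t, rfl⟩ := ht
  have hxm : x ∈ IsLocalRing.maximalIdeal O := by rw [hm]; exact Ideal.subset_span (by simp)
  have hym : y ∈ IsLocalRing.maximalIdeal O := by rw [hm]; exact Ideal.subset_span (by simp)
  have hzm : z ∈ IsLocalRing.maximalIdeal O := by rw [hm]; exact Ideal.subset_span (by simp)
  have : v = x • (a - (y • p + z • q)) + y • (b - (-(x • p) + z • t))
      + z • (c - (-(x • q) - y • t)) := by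
    rw [hvabc]; module
  rw [this]
  refine add_mem (add_mem ?_ ?_) ?_ <;> refine Submodule.smul_mem_smul (by assumption) ?_ <;>
    simp [LinearMap.mem_ker, h1, h2, h3]

/-- The colon ideal `(f : 𝔠)`. -/
def colonIdeal (f : O) (c : Set O) : Ideal O where
  carrier := {j | ∀ t ∈ c, f ∣ j * t}
  add_mem' := fun ha hb t ht => by rw [add_mul]; exact dvd_add (ha t ht) (hb t ht)
  zero_mem' := fun t _ => by simp
  smul_mem' := fun r a ha t ht => by
    rw [smul_eq_mul, mul_assoc]; exact Dvd.dvd.mul_left (ha t ht) r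

theorem colonIdeal_isPrincipal [IsDomain O] [IsLocalRing O] [IsNoetherianRing O] {x y z : O}
    (hm : IsLocalRing.maximalIdeal O = Ideal.span {x, y, z}) (hx : x ≠ 0)
    (hxy : ∀ a b, x * a = y * b → ∃ c, b = x * c)
    (hz : ∀ a, z * a ∈ Ideal.span {x, y} → a ∈ Ideal.span {x, y})
    (f : O) (hf : f ≠ 0) (𝔠 : Set O) :
    ∃ g, colonIdeal f 𝔠 = Ideal.span {g} := by
  have hxm : x ∈ IsLocalRing.maximalIdeal O := by rw [hm]; exact Ideal.subset_span (by simp)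
  have H1 : ∀ a b c, x * a + y * b + z * c = 0 → ∃ p q s, a = y * p + z * q ∧
      b = -(x * p) + z * s ∧ c = -(x * q) - y * s := by
    intro a b c h
    have h1 : z * c ∈ Ideal.span {x, y} :=
      Ideal.mem_span_pair.2 ⟨-a, -b, by linear_combination -h⟩
    obtain ⟨q, s, hqs⟩ := Ideal.mem_span_pair.1 (hz c h1)
    have h2 : x * (a + z * q) = y * (-(b + z * s)) := by linear_combination h + z * hqs
    obtain ⟨p, hp⟩ := hxy _ _ h2
    refine ⟨p, -q, -s, ?_, by linear_combination -hp, by linear_combination -hqs⟩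
    have : x * (a + z * q) = x * (y * p) := by rw [h2, hp]; ring
    linear_combination mul_left_cancel₀ hx this
  set J := colonIdeal f 𝔠 with hJ
  have hfJ : f ∈ J := fun t _ => Dvd.intro _ rfl
  have H2 : ∀ p ∈ J, ∀ q ∈ J, ∀ s ∈ J, y * p + z * q = 0 → x * p = z * s → x * q + y * s = 0 →
      ∃ t ∈ J, p = z * t ∧ q = -(y * t) ∧ s = x * t := by
    intro p hp q hq s hs h1 h2 h3
    obtain ⟨t, ht⟩ := hxy q (-s) (by linear_combination h3)
    have hst : s = x * (-t) := by linear_combination -ht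
    have hpt : p = z * (-t) := mul_left_cancel₀ hx (by rw [h2, hst]; ring)
    have hqt : q = -(y * (-t)) := mul_left_cancel₀ hx (by rw [hst] at h3; linear_combination h3)
    refine ⟨-t, ?_, hpt, hqt, hst⟩
    intro c hc
    obtain ⟨r, hr⟩ := hs c hc
    obtain ⟨r', hr'⟩ := hq c hc
    have : x * (-r') = y * r := mul_left_cancel₀ hf (by
      rw [hst] at hr; rw [hqt] at hr'; linear_combination x * hr' + y * hr)
    obtain ⟨e, he⟩ := hxy _ _ this
    exact ⟨e, mul_left_cancel₀ hx (by rw [hst] at hr; rw [he] at hr; linear_combination hr)⟩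
  obtain ⟨r, j, hjr, hjmin⟩ := exists_minimal_surjection (N := O) J (IsNoetherian.noetherian _)
  set K := LinearMap.ker j with hKdef
  have hKos : KoszulExact x y z K := by
    intro a ha b hb c hc h
    have hc1 : ∀ i, ∃ p q s, a i = y * p + z * q ∧ b i = -(x * p) + z * s ∧ c i = -(x * q) - y * s :=
      fun i => H1 _ _ _ (by simpa using congrFun h i)
    choose p q s h1 h2 h3 using hc1
    have e1 : a = y • p + z • q := by ext i; simp [h1]
    have e2 : b = -(x • p) + z • s := by ext i; simp [h2]
    have e3 : c = -(x • q) - y • s := by ext i; simp [h3]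
    have hjJ : ∀ w, j w ∈ J := fun w => hjr ▸ ⟨w, rfl⟩
    have k1 : j a = 0 := ha
    have k2 : j b = 0 := hb
    have k3 : j c = 0 := hc
    rw [e1] at k1; rw [e2] at k2; rw [e3] at k3
    simp only [map_add, map_smul, map_neg, map_sub, smul_eq_mul] at k1 k2 k3
    obtain ⟨t, ht, t1, t2, t3⟩ := H2 (j p) (hjJ p) (j q) (hjJ q) (j s) (hjJ s) k1
      (by linear_combination -k2) (by linear_combination -k3)
    rw [← hjr] at ht
    obtain ⟨t, rfl⟩ := ht
    refine ⟨p - z • t, ?_, q + y • t, ?_, s - x • t, ?_, ?_, ?_, ?_⟩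
    · simp [hKdef, LinearMap.mem_ker, t1]
    · simp [hKdef, LinearMap.mem_ker, t2]
    · simp [hKdef, LinearMap.mem_ker, t3]
    · rw [e1]; module
    · rw [e2]; module
    · rw [e3]; module
  obtain ⟨s, l, hl, hlinj⟩ := hKos.exists_basis hm K (IsNoetherian.noetherian _)
  have hrank : s + 1 = r := by
    have h1 := Submodule.finrank_quotient_add_finrank (LinearMap.ker j)
    rw [j.quotKerEquivRange.finrank_eq] at h1
    have h2 : Module.finrank O (LinearMap.ker j) = s := by
      rw [← hKdef, ← hl, LinearMap.finrank_range_of_inj hlinj, Module.finrank_fin_fun]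
    have h3 : Module.finrank O (LinearMap.range j) = 1 := by
      rw [hjr]
      refine le_antisymm (by simpa using Submodule.finrank_le J) ?_
      have : Nontrivial J := ⟨⟨⟨f, hfJ⟩, 0, fun h => hf (congrArg Subtype.val h)⟩⟩
      exact Module.finrank_pos
    rw [h2, h3, Module.finrank_fin_fun] at h1
    omega
  subst hrank
  let A : Matrix (Fin (s + 1)) (Fin s) O := LinearMap.toMatrix' l
  have hAl : ∀ u, A.mulVec u = l u := fun u => LinearMap.toMatrix'_mulVec l u
  have hker : ∀ v, j v = 0 → A.borderDet v = 0 := by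
    intro v hv
    have : v ∈ K := hv
    rw [← hl] at this
    obtain ⟨u, rfl⟩ := this
    have : l u = ∑ i, u i • (fun q => A q i) := by
      rw [← hAl]; ext q; simp [Matrix.mulVec, dotProduct, mul_comm]
    rw [this, map_sum]
    exact Finset.sum_eq_zero fun i _ => by rw [map_smul, A.borderDet_col, smul_zero]
  have hprop : ∀ v w, j v * A.borderDet w = j w * A.borderDet v := by
    intro v w
    have := hker (j v • w - j w • v) (by simp [mul_comm])
    rw [map_sub, map_smul, map_smul, smul_eq_mul, smul_eq_mul] at this
    linear_combination this
  have hmc : ∀ a b, b ≠ 0 → (∀ v, b ∣ a * A.borderDet v) → b ∣ a := by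
    intro a b hb h
    let π := Ideal.Quotient.mk (Ideal.span {b})
    have hπ : ∀ c, π c = 0 ↔ b ∣ c := fun c => by
      rw [Ideal.Quotient.eq_zero_iff_mem, Ideal.mem_span_singleton]
    rw [← hπ]
    have hbd : ∀ v, (A.map π).borderDet (fun i => π (v i)) = π (A.borderDet v) := by
      intro v
      show Matrix.det _ = π (Matrix.det _)
      rw [RingHom.map_det]
      congr 1; ext i k; refine Fin.cases ?_ (fun k => ?_) k <;> simp
    apply McCoy.borderDet_kill (A.map π)
    · intro u hu
      choose u' hu' using fun i => Ideal.Quotient.mk_surjective (u i)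
      have : ∀ q, b ∣ l u' q := by
        intro q
        rw [← hπ, ← hAl]
        have := congrFun hu q
        simpa [Matrix.mulVec, dotProduct, ← hu'] using this
      choose v hv using this
      have hv' : l u' = b • v := by ext q; simp [hv]
      have hjv : j v = 0 := by
        have : j (l u') = 0 := by
          have : l u' ∈ K := hl ▸ ⟨u', rfl⟩
          exact this
        rw [hv', map_smul, smul_eq_mul] at this
        exact (mul_eq_zero.1 this).resolve_left hb
      have : v ∈ K := hjv
      rw [← hl] at this
      obtain ⟨w, rfl⟩ := this
      rw [← map_smul] at hv'
      have := hlinj hv'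
      ext i
      rw [← hu' i, this]
      simp only [Pi.smul_apply, Pi.zero_apply]
      exact (hπ _).2 (Dvd.intro _ rfl)
    · intro v
      choose v' hv' using fun i => Ideal.Quotient.mk_surjective (v i)
      have h1 : v = fun i => π (v' i) := by ext i; exact (hv' i).symm
      rw [h1, hbd, ← map_mul, hπ]
      exact h v'
  have hne : ∃ w, A.borderDet w ≠ 0 := by
    by_contra hcon
    push Not at hcon
    have : x ∣ 1 := hmc 1 x hx (fun v => by rw [hcon]; simp)
    exact (IsLocalRing.mem_maximalIdeal x).1 hxm (isUnit_of_dvd_one this)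
  obtain ⟨w, hw⟩ := hne
  obtain ⟨g, hg⟩ := hmc (j w) (A.borderDet w) hw (fun v => ⟨j v, by rw [← hprop v w]; ring⟩)
  have hjg : ∀ v, j v = g * A.borderDet v := by
    intro v
    apply mul_right_cancel₀ hw
    rw [hprop v w, hg]; ring
  refine ⟨g, le_antisymm ?_ ?_⟩
  · intro t ht
    rw [← hjr] at ht
    obtain ⟨v, rfl⟩ := ht
    rw [hjg, Ideal.mem_span_singleton]
    exact Dvd.intro _ rfl
  · rw [Ideal.span_singleton_le_iff_mem]
    intro t ht
    apply hmc _ _ hf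
    intro v
    have : j v ∈ J := hjr ▸ ⟨v, rfl⟩
    have := this t ht
    rw [hjg] at this
    convert this using 1; ring

end Koszul

/-! ### Gradings given by a coaction -/

/-- An `ℕ`-grading of a ring, encoded by the coaction `a ↦ ∑ aₖ Tᵏ`. -/
structure Coaction (A : Type*) [CommRing A] where
  /-- the coaction map -/
  toHom : A →+* Polynomial A
  eval_one : ∀ a, (toHom a).eval 1 = a
  coassoc : ∀ a k, toHom ((toHom a).coeff k) = Polynomial.monomial k ((toHom a).coeff k)

namespace Coaction
variable {A : Type*} [CommRing A] (D : Coaction A)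

/-- Homogeneous of degree `n`. -/
def Hom (n : ℕ) (a : A) : Prop := D.toHom a = Polynomial.monomial n a

/-- The component of degree `n`. -/
noncomputable def comp (n : ℕ) (a : A) : A := (D.toHom a).coeff n

variable {D}

theorem hom_comp (n : ℕ) (a : A) : D.Hom n (D.comp n a) := D.coassoc a n

theorem comp_add (n : ℕ) (a b : A) : D.comp n (a + b) = D.comp n a + D.comp n b := by
  simp [comp]

theorem comp_sum {ι : Type*} (s : Finset ι) (n : ℕ) (f : ι → A) :
    D.comp n (∑ i ∈ s, f i) = ∑ i ∈ s, D.comp n (f i) := by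
  simp [comp, Polynomial.finsetSum_coeff]

theorem sum_comp (a : A) : ∑ k ∈ Finset.range ((D.toHom a).natDegree + 1), D.comp k a = a := by
  conv_rhs => rw [← D.eval_one a, Polynomial.eval_eq_sum_range]
  simp [comp]

theorem Hom.comp_self {n : ℕ} {a : A} (h : D.Hom n a) : D.comp n a = a := by
  rw [comp, h]; simp

theorem Hom.zero (n : ℕ) : D.Hom n 0 := by simp [Hom]

theorem Hom.add {n : ℕ} {a b : A} (ha : D.Hom n a) (hb : D.Hom n b) : D.Hom n (a + b) := by
  simp only [Hom] at *; simp [ha, hb]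

theorem Hom.sub {n : ℕ} {a b : A} (ha : D.Hom n a) (hb : D.Hom n b) : D.Hom n (a - b) := by
  simp only [Hom] at *; simp [ha, hb]

theorem Hom.mul {n m : ℕ} {a b : A} (ha : D.Hom n a) (hb : D.Hom m b) : D.Hom (n + m) (a * b) := by
  simp only [Hom] at *; simp [ha, hb, Polynomial.monomial_mul_monomial]

theorem Hom.one : D.Hom 0 1 := by simp [Hom]

theorem Hom.pow {n : ℕ} {a : A} (ha : D.Hom n a) (k : ℕ) : D.Hom (k * n) (a ^ k) := by
  induction k with
  | zero => simpa using Hom.one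
  | succ k ih => rw [pow_succ, add_mul, one_mul]; exact ih.mul ha

theorem comp_mul_hom {m : ℕ} {b : A} (hb : D.Hom m b) (n : ℕ) (a : A) :
    D.comp (n + m) (a * b) = D.comp n a * b := by
  have hb' : D.toHom b = Polynomial.monomial m b := hb
  simp only [comp, map_mul, hb', Polynomial.coeff_mul_monomial]

theorem comp_mul_hom_of_lt {m : ℕ} {b : A} (hb : D.Hom m b) {n : ℕ} (hn : n < m) (a : A) :
    D.comp n (a * b) = 0 := by
  have hb' : D.toHom b = Polynomial.monomial m b := hb
  simp only [comp, map_mul, hb', ← Polynomial.C_mul_X_pow_eq_monomial, ← mul_assoc]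
  rw [Polynomial.coeff_mul_X_pow', if_neg (by omega)]

theorem Hom.of_mul [IsDomain A] {n : ℕ} {a b : A} (h : D.Hom n (a * b)) (hab : a * b ≠ 0) :
    ∃ m k, m + k = n ∧ D.Hom m a ∧ D.Hom k b := by
  have ha : a ≠ 0 := left_ne_zero_of_mul hab
  have hb : b ≠ 0 := right_ne_zero_of_mul hab
  have hne : ∀ c, c ≠ 0 → D.toHom c ≠ 0 := fun c hc h => hc (by rw [← D.eval_one c, h]; simp)
  have h' : D.toHom a * D.toHom b = Polynomial.monomial n (a * b) := by rw [← map_mul]; exact h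
  have h1 := Polynomial.natDegree_mul (hne a ha) (hne b hb)
  have h2 := Polynomial.natTrailingDegree_mul (hne a ha) (hne b hb)
  rw [h', Polynomial.natDegree_monomial_eq _ hab] at h1
  rw [h', Polynomial.natTrailingDegree_monomial hab] at h2
  have h3 := Polynomial.natTrailingDegree_le_natDegree (D.toHom a)
  have h4 := Polynomial.natTrailingDegree_le_natDegree (D.toHom b)
  have key : ∀ c, (D.toHom c).natTrailingDegree = (D.toHom c).natDegree →
      D.Hom (D.toHom c).natDegree c := by
    intro c hc
    have hmon : D.toHom c = Polynomial.monomial (D.toHom c).natDegree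
        ((D.toHom c).coeff (D.toHom c).natDegree) := by
      ext k
      rw [Polynomial.coeff_monomial]
      split_ifs with hk
      · rw [hk]
      · rcases lt_or_gt_of_ne hk with hk | hk
        · exact Polynomial.coeff_eq_zero_of_natDegree_lt hk
        · exact Polynomial.coeff_eq_zero_of_lt_natTrailingDegree (by omega)
    have h5 := D.eval_one c
    rw [hmon] at h5
    simp only [Polynomial.eval_monomial, one_pow, mul_one] at h5
    rw [Hom]
    conv_lhs => rw [hmon]
    rw [h5]
  exact ⟨_, _, h1.symm, key a (by omega), key b (by omega)⟩

end Coaction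

/-! ### The standard grading of a polynomial ring -/

section MvPoly
variable {σ k : Type*} [CommRing k]

theorem MvPolynomial.coeff_aeval_X_mul_T (p : MvPolynomial σ k) (n : ℕ) :
    (aeval (fun i => Polynomial.C (X i : MvPolynomial σ k) * Polynomial.X) p :
      Polynomial (MvPolynomial σ k)).coeff n = homogeneousComponent n p := by
  classical
  induction p using MvPolynomial.induction_on' with
  | monomial d a =>
    have : (aeval (fun i => Polynomial.C (X i : MvPolynomial σ k) * Polynomial.X) (monomial d a) :
      Polynomial (MvPolynomial σ k)) = Polynomial.monomial d.degree (monomial d a) := by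
      rw [aeval_monomial, Finsupp.prod]
      simp only [mul_pow, Finset.prod_mul_distrib, ← Polynomial.C_pow, ← map_prod]
      rw [Finset.prod_pow_eq_pow_sum, ← mul_assoc, ← Polynomial.C_mul_X_pow_eq_monomial, monomial_eq]
      congr 1
      rw [Polynomial.C_mul]; rfl
    rw [this, Polynomial.coeff_monomial]
    ext e
    rw [coeff_homogeneousComponent]
    by_cases h : d = e
    · subst h; split_ifs <;> simp
    · split_ifs <;> simp [h]
  | add p q hp hq => simp [hp, hq]

/-- The standard grading of a polynomial ring. -/
noncomputable def MvPolynomial.grading (σ k : Type*) [CommRing k] : Coaction (MvPolynomial σ k) where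
  toHom := (aeval (fun i => Polynomial.C (X i : MvPolynomial σ k) * Polynomial.X) :
      MvPolynomial σ k →ₐ[k] Polynomial (MvPolynomial σ k)).toRingHom
  eval_one a := by
    have : ((Polynomial.aeval (1 : MvPolynomial σ k)).restrictScalars k).comp
      (aeval (fun i => Polynomial.C (X i : MvPolynomial σ k) * Polynomial.X)) = AlgHom.id k _ := by
      ext i; simp
    simpa [Polynomial.aeval_def] using DFunLike.congr_fun this a
  coassoc a n := by
    ext m
    simp only [AlgHom.toRingHom_eq_coe, RingHom.coe_coe, coeff_aeval_X_mul_T]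
    rw [Polynomial.coeff_monomial,
      homogeneousComponent_of_mem (homogeneousComponent_mem n a)]
    simp [eq_comm]

theorem MvPolynomial.grading_comp (p : MvPolynomial σ k) (n : ℕ) :
    (grading σ k).comp n p = homogeneousComponent n p := coeff_aeval_X_mul_T p n

theorem MvPolynomial.grading_hom {p : MvPolynomial σ k} {n : ℕ} :
    (grading σ k).Hom n p ↔ p.IsHomogeneous n := by
  constructor
  · intro h
    rw [← h.comp_self, grading_comp]
    exact homogeneousComponent_isHomogeneous n p
  · intro h
    ext1 m
    have := grading_comp p m
    rw [Coaction.comp] at this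
    rw [this, homogeneousComponent_of_mem h, Polynomial.coeff_monomial]
    simp [eq_comm]

theorem MvPolynomial.IsHomogeneous.of_mul [IsDomain k] {n : ℕ} {a b : MvPolynomial σ k}
    (h : (a * b).IsHomogeneous n) (hab : a * b ≠ 0) :
    ∃ m l, m + l = n ∧ a.IsHomogeneous m ∧ b.IsHomogeneous l := by
  obtain ⟨m, l, h1, h2, h3⟩ := (grading_hom.2 h).of_mul hab
  exact ⟨m, l, h1, grading_hom.1 h2, grading_hom.1 h3⟩

theorem MvPolynomial.IsHomogeneous.of_dvd [IsDomain k] {n : ℕ} {a b : MvPolynomial σ k}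
    (h : b.IsHomogeneous n) (hb : b ≠ 0) (hab : a ∣ b) : ∃ m ≤ n, a.IsHomogeneous m := by
  obtain ⟨c, rfl⟩ := hab
  obtain ⟨m, l, h1, h2, h3⟩ := h.of_mul hb
  exact ⟨m, by omega, h2⟩

theorem MvPolynomial.IsHomogeneous.of_pow [IsDomain k] {n e : ℕ} (he : e ≠ 0) {a : MvPolynomial σ k}
    (h : (a ^ e).IsHomogeneous (e * n)) : a.IsHomogeneous n := by
  by_cases ha : a = 0
  · rw [ha]; exact isHomogeneous_zero _ _ _
  obtain ⟨m, -, hm⟩ := h.of_dvd (pow_ne_zero _ ha) (dvd_pow_self a he)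
  have := (hm.pow e).inj_right h (pow_ne_zero _ ha)
  rw [mul_comm] at this
  rwa [← Nat.eq_of_mul_eq_mul_left (Nat.pos_of_ne_zero he) this]

end MvPoly

/-! ### The graded coordinate ring `ℂ[X₀,…,X₃,W]/(W² - F)` -/

/-- The polynomial ring in four variables. -/
abbrev Poly4 : Type := MvPolynomial (Fin 4) ℂ
/-- The polynomial ring in three variables. -/
abbrev Poly3 : Type := MvPolynomial (Fin 3) ℂ
/-- The polynomial ring in two variables. -/
abbrev Poly2 : Type := MvPolynomial (Fin 2) ℂ

/-- The coordinate ring of the cone over the double solid, `W² = F`. -/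
abbrev DRing (F : Poly4) : Type := QuadraticAlgebra Poly4 F 0

namespace DRing
variable {F : Poly4}

/-- The square root of `F`. -/
noncomputable def W (F : Poly4) : DRing F := ⟨0, 1⟩

/-- The inclusion of the polynomial ring. -/
noncomputable def inc (F : Poly4) : Poly4 →ₐ[ℂ] DRing F where
  toFun p := ⟨p, 0⟩
  map_one' := rfl
  map_mul' p q := by ext <;> simp
  map_zero' := rfl
  map_add' p q := by ext <;> simp
  commutes' r := rfl

@[simp] theorem inc_re (p : Poly4) : (inc F p).re = p := rfl
@[simp] theorem inc_im (p : Poly4) : (inc F p).im = 0 := rfl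
@[simp] theorem W_re : (W F).re = 0 := rfl
@[simp] theorem W_im : (W F).im = 1 := rfl

theorem eq_inc_add (r : DRing F) : r = inc F r.re + W F * inc F r.im := by
  ext <;> simp

theorem W_sq : W F ^ 2 = inc F F := by
  rw [pow_two]; ext <;> simp

variable {A : Type*} [CommRing A] [Algebra ℂ A]

/-- Evaluation of the coordinate ring at a point of the cone. -/
noncomputable def evalHom (x : Fin 4 → A) (w : A) (h : w ^ 2 = aeval x F) : DRing F →ₐ[ℂ] A where
  toFun r := aeval x r.re + w * aeval x r.im
  map_one' := by simp [QuadraticAlgebra.re_one, QuadraticAlgebra.im_one]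
  map_mul' r s := by
    simp only [QuadraticAlgebra.re_mul, QuadraticAlgebra.im_mul, map_add, map_mul, map_zero]
    linear_combination (-(aeval x r.im) * aeval x s.im) * h
  map_zero' := by simp
  map_add' r s := by simp; ring
  commutes' c := by
    change aeval x (algebraMap ℂ Poly4 c) + w * aeval x 0 = _
    simp

theorem evalHom_apply (x : Fin 4 → A) (w : A) (h : w ^ 2 = aeval x F) (r : DRing F) :
    evalHom x w h r = aeval x r.re + w * aeval x r.im := rfl

@[simp] theorem evalHom_inc (x : Fin 4 → A) (w : A) (h : w ^ 2 = aeval x F) (p : Poly4) :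
    evalHom x w h (inc F p) = aeval x p := by simp [evalHom_apply]

@[simp] theorem evalHom_W (x : Fin 4 → A) (w : A) (h : w ^ 2 = aeval x F) :
    evalHom x w h (W F) = w := by simp [evalHom_apply]

theorem algHom_ext' {f g : DRing F →ₐ[ℂ] A} (h : ∀ i, f (inc F (X i)) = g (inc F (X i)))
    (hW : f (W F) = g (W F)) : f = g := by
  have : f.comp (inc F) = g.comp (inc F) := by
    ext i; exact h i
  ext r
  rw [eq_inc_add r, map_add, map_mul, map_add, map_mul, hW]
  have h1 := DFunLike.congr_fun this r.re
  have h2 := DFunLike.congr_fun this r.im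
  simp only [AlgHom.comp_apply] at h1 h2
  rw [h1, h2]

theorem eq_evalHom (f : DRing F →ₐ[ℂ] A) :
    ∃ h, f = evalHom (fun i => f (inc F (X i))) (f (W F)) h := by
  have h : (f (W F)) ^ 2 = aeval (fun i => f (inc F (X i))) F := by
    rw [← map_pow, W_sq]
    have : f.comp (inc F) = aeval (fun i => f (inc F (X i))) := by ext i; simp
    exact DFunLike.congr_fun this F
  exact ⟨h, algHom_ext' (by simp) (by simp)⟩

theorem coeff_evalHom_T (h) (r : DRing F) (n : ℕ) :
    (evalHom (A := Polynomial (DRing F))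
      (fun i => Polynomial.C (inc F (X i)) * Polynomial.X)
      (Polynomial.C (W F) * Polynomial.X ^ 3) h r).coeff n =
      inc F (homogeneousComponent n r.re) +
        W F * inc F (if 3 ≤ n then homogeneousComponent (n - 3) r.im else 0) := by
  have key : ∀ p : Poly4, ∀ m, (aeval (fun i => Polynomial.C (inc F (X i)) * Polynomial.X) p :
      Polynomial (DRing F)).coeff m = inc F (homogeneousComponent m p) := by
    intro p m
    rw [← coeff_aeval_X_mul_T]
    have : (aeval (fun i => Polynomial.C (inc F (X i)) * Polynomial.X) :
        Poly4 →ₐ[ℂ] Polynomial (DRing F)) = (Polynomial.mapAlgHom (inc F)).comp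
          (aeval (fun i => Polynomial.C (X i) * Polynomial.X)) := by
      ext i : 1; simp
    rw [this]; simp
  rw [evalHom_apply, Polynomial.coeff_add, key, mul_assoc, Polynomial.coeff_C_mul,
    Polynomial.coeff_X_pow_mul']
  split_ifs
  · rw [key]
  · simp

/-- The grading with weights `1` for `Xᵢ` and `3` for `W`. -/
noncomputable def grading (hF : F.IsHomogeneous 6) : Coaction (DRing F) :=
  have h : (Polynomial.C (W F) * Polynomial.X ^ 3) ^ 2 =
      aeval (fun i => Polynomial.C (inc F (X i)) * Polynomial.X) F := by
    have h1 := (MvPolynomial.grading_hom (σ := Fin 4) (k := ℂ)).2 hF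
    have : (aeval (fun i => Polynomial.C (inc F (X i)) * Polynomial.X) :
        Poly4 →ₐ[ℂ] Polynomial (DRing F)) = (Polynomial.mapAlgHom (inc F)).comp
          (aeval (fun i => Polynomial.C (X i) * Polynomial.X)) := by
      ext i : 1; simp
    have h2 : aeval (fun i => Polynomial.C (X i) * Polynomial.X) F = Polynomial.monomial 6 F := h1
    rw [this, AlgHom.comp_apply, h2, mul_pow, ← Polynomial.C_pow, W_sq, ← pow_mul]
    simp [Polynomial.C_mul_X_pow_eq_monomial]
  { toHom := (evalHom (A := Polynomial (DRing F))
      (fun i => Polynomial.C (inc F (X i)) * Polynomial.X)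
      (Polynomial.C (W F) * Polynomial.X ^ 3) h).toRingHom
    eval_one := by
      intro a
      have : ((Polynomial.aeval (1 : DRing F)).restrictScalars ℂ).comp
          (evalHom (A := Polynomial (DRing F))
            (fun i => Polynomial.C (inc F (X i)) * Polynomial.X)
            (Polynomial.C (W F) * Polynomial.X ^ 3) h) = AlgHom.id ℂ _ := by
        apply algHom_ext' <;> simp
      simpa [Polynomial.aeval_def] using DFunLike.congr_fun this a
    coassoc := by
      intro a n
      ext1 m
      simp only [AlgHom.toRingHom_eq_coe, RingHom.coe_coe, coeff_evalHom_T,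
        Polynomial.coeff_monomial]
      simp only [QuadraticAlgebra.re_add, inc_re, QuadraticAlgebra.re_mul, W_re, inc_im,
        QuadraticAlgebra.im_add, QuadraticAlgebra.im_mul, W_im]
      simp only [mul_zero, zero_mul, add_zero, zero_add, one_mul]
      rw [homogeneousComponent_of_mem (homogeneousComponent_mem n _)]
      by_cases hnm : n = m
      · subst hnm
        simp only [if_true]
        split_ifs with h3
        · rw [homogeneousComponent_of_mem (homogeneousComponent_mem _ _)]; simp
        · simp
      · rw [if_neg (Ne.symm hnm), if_neg hnm]
        split_ifs with h3 h4
        · rw [homogeneousComponent_of_mem (homogeneousComponent_mem _ _), if_neg (by omega)]; simp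
        · simp
        · simp }

theorem grading_comp (hF : F.IsHomogeneous 6) (r : DRing F) (n : ℕ) :
    (grading hF).comp n r = ⟨homogeneousComponent n r.re,
      if 3 ≤ n then homogeneousComponent (n - 3) r.im else 0⟩ := by
  have := coeff_evalHom_T (by
    have := (grading hF).toHom.map_pow (W F) 2
    rw [W_sq] at this
    simpa [grading] using this.symm) r n
  refine Eq.trans this ?_
  ext <;> simp

theorem hom_iff (hF : F.IsHomogeneous 6) {r : DRing F} {n : ℕ} :
    (grading hF).Hom n r ↔
      r.re.IsHomogeneous n ∧ (r.im = 0 ∨ ∃ k, k + 3 = n ∧ r.im.IsHomogeneous k) := by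
  constructor
  · intro h
    have h1 := h.comp_self
    rw [grading_comp] at h1
    have e1 := congrArg QuadraticAlgebra.re h1
    have e2 := congrArg QuadraticAlgebra.im h1
    simp only at e1 e2
    refine ⟨e1 ▸ homogeneousComponent_isHomogeneous _ _, ?_⟩
    by_cases h3 : 3 ≤ n
    · rw [if_pos h3] at e2
      exact Or.inr ⟨n - 3, by omega, e2 ▸ homogeneousComponent_isHomogeneous _ _⟩
    · rw [if_neg h3] at e2; exact Or.inl e2.symm
  · rintro ⟨h1, h2⟩
    have : (grading hF).comp n r = r := by
      rw [grading_comp]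
      ext1
      · exact homogeneousComponent_eq_self h1
      · rcases h2 with h2 | ⟨k, rfl, h2⟩
        · simp [h2]
        · simp [homogeneousComponent_eq_self h2]
    rw [← this]; exact Coaction.hom_comp n r

theorem hom_inc (hF : F.IsHomogeneous 6) {p : Poly4} {n : ℕ} (h : p.IsHomogeneous n) :
    (grading hF).Hom n (inc F p) := (hom_iff hF).2 ⟨h, Or.inl rfl⟩

theorem hom_W (hF : F.IsHomogeneous 6) : (grading hF).Hom 3 (W F) :=
  (hom_iff hF).2 ⟨isHomogeneous_zero _ _ _, Or.inr ⟨0, rfl, isHomogeneous_one _ _⟩⟩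

/-- Evaluation at homogeneous elements of a polynomial ring is graded. -/
theorem Hom.evalHom {hF : F.IsHomogeneous 6} {r : DRing F} {n : ℕ} (hr : (grading hF).Hom n r)
    {σ : Type*} {x : Fin 4 → MvPolynomial σ ℂ} {w : MvPolynomial σ ℂ} {M : ℕ}
    (hx : ∀ i, (x i).IsHomogeneous M) (hw : w.IsHomogeneous (3 * M)) (h : w ^ 2 = aeval x F) :
    (DRing.evalHom x w h r).IsHomogeneous (n * M) := by
  obtain ⟨h1, h2⟩ := (hom_iff hF).1 hr
  rw [evalHom_apply]
  refine IsHomogeneous.add (by rw [mul_comm]; exact h1.aeval _ hx) ?_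
  rcases h2 with h2 | ⟨k, rfl, h2⟩
  · rw [h2]; simp [isHomogeneous_zero]
  · rw [add_mul, add_comm]
    exact hw.mul (by rw [mul_comm]; exact h2.aeval _ hx)

instance : IsNoetherianRing (DRing F) :=
  IsNoetherianRing.of_finite Poly4 (DRing F)

instance : Algebra.FiniteType ℂ (DRing F) := by
  refine Algebra.FiniteType.of_surjective (aeval (R := ℂ)
    (fun i : Option (Fin 4) => i.elim (W F) (fun i => inc F (X i)))) ?_
  intro r
  have : ∀ p : Poly4, ∃ q, (aeval (R := ℂ)
    (fun i : Option (Fin 4) => i.elim (W F) (fun i => inc F (X i)))) q = inc F p := by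
    intro p
    refine ⟨rename some p, ?_⟩
    rw [aeval_rename]
    have : inc F = aeval (fun i => inc F (X i)) := by ext i : 1; simp
    conv_rhs => rw [this]
    rfl
  obtain ⟨q1, h1⟩ := this r.re
  obtain ⟨q2, h2⟩ := this r.im
  refine ⟨q1 + X none * q2, ?_⟩
  rw [map_add, map_mul, h1, h2, aeval_X]
  exact (eq_inc_add r).symm

/-- The Nullstellensatz for the cone, at the vertex. -/
theorem exists_pow_mem_of_forall_point (I : Ideal (DRing F))
    (h : ∀ (a : Fin 4 → ℂ) (b : ℂ) (hab : b ^ 2 = aeval a F), a ≠ 0 →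
      ∃ r ∈ I, evalHom a b hab r ≠ 0) (k : Fin 4) : ∃ n, inc F (X k) ^ n ∈ I := by
  have hJ : IsJacobsonRing (DRing F) := isJacobsonRing_of_finiteType (A := ℂ)
  rw [← Ideal.mem_radical_iff, Ideal.radical_eq_jacobson, Ideal.jacobson, Submodule.mem_sInf]
  rintro m ⟨hIm, hm⟩
  let _ : Field (DRing F ⧸ m) := Ideal.Quotient.field m
  have hfin : Module.Finite ℂ (DRing F ⧸ m) := finite_of_finite_type_of_isJacobsonRing ℂ _
  have hbij := IsAlgClosed.algebraMap_bijective_of_isIntegral (k := ℂ) (K := DRing F ⧸ m)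
  let e : ℂ ≃ₐ[ℂ] (DRing F ⧸ m) := AlgEquiv.ofBijective (Algebra.ofId ℂ _) hbij
  let f : DRing F →ₐ[ℂ] ℂ := (e.symm : (DRing F ⧸ m) →ₐ[ℂ] ℂ).comp (Ideal.Quotient.mkₐ ℂ m)
  have hf : ∀ r ∈ m, f r = 0 := by
    intro r hr
    have : Ideal.Quotient.mk m r = 0 := Ideal.Quotient.eq_zero_iff_mem.2 hr
    simp [f, this]
  have hf' : ∀ r, f r = 0 → r ∈ m := by
    intro r hr
    have : Ideal.Quotient.mkₐ ℂ m r = 0 := by simpa [f] using hr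
    exact Ideal.Quotient.eq_zero_iff_mem.1 this
  obtain ⟨hab, hfe⟩ := eq_evalHom f
  by_cases ha : (fun i => f (inc F (X i))) = 0
  · exact hf' _ (congrFun ha k)
  · obtain ⟨r, hr, hne⟩ := h _ _ hab ha
    rw [← hfe] at hne
    exact absurd (hf r (hIm hr)) hne

end DRing

/-! ### Local factoriality of the cone away from its vertex -/

section Localize
variable {R : Type*} [CommRing R] [IsDomain R] [IsNoetherianRing R]

/-- In a regular local ring of dimension three, the colon ideal is generated by one member of any
given system of generators; the statement is cleared of denominators. -/
theorem exists_local_generator (𝔭 : Ideal R) [𝔭.IsPrime] {x y z : R} (hx𝔭 : x ∈ 𝔭) (hy𝔭 : y ∈ 𝔭)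
    (hz𝔭 : z ∈ 𝔭) (hx : x ≠ 0) (hxy : ∀ a b, x * a = y * b → ∃ c, b = x * c)
    (hz : ∀ a, z * a ∈ Ideal.span {x, y} → a ∈ Ideal.span {x, y}) (s : R) (hs : s ∉ 𝔭)
    (hs𝔭 : ∀ r ∈ 𝔭, s * r ∈ Ideal.span {x, y, z}) (f : R) (hf : f ≠ 0) (T : Finset R)
    (G : Finset R) (hG : Ideal.span (G : Set R) = colonIdeal f (T : Set R)) :
    ∃ g ∈ G, ∃ h, h ∉ 𝔭 ∧ ∀ j ∈ G, g ∣ h * j := by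
  classical
  set O := Localization.AtPrime 𝔭
  let ι := algebraMap R O
  have hιinj : Function.Injective ι := IsLocalization.injective O 𝔭.primeCompl_le_nonZeroDivisors
  have hunit : ∀ t, t ∉ 𝔭 → IsUnit (ι t) := fun t ht =>
    IsLocalization.map_units O (⟨t, ht⟩ : 𝔭.primeCompl)
  have hO : IsNoetherianRing O := IsLocalization.isNoetherianRing 𝔭.primeCompl O inferInstance
  have hfrac : ∀ a : O, ∃ r t, t ∉ 𝔭 ∧ a * ι t = ι r := by
    intro a
    obtain ⟨⟨r, t⟩, h⟩ := IsLocalization.surj 𝔭.primeCompl a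
    exact ⟨r, t, t.2, h⟩
  have hmax : IsLocalRing.maximalIdeal O = Ideal.span {ι x, ι y, ι z} := by
    apply le_antisymm
    · rw [← Localization.AtPrime.map_eq_maximalIdeal, Ideal.map_le_iff_le_comap]
      intro r hr
      rw [Ideal.mem_comap, ← Ideal.unit_mul_mem_iff_mem _ (hunit s hs), ← map_mul]
      have := Ideal.mem_map_of_mem ι (hs𝔭 r hr)
      rwa [Ideal.map_span, Set.image_insert_eq, Set.image_insert_eq, Set.image_singleton] at this
    · rw [← Localization.AtPrime.map_eq_maximalIdeal, Ideal.span_le]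
      rintro _ (rfl | rfl | rfl) <;> exact Ideal.mem_map_of_mem _ (by assumption)
  have hdvd : ∀ a b : R, ι a ∣ ι b → ∃ h, h ∉ 𝔭 ∧ a ∣ h * b := by
    rintro a b ⟨c, hc⟩
    obtain ⟨r, t, ht, h⟩ := hfrac c
    refine ⟨t, ht, r, hιinj ?_⟩
    rw [map_mul, map_mul, hc, ← h]; ring
  have hspan : ∀ a b, ι a ∈ Ideal.span {ι b} → ∃ h, h ∉ 𝔭 ∧ b ∣ h * a := fun a b h =>
    hdvd b a (Ideal.mem_span_singleton.1 h)
  obtain ⟨g, hg⟩ := colonIdeal_isPrincipal hmax ((map_ne_zero_iff ι hιinj).2 hx) (by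
      intro a b hab
      obtain ⟨r, t, ht, h⟩ := hfrac a
      obtain ⟨r', t', ht', h'⟩ := hfrac b
      obtain ⟨c, hc⟩ := hxy (r * t') (r' * t) (hιinj (by
        simp only [map_mul, ← h, ← h']; linear_combination ι t * ι t' * hab))
      obtain ⟨u, hu⟩ := (hunit _ ht).mul (hunit _ ht')
      refine ⟨ι c * ↑u⁻¹, ?_⟩
      have h1 : b * u = ι x * ι c := by
        rw [hu]
        rw [← map_mul ι x c, ← hc, map_mul, ← h']; ring
      rw [← mul_assoc, ← h1]; simp) (by
      intro a ha
      obtain ⟨r, t, ht, h⟩ := hfrac a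
      obtain ⟨p, q, hpq⟩ := Ideal.mem_span_pair.1 ha
      obtain ⟨p', t1, ht1, hp⟩ := hfrac p
      obtain ⟨q', t2, ht2, hq⟩ := hfrac q
      have h1 : z * (r * t1 * t2) ∈ Ideal.span {x, y} := by
        refine Ideal.mem_span_pair.2 ⟨p' * t2 * t, q' * t1 * t, hιinj ?_⟩
        simp only [map_mul, map_add, ← h, ← hp, ← hq]
        linear_combination ι t * ι t1 * ι t2 * hpq
      have h2 := Ideal.mem_map_of_mem ι (hz _ h1)
      rw [Ideal.map_span, Set.image_insert_eq, Set.image_singleton, map_mul, map_mul, ← h] at h2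
      rw [← Ideal.unit_mul_mem_iff_mem _ (((hunit t ht).mul (hunit t1 ht1)).mul (hunit t2 ht2))]
      convert h2 using 1; ring) (ι f)
    ((map_ne_zero_iff ι hιinj).2 hf) (ι '' (T : Set R))
  -- the colon ideal of the localization is the localization of the colon ideal
  have hGin : ∀ j ∈ G, g ∣ ι j := by
    intro j hj
    rw [← Ideal.mem_span_singleton, ← hg]
    rintro _ ⟨t, ht, rfl⟩
    have : j ∈ colonIdeal f (T : Set R) := hG ▸ Ideal.subset_span hj
    rw [← map_mul]
    exact map_dvd ι (this t ht)
  have hgmem : g ∈ Ideal.span (ι '' (G : Set R)) := by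
    rw [← Ideal.map_span, hG]
    obtain ⟨r, t, ht, h⟩ := hfrac g
    have hgg : g ∈ colonIdeal (ι f) (ι '' (T : Set R)) := by
      rw [hg]; exact Ideal.mem_span_singleton_self g
    have : ∀ q : R, ∃ h, h ∉ 𝔭 ∧ (q ∈ T → f ∣ h * (r * q)) := by
      intro q
      by_cases hq : q ∈ T
      · have h1 := hgg (ι q) ⟨q, hq, rfl⟩
        have h2 : ι f ∣ ι (r * q) := by
          rw [map_mul, ← h, mul_right_comm]; exact Dvd.dvd.mul_right h1 _
        obtain ⟨w, hw, hw'⟩ := hdvd _ _ h2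
        exact ⟨w, hw, fun _ => hw'⟩
      · exact ⟨1, fun h => (Ideal.IsPrime.ne_top ‹_›) ((Ideal.eq_top_iff_one _).2 h), fun h => absurd h hq⟩
    choose w hw hw' using this
    have hP : (∏ q ∈ T, w q) ∉ 𝔭 := by
      intro hmem
      obtain ⟨q, _, hq⟩ := (Ideal.IsPrime.prod_mem_iff).1 hmem
      exact hw q hq
    have hr : (∏ q ∈ T, w q) * r ∈ colonIdeal f (T : Set R) := by
      intro q hq
      obtain ⟨e, he⟩ := Finset.dvd_prod_of_mem w hq
      obtain ⟨e', he'⟩ := hw' q hq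
      exact ⟨e * e', by rw [he]; linear_combination e * he'⟩
    have h3 := Ideal.mem_map_of_mem ι hr
    rw [map_mul, ← h] at h3
    obtain ⟨u, hu⟩ := (hunit _ hP).mul (hunit _ ht)
    have h4 := Ideal.mul_mem_left _ (↑u⁻¹ : O) h3
    have h5 : (↑u⁻¹ : O) * (ι (∏ q ∈ T, w q) * (g * ι t)) = g := by
      have : ι (∏ q ∈ T, w q) * (g * ι t) = u * g := by rw [hu]; ring
      rw [this]; simp
    rwa [h5] at h4
  have hg0 : g ≠ 0 := by
    rintro rfl
    have hfc : f ∈ colonIdeal f (T : Set R) := fun t _ => Dvd.intro _ rfl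
    have : ι f ∈ colonIdeal (ι f) (ι '' (T : Set R)) := fun t _ => Dvd.intro _ rfl
    rw [hg, Ideal.mem_span_singleton, zero_dvd_iff] at this
    exact hf ((map_eq_zero_iff ι hιinj).1 this)
  -- one of the generators is associated with `g`
  have hass : ∃ j ∈ G, ι j ∣ g := by
    by_contra hcon
    push Not at hcon
    have : Ideal.span (ι '' (G : Set R)) ≤ Ideal.span {g} * IsLocalRing.maximalIdeal O := by
      rw [Ideal.span_le]
      rintro _ ⟨j, hj, rfl⟩
      obtain ⟨c, hc⟩ := hGin j hj
      rw [hc]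
      refine Ideal.mul_mem_mul (Ideal.mem_span_singleton_self g) ?_
      rw [IsLocalRing.mem_maximalIdeal]
      intro hcu
      obtain ⟨u, rfl⟩ := hcu
      exact hcon j hj ⟨↑u⁻¹, by rw [hc]; simp⟩
    have h1 := this hgmem
    rw [Ideal.mem_span_singleton_mul] at h1
    obtain ⟨c, hc, hgc⟩ := h1
    have : c = 1 := mul_left_cancel₀ hg0 (by rw [hgc, mul_one])
    rw [this] at hc
    exact (IsLocalRing.mem_maximalIdeal _).1 hc isUnit_one
  obtain ⟨j₀, hj₀, hjg⟩ := hass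
  have : ∀ q : R, ∃ h, h ∉ 𝔭 ∧ (q ∈ G → j₀ ∣ h * q) := by
    intro q
    by_cases hq : q ∈ G
    · obtain ⟨w, hw, hw'⟩ := hdvd _ _ (hjg.trans (hGin q hq))
      exact ⟨w, hw, fun _ => hw'⟩
    · exact ⟨1, fun h => (Ideal.IsPrime.ne_top ‹_›) ((Ideal.eq_top_iff_one _).2 h), fun h => absurd h hq⟩
  choose w hw hw' using this
  refine ⟨j₀, hj₀, ∏ q ∈ G, w q, ?_, ?_⟩
  · intro hmem
    obtain ⟨q, _, hq⟩ := (Ideal.IsPrime.prod_mem_iff).1 hmem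
    exact hw q hq
  · intro q hq
    obtain ⟨e, he⟩ := Finset.dvd_prod_of_mem w hq
    obtain ⟨e', he'⟩ := hw' q hq
    exact ⟨e * e', by rw [he]; linear_combination e * he'⟩

end Localize

theorem MvPolynomial.aeval_mul_of_isHomogeneous {σ k A : Type*} [CommRing k] [CommRing A] [Algebra k A]
    {p : MvPolynomial σ k} {n : ℕ} (hp : p.IsHomogeneous n) (y : σ → A) (t : A) :
    aeval (fun i => y i * t) p = aeval y p * t ^ n := by
  rw [aeval_def, aeval_def, eval₂_eq, eval₂_eq, Finset.sum_mul]
  refine Finset.sum_congr rfl fun d hd => ?_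
  have : d.degree = n := hp.degree_eq_sum_deg_support hd ▸ rfl
  simp only [mul_pow, Finset.prod_mul_distrib]
  rw [Finset.prod_pow_eq_pow_sum, ← this, mul_assoc]; rfl

namespace DRing
variable {F : Poly4}

section line
variable (a : Fin 4 → ℂ) (i₀ : Fin 4)

/-- The linear forms `Xⱼ - aⱼ X_{i₀}`. -/
noncomputable def lineForm (j : Fin 4) : Poly4 := X j - C (a j) * X i₀

open Classical in
/-- Substitution of `aⱼ X_{i₀}` for `Xⱼ`, `j ∈ J`. -/
noncomputable def lineSub (J : Set (Fin 4)) : Poly4 →ₐ[ℂ] Poly4 :=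
  aeval (fun j => if j ∈ J then C (a j) * X i₀ else X j)

theorem sub_lineSub_mem (J : Set (Fin 4)) (p : Poly4) :
    p - lineSub a i₀ J p ∈ Ideal.span (lineForm a i₀ '' J) := by
  have : (Ideal.Quotient.mkₐ ℂ (Ideal.span (lineForm a i₀ '' J))).comp (lineSub a i₀ J)
      = Ideal.Quotient.mkₐ ℂ (Ideal.span (lineForm a i₀ '' J)) := by
    ext j
    simp only [AlgHom.comp_apply, lineSub, aeval_X]
    split_ifs with hj
    · symm
      refine (Ideal.Quotient.eq).2 (Ideal.subset_span ⟨j, hj, rfl⟩)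
    · rfl
  exact (Ideal.Quotient.eq).1 (DFunLike.congr_fun this p).symm

variable {a i₀}

theorem lineSub_X_self (ha : a i₀ = 1) (J : Set (Fin 4)) : lineSub a i₀ J (X i₀) = X i₀ := by
  simp [lineSub, ha]

theorem lineSub_lineForm_of_mem (ha : a i₀ = 1) {J : Set (Fin 4)} {j : Fin 4} (hj : j ∈ J) :
    lineSub a i₀ J (lineForm a i₀ j) = 0 := by
  rw [lineForm, map_sub, map_mul, lineSub_X_self ha]
  simp [lineSub, hj]

theorem lineSub_lineForm_of_notMem (ha : a i₀ = 1) {J : Set (Fin 4)} {j : Fin 4} (hj : j ∉ J) :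
    lineSub a i₀ J (lineForm a i₀ j) = lineForm a i₀ j := by
  rw [lineForm, map_sub, map_mul, lineSub_X_self ha]
  simp [lineSub, hj]

theorem mem_span_lineForm_iff (ha : a i₀ = 1) {J : Set (Fin 4)} {p : Poly4} :
    p ∈ Ideal.span (lineForm a i₀ '' J) ↔ lineSub a i₀ J p = 0 := by
  constructor
  · intro h
    have : Ideal.span (lineForm a i₀ '' J) ≤ RingHom.ker (lineSub a i₀ J) := by
      rw [Ideal.span_le]
      rintro _ ⟨j, hj, rfl⟩
      exact lineSub_lineForm_of_mem ha hj
    exact this h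
  · intro h
    simpa [h] using sub_lineSub_mem a i₀ J p

theorem lineForm_ne_zero {j : Fin 4} (hj : j ≠ i₀) : lineForm a i₀ j ≠ 0 := by
  intro h
  have := congrArg (eval (Pi.single j (1 : ℂ))) h
  simp [lineForm, hj.symm] at this

theorem mem_span_lineForm_of_mul (ha : a i₀ = 1) {J : Set (Fin 4)} {j : Fin 4} (hj : j ∉ J) (hj0 : j ≠ i₀)
    {p : Poly4} (h : lineForm a i₀ j * p ∈ Ideal.span (lineForm a i₀ '' J)) :
    p ∈ Ideal.span (lineForm a i₀ '' J) := by
  rw [mem_span_lineForm_iff ha] at *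
  rw [map_mul, lineSub_lineForm_of_notMem ha hj] at h
  exact (mul_eq_zero.1 h).resolve_left (lineForm_ne_zero hj0)

theorem mem_span_inc_pair {x y : Poly4} {r : DRing F} :
    r ∈ Ideal.span {inc F x, inc F y} ↔ r.re ∈ Ideal.span {x, y} ∧ r.im ∈ Ideal.span {x, y} := by
  simp only [Ideal.mem_span_pair]
  constructor
  · rintro ⟨p, q, rfl⟩
    exact ⟨⟨p.re, q.re, by simp⟩, ⟨p.im, q.im, by simp⟩⟩
  · rintro ⟨⟨p, q, h⟩, ⟨p', q', h'⟩⟩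
    refine ⟨⟨p, p'⟩, ⟨q, q'⟩, ?_⟩
    ext1 <;> simp [h, h']

theorem lineForm_pair_regular (ha : a i₀ = 1) {k l : Fin 4} (hkl : l ≠ k) (hl : l ≠ i₀) (r s : DRing F)
    (h : inc F (lineForm a i₀ k) * r = inc F (lineForm a i₀ l) * s) :
    ∃ c, s = inc F (lineForm a i₀ k) * c := by
  have h1 := congrArg QuadraticAlgebra.re h
  have h2 := congrArg QuadraticAlgebra.im h
  simp at h1 h2
  have key : ∀ p q, lineForm a i₀ k * p = lineForm a i₀ l * q → ∃ c, q = lineForm a i₀ k * c := by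
    intro p q hpq
    have := mem_span_lineForm_of_mul ha (J := {k}) (j := l) (by simpa using hkl) hl (p := q) (by
      rw [← hpq, Set.image_singleton]
      exact Ideal.mem_span_singleton.2 (Dvd.intro _ rfl))
    rw [Set.image_singleton, Ideal.mem_span_singleton] at this
    exact this
  obtain ⟨c, hc⟩ := key _ _ h1
  obtain ⟨d, hd⟩ := key _ _ h2
  exact ⟨⟨c, d⟩, by ext1 <;> simp [hc, hd]⟩

end line

/-- Restriction to the line of the cone through `(a, b)`. -/
noncomputable def lineHom (hF : F.IsHomogeneous 6) (a : Fin 4 → ℂ) (b : ℂ) (hab : b ^ 2 = aeval a F) :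
    DRing F →ₐ[ℂ] Polynomial ℂ :=
  evalHom (fun i => Polynomial.C (a i) * Polynomial.X) (Polynomial.C b * Polynomial.X ^ 3) (by
    rw [aeval_mul_of_isHomogeneous hF (fun i => Polynomial.C (a i)), mul_pow, ← pow_mul, ← Polynomial.C_pow, hab]
    congr 1
    exact (aeval_algebraMap_apply (A := ℂ) (Polynomial ℂ) a F).symm)

theorem lineHom_eval_one (hF : F.IsHomogeneous 6) (a : Fin 4 → ℂ) (b : ℂ) (hab : b ^ 2 = aeval a F)
    (r : DRing F) : (lineHom hF a b hab r).eval 1 = evalHom a b hab r := by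
  have : (Polynomial.aeval (1 : ℂ)).comp (lineHom hF a b hab) = evalHom a b hab := by
    apply algHom_ext' <;> simp [lineHom]
  rw [← this]; simp

theorem lineSub_univ (a : Fin 4 → ℂ) (i₀ : Fin 4) (p : Poly4) :
    lineSub a i₀ Set.univ p = Polynomial.aeval (X i₀ : Poly4)
      (aeval (fun i => Polynomial.C (a i) * Polynomial.X) p : Polynomial ℂ) := by
  have : lineSub a i₀ Set.univ = (Polynomial.aeval (X i₀ : Poly4)).comp
      (aeval (fun i => Polynomial.C (a i) * Polynomial.X) : Poly4 →ₐ[ℂ] Polynomial ℂ) := by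
    ext j; simp [lineSub, MvPolynomial.algebraMap_eq]
  rw [this]; rfl

theorem exists_compl_pair : ∀ i j : Fin 4, i ≠ j → ∃ k l, k ≠ l ∧ k ≠ i ∧ k ≠ j ∧ l ≠ i ∧ l ≠ j ∧
    ∀ m, m = i ∨ m = j ∨ m = k ∨ m = l := by decide

theorem lineHom_lineForm (hF : F.IsHomogeneous 6)
    (a : Fin 4 → ℂ) (b : ℂ) (hab : b ^ 2 = aeval a F) (i₀ : Fin 4) (ha : a i₀ = 1) (j : Fin 4) :
    lineHom hF a b hab (inc F (lineForm a i₀ j)) = 0 := by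
  simp [lineHom, lineForm, ha, MvPolynomial.algHom_C]

theorem inc_sub_lineSub_mem (a : Fin 4 → ℂ) (i₀ : Fin 4) (I : Ideal (DRing F))
    (hI : ∀ j, inc F (lineForm a i₀ j) ∈ I) (p : Poly4) :
    inc F p - inc F (lineSub a i₀ Set.univ p) ∈ I := by
  have h1 := sub_lineSub_mem a i₀ Set.univ p
  have h2 : Ideal.span (lineForm a i₀ '' Set.univ) ≤ I.comap (inc F) := by
    rw [Ideal.span_le]
    rintro _ ⟨j, -, rfl⟩
    exact hI j
  rw [← map_sub]
  exact h2 h1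

theorem lineForm_self {a : Fin 4 → ℂ} {i₀ : Fin 4} (ha : a i₀ = 1) : lineForm a i₀ i₀ = 0 := by
  simp [lineForm, ha]

theorem inc_lineForm_ne_zero (a : Fin 4 → ℂ) {i₀ j : Fin 4} (hj : j ≠ i₀) :
    inc F (lineForm a i₀ j) ≠ 0 := fun h => lineForm_ne_zero hj (congrArg QuadraticAlgebra.re h)

theorem lineSub_univ_self (hF : F.IsHomogeneous 6) (a : Fin 4 → ℂ) (b : ℂ)
    (hab : b ^ 2 = aeval a F) (i₀ : Fin 4) :
    lineSub a i₀ Set.univ F = C (b ^ 2) * X i₀ ^ 6 := by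
  rw [lineSub_univ, aeval_mul_of_isHomogeneous hF (fun i => Polynomial.C (a i)), hab]
  have := (aeval_algebraMap_apply (A := ℂ) (Polynomial ℂ) a F)
  have h2 : aeval (fun i => Polynomial.C (a i)) F = Polynomial.C (aeval a F) := this
  rw [h2]
  simp [MvPolynomial.algebraMap_eq]

/-- Existence of a regular system of parameters generating the ideal of a line up to a denominator. -/
def HasRegularParameters (hF : F.IsHomogeneous 6) (a : Fin 4 → ℂ) (b : ℂ) (hab : b ^ 2 = aeval a F) : Prop :=
    ∃ x y z s : DRing F, lineHom hF a b hab x = 0 ∧ lineHom hF a b hab y = 0 ∧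
      lineHom hF a b hab z = 0 ∧ x ≠ 0 ∧ (∀ p q, x * p = y * q → ∃ c, q = x * c) ∧
      (∀ p, z * p ∈ Ideal.span {x, y} → p ∈ Ideal.span {x, y}) ∧ lineHom hF a b hab s ≠ 0 ∧
      ∀ r, lineHom hF a b hab r = 0 → s * r ∈ Ideal.span {x, y, z}

/-- Regular parameters along a line of ramification points. -/
theorem exists_regular_parameters_ramified (hF : F.IsHomogeneous 6)
    (a : Fin 4 → ℂ) (b : ℂ) (hab : b ^ 2 = aeval a F) (i₀ : Fin 4) (ha : a i₀ = 1)
    (hsm : ∀ v : Fin 4 → ℂ, (∀ i, eval v (pderiv i F) = 0) → v = 0) (hb : b = 0) :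
    HasRegularParameters hF a b hab := by
  have hline := lineHom_lineForm hF a b hab i₀ ha
  have hmem := inc_sub_lineSub_mem (F := F) a i₀
  have hzero := lineForm_self ha
  have hinc0 := fun j => inc_lineForm_ne_zero (F := F) a (i₀ := i₀) (j := j)
  have hFa := lineSub_univ_self hF a b hab i₀
  obtain ⟨j₀, hj₀, hFj⟩ : ∃ j₀, j₀ ≠ i₀ ∧ eval a (pderiv j₀ F) ≠ 0 := by
    by_contra hcon
    push Not at hcon
    have heul := congrArg (eval a) hF.sum_X_mul_pderiv
    have hFz : eval a F = 0 := by rw [← coe_aeval_eq_eval, RingHom.coe_coe, ← hab, hb]; simp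
    rw [map_sum, map_nsmul, hFz, smul_zero, Finset.sum_eq_single i₀] at heul
    · have hi : eval a (pderiv i₀ F) = 0 := by simpa [ha] using heul
      have := hsm a (fun i => if h : i = i₀ then h ▸ hi else hcon i h)
      rw [this] at ha
      simp at ha
    · intro j _ hj; simp [hcon j hj]
    · simp
  obtain ⟨k, l, hkl, hki, hkj, hli, hlj, hcov⟩ := exists_compl_pair i₀ j₀ hj₀.symm
  set J : Set (Fin 4) := {k, l}
  have hpd : ∀ p, pderiv j₀ (lineSub a i₀ J p) = lineSub a i₀ J (pderiv j₀ p) := by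
    intro p
    induction p using MvPolynomial.induction_on with
    | C c => simp [lineSub, MvPolynomial.algHom_C]
    | add p q hp hq => simp [hp, hq]
    | mul_X p i hp =>
      simp only [map_mul, pderiv_mul, map_add, hp]
      congr 2
      simp only [lineSub, aeval_X]
      split_ifs with hi
      · have : i ≠ j₀ := by rintro rfl; rcases hi with h | h; exacts [hkj h.symm, hlj h.symm]
        rw [pderiv_X_of_ne this, pderiv_C_mul, pderiv_X_of_ne hj₀.symm]; simp
      · by_cases hij : i = j₀
        · subst hij; simp
        · rw [pderiv_X_of_ne hij]; simp
  have hev : ∀ p, eval a (lineSub a i₀ J p) = eval a p := by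
    intro p
    have : (aeval a).comp (lineSub a i₀ J) = aeval a := by
      ext j; simp only [AlgHom.comp_apply, lineSub, aeval_X]
      split_ifs <;> simp [ha]
    exact DFunLike.congr_fun this p
  set G := lineSub a i₀ J F with hG
  have hGd : eval a (pderiv j₀ G) ≠ 0 := by rw [hG, hpd, hev]; exact hFj
  have hG0 : G ≠ 0 := by intro h; rw [h] at hGd; simp at hGd
  -- `G` is divisible by the form attached to `j₀`
  obtain ⟨E, hE⟩ : lineForm a i₀ j₀ ∣ G := by
    have h1 := sub_lineSub_mem a i₀ {j₀} G
    rw [Set.image_singleton, Ideal.mem_span_singleton] at h1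
    have h2 : lineSub a i₀ {j₀} G = 0 := by
      have : (lineSub a i₀ {j₀}).comp (lineSub a i₀ J) = lineSub a i₀ Set.univ := by
        ext1 m
        simp only [AlgHom.comp_apply]
        rcases hcov m with h | h | h | h <;> subst h
        · rw [lineSub_X_self ha, lineSub_X_self ha, lineSub_X_self ha]
        · have : m ∉ J := by rintro (h | h); exacts [hkj h.symm, hlj h.symm]
          simp [lineSub, this]
        · simp [lineSub, J, hj₀.symm, MvPolynomial.algHom_C]
        · simp [lineSub, J, hj₀.symm, MvPolynomial.algHom_C]
      have h3 := DFunLike.congr_fun this F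
      rw [AlgHom.comp_apply, hFa, hb] at h3
      simpa using h3
    simpa [h2] using h1
  have hEa : eval a E ≠ 0 := by
    have : eval a (pderiv j₀ G) = eval a E := by
      rw [hE, pderiv_mul, map_add, map_mul, map_mul]
      simp [lineForm, ha, pderiv_X_of_ne hj₀.symm]
    rwa [this] at hGd
  refine ⟨inc F (lineForm a i₀ k), inc F (lineForm a i₀ l), W F, inc F E, hline k, hline l,
    by simp [lineHom, hb], hinc0 k hki, lineForm_pair_regular ha hkl.symm hli, ?_, ?_, ?_⟩
  · intro p hp
    rw [mem_span_inc_pair] at hp ⊢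
    have hJi : lineForm a i₀ '' J = {lineForm a i₀ k, lineForm a i₀ l} := Set.image_pair _ _ _
    rw [← hJi] at hp ⊢
    simp only [QuadraticAlgebra.re_mul, W_re, W_im, QuadraticAlgebra.im_mul] at hp
    simp only [zero_mul, mul_one, one_mul, add_zero, zero_add] at hp
    refine ⟨hp.2, ?_⟩
    have := hp.1
    rw [mem_span_lineForm_iff ha, map_mul] at this
    exact (mem_span_lineForm_iff ha).2 ((mul_eq_zero.1 this).resolve_left hG0)
  · intro h
    have := congrArg (Polynomial.eval 1) h
    rw [lineHom_eval_one, evalHom_inc] at this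
    simp only [Polynomial.eval_zero] at this
    exact hEa this
  · intro r hr
    set I : Ideal (DRing F) := Ideal.span {inc F (lineForm a i₀ k), inc F (lineForm a i₀ l), W F}
    have hkI : inc F (lineForm a i₀ k) ∈ I := Ideal.subset_span (by simp)
    have hlI : inc F (lineForm a i₀ l) ∈ I := Ideal.subset_span (by simp)
    have hWI : W F ∈ I := Ideal.subset_span (by simp)
    have hEj : inc F (lineForm a i₀ j₀ * E) ∈ I := by
      have h1 : inc F F ∈ I := by rw [← W_sq, pow_two]; exact I.mul_mem_left _ hWI
      have h2 : inc F (F - G) ∈ I := by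
        have h3 := sub_lineSub_mem a i₀ J F
        have h4 : Ideal.span (lineForm a i₀ '' J) ≤ I.comap (inc F) := by
          rw [Ideal.span_le]
          rintro _ ⟨j, hj, rfl⟩
          rcases hj with rfl | rfl
          · exact hkI
          · exact hlI
        exact h4 h3
      rw [← hE]
      have := I.sub_mem h1 h2
      rwa [← map_sub, sub_sub_cancel] at this
    have hcol : ∀ p, inc F E * (inc F p - inc F (lineSub a i₀ Set.univ p)) ∈ I := by
      intro p
      have h1 := hmem ((I.colon {inc F E})) (by
        intro j
        rw [Submodule.mem_colon_singleton, smul_eq_mul]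
        rcases hcov j with h | h | h | h <;> subst h
        · rw [hzero]; simp
        · rw [← map_mul]; exact hEj
        · exact I.mul_mem_right _ hkI
        · exact I.mul_mem_right _ hlI) p
      rw [Submodule.mem_colon_singleton, smul_eq_mul] at h1
      rwa [mul_comm]
    rw [lineHom, evalHom_apply, hb] at hr
    simp only [map_zero, zero_mul, add_zero] at hr
    have h1 := hcol r.re
    rw [lineSub_univ, hr, map_zero, map_zero, sub_zero] at h1
    rw [eq_inc_add r, mul_add]
    refine I.add_mem h1 ?_
    rw [mul_left_comm]
    exact I.mul_mem_right _ hWI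

/-- Regular parameters along a line of points off the ramification divisor. -/
theorem exists_regular_parameters_unramified (hF : F.IsHomogeneous 6)
    (a : Fin 4 → ℂ) (b : ℂ) (hab : b ^ 2 = aeval a F) (i₀ : Fin 4) (ha : a i₀ = 1) (hb : b ≠ 0) :
    HasRegularParameters hF a b hab := by
  have hline := lineHom_lineForm hF a b hab i₀ ha
  have hmem := inc_sub_lineSub_mem (F := F) a i₀
  have hzero := lineForm_self ha
  have hinc0 := fun j => inc_lineForm_ne_zero (F := F) a (i₀ := i₀) (j := j)
  have hFa := lineSub_univ_self hF a b hab i₀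
  obtain ⟨j₀, hj₀⟩ : ∃ j₀ : Fin 4, j₀ ≠ i₀ := exists_ne i₀
  obtain ⟨k, l, hkl, hki, hkj, hli, hlj, hcov⟩ := exists_compl_pair i₀ j₀ hj₀.symm
  refine ⟨inc F (lineForm a i₀ k), inc F (lineForm a i₀ l), inc F (lineForm a i₀ j₀),
    W F + inc F (C b * X i₀ ^ 3), hline k, hline l, hline j₀, hinc0 k hki,
    lineForm_pair_regular ha hkl.symm hli, ?_, ?_, ?_⟩
  · intro p hp
    rw [mem_span_inc_pair] at hp ⊢
    have hJi : lineForm a i₀ '' {k, l} = {lineForm a i₀ k, lineForm a i₀ l} := Set.image_pair _ _ _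
    rw [← hJi] at hp ⊢
    simp at hp
    have hj : j₀ ∉ ({k, l} : Set (Fin 4)) := by rintro (h | h); exacts [hkj h.symm, hlj h.symm]
    exact ⟨mem_span_lineForm_of_mul ha hj hj₀ hp.1, mem_span_lineForm_of_mul ha hj hj₀ hp.2⟩
  · intro h
    have := congrArg (Polynomial.eval 1) h
    rw [lineHom_eval_one] at this
    rw [map_add, evalHom_W, evalHom_inc] at this
    simp only [map_mul, map_pow, aeval_X, ha, MvPolynomial.algHom_C, Polynomial.eval_zero] at this
    simp only [Algebra.algebraMap_self, RingHom.id_apply] at this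
    apply hb
    linear_combination this / 2
  · intro r hr
    set I : Ideal (DRing F) := Ideal.span {inc F (lineForm a i₀ k), inc F (lineForm a i₀ l), inc F (lineForm a i₀ j₀)}
    have hI : ∀ j, inc F (lineForm a i₀ j) ∈ I := by
      intro j
      rcases hcov j with h | h | h | h <;> subst h
      · rw [hzero]; simp
      all_goals exact Ideal.subset_span (by simp)
    rw [lineHom, evalHom_apply] at hr
    set p := inc F (lineSub a i₀ Set.univ r.re)
    set q := inc F (lineSub a i₀ Set.univ r.im)
    have h1 : p + inc F (C b * X i₀ ^ 3) * q = 0 := by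
      have := congrArg (fun t => inc F (Polynomial.aeval (X i₀ : Poly4) t)) hr
      simp only [map_add, map_mul, ← lineSub_univ, map_zero, map_pow, Polynomial.aeval_X,
        Polynomial.aeval_C] at this
      simpa [p, q, MvPolynomial.algebraMap_eq] using this
    have h2 : W F ^ 2 - inc F (C b * X i₀ ^ 3) ^ 2 ∈ I := by
      have := hmem I hI F
      rw [hFa] at this
      convert this using 1
      rw [W_sq, ← map_pow]; congr 2
      rw [mul_pow, ← pow_mul, map_pow]
    have h3 : (W F + inc F (C b * X i₀ ^ 3)) * r = (W F + inc F (C b * X i₀ ^ 3)) *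
        ((inc F r.re - p) + W F * (inc F r.im - q)) +
        (W F ^ 2 - inc F (C b * X i₀ ^ 3) ^ 2) * q := by
      have h4 := eq_inc_add r
      generalize (W F) = w at *
      generalize inc F (C b * X i₀ ^ 3) = c at *
      generalize inc F r.re = α at *
      generalize inc F r.im = β at *
      linear_combination (w + c) * h4 + (w + c) * h1
    rw [h3]
    exact I.add_mem (I.mul_mem_left _ (I.add_mem (hmem I hI _) (I.mul_mem_left _ (hmem I hI _))))
      (I.mul_mem_right _ h2)

/-- Regular parameters of the cone along the line through a closed point other than the vertex. -/
theorem exists_regular_parameters (hF : F.IsHomogeneous 6)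
    (a : Fin 4 → ℂ) (b : ℂ) (hab : b ^ 2 = aeval a F) (i₀ : Fin 4) (ha : a i₀ = 1)
    (hsm : ∀ v : Fin 4 → ℂ, (∀ i, eval v (pderiv i F) = 0) → v = 0) :
    HasRegularParameters hF a b hab := by
  by_cases hb : b = 0
  · exact exists_regular_parameters_ramified hF a b hab i₀ ha hsm hb
  · exact exists_regular_parameters_unramified hF a b hab i₀ ha hb

end DRing

namespace Coaction
variable {A : Type*} [CommRing A] {D : Coaction A}

theorem comp_mem_colonIdeal [IsDomain A] {N : ℕ} {f : A} (hf : D.Hom N f) {T : Set A}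
    (hT : ∀ t ∈ T, ∃ m, D.Hom m t) {r : A} (hr : r ∈ colonIdeal f T) (n : ℕ) :
    D.comp n r ∈ colonIdeal f T := by
  intro t ht
  obtain ⟨m, hm⟩ := hT t ht
  obtain ⟨u, hu⟩ := hr t ht
  rw [← comp_mul_hom hm, hu, mul_comm f u]
  by_cases h : N ≤ n + m
  · obtain ⟨e, he⟩ := Nat.exists_eq_add_of_le h
    rw [he, add_comm N e, comp_mul_hom hf]
    exact Dvd.intro_left _ rfl
  · rw [comp_mul_hom_of_lt hf (by omega)]; exact dvd_zero _

theorem exists_homogeneous_generators [IsNoetherianRing A] (I : Ideal A)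
    (hI : ∀ r ∈ I, ∀ n, D.comp n r ∈ I) :
    ∃ G : Finset A, Ideal.span (G : Set A) = I ∧ ∀ g ∈ G, ∃ n, D.Hom n g := by
  classical
  obtain ⟨G, hG⟩ := (IsNoetherian.noetherian I : I.FG)
  refine ⟨G.biUnion fun g => (Finset.range ((D.toHom g).natDegree + 1)).image fun k => D.comp k g,
    le_antisymm ?_ ?_, ?_⟩
  · rw [Ideal.span_le]
    intro x hx
    simp only [Finset.coe_biUnion, Finset.coe_image, Set.mem_iUnion] at hx
    obtain ⟨g, hg, k, -, rfl⟩ := hx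
    exact hI g (hG ▸ Submodule.subset_span hg) k
  · rw [← hG, Submodule.span_le]
    intro g hg
    rw [SetLike.mem_coe, ← D.sum_comp g]
    refine Submodule.sum_mem _ fun k hk => Ideal.subset_span ?_
    simp only [Finset.coe_biUnion, Finset.coe_image, Set.mem_iUnion]
    exact ⟨g, hg, k, hk, rfl⟩
  · intro x hx
    simp only [Finset.mem_biUnion, Finset.mem_image] at hx
    obtain ⟨g, hg, k, -, rfl⟩ := hx
    exact ⟨k, hom_comp k g⟩

end Coaction

namespace DRing
variable {F : Poly4}

/-- The divisorial hull of a homogeneous ideal, with homogeneous local generators on a cover of the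
punctured cone. -/
theorem exists_divisorial_hull (hF : F.IsHomogeneous 6)
    (hsm : ∀ v : Fin 4 → ℂ, (∀ i, eval v (pderiv i F) = 0) → v = 0) [IsDomain (DRing F)]
    {ι : Type*} (f : ι → DRing F) {N : ℕ} (hf : ∀ i, (grading hF).Hom N (f i)) (i₀ : ι)
    (hf0 : f i₀ ≠ 0) :
    ∃ G : Finset (DRing F), (∀ g ∈ G, ∃ n, (grading hF).Hom n g) ∧
      (∀ i, f i ∈ Ideal.span (G : Set (DRing F))) ∧
      (∀ j ∈ G, j ≠ 0 → ∀ u v, v ≠ 0 → (∀ i, v * j ∣ u * f i) → v ∣ u) ∧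
      ∃ (m : ℕ) (h j : Fin m → DRing F) (Y : ℕ) (l : Fin 4 → Fin m → DRing F),
        3 ≤ Y ∧ (∀ a, j a ∈ G) ∧ (∀ a, h a ≠ 0) ∧ (∀ a, j a ≠ 0) ∧ (∀ a, ∀ g ∈ G, j a ∣ h a * g) ∧
        (∀ k, inc F (X k) ^ Y = ∑ a, l k a * h a) ∧
        (∀ k a, (grading hF).Hom Y (l k a * h a)) := by
  classical
  have hc : ∀ t ∈ Set.range f, ∃ m, (grading hF).Hom m t := by
    rintro _ ⟨i, rfl⟩; exact ⟨N, hf i⟩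
  obtain ⟨T, hT, hThom⟩ := Coaction.exists_homogeneous_generators (D := grading hF)
    (colonIdeal (f i₀) (Set.range f)) (fun r hr n => Coaction.comp_mem_colonIdeal (hf i₀) hc hr n)
  obtain ⟨G, hG, hGhom⟩ := Coaction.exists_homogeneous_generators (D := grading hF)
    (colonIdeal (f i₀) (T : Set (DRing F)))
    (fun r hr n => Coaction.comp_mem_colonIdeal (hf i₀) hThom hr n)
  have hGc : ∀ g ∈ G, g ∈ colonIdeal (f i₀) (T : Set (DRing F)) := fun g hg =>
    hG ▸ Ideal.subset_span hg
  refine ⟨G, hGhom, ?_, ?_, ?_⟩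
  · intro i
    rw [hG]
    intro t ht
    have : t ∈ colonIdeal (f i₀) (Set.range f) := hT ▸ Ideal.subset_span ht
    rw [mul_comm]
    exact this _ ⟨i, rfl⟩
  · intro j hj hj0 u v hv h
    choose q hq using h
    have hq0 : q i₀ ∈ colonIdeal (f i₀) (Set.range f) := by
      rintro _ ⟨i, rfl⟩
      refine ⟨q i, mul_left_cancel₀ (mul_ne_zero hv hj0) ?_⟩
      rw [← mul_assoc, ← hq i₀]
      have := hq i
      generalize f i₀ = f0 at *
      calc u * f0 * f i = u * f i * f0 := by ring
        _ = _ := by rw [this]; ring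
    rw [← hT] at hq0
    have hjq : f i₀ ∣ j * q i₀ := by
      have : Ideal.span (T : Set (DRing F)) ≤ (colonIdeal (f i₀) {j}) := by
        rw [Ideal.span_le]
        intro t ht s hs
        rw [Set.mem_singleton_iff.1 hs, mul_comm]
        exact hGc j hj t ht
      rw [mul_comm]
      exact this hq0 j rfl
    obtain ⟨e, he⟩ := hjq
    refine ⟨e, mul_right_cancel₀ hf0 ?_⟩
    rw [hq i₀, mul_assoc, he]; ring
  · -- homogeneous local generators
    have hJ0 : ∀ (a : Fin 4 → ℂ) (b : ℂ) (hab : b ^ 2 = aeval a F), a ≠ 0 → ∃ j ∈ G, ∃ h, (∃ n, (grading hF).Hom n h) ∧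
        evalHom a b hab h ≠ 0 ∧ ∀ g ∈ G, j ∣ h * g := by
      intro a b hab ha
      obtain ⟨i, hi⟩ : ∃ i, a i ≠ 0 := by
        by_contra hcon; push Not at hcon; exact ha (funext hcon)
      set a' : Fin 4 → ℂ := fun k => a k * (a i)⁻¹ with ha'
      set b' := b * (a i)⁻¹ ^ 3 with hb'
      have hab' : b' ^ 2 = aeval a' F := by
        rw [ha', aeval_mul_of_isHomogeneous hF a, ← hab, hb']; ring
      have ha1 : a' i = 1 := mul_inv_cancel₀ hi
      clear_value a' b'
      obtain ⟨x, y, z, s, hx, hy, hz, hx0, hxy, hzz, hs, hsr⟩ :=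
        exists_regular_parameters hF a' b' hab' i ha1 hsm
      let 𝔭 : Ideal (DRing F) := RingHom.ker (lineHom hF a' b' hab')
      have : 𝔭.IsPrime := RingHom.ker_isPrime _
      obtain ⟨j, hj, h, hh, hdiv⟩ := exists_local_generator 𝔭 (x := x) (y := y) (z := z) hx hy hz hx0
        hxy hzz s hs hsr (f i₀) hf0 T G hG
      obtain ⟨n, hn⟩ : ∃ n, (grading hF).comp n h ∉ 𝔭 := by
        by_contra hcon
        push Not at hcon
        apply hh
        rw [← (grading hF).sum_comp h]
        exact Submodule.sum_mem _ fun k _ => hcon k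
      obtain ⟨ej, hej⟩ := hGhom j hj
      refine ⟨j, hj, (grading hF).comp n h, ⟨n, Coaction.hom_comp n h⟩, ?_, ?_⟩
      · intro h0
        apply hn
        obtain ⟨h1, h2⟩ := (hom_iff hF).1 (Coaction.hom_comp (D := grading hF) n h)
        set r := (grading hF).comp n h
        have hr : lineHom hF a' b' hab' r = Polynomial.C (evalHom a' b' hab' r) * Polynomial.X ^ n := by
          have hre : ∀ p : Poly4, ∀ m, p.IsHomogeneous m →
              aeval (fun i => Polynomial.C (a' i) * Polynomial.X) p =
                Polynomial.C (aeval a' p) * Polynomial.X ^ m := by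
            intro p m hp
            rw [aeval_mul_of_isHomogeneous hp (fun i => Polynomial.C (a' i))]
            congr 1
            exact (aeval_algebraMap_apply (A := ℂ) (Polynomial ℂ) a' p)
          rw [lineHom, evalHom_apply, evalHom_apply, hre _ _ h1]
          rcases h2 with h2 | ⟨k, rfl, h2⟩
          · simp [h2]
          · rw [hre _ _ h2, Polynomial.C_add, Polynomial.C_mul]; ring
        have hev : evalHom a' b' hab' r = evalHom a b hab r * (a i)⁻¹ ^ n := by
          rw [evalHom_apply, evalHom_apply, ha', aeval_mul_of_isHomogeneous h1 a]
          rcases h2 with h2 | ⟨k, rfl, h2⟩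
          · simp [h2]
          · rw [aeval_mul_of_isHomogeneous h2 a, hb']; ring
        change lineHom hF a' b' hab' r = 0
        rw [hr, hev, h0]; simp
      · intro g hg
        obtain ⟨eg, heg⟩ := hGhom g hg
        obtain ⟨u, hu⟩ := hdiv g hg
        rw [← Coaction.comp_mul_hom heg, hu, mul_comm j u]
        by_cases hle : ej ≤ n + eg
        · obtain ⟨e, he⟩ := Nat.exists_eq_add_of_le hle
          rw [he, add_comm ej e, Coaction.comp_mul_hom hej]
          exact Dvd.intro_left _ rfl
        · rw [Coaction.comp_mul_hom_of_lt hej (by omega)]; exact dvd_zero _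
    let H : Set (DRing F) := {h | (∃ n, (grading hF).Hom n h) ∧ h ≠ 0 ∧ ∃ j ∈ G, ∀ g ∈ G, j ∣ h * g}
    have hpow := exists_pow_mem_of_forall_point (Ideal.span H) (by
      intro a b hab ha
      obtain ⟨j, hj, h, hh, hne, hdiv⟩ := hJ0 a b hab ha
      exact ⟨h, Ideal.subset_span ⟨hh, fun h0 => hne (by rw [h0, map_zero]), j, hj, hdiv⟩, hne⟩)
    obtain ⟨H', hH'sub, hH'⟩ : ∃ H' : Finset (DRing F), (H' : Set (DRing F)) ⊆ H ∧
        Ideal.span (H' : Set (DRing F)) = Ideal.span H := by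
      obtain ⟨H', h1, h2⟩ := Submodule.fg_span_iff_fg_span_finset_subset H |>.1
        (IsNoetherian.noetherian (Submodule.span (DRing F) H))
      exact ⟨H', h1, h2.symm⟩
    choose n hn using hpow
    let Y := n 0 + n 1 + n 2 + n 3 + 3
    have hY : ∀ k, inc F (X k) ^ Y ∈ Ideal.span (H' : Set (DRing F)) := by
      intro k
      rw [hH']
      have : n k ≤ Y := by fin_cases k <;> simp [Y] <;> omega
      obtain ⟨e, he⟩ := Nat.exists_eq_add_of_le this
      rw [he, pow_add]
      exact Ideal.mul_mem_right _ _ (hn k)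
    let e := H'.equivFin
    let h : Fin H'.card → DRing F := fun a => (e.symm a : DRing F)
    have hhH : ∀ a, h a ∈ H := fun a => hH'sub (e.symm a).2
    choose eh heh using fun a => (hhH a).1
    choose j hj hjdiv using fun a => (hhH a).2.2
    have hrange : Set.range h = (H' : Set (DRing F)) := by
      ext x; constructor
      · rintro ⟨a, rfl⟩; exact (e.symm a).2
      · intro hx; exact ⟨e ⟨x, hx⟩, by simp [h]⟩
    have hexp : ∀ k, ∃ c : Fin H'.card → DRing F, ∑ a, c a * h a = inc F (X k) ^ Y := by
      intro k
      have := hY k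
      rw [← hrange] at this
      exact (Submodule.mem_span_range_iff_exists_fun (DRing F)).1 this
    choose c hc using hexp
    have hXY : ∀ k, (grading hF).Hom Y (inc F (X k) ^ Y) := by
      intro k
      rw [← map_pow]
      exact hom_inc hF (isHomogeneous_X_pow k Y)
    have hG0 : ∃ g ∈ G, g ≠ 0 := by
      by_contra hcon
      push Not at hcon
      have hbot : Ideal.span (G : Set (DRing F)) = ⊥ := Ideal.span_eq_bot.2 hcon
      have : f i₀ ∈ Ideal.span (G : Set (DRing F)) := by rw [hG]; exact fun t _ => Dvd.intro _ rfl
      rw [hbot] at this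
      exact hf0 this
    refine ⟨H'.card, h, j, Y, fun k a => if eh a ≤ Y then (grading hF).comp (Y - eh a) (c k a) else 0,
      by simp [Y], hj, fun a => (hhH a).2.1, ?_, hjdiv, ?_, ?_⟩
    · intro a ha
      obtain ⟨g, hg, hg0⟩ := hG0
      have := hjdiv a g hg
      rw [ha, zero_dvd_iff] at this
      exact (mul_ne_zero (hhH a).2.1 hg0) this
    · intro k
      rw [← (hXY k).comp_self, ← hc k, Coaction.comp_sum]
      refine Finset.sum_congr rfl fun a _ => ?_
      beta_reduce
      split_ifs with hle
      · conv_lhs => rw [← Nat.sub_add_cancel hle]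
        rw [Coaction.comp_mul_hom (heh a)]
      · rw [Coaction.comp_mul_hom_of_lt (heh a) (by omega), zero_mul]
    · intro k a
      dsimp only
      split_ifs with hle
      · have := (Coaction.hom_comp (D := grading hF) (Y - eh a) (c k a)).mul (heh a)
        rwa [Nat.sub_add_cancel hle] at this
      · rw [zero_mul]; exact Coaction.Hom.zero _

end DRing

theorem MvPolynomial.derivation_aeval {σ A : Type*} [Fintype σ] [CommRing A] [Algebra ℂ A]
    (δ : Derivation ℂ A A) (x : σ → A) (p : MvPolynomial σ ℂ) :
    δ (aeval x p) = ∑ k, aeval x (pderiv k p) * δ (x k) := by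
  classical
  induction p using MvPolynomial.induction_on with
  | C c => simp [MvPolynomial.algHom_C]
  | add p q hp hq => simp only [map_add, hp, hq, add_mul, Finset.sum_add_distrib]
  | mul_X p i hp =>
    simp only [map_mul, aeval_X, Derivation.leibniz, hp, smul_eq_mul, map_add, add_mul,
      Finset.sum_add_distrib, pderiv_X]
    rw [Finset.mul_sum]
    congr 1
    · rw [Finset.sum_eq_single i]
      · simp
      · intro k _ hk; simp [Ne.symm hk]
      · simp
    · exact Finset.sum_congr rfl fun k _ => by ring

theorem Derivation.sum_smul_apply {ι A : Type*} [CommRing A] [Algebra ℂ A] (s : Finset ι)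
    (a : ι → A) (d : ι → Derivation ℂ A A) (z : A) :
    (∑ j ∈ s, a j • d j) z = ∑ j ∈ s, a j * d j z := by
  classical
  induction s using Finset.induction_on with
  | empty => simp
  | insert i s hi ih => rw [Finset.sum_insert hi, Finset.sum_insert hi, Derivation.add_apply, ih]; simp

/-- Powers of the variables lie in the Jacobian ideal of a smooth form. -/
theorem MvPolynomial.exists_X_pow_mem_jacobian {F : Poly4}
    (hsm : ∀ v : Fin 4 → ℂ, (∀ i, eval v (pderiv i F) = 0) → v = 0) :
    ∃ Y : ℕ, ∀ k, (X k : Poly4) ^ Y ∈ Ideal.span (Set.range fun i => pderiv i F) := by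
  have h : ∀ k, ∃ n, (X k : Poly4) ^ n ∈ Ideal.span (Set.range fun i => pderiv i F) := by
    intro k
    rw [← Ideal.mem_radical_iff, ← MvPolynomial.vanishingIdeal_zeroLocus_eq_radical (K := ℂ)]
    rw [MvPolynomial.mem_vanishingIdeal_iff]
    intro v hv
    have := hsm v (fun i => hv _ (Ideal.subset_span ⟨i, rfl⟩))
    simp [this]
  choose n hn using h
  refine ⟨∑ i, n i, fun k => ?_⟩
  have := Finset.single_le_sum (f := n) (fun i _ => Nat.zero_le _) (Finset.mem_univ k)
  obtain ⟨e, he⟩ := Nat.exists_eq_add_of_le this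
  rw [he, pow_add]
  exact Ideal.mul_mem_right _ _ (hn k)

/-- If the `xₖ` have no common prime factor, then `d ∣ xₖʸ z` for all `k` forces `d ∣ z`. -/
theorem dvd_of_forall_dvd_pow_mul {A ι : Type*} [CommRing A] [IsDomain A]
    [UniqueFactorizationMonoid A] (x : ι → A) (hx : ∀ p, Prime p → ∃ k, ¬ p ∣ x k) (Y : ℕ)
    {d z : A} (hd : d ≠ 0) (h : ∀ k, d ∣ x k ^ Y * z) : d ∣ z := by
  induction d using UniqueFactorizationMonoid.induction_on_prime generalizing z with
  | h₁ => exact absurd rfl hd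
  | h₂ d hu => exact hu.dvd
  | h₃ a p ha hp ih =>
    obtain ⟨k, hk⟩ := hx p hp
    have hpz : p ∣ z := by
      rcases hp.dvd_or_dvd ((Dvd.intro _ rfl).trans (h k)) with h1 | h1
      · exact absurd (hp.dvd_of_dvd_pow h1) hk
      · exact h1
    obtain ⟨z', rfl⟩ := hpz
    exact mul_dvd_mul_left p (ih ha fun k => by
      have := h k
      rw [mul_left_comm] at this
      exact (mul_dvd_mul_iff_left hp.ne_zero).1 this)

namespace DRing
variable {F : Poly4}

/-- The derivation `2W ∂ᵢ` of the coordinate ring. -/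
noncomputable def H (i : Fin 4) (r : DRing F) : DRing F :=
  ⟨2 * F * pderiv i r.im + pderiv i F * r.im, 2 * pderiv i r.re⟩

theorem H_add (i : Fin 4) (r s : DRing F) : H i (r + s) = H i r + H i s := by
  ext1 <;> simp [H] <;> ring

theorem H_mul (i : Fin 4) (r s : DRing F) : H i (r * s) = r * H i s + s * H i r := by
  ext1 <;> simp [H, Derivation.leibniz] <;> ring

end DRing

/-- A rational parametrization of the double solid `W² = F`. -/
structure RatParam (F : Poly4) where
  /-- the degree of the parametrization -/
  M : ℕ
  /-- the coordinates of the parametrization -/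
  ξ : Fin 4 → Poly4
  /-- the image of `W` -/
  ω : Poly4
  M_pos : 0 < M
  hom_ξ : ∀ i, (ξ i).IsHomogeneous M
  hom_ω : ω.IsHomogeneous (3 * M)
  sq : ω ^ 2 = aeval ξ F
  inj : Function.Injective (DRing.evalHom ξ ω sq)
  coprime : ∀ p, Prime p → ∃ k, ¬ p ∣ ξ k
  /-- the degree of the inverse map -/
  N : ℕ
  /-- the inverse map -/
  f : Fin 4 → DRing F
  /-- the common factor -/
  c : Poly4
  hF : F.IsHomogeneous 6
  hom_f : ∀ i, (DRing.grading hF).Hom N (f i)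
  c_ne_zero : c ≠ 0
  eval_f : ∀ i, DRing.evalHom ξ ω sq (f i) = X i * c

namespace RatParam
variable {F : Poly4} (D : RatParam F)

/-- The parametrization as a homomorphism. -/
noncomputable abbrev Ψ : DRing F →ₐ[ℂ] Poly4 := DRing.evalHom D.ξ D.ω D.sq

theorem Ψ_ne_zero {r : DRing F} (h : r ≠ 0) : D.Ψ r ≠ 0 :=
  (map_ne_zero_iff _ D.inj).2 h

theorem isDomain (D : RatParam F) : IsDomain (DRing F) := Function.Injective.isDomain D.Ψ.toRingHom D.inj

theorem ω_ne_zero : D.ω ≠ 0 := by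
  have := D.Ψ_ne_zero (r := DRing.W F) (fun h => by simpa using congrArg QuadraticAlgebra.im h)
  simpa using this

theorem ξ_ne_zero (k : Fin 4) : D.ξ k ≠ 0 := by
  have := D.Ψ_ne_zero (r := DRing.inc F (X k)) (fun h => by
    simpa using congrArg QuadraticAlgebra.re h)
  simpa using this

theorem derivation_Ψ (δ : Derivation ℂ Poly4 Poly4) (r : DRing F) :
    δ (D.Ψ r) = (∑ k, (aeval D.ξ (pderiv k r.re) + D.ω * aeval D.ξ (pderiv k r.im)) * δ (D.ξ k)) +
      aeval D.ξ r.im * δ D.ω := by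
  rw [DRing.evalHom_apply, map_add, Derivation.leibniz, derivation_aeval, derivation_aeval]
  simp only [smul_eq_mul, Finset.mul_sum, add_mul, Finset.sum_add_distrib, mul_assoc]
  ring

theorem two_ω_derivation (δ : Derivation ℂ Poly4 Poly4) :
    2 * D.ω * δ D.ω = ∑ k, aeval D.ξ (pderiv k F) * δ (D.ξ k) := by
  rw [← derivation_aeval, ← D.sq, pow_two, Derivation.leibniz, smul_eq_mul]; ring

/-- The Jacobian matrix. -/
noncomputable def jacMat : Matrix (Fin 4) (Fin 4) Poly4 :=
  Matrix.of fun k j => pderiv j (D.ξ k)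

/-- The derivation `z ↦ ∂(ξ₀,…,z,…,ξ₃)/∂(τ₀,…,τ₃)`, with `z` in place `i`. -/
noncomputable def jacDer (i : Fin 4) : Derivation ℂ Poly4 Poly4 :=
  ∑ j, D.jacMat.adjugate j i • pderiv j

theorem jacDer_apply (i : Fin 4) (z : Poly4) :
    D.jacDer i z = ∑ j, D.jacMat.adjugate j i * pderiv j z := by
  simp [jacDer, Derivation.sum_smul_apply]

theorem jacDer_ξ (i m : Fin 4) : D.jacDer i (D.ξ m) = if m = i then D.jacMat.det else 0 := by
  have := congrFun (congrFun (Matrix.mul_adjugate D.jacMat) m) i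
  rw [Matrix.mul_apply, Matrix.smul_apply, Matrix.one_apply] at this
  rw [jacDer_apply]
  simp only [smul_eq_mul, mul_ite, mul_one, mul_zero] at this
  rw [← this]
  exact Finset.sum_congr rfl fun j _ => by rw [mul_comm]; rfl

theorem two_ω_jacDer_ω (i : Fin 4) :
    2 * D.ω * D.jacDer i D.ω = D.jacMat.det * aeval D.ξ (pderiv i F) := by
  rw [two_ω_derivation, Finset.sum_eq_single i]
  · rw [jacDer_ξ, if_pos rfl, mul_comm]
  · intro k _ hk; rw [jacDer_ξ, if_neg hk, mul_zero]
  · simp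

theorem det_jacMat_ne_zero : D.jacMat.det ≠ 0 := by
  intro h0
  obtain ⟨a, ha0, ha⟩ := Matrix.exists_mulVec_eq_zero_iff.2 h0
  let δ : Derivation ℂ Poly4 Poly4 := ∑ j, a j • pderiv j
  have hδ : ∀ z, δ z = ∑ j, a j * pderiv j z := fun z => by simp [δ, Derivation.sum_smul_apply]
  have hδξ : ∀ k, δ (D.ξ k) = 0 := by
    intro k
    have := congrFun ha k
    rw [hδ, ← Pi.zero_apply (M := fun _ : Fin 4 => Poly4) k, ← this]
    exact Finset.sum_congr rfl fun j _ => mul_comm _ _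
  have hδω : δ D.ω = 0 := by
    have := D.two_ω_derivation δ
    simp only [hδξ, mul_zero, Finset.sum_const_zero] at this
    exact (mul_eq_zero.1 this).resolve_left (mul_ne_zero two_ne_zero D.ω_ne_zero)
  have hδΨ : ∀ r, δ (D.Ψ r) = 0 := by
    intro r; rw [derivation_Ψ]; simp [hδξ, hδω]
  have h1 : ∀ i, a i * D.c = - (X i * δ D.c) := by
    intro i
    have := hδΨ (D.f i)
    rw [D.eval_f, Derivation.leibniz, smul_eq_mul, smul_eq_mul] at this
    have h2 : δ (X i) = a i := by
      rw [hδ, Finset.sum_eq_single i]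
      · simp
      · intro j _ hj; rw [pderiv_X_of_ne hj.symm, mul_zero]
      · simp
    rw [h2] at this
    linear_combination this
  have hδc : δ D.c ≠ 0 := by
    intro h
    apply ha0
    ext1 i
    have := h1 i
    rw [h, mul_zero, neg_zero] at this
    exact (mul_eq_zero.1 this).resolve_right D.c_ne_zero
  have h2 := hδξ 0
  have h3 : δ D.c * (D.M • D.ξ 0) = 0 := by
    rw [← (D.hom_ξ 0).sum_X_mul_pderiv, Finset.mul_sum]
    have : D.c * δ (D.ξ 0) = 0 := by rw [h2, mul_zero]
    rw [hδ, Finset.mul_sum] at this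
    rw [← neg_eq_zero, ← this, ← Finset.sum_neg_distrib]
    refine Finset.sum_congr rfl fun j _ => ?_
    linear_combination (-pderiv j (D.ξ 0)) * h1 j
  rcases mul_eq_zero.1 h3 with h | h
  · exact hδc h
  · rw [nsmul_eq_mul] at h
    rcases mul_eq_zero.1 h with h | h
    · exact D.M_pos.ne' (by exact_mod_cast h)
    · exact D.ξ_ne_zero 0 h

theorem exists_det_eq (hsm : ∀ v : Fin 4 → ℂ, (∀ i, eval v (pderiv i F) = 0) → v = 0) :
    ∃ G, D.jacMat.det = G * D.ω := by
  obtain ⟨Y, hY⟩ := exists_X_pow_mem_jacobian hsm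
  have : D.ω ∣ D.jacMat.det := by
    apply dvd_of_forall_dvd_pow_mul D.ξ D.coprime Y D.ω_ne_zero
    intro k
    have h1 := hY k
    obtain ⟨q, hq⟩ := (Submodule.mem_span_range_iff_exists_fun Poly4).1 h1
    have h3 := congrArg (aeval D.ξ) hq
    simp only [smul_eq_mul, map_sum, map_mul, map_pow, aeval_X] at h3
    rw [← h3, Finset.sum_mul]
    refine Finset.dvd_sum fun i _ => ?_
    have := D.two_ω_jacDer_ω i
    exact ⟨aeval D.ξ (q i) * (2 * D.jacDer i D.ω), by linear_combination (-aeval D.ξ (q i)) * this⟩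
  obtain ⟨G, hG⟩ := this
  exact ⟨G, by rw [hG, mul_comm]⟩

theorem two_jacDer_Ψ {G : Poly4} (hG : D.jacMat.det = G * D.ω) (i : Fin 4) (r : DRing F) :
    2 * D.jacDer i (D.Ψ r) = G * D.Ψ (DRing.H i r) := by
  have hω : 2 * D.jacDer i D.ω = G * aeval D.ξ (pderiv i F) := by
    apply mul_left_cancel₀ D.ω_ne_zero
    have := D.two_ω_jacDer_ω i
    rw [hG] at this
    linear_combination this
  rw [derivation_Ψ, Finset.sum_eq_single i]
  · rw [jacDer_ξ, if_pos rfl, hG, DRing.evalHom_apply]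
    simp only [DRing.H, map_add, map_mul, ← D.sq, map_ofNat]
    linear_combination (aeval D.ξ r.im) * hω
  · intro k _ hk; rw [jacDer_ξ, if_neg hk, mul_zero]
  · simp

end RatParam

/-! ### Koszul exactness for powers of the variables -/

section KoszulPow
variable {R : Type*} [CommRing R] (y : Fin 4 → R) (Q : Fin 4 → R →+ R)

theorem koszul_one (hself : ∀ k r, Q k (y k * r) = r)
    (hne : ∀ k l r, l ≠ k → Q k (y l * r) = y l * Q k r)
    {c01 c02 c03 c12 c13 c23 : R} (h012 : y 2 * c01 + y 0 * c12 - y 1 * c02 = 0)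
    (h013 : y 3 * c01 + y 0 * c13 - y 1 * c03 = 0) (h023 : y 3 * c02 + y 0 * c23 - y 2 * c03 = 0) :
    ∃ b0 b1 b2 b3, c01 = y 1 * b0 - y 0 * b1 ∧ c02 = y 2 * b0 - y 0 * b2 ∧
      c03 = y 3 * b0 - y 0 * b3 ∧ c12 = y 2 * b1 - y 1 * b2 ∧ c13 = y 3 * b1 - y 1 * b3 ∧
      c23 = y 3 * b2 - y 2 * b3 := by
  have q0 : ∀ {a b c : R} {k l : Fin 4}, k ≠ 0 → l ≠ 0 → y k * a + y 0 * b - y l * c = 0 →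
      b = y l * Q 0 c - y k * Q 0 a := by
    intro a b c k l hk hl h
    have := congrArg (Q 0) h
    rw [map_sub, map_add, hself, hne _ _ _ hk, hne _ _ _ hl, map_zero] at this
    linear_combination this
  have e12 := q0 (by decide) (by decide) h012
  have e13 := q0 (by decide) (by decide) h013
  have e23 := q0 (by decide) (by decide) h023
  have f12 : y 2 * (c01 - y 0 * Q 0 c01) = y 1 * (c02 - y 0 * Q 0 c02) := by
    rw [e12] at h012; linear_combination h012
  have f13 : y 3 * (c01 - y 0 * Q 0 c01) = y 1 * (c03 - y 0 * Q 0 c03) := by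
    rw [e13] at h013; linear_combination h013
  have g2 := congrArg (Q 1) f12
  rw [hself, hne _ _ _ (by decide)] at g2
  have g3 := congrArg (Q 1) f13
  rw [hself, hne _ _ _ (by decide)] at g3
  have g1 : c01 - y 0 * Q 0 c01 = y 1 * Q 1 (c01 - y 0 * Q 0 c01) := by
    rw [← g2, mul_left_comm] at f12
    have := congrArg (Q 2) f12
    rwa [hself, hself] at this
  generalize Q 1 (c01 - y 0 * Q 0 c01) = b0 at *
  refine ⟨b0, -Q 0 c01, -Q 0 c02, -Q 0 c03, ?_, ?_, ?_, ?_, ?_, ?_⟩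
  · linear_combination g1
  · linear_combination -g2
  · linear_combination -g3
  · linear_combination e12
  · linear_combination e13
  · linear_combination e23

theorem koszul_two (hself : ∀ k r, Q k (y k * r) = r)
    (hne : ∀ k l r, l ≠ k → Q k (y l * r) = y l * Q k r) {t012 t013 t023 t123 : R}
    (h : y 0 * t123 - y 1 * t023 + y 2 * t013 - y 3 * t012 = 0) :
    ∃ s01 s02 s03 s12 s13 s23, t012 = y 2 * s01 + y 0 * s12 - y 1 * s02 ∧
      t013 = y 3 * s01 + y 0 * s13 - y 1 * s03 ∧ t023 = y 3 * s02 + y 0 * s23 - y 2 * s03 ∧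
      t123 = y 3 * s12 + y 1 * s23 - y 2 * s13 := by
  have h0 := congrArg (Q 0) h
  rw [map_sub, map_add, map_sub, hself, hne _ _ _ (by decide), hne _ _ _ (by decide),
    hne _ _ _ (by decide), map_zero] at h0
  have h1 : y 1 * (t023 - y 0 * Q 0 t023) - y 2 * (t013 - y 0 * Q 0 t013) +
      y 3 * (t012 - y 0 * Q 0 t012) = 0 := by linear_combination -h + y 0 * h0
  generalize Q 0 t012 = s12 at *
  generalize Q 0 t013 = s13 at *
  generalize Q 0 t023 = s23 at *
  have h2 := congrArg (Q 1) h1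
  rw [map_add, map_sub, hself, hne _ _ _ (by decide), hne _ _ _ (by decide), map_zero] at h2
  have h3 : y 2 * (t013 - y 0 * s13 - y 1 * Q 1 (t013 - y 0 * s13)) =
      y 3 * (t012 - y 0 * s12 - y 1 * Q 1 (t012 - y 0 * s12)) := by
    linear_combination -h1 + y 1 * h2
  generalize Q 1 (t013 - y 0 * s13) = u at *
  generalize Q 1 (t012 - y 0 * s12) = v at *
  have h4 := congrArg (Q 2) h3
  rw [hself, hne _ _ _ (by decide)] at h4
  have h5 : y 2 * Q 2 (t012 - y 0 * s12 - y 1 * v) = t012 - y 0 * s12 - y 1 * v := by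
    rw [h4, mul_left_comm] at h3
    have := congrArg (Q 3) h3
    rwa [hself, hself] at this
  generalize Q 2 (t012 - y 0 * s12 - y 1 * v) = w at *
  exact ⟨w, -v, -u, s12, s13, s23, by linear_combination -h5, by linear_combination h4,
    by linear_combination h2, by linear_combination h0⟩

end KoszulPow

theorem MvPolynomial.X_coprime (p : Poly4) (hp : Prime p) : ∃ k, ¬ p ∣ (X k : Poly4) := by
  by_contra hcon
  push Not at hcon
  have h0 : (X 0 : Poly4) ∣ X 1 :=
    ((hp.dvd_prime_iff_associated X_prime).1 (hcon 0)).symm.dvd.trans (hcon 1)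
  obtain ⟨q, hq⟩ := h0
  have := congrArg (eval (Pi.single (1 : Fin 4) (1 : ℂ))) hq
  simp at this

namespace DRing
variable {F : Poly4}

/-- Division by a power of a variable, discarding the remainder. -/
noncomputable def divX (Y : ℕ) (k : Fin 4) : DRing F →+ DRing F where
  toFun r := ⟨r.re.divMonomial (Finsupp.single k Y), r.im.divMonomial (Finsupp.single k Y)⟩
  map_zero' := by ext1 <;> simp
  map_add' r s := by ext1 <;> simp [MvPolynomial.add_divMonomial]

theorem inc_mul (p : Poly4) (r : DRing F) : inc F p * r = ⟨p * r.re, p * r.im⟩ := by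
  ext1 <;> simp

theorem divX_self (Y : ℕ) (k : Fin 4) (r : DRing F) : divX Y k (inc F (X k) ^ Y * r) = r := by
  rw [← map_pow, inc_mul]
  ext1 <;> simp [divX, X_pow_eq_monomial]

theorem divX_ne (Y : ℕ) (k l : Fin 4) (r : DRing F) (h : l ≠ k) :
    divX Y k (inc F (X l) ^ Y * r) = inc F (X l) ^ Y * divX Y k r := by
  have key : ∀ p : Poly4, (X l ^ Y * p).divMonomial (Finsupp.single k Y) =
      X l ^ Y * p.divMonomial (Finsupp.single k Y) := by
    intro p
    ext d
    rw [coeff_divMonomial, X_pow_eq_monomial, coeff_monomial_mul', coeff_monomial_mul',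
      coeff_divMonomial]
    have h1 : Finsupp.single l Y ≤ Finsupp.single k Y + d ↔ Finsupp.single l Y ≤ d := by
      rw [Finsupp.single_le_iff, Finsupp.single_le_iff]; simp [h.symm]
    by_cases h2 : Finsupp.single l Y ≤ d
    · rw [if_pos h2, if_pos (h1.2 h2), add_tsub_assoc_of_le h2]
    · rw [if_neg h2, if_neg (fun h3 => h2 (h1.1 h3))]
  rw [← map_pow, inc_mul, inc_mul]
  ext1 <;> simp [divX, key]

/-- If `X₀ʸ a = X₁ʸ b` then `X₀ʸ` divides `b`. -/
theorem dvd_of_X_pow_mul_eq {Y : ℕ} {a b : DRing F}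
    (h : inc F (X 0) ^ Y * a = inc F (X 1) ^ Y * b) : ∃ c, b = inc F (X 0) ^ Y * c := by
  have := congrArg (divX Y 1) h
  rw [divX_self, divX_ne _ _ _ _ (by decide)] at this
  exact ⟨_, this.symm⟩

end DRing

theorem sum_mul_sum_add {A ι : Type*} [CommRing A] [Fintype ι] (a p : ι → A) (x : ι → ι → A)
    (w : ι → A) (q : A) : ∑ j, a j * ((∑ k, p k * x k j) + q * w j) =
      (∑ k, p k * ∑ j, a j * x k j) + q * ∑ j, a j * w j := by
  simp only [mul_add, Finset.sum_add_distrib, Finset.mul_sum]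
  rw [Finset.sum_comm]
  refine congrArg₂ (· + ·) ?_ ?_
  · exact Finset.sum_congr rfl fun k _ => Finset.sum_congr rfl fun j _ => by ring
  · exact Finset.sum_congr rfl fun j _ => by ring

namespace RatParam
variable {F : Poly4} (D : RatParam F)

/-- The one-form `∑ bₖ dXₖ + b_W dW`, pulled back and evaluated on `∂ⱼ`. -/
noncomputable def pair (j : Fin 4) : (Option (Fin 4) → DRing F) →+ Poly4 where
  toFun b := (∑ k, D.Ψ (b (some k)) * pderiv j (D.ξ k)) + D.Ψ (b none) * pderiv j D.ω
  map_zero' := by simp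
  map_add' b c := by
    simp only [Pi.add_apply, map_add, add_mul, Finset.sum_add_distrib]; ring

theorem pair_apply (j : Fin 4) (b : Option (Fin 4) → DRing F) : D.pair j b =
    (∑ k, D.Ψ (b (some k)) * pderiv j (D.ξ k)) + D.Ψ (b none) * pderiv j D.ω := rfl

theorem pair_smul (j : Fin 4) (r : DRing F) (b : Option (Fin 4) → DRing F) :
    D.pair j (r • b) = D.Ψ r * D.pair j b := by
  simp only [pair_apply, Pi.smul_apply, smul_eq_mul, map_mul, mul_add, Finset.mul_sum, mul_assoc]

/-- The differential of an element of the coordinate ring. -/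
noncomputable def grad (r : DRing F) : Option (Fin 4) → DRing F
  | none => DRing.inc F r.im
  | some k => ⟨pderiv k r.re, pderiv k r.im⟩

theorem pair_grad (j : Fin 4) (r : DRing F) : D.pair j (grad r) = pderiv j (D.Ψ r) := by
  rw [derivation_Ψ, pair_apply]
  simp only [grad, DRing.evalHom_apply, DRing.inc_re, DRing.inc_im, map_zero, mul_zero, add_zero]

/-- The differential of `F - W²`. -/
noncomputable def relForm (F : Poly4) : Option (Fin 4) → DRing F
  | none => -2 * DRing.W F
  | some k => DRing.inc F (pderiv k F)

theorem pair_relForm (j : Fin 4) : D.pair j (relForm F) = 0 := by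
  have := D.two_ω_derivation (pderiv j)
  rw [pair_apply]
  simp only [relForm, map_mul, map_neg, map_ofNat, DRing.evalHom_W, DRing.evalHom_inc]
  rw [← this]; ring

theorem sum_adjugate_mul_pair (i : Fin 4) (b : Option (Fin 4) → DRing F) :
    ∑ j, D.jacMat.adjugate j i * D.pair j b =
      (∑ k, D.Ψ (b (some k)) * D.jacDer i (D.ξ k)) + D.Ψ (b none) * D.jacDer i D.ω := by
  rw [jacDer_apply]
  simp_rw [jacDer_apply, pair_apply]
  exact sum_mul_sum_add _ _ (fun k j => pderiv j (D.ξ k)) _ _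

theorem two_W_mul_add_eq_zero (hsm : ∀ v : Fin 4 → ℂ, (∀ i, eval v (pderiv i F) = 0) → v = 0)
    (b : Option (Fin 4) → DRing F) (hb : ∀ j, D.pair j b = 0) (i : Fin 4) :
    2 * DRing.W F * b (some i) + DRing.inc F (pderiv i F) * b none = 0 := by
  obtain ⟨G, hG⟩ := D.exists_det_eq hsm
  have hG0 : G ≠ 0 := by
    rintro rfl; exact D.det_jacMat_ne_zero (by rw [hG, zero_mul])
  apply D.inj
  have h2 : ∑ j, D.jacMat.adjugate j i * D.pair j b = 0 := by simp [hb]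
  rw [D.sum_adjugate_mul_pair, Finset.sum_eq_single i, jacDer_ξ, if_pos rfl, hG] at h2
  · have h4 := D.two_jacDer_Ψ hG i (DRing.W F)
    have h5 : DRing.H i (DRing.W F) = DRing.inc F (pderiv i F) := by
      ext1 <;> simp [DRing.H]
    rw [DRing.evalHom_W, h5] at h4
    rw [map_zero, map_add, map_mul, map_mul, map_mul, DRing.evalHom_W, map_ofNat]
    apply mul_left_cancel₀ hG0
    linear_combination 2 * h2 - D.Ψ (b none) * h4
  · intro k _ hk; rw [jacDer_ξ, if_neg hk, mul_zero]
  · simp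

theorem exists_eq_smul_relForm (hsm : ∀ v : Fin 4 → ℂ, (∀ i, eval v (pderiv i F) = 0) → v = 0)
    (b : Option (Fin 4) → DRing F) (hb : ∀ j, D.pair j b = 0) : ∃ t : DRing F, b = t • relForm F := by
  have hF0 : F ≠ 0 := by
    intro h
    have : D.ω ^ 2 = 0 := D.sq.trans ((congrArg (aeval D.ξ) h).trans (map_zero _))
    exact D.ω_ne_zero (pow_eq_zero_iff two_ne_zero |>.1 this)
  have h1 := D.two_W_mul_add_eq_zero hsm b hb
  have hre : ∀ i, 2 * (F * (b (some i)).im) + pderiv i F * (b none).re = 0 := by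
    intro i
    have := congrArg QuadraticAlgebra.re (h1 i)
    rw [mul_assoc] at this
    simpa [two_mul] using this
  have him : ∀ i, 2 * (b (some i)).re + pderiv i F * (b none).im = 0 := by
    intro i
    have := congrArg QuadraticAlgebra.im (h1 i)
    rw [mul_assoc] at this
    simpa [two_mul] using this
  have hdvd : F ∣ (b none).re := by
    obtain ⟨Y, hY⟩ := exists_X_pow_mem_jacobian hsm
    apply dvd_of_forall_dvd_pow_mul X X_coprime Y hF0
    intro k
    obtain ⟨q, hq⟩ := (Submodule.mem_span_range_iff_exists_fun Poly4).1 (hY k)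
    simp only [smul_eq_mul] at hq
    rw [← hq, Finset.sum_mul]
    refine Finset.dvd_sum fun i _ => ?_
    exact ⟨-(2 * q i * (b (some i)).im), by linear_combination q i * hre i⟩
  obtain ⟨α, hα⟩ := hdvd
  have half : (2 : Poly4) * C 2⁻¹ = 1 := by
    rw [← map_ofNat C 2, ← C_mul]; norm_num
  refine ⟨⟨-C 2⁻¹ * (b none).im, -C 2⁻¹ * α⟩, ?_⟩
  funext i
  rcases i with _ | i
  · simp only [Pi.smul_apply, relForm, smul_eq_mul]
    rw [show (-2 : DRing F) * DRing.W F = ⟨0, -2⟩ by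
      ext1 <;> simp [QuadraticAlgebra.re_ofNat, QuadraticAlgebra.im_ofNat]]
    ext1
    · simp [hα]; linear_combination (-F * α) * half
    · simp; linear_combination (-(b none).im) * half
  · simp only [Pi.smul_apply, relForm, smul_eq_mul]
    ext1
    · simp
      linear_combination (C 2⁻¹) * him i - (b (some i)).re * half
    · simp
      have h6 := hre i
      rw [hα] at h6
      have h7 : 2 * (b (some i)).im + pderiv i F * α = 0 :=
        mul_left_cancel₀ hF0 (by linear_combination h6)
      linear_combination (C 2⁻¹) * h7 - (b (some i)).im * half

/-- The parametrization is compatible with the gradings. -/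
theorem comp_Ψ (r : DRing F) (n : ℕ) : (MvPolynomial.grading (Fin 4) ℂ).comp (n * D.M) (D.Ψ r) =
    D.Ψ ((DRing.grading D.hF).comp n r) := by
  let A : Poly4 →ₐ[ℂ] Polynomial Poly4 := aeval (fun i => Polynomial.C (X i : Poly4) * Polynomial.X)
  have hA : ∀ {p : Poly4} {m : ℕ}, p.IsHomogeneous m → A p = Polynomial.monomial m p :=
    fun h => MvPolynomial.grading_hom.2 h
  have h : (Polynomial.C (DRing.W F) * Polynomial.X ^ 3) ^ 2 =
      aeval (fun i => Polynomial.C (DRing.inc F (X i)) * Polynomial.X) F := by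
    have := (DRing.grading D.hF).toHom.map_pow (DRing.W F) 2
    rw [DRing.W_sq] at this
    simpa [DRing.grading] using this.symm
  let B : DRing F →ₐ[ℂ] Polynomial (DRing F) := DRing.evalHom
    (fun i => Polynomial.C (DRing.inc F (X i)) * Polynomial.X)
    (Polynomial.C (DRing.W F) * Polynomial.X ^ 3) h
  have key : A.comp D.Ψ = (((Polynomial.expand Poly4 D.M).restrictScalars ℂ).comp
      (Polynomial.mapAlgHom D.Ψ)).comp B := by
    apply DRing.algHom_ext'
    · intro i
      simp only [AlgHom.comp_apply, DRing.evalHom_inc, aeval_X, hA (D.hom_ξ i), B]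
      simp [Polynomial.C_mul_X_pow_eq_monomial]
    · simp only [AlgHom.comp_apply, DRing.evalHom_W, hA D.hom_ω, B]
      simp [← Polynomial.C_mul_X_pow_eq_monomial, mul_comm 3, pow_mul]
  have h1 := congrArg (fun q => Polynomial.coeff q (n * D.M)) (DFunLike.congr_fun key r)
  simp only [AlgHom.comp_apply, AlgHom.restrictScalars_apply] at h1
  rw [Polynomial.coeff_expand_mul D.M_pos] at h1
  refine Eq.trans h1 ?_
  simp only [Polynomial.coe_mapAlgHom, Polynomial.coeff_map]
  rfl

end RatParam

namespace RatParam
variable {F : Poly4} (D : RatParam F)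

theorem smul_relForm_injective (D : RatParam F) {t s : DRing F} (h : t • relForm F = s • relForm F) :
    t = s := by
  have := D.isDomain
  have h1 := congrFun h none
  simp only [Pi.smul_apply, relForm, smul_eq_mul] at h1
  refine mul_right_cancel₀ (mul_ne_zero ?_ ?_) h1
  · have h2 : D.Ψ (-2) ≠ 0 := by rw [map_neg, map_ofNat]; exact neg_ne_zero.2 two_ne_zero
    exact fun h3 => h2 (by rw [h3, map_zero])
  · exact fun h3 => D.ω_ne_zero (by rw [← DRing.evalHom_W D.ξ D.ω D.sq, h3, map_zero])

/-- Forms with coefficients in the coordinate ring satisfying the Čech cocycle condition modulo the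
relation `F = W²` are coboundaries modulo that relation. -/
theorem exists_coboundary (hsm : ∀ v : Fin 4 → ℂ, (∀ i, eval v (pderiv i F) = 0) → v = 0) (Y : ℕ)
    (Ω : Fin 4 → Fin 4 → Poly4) (C : Fin 4 → Fin 4 → Option (Fin 4) → DRing F)
    (hC : ∀ k l j, D.pair j (C k l) = D.ξ l ^ Y * Ω k j - D.ξ k ^ Y * Ω l j) :
    ∃ b : Fin 4 → Option (Fin 4) → DRing F, ∀ k l j,
      D.ξ l ^ Y * (Ω k j - D.pair j (b k)) = D.ξ k ^ Y * (Ω l j - D.pair j (b l)) := by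
  have := D.isDomain
  let y : Fin 4 → DRing F := fun k => DRing.inc F (X k) ^ Y
  have hy : ∀ k, D.Ψ (y k) = D.ξ k ^ Y := fun k => by simp [y]
  have ht : ∀ k l m, ∃ t : DRing F, y m • C k l + y k • C l m - y l • C k m = t • relForm F := by
    intro k l m
    apply D.exists_eq_smul_relForm hsm
    intro j
    rw [map_sub, map_add, pair_smul, pair_smul, pair_smul, hC, hC, hC, hy, hy, hy]
    ring
  choose t ht using ht
  have hrel : y 0 * t 1 2 3 - y 1 * t 0 2 3 + y 2 * t 0 1 3 - y 3 * t 0 1 2 = 0 := by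
    apply D.smul_relForm_injective
    rw [sub_smul, add_smul, sub_smul, mul_smul, mul_smul, mul_smul, mul_smul, ← ht, ← ht, ← ht, ← ht]
    generalize y 0 = y0
    generalize y 1 = y1
    generalize y 2 = y2
    generalize y 3 = y3
    module
  obtain ⟨s01, s02, s03, s12, s13, s23, e012, e013, e023, -⟩ :=
    koszul_two y (fun k => DRing.divX Y k) (fun k r => DRing.divX_self Y k r)
      (fun k l r h => DRing.divX_ne Y k l r h) hrel
  have hb : ∀ i, ∃ b0 b1 b2 b3 : DRing F,
      (C 0 1 i - s01 * relForm F i) = y 1 * b0 - y 0 * b1 ∧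
      (C 0 2 i - s02 * relForm F i) = y 2 * b0 - y 0 * b2 ∧
      (C 0 3 i - s03 * relForm F i) = y 3 * b0 - y 0 * b3 ∧
      (C 1 2 i - s12 * relForm F i) = y 2 * b1 - y 1 * b2 ∧
      (C 1 3 i - s13 * relForm F i) = y 3 * b1 - y 1 * b3 ∧
      (C 2 3 i - s23 * relForm F i) = y 3 * b2 - y 2 * b3 := by
    intro i
    have h012 := congrFun (ht 0 1 2) i
    have h013 := congrFun (ht 0 1 3) i
    have h023 := congrFun (ht 0 2 3) i
    simp only [Pi.sub_apply, Pi.add_apply, Pi.smul_apply, smul_eq_mul] at h012 h013 h023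
    rw [e012] at h012
    rw [e013] at h013
    rw [e023] at h023
    refine koszul_one y (fun k => DRing.divX Y k) (fun k r => DRing.divX_self Y k r)
      (fun k l r h => DRing.divX_ne Y k l r h) ?_ ?_ ?_
    · linear_combination h012
    · linear_combination h013
    · linear_combination h023
  choose b0 b1 b2 b3 h01 h02 h03 h12 h13 h23 using hb
  have fin : ∀ (c : Option (Fin 4) → DRing F) (s y1 y2 : DRing F) (b b' : Option (Fin 4) → DRing F)
      (j : Fin 4), (∀ i, c i - s * relForm F i = y1 * b i - y2 * b' i) →
      D.pair j c = D.Ψ y1 * D.pair j b - D.Ψ y2 * D.pair j b' := by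
    intro c s y1 y2 b b' j h
    have : c = s • relForm F + y1 • b - y2 • b' := by
      funext i
      have := h i
      simp only [Pi.sub_apply, Pi.add_apply, Pi.smul_apply, smul_eq_mul]
      linear_combination this
    rw [this, map_sub, map_add, pair_smul, pair_smul, pair_smul, pair_relForm]; ring
  have pr : ∀ (k l : Fin 4) (s : DRing F) (b b' : Option (Fin 4) → DRing F),
      (∀ i, C k l i - s * relForm F i = y l * b i - y k * b' i) → ∀ j,
      D.ξ l ^ Y * (Ω k j - D.pair j b) = D.ξ k ^ Y * (Ω l j - D.pair j b') := by
    intro k l s b b' h j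
    have := fin _ _ _ _ _ _ j h
    rw [hy, hy] at this
    linear_combination this - hC k l j
  have key : ∀ k l j, k < l → D.ξ l ^ Y * (Ω k j - D.pair j (![b0, b1, b2, b3] k)) =
      D.ξ k ^ Y * (Ω l j - D.pair j (![b0, b1, b2, b3] l)) := by
    intro k l j hkl
    fin_cases k <;> fin_cases l <;> first | exact absurd hkl (by decide) | skip
    · exact pr 0 1 _ _ _ h01 j
    · exact pr 0 2 _ _ _ h02 j
    · exact pr 0 3 _ _ _ h03 j
    · exact pr 1 2 _ _ _ h12 j
    · exact pr 1 3 _ _ _ h13 j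
    · exact pr 2 3 _ _ _ h23 j
  refine ⟨![b0, b1, b2, b3], fun k l j => ?_⟩
  rcases lt_trichotomy k l with h | h | h
  · exact key k l j h
  · subst h; rfl
  · exact (key l k j h).symm

/-- The part of a form `∑ bₖ dXₖ + b_W dW` of total degree `Y`. -/
noncomputable def formComp (Y : ℕ) (b : Option (Fin 4) → DRing F) : Option (Fin 4) → DRing F
  | none => (DRing.grading D.hF).comp (Y - 3) (b none)
  | some k => (DRing.grading D.hF).comp (Y - 1) (b (some k))

theorem comp_pair {Y : ℕ} (hY : 3 ≤ Y) (b : Option (Fin 4) → DRing F) (j : Fin 4) :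
    (MvPolynomial.grading (Fin 4) ℂ).comp (Y * D.M - 1) (D.pair j b) =
      D.pair j (D.formComp Y b) := by
  have hM := D.M_pos
  have h1 : Y * D.M - 1 = (Y - 1) * D.M + (D.M - 1) := by
    obtain ⟨e, rfl⟩ := Nat.exists_eq_add_of_le hY
    obtain ⟨m, hm⟩ : ∃ m, D.M = m + 1 := ⟨D.M - 1, by omega⟩
    rw [hm]; simp only [show 3 + e - 1 = e + 2 by omega]; ring_nf; omega
  have h3 : Y * D.M - 1 = (Y - 3) * D.M + (3 * D.M - 1) := by
    obtain ⟨e, rfl⟩ := Nat.exists_eq_add_of_le hY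
    obtain ⟨m, hm⟩ : ∃ m, D.M = m + 1 := ⟨D.M - 1, by omega⟩
    rw [hm]; simp only [show 3 + e - 3 = e by omega]; ring_nf; omega
  rw [pair_apply, pair_apply, Coaction.comp_add, Coaction.comp_sum]
  congr 1
  · refine Finset.sum_congr rfl fun k _ => ?_
    rw [h1, Coaction.comp_mul_hom (grading_hom.2 (D.hom_ξ k).pderiv), comp_Ψ]
    rfl
  · rw [h3, Coaction.comp_mul_hom (grading_hom.2 D.hom_ω.pderiv), comp_Ψ]
    rfl

/-- Existence of a logarithmic connection on a divisorial ideal of the cone: for local generators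
`Ψ jₐ = φ eₐ` on the cover `Ψ hₐ = eₐ e'ₐ`, the forms `Xₖʸ hₐ d log eₐ` are regular. -/
theorem exists_log_connection (hsm : ∀ v : Fin 4 → ℂ, (∀ i, eval v (pderiv i F) = 0) → v = 0)
    {m : ℕ} (h : Fin m → DRing F) (r : Fin m → Fin m → DRing F) {Y : ℕ} (hY : 3 ≤ Y)
    (l : Fin 4 → Fin m → DRing F) (e e' : Fin m → Poly4) (he : ∀ a, D.Ψ (h a) = e a * e' a)
    (hr : ∀ a b, D.Ψ (r a b) = e' a * e b) (hsum : ∀ k, DRing.inc F (X k) ^ Y = ∑ a, l k a * h a)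
    (hhom : ∀ k a, (DRing.grading D.hF).Hom Y (l k a * h a)) (h0 : ∀ a, h a ≠ 0) :
    ∀ a k, ∃ x : Option (Fin 4) → DRing F, ∀ j,
      D.ξ k ^ Y * (e' a * pderiv j (e a)) = D.pair j x := by
  have := D.isDomain
  have hYsum : ∀ k, D.ξ k ^ Y = ∑ a, D.Ψ (l k a) * (e a * e' a) := by
    intro k
    have := congrArg D.Ψ (hsum k)
    rw [map_pow, DRing.evalHom_inc, aeval_X, map_sum] at this
    rw [this]
    exact Finset.sum_congr rfl fun a _ => by rw [map_mul, he]
  let cab : Fin m → Fin m → Option (Fin 4) → DRing F := fun a b =>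
    h b • grad (h a) - r b a • grad (r a b)
  have hcab : ∀ a b j, D.pair j (cab a b) = (e b * e' b) * (e' a * pderiv j (e a)) -
      (e a * e' a) * (e' b * pderiv j (e b)) := by
    intro a b j
    simp only [cab]
    rw [map_sub, pair_smul, pair_smul, pair_grad, pair_grad, he, he, hr, hr, Derivation.leibniz,
      Derivation.leibniz]
    simp only [smul_eq_mul]
    ring
  let Ω : Fin 4 → Fin 4 → Poly4 := fun k j => ∑ a, D.Ψ (l k a) * (e' a * pderiv j (e a))
  have hrow : ∀ a k j, D.pair j (∑ b, l k b • cab a b) =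
      D.ξ k ^ Y * (e' a * pderiv j (e a)) - (e a * e' a) * Ω k j := by
    intro a k j
    rw [map_sum, hYsum, Finset.sum_mul, Finset.mul_sum, ← Finset.sum_sub_distrib]
    refine Finset.sum_congr rfl fun b _ => ?_
    rw [pair_smul, hcab]; ring
  obtain ⟨b, hb⟩ := D.exists_coboundary hsm Y Ω (fun k l' => ∑ a, l k a • ∑ b, l l' b • cab a b) (by
    intro k l' j
    rw [map_sum]
    simp only [pair_smul, hrow]
    rw [hYsum k, Finset.mul_sum, Finset.sum_mul, ← Finset.sum_sub_distrib]
    exact Finset.sum_congr rfl fun a _ => by ring)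
  have hΩhom : ∀ k j, (Ω k j).IsHomogeneous (Y * D.M - 1) := by
    intro k j
    refine IsHomogeneous.sum _ _ _ fun a _ => ?_
    by_cases hl : l k a = 0
    · rw [hl, map_zero, zero_mul]; exact isHomogeneous_zero _ _ _
    have h1 : (D.Ψ (l k a * h a)).IsHomogeneous (Y * D.M) :=
      DRing.Hom.evalHom (hhom k a) D.hom_ξ D.hom_ω D.sq
    have h2 := D.Ψ_ne_zero (mul_ne_zero hl (h0 a))
    have h3 : D.Ψ (l k a * h a) = (D.Ψ (l k a) * e' a) * e a := by rw [map_mul, he]; ring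
    rw [h3] at h1 h2
    obtain ⟨p, q, hpq, hp, hq⟩ := h1.of_mul h2
    rw [← mul_assoc]
    rcases Nat.eq_zero_or_pos q with hq0 | hq0
    · subst hq0
      rw [← totalDegree_zero_iff_isHomogeneous, totalDegree_eq_zero_iff_eq_C] at hq
      rw [hq, pderiv_C, mul_zero]; exact isHomogeneous_zero _ _ _
    · have := hp.mul (hq.pderiv (i := j))
      rwa [show p + (q - 1) = Y * D.M - 1 by omega] at this
  have hΩ : ∀ k j, Ω k j = D.pair j (D.formComp Y (b k)) := by
    intro k j
    have hd : D.ξ k ^ Y ∣ Ω k j - D.pair j (b k) := by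
      apply dvd_of_forall_dvd_pow_mul D.ξ D.coprime Y (pow_ne_zero _ (D.ξ_ne_zero k))
      intro l'
      exact ⟨_, hb k l' j⟩
    obtain ⟨q, hq⟩ := hd
    have h1 : (MvPolynomial.grading (Fin 4) ℂ).comp (Y * D.M - 1) (q * D.ξ k ^ Y) = 0 := by
      apply Coaction.comp_mul_hom_of_lt (grading_hom.2 (by simpa [mul_comm] using (D.hom_ξ k).pow Y))
      have := Nat.mul_pos (show 0 < Y by omega) D.M_pos
      omega
    have h2 : Ω k j = D.pair j (b k) + q * D.ξ k ^ Y := by linear_combination hq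
    have h3 := (grading_hom.2 (hΩhom k j)).comp_self
    rw [h2, Coaction.comp_add, h1, comp_pair D hY, add_zero] at h3
    rw [h2]; exact h3.symm
  intro a k
  refine ⟨(∑ b, l k b • cab a b) + h a • D.formComp Y (b k), fun j => ?_⟩
  rw [map_add, hrow, pair_smul, ← hΩ, he]; ring

end RatParam

theorem Derivation.mul_pow_apply {A : Type*} [CommRing A] [Algebra ℂ A] (δ : Derivation ℂ A A) (a : A)
    (m : ℕ) : a * δ (a ^ m) = m * a ^ m * δ a := by
  induction m with
  | zero => simp
  | succ m ih =>
    rw [pow_succ, Derivation.leibniz, smul_eq_mul, smul_eq_mul, mul_add, mul_left_comm a a, ih]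
    push_cast; ring

theorem MvPolynomial.exists_pderiv_ne_zero {σ : Type*} {p : MvPolynomial σ ℂ}
    (hp : p.totalDegree ≠ 0) : ∃ i, pderiv i p ≠ 0 := by
  by_contra! hcon
  obtain ⟨m, hm, hm0⟩ : ∃ m ∈ p.support, m ≠ 0 := by
    by_contra! hh
    refine hp ((totalDegree_eq_zero_iff _ _).2 fun m hm n => ?_)
    rw [hh m hm]; simp
  obtain ⟨i, hi⟩ : ∃ i, m i ≠ 0 := by
    by_contra! hh; exact hm0 (Finsupp.ext hh)
  have h2 := congrArg (coeff (m - Finsupp.single i 1)) (hcon i)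
  have h3 : m - Finsupp.single i 1 + Finsupp.single i 1 = m := by
    apply tsub_add_cancel_of_le
    rw [Finsupp.single_le_iff]; omega
  rw [coeff_pderiv, coeff_zero, h3] at h2
  rcases mul_eq_zero.1 h2 with h4 | h4
  · exact (mem_support_iff.1 hm) h4
  · exact Nat.cast_add_one_ne_zero _ h4

theorem MvPolynomial.totalDegree_pderiv_lt {σ : Type*} {p : MvPolynomial σ ℂ}
    (hp : p.totalDegree ≠ 0) (i : σ) : (pderiv i p).totalDegree < p.totalDegree := by
  rw [totalDegree, Finset.sup_lt_iff (Nat.pos_of_ne_zero hp)]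
  intro m hm
  rw [mem_support_iff, coeff_pderiv] at hm
  have := le_totalDegree (mem_support_iff.2 (left_ne_zero_of_mul hm))
  rw [Finsupp.sum_add_index' (fun _ => rfl) (fun _ _ _ => rfl), Finsupp.sum_single_index rfl] at this
  omega

namespace DRing
variable {F : Poly4}

theorem H_inc (i : Fin 4) (p : Poly4) : H i (inc F p) = 2 * W F * inc F (pderiv i p) := by
  ext1 <;> simp [H, QuadraticAlgebra.re_ofNat, QuadraticAlgebra.im_ofNat]

theorem H_W_mul_inc (i : Fin 4) (p : Poly4) :
    H i (W F * inc F p) = inc F (2 * F * pderiv i p + pderiv i F * p) := by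
  ext1 <;> simp [H]

theorem mul_H_pow (i : Fin 4) (s : DRing F) (K : ℕ) : s * H i (s ^ K) = K * s ^ K * H i s := by
  induction K with
  | zero =>
    have : H i (1 : DRing F) = 0 := by
      rw [← map_one (inc F), H_inc, pderiv_one, map_zero, mul_zero]
    rw [pow_zero, this]; simp
  | succ m ih =>
    rw [pow_succ, H_mul, mul_add, mul_left_comm s s, ih]
    push_cast; ring

theorem inc_mem_of_two_mul {I : Ideal (DRing F)} {r : DRing F} (h : 2 * r ∈ I) : r ∈ I := by
  have h1 := I.mul_mem_left (inc F (C 2⁻¹)) h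
  have h2 : inc F (C 2⁻¹) * (2 * r) = r := by
    have : (2 : DRing F) = inc F (C 2) := by rw [show (C 2 : Poly4) = 2 from map_ofNat _ 2, map_ofNat]
    rw [this, ← mul_assoc, ← map_mul, ← C_mul]; norm_num
  rwa [h2] at h1

/-- A nonzero ideal of the coordinate ring stable under the derivations `2W ∂ᵢ` contains powers of
the variables. -/
theorem exists_X_pow_mem_of_stable [IsDomain (DRing F)]
    (hsm : ∀ v : Fin 4 → ℂ, (∀ i, eval v (pderiv i F) = 0) → v = 0)
    (I : Ideal (DRing F)) (hI : ∀ i, ∀ r ∈ I, H i r ∈ I) {r : DRing F} (hr : r ∈ I) (hr0 : r ≠ 0)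
    (k : Fin 4) : ∃ n, inc F (X k) ^ n ∈ I := by
  have hWF : ∀ i p, inc F p ∈ I → inc F (F * pderiv i p) ∈ I := by
    intro i p hp
    apply inc_mem_of_two_mul
    have := I.mul_mem_left (W F) (hI i _ hp)
    rw [H_inc] at this
    rw [map_mul, ← W_sq]
    convert this using 1
    ring
  have hstep : ∀ (d : ℕ) (p : Poly4), p.totalDegree = d → p ≠ 0 → ∀ K, inc F (F ^ K * p) ∈ I →
      ∃ K, inc F (F ^ K) ∈ I := by
    intro d
    induction d using Nat.strong_induction_on with
    | _ d ih =>
      intro p hd hp K hK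
      rcases Nat.eq_zero_or_pos d with h0 | h0
      · rw [h0, totalDegree_eq_zero_iff_eq_C] at hd
        have hc : coeff 0 p ≠ 0 := fun h => hp (by rw [hd, h, C_0])
        refine ⟨K, ?_⟩
        have h1 := I.mul_mem_left (inc F (C (coeff 0 p)⁻¹)) hK
        rw [← map_mul, hd, mul_left_comm, ← C_mul, coeff_C, if_pos rfl, inv_mul_cancel₀ hc, C_1, mul_one] at h1
        exact h1
      · obtain ⟨i, hi⟩ := exists_pderiv_ne_zero (p := p) (by omega)
        refine ih (pderiv i p).totalDegree ?_ (pderiv i p) rfl hi (K + 1) ?_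
        · rw [← hd]; exact totalDegree_pderiv_lt (by omega) i
        · have h1 := hWF i _ hK
          rw [Derivation.leibniz, smul_eq_mul, smul_eq_mul] at h1
          have h2 := I.mul_mem_left (inc F (K * pderiv i F)) hK
          have h3 := I.sub_mem h1 h2
          rw [← map_mul, ← map_sub] at h3
          convert h3 using 2
          linear_combination (-p) * Derivation.mul_pow_apply (pderiv i) F K
  obtain ⟨Y, hY⟩ := exists_X_pow_mem_jacobian hsm
  obtain ⟨q, hq⟩ := (Submodule.mem_span_range_iff_exists_fun Poly4).1 (hY k)
  simp only [smul_eq_mul] at hq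
  let x := inc F (X k)
  have hconj : r * (⟨r.re, -r.im⟩ : DRing F) = inc F (r.re ^ 2 - F * r.im ^ 2) := by
    ext1
    · simp only [QuadraticAlgebra.re_mul, inc_re]; ring
    · simp only [QuadraticAlgebra.im_mul, inc_im]; ring
  have hnorm : ∃ p, p ≠ 0 ∧ inc F p ∈ I := by
    refine ⟨r.re ^ 2 - F * r.im ^ 2, ?_, ?_⟩
    · intro h
      have h1 := hconj
      rw [h, map_zero, mul_eq_zero] at h1
      rcases h1 with h1 | h1
      · exact hr0 h1
      · have h2 := congrArg QuadraticAlgebra.re h1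
        have h3 := congrArg QuadraticAlgebra.im h1
        apply hr0
        ext1
        · simpa using h2
        · simpa using h3
    · have := I.mul_mem_right (⟨r.re, -r.im⟩ : DRing F) hr
      rwa [hconj] at this
  obtain ⟨p, hp0, hp⟩ := hnorm
  obtain ⟨K, hK⟩ := hstep _ p rfl hp0 0 (by simpa using hp)
  have hxH : ∀ (i : Fin 4) (n : ℕ) (t : DRing F), x ^ n * t ∈ I → x ^ (n + 1) * H i t ∈ I := by
    intro i n t ht
    have h1 := I.mul_mem_left x (hI i _ ht)
    rw [H_mul, mul_add, mul_left_comm x t, mul_H_pow] at h1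
    have h2 := I.mul_mem_left (n * H i x) ht
    have h3 := I.sub_mem h1 h2
    convert h3 using 1
    ring
  have hred : ∀ m n : ℕ, x ^ n * inc F (F ^ (m + 1)) ∈ I → ∃ n, x ^ n * inc F (F ^ m) ∈ I := by
    intro m n h
    have hm : ((m : ℂ) + 1) ≠ 0 := by exact_mod_cast Nat.succ_ne_zero m
    have h1 : ∀ i, x ^ (n + 1) * (W F * inc F (F ^ m * pderiv i F)) ∈ I := by
      intro i
      have h1 := hxH i n _ h
      rw [H_inc] at h1
      apply inc_mem_of_two_mul
      have h2 := I.mul_mem_left (inc F (C ((m : ℂ) + 1)⁻¹)) h1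
      convert h2 using 1
      have h3 : pderiv i (F ^ (m + 1)) = C ((m : ℂ) + 1) * (F ^ m * pderiv i F) := by
        rw [Derivation.leibniz_pow]; simp only [smul_eq_mul, nsmul_eq_mul, Nat.add_sub_cancel]
        push_cast; simp
      have h4 : inc F (C ((m : ℂ) + 1)⁻¹) * inc F (C ((m : ℂ) + 1)) = 1 := by
        rw [← map_mul, ← C_mul, inv_mul_cancel₀ hm]; simp
      rw [h3, map_mul _ (C ((m : ℂ) + 1))]
      linear_combination (-(x ^ (n + 1) * (2 * W F * inc F (F ^ m * pderiv i F)))) * h4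
    have h2 : ∀ i j, x ^ (n + 2) * inc F (F ^ m * pderiv i F * pderiv j F) ∈ I := by
      intro i j
      have h2 := hxH j _ _ (h1 i)
      rw [H_W_mul_inc, Derivation.leibniz, smul_eq_mul, smul_eq_mul] at h2
      have hm2 : (2 * (m : ℂ) + 1) ≠ 0 := by exact_mod_cast Nat.succ_ne_zero (2 * m)
      have h5 := I.mul_mem_left (x ^ 2 * inc F (2 * pderiv j (pderiv i F))) h
      have h6 := I.mul_mem_left (inc F (C (2 * (m : ℂ) + 1)⁻¹)) (I.sub_mem h2 h5)
      convert h6 using 1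
      have h4 : inc F (C (2 * (m : ℂ) + 1)⁻¹) * inc F (2 * m + 1) = 1 := by
        have : (2 * m + 1 : Poly4) = C (2 * (m : ℂ) + 1) := by
          rw [C_add, C_mul, C_1, show (C 2 : Poly4) = 2 from map_ofNat _ 2]; simp
        rw [this, ← map_mul, ← C_mul, inv_mul_cancel₀ hm2]; simp
      have h7 : 2 * F * (F ^ m * pderiv j (pderiv i F) + pderiv i F * pderiv j (F ^ m)) +
          pderiv j F * (F ^ m * pderiv i F) = (2 * m + 1) * (F ^ m * pderiv i F * pderiv j F) +
            2 * pderiv j (pderiv i F) * F ^ (m + 1) := by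
        linear_combination (2 * pderiv i F) * Derivation.mul_pow_apply (pderiv j) F m
      rw [h7, map_add, map_mul _ (2 * (m : Poly4) + 1), map_mul _ (2 * pderiv j (pderiv i F))]
      linear_combination (-(x ^ (n + 2) * inc F (F ^ m * pderiv i F * pderiv j F))) * h4
    have hsum : x ^ Y = ∑ i, inc F (q i) * inc F (pderiv i F) := by
      simp only [x]
      rw [← map_pow, ← hq, map_sum]; simp only [map_mul]
    refine ⟨n + 2 + Y + Y, ?_⟩
    rw [pow_add, pow_add, hsum, Finset.mul_sum, Finset.sum_mul]
    refine I.sum_mem fun i _ => ?_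
    rw [Finset.mul_sum, Finset.sum_mul, Finset.sum_mul]
    refine I.sum_mem fun j _ => ?_
    have := I.mul_mem_left (inc F (q i) * inc F (q j)) (h2 j i)
    convert this using 1
    simp only [map_mul]; ring
  have hfin : ∀ m n : ℕ, x ^ n * inc F (F ^ m) ∈ I → ∃ n, x ^ n ∈ I := by
    intro m
    induction m with
    | zero => intro n h; exact ⟨n, by simpa using h⟩
    | succ m ih =>
      intro n h
      obtain ⟨n', h'⟩ := hred m n h
      exact ih n' h'
  exact hfin K 0 (by simpa using hK)

end DRing

namespace RatParam
variable {F : Poly4} (D : RatParam F)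

/-- Saturation of `{r | Ψ r E₁ ∈ E₂ Ψ R}`, when `E₁` and `E₂` have logarithmic derivatives that are
regular away from `s`. -/
theorem exists_pow_mul_of_log_derivative (hsm : ∀ v : Fin 4 → ℂ, (∀ i, eval v (pderiv i F) = 0) → v = 0)
    {G : Poly4} (hG : D.jacMat.det = G * D.ω) (s : DRing F) (E₁ E₂ : Poly4) (Z₁ Z₂ : Fin 4 → DRing F)
    (h₁ : ∀ i, D.Ψ s * (2 * D.jacDer i E₁) = E₁ * (G * D.Ψ (Z₁ i)))
    (h₂ : ∀ i, D.Ψ s * (2 * D.jacDer i E₂) = E₂ * (G * D.Ψ (Z₂ i)))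
    {r₀ q₀ : DRing F} (hr₀ : r₀ ≠ 0) (h₀ : D.Ψ r₀ * E₁ = E₂ * D.Ψ q₀) (k : Fin 4) :
    ∃ n K q, D.Ψ (s ^ K * DRing.inc F (X k) ^ n) * E₁ = E₂ * D.Ψ q := by
  have := D.isDomain
  have hG0 : G ≠ 0 := by rintro rfl; exact D.det_jacMat_ne_zero (by rw [hG, zero_mul])
  let I : Ideal (DRing F) :=
    { carrier := {r | ∃ K q, D.Ψ (s ^ K * r) * E₁ = E₂ * D.Ψ q}
      zero_mem' := ⟨0, 0, by simp⟩
      add_mem' := by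
        rintro a b ⟨K, q, h⟩ ⟨K', q', h'⟩
        refine ⟨K + K', s ^ K' * q + s ^ K * q', ?_⟩
        simp only [map_mul, map_add, map_pow, pow_add] at h h' ⊢
        linear_combination D.Ψ s ^ K' * h + D.Ψ s ^ K * h'
      smul_mem' := by
        rintro t a ⟨K, q, h⟩
        refine ⟨K, t * q, ?_⟩
        simp only [map_mul, smul_eq_mul, map_pow] at h ⊢
        linear_combination D.Ψ t * h }
  have hI : ∀ i, ∀ r ∈ I, DRing.H i r ∈ I := by
    rintro i r ⟨K, q, h⟩
    refine ⟨K + 1, Z₂ i * q + s * DRing.H i q - q * (K * DRing.H i s + Z₁ i), ?_⟩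
    have h3 := congrArg (fun z => 2 * D.jacDer i z) h
    simp only [Derivation.leibniz, smul_eq_mul] at h3
    have h4 := D.two_jacDer_Ψ hG i (s ^ K * r)
    have h5 := D.two_jacDer_Ψ hG i q
    have h6 : D.Ψ s * D.Ψ (DRing.H i (s ^ K * r)) =
        D.Ψ (s ^ (K + 1) * DRing.H i r) + D.Ψ (s ^ K * r) * D.Ψ (K * DRing.H i s) := by
      rw [← map_mul, ← map_mul, ← map_add]
      congr 1
      rw [DRing.H_mul]
      linear_combination r * DRing.mul_H_pow i s K
    apply mul_left_cancel₀ hG0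
    rw [map_sub, map_add, map_mul _ (Z₂ i) q, map_mul _ s (DRing.H i q), map_mul _ q, map_add]
    have e1 := h₁ i
    have e2 := h₂ i
    generalize D.Ψ (s ^ K * r) = A at *
    generalize D.Ψ (s ^ (K + 1) * DRing.H i r) = B at *
    generalize D.Ψ (DRing.H i (s ^ K * r)) = A' at *
    generalize D.jacDer i A = dA at *
    generalize D.jacDer i E₁ = d1 at *
    generalize D.jacDer i E₂ = d2 at *
    generalize D.jacDer i (D.Ψ q) = dq at *
    generalize D.Ψ s = S at *
    generalize D.Ψ q = Q at *
    generalize D.Ψ (Z₁ i) = z1 at *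
    generalize D.Ψ (Z₂ i) = z2 at *
    generalize D.Ψ (DRing.H i q) = Hq at *
    generalize D.Ψ ((K : DRing F) * DRing.H i s) = hs at *
    linear_combination S * h3 - G * E₁ * h6 - S * E₁ * h4 + S * E₂ * h5 - A * e1 + Q * e2 -
      G * (hs + z1) * h
  have hr : r₀ ∈ I := ⟨0, q₀, by simpa using h₀⟩
  obtain ⟨n, K, q, h⟩ := DRing.exists_X_pow_mem_of_stable hsm I hI hr hr₀ k
  exact ⟨n, K, q, h⟩

theorem aeval_f {A : Poly4} {k : ℕ} (hA : A.IsHomogeneous k) :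
    D.Ψ (aeval D.f A) = A * D.c ^ k := by
  have h : D.Ψ (aeval D.f A) = aeval (fun i => X i * D.c) A := by
    rw [show (fun i => (X i : Poly4) * D.c) = fun i => D.Ψ (D.f i) from funext fun i => (D.eval_f i).symm]
    exact (MvPolynomial.comp_aeval_apply (φ := D.Ψ) (f := D.f) A)
  rw [h, aeval_mul_of_isHomogeneous hA, aeval_X_left_apply]

/-- The `M`-th power of a form lies in the fraction field of the coordinate ring. -/
theorem exists_mul_pow_eq {e : Poly4} {d : ℕ} (he : e.IsHomogeneous d) :
    ∃ r q : DRing F, r ≠ 0 ∧ D.Ψ r * e ^ D.M = D.Ψ q := by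
  refine ⟨aeval D.f (D.ξ 0 ^ d), aeval D.f (e ^ D.M) * DRing.inc F (X 0) ^ d, ?_, ?_⟩
  · intro h
    have := D.aeval_f ((D.hom_ξ 0).pow d)
    rw [h, map_zero] at this
    exact mul_ne_zero (pow_ne_zero _ (D.ξ_ne_zero 0)) (pow_ne_zero _ D.c_ne_zero) this.symm
  · rw [map_mul, D.aeval_f ((D.hom_ξ 0).pow d), D.aeval_f (he.pow D.M), map_pow, DRing.evalHom_inc,
      aeval_X, mul_comm d D.M]
    ring

theorem mem_range_of_forall_radical (D : RatParam F) (z : Poly4)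
    (h : ∀ k, ∃ B q, D.Ψ (DRing.inc F (X k) ^ B) * z = D.Ψ q) : ∃ q, D.Ψ q = z := by
  obtain ⟨B, p, hp⟩ := h 0
  obtain ⟨B', p', hp'⟩ := h 1
  have h1 : DRing.inc F (X 0) ^ (B + B') * (DRing.inc F (X 1) ^ B * p') =
      DRing.inc F (X 1) ^ (B + B') * (DRing.inc F (X 0) ^ B' * p) := by
    apply D.inj
    rw [map_mul, map_mul, map_mul, map_mul, ← hp, ← hp']
    simp only [map_pow, map_mul, pow_add]
    ring
  obtain ⟨c, hc⟩ := DRing.dvd_of_X_pow_mul_eq h1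
  refine ⟨c, ?_⟩
  have h2 := congrArg D.Ψ hc
  rw [map_mul, map_mul, ← hp, ← mul_assoc, ← map_mul, ← pow_add, add_comm B'] at h2
  refine (mul_left_cancel₀ (D.Ψ_ne_zero ?_) h2).symm
  exact fun h3 => pow_ne_zero (B + B') (D.ξ_ne_zero 0) (by
    have := congrArg D.Ψ h3; simpa using this)

theorem dvd_of_forall_radical (D : RatParam F) (u v : DRing F) (hv : v ≠ 0)
    (h : ∀ k, ∃ B, v ∣ u * DRing.inc F (X k) ^ B) : v ∣ u := by
  have := D.isDomain
  obtain ⟨B, p, hp⟩ := h 0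
  obtain ⟨B', p', hp'⟩ := h 1
  have h1 : DRing.inc F (X 0) ^ (B + B') * (DRing.inc F (X 1) ^ B * p') =
      DRing.inc F (X 1) ^ (B + B') * (DRing.inc F (X 0) ^ B' * p) := by
    apply mul_left_cancel₀ hv
    simp only [pow_add]
    linear_combination DRing.inc F (X 1) ^ (B' + B) * DRing.inc F (X 0) ^ B' * hp -
      DRing.inc F (X 0) ^ (B + B') * DRing.inc F (X 1) ^ B * hp'
  obtain ⟨c, hc⟩ := DRing.dvd_of_X_pow_mul_eq h1
  refine ⟨c, ?_⟩
  have h0 : DRing.inc F (X 0) ≠ 0 := fun h3 => D.ξ_ne_zero 0 (by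
    have := congrArg D.Ψ h3; simpa using this)
  apply mul_left_cancel₀ (pow_ne_zero (B + B') h0)
  rw [pow_add] at hc ⊢
  linear_combination v * hc + DRing.inc F (X 0) ^ B' * hp

theorem exists_gcd {A ι : Type*} [CommRing A] [IsDomain A] [UniqueFactorizationMonoid A]
    (s : Finset ι) (f : ι → A) {i₀ : ι} (hi : i₀ ∈ s) (h0 : f i₀ ≠ 0) :
    ∃ φ, φ ≠ 0 ∧ (∀ i ∈ s, φ ∣ f i) ∧ ∀ d t, (∀ i ∈ s, d ∣ t * f i) → d ∣ t * φ := by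
  classical
  obtain ⟨inst⟩ : Nonempty (GCDMonoid A) := ⟨UniqueFactorizationMonoid.toGCDMonoid A⟩
  have key : ∀ s : Finset ι, ∃ φ, (∀ i ∈ s, φ ∣ f i) ∧ ∀ d t, (∀ i ∈ s, d ∣ t * f i) → d ∣ t * φ := by
    intro s
    induction s using Finset.induction_on with
    | empty => exact ⟨0, by simp, by simp⟩
    | insert a s ha ih =>
      obtain ⟨φ, h1, h2⟩ := ih
      refine ⟨gcd (f a) φ, ?_, fun d t h => ?_⟩
      · intro i hi
        rcases Finset.mem_insert.1 hi with rfl | hi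
        · exact gcd_dvd_left _ _
        · exact (gcd_dvd_right _ _).trans (h1 i hi)
      · have h3 := dvd_gcd (h a (Finset.mem_insert_self _ _))
          (h2 d t fun i hi => h i (Finset.mem_insert_of_mem hi))
        exact h3.trans (gcd_mul_left' t (f a) φ).dvd
  obtain ⟨φ, h1, h2⟩ := key s
  exact ⟨φ, fun h => h0 (zero_dvd_iff.1 (h ▸ h1 i₀ hi)), h1, h2⟩

end RatParam

theorem dvd_of_forall_dvd_mul_prod {A ι : Type*} [CommRing A] (f : ι → A) (j : A) (hj : j ≠ 0)
    [IsDomain A] (h : ∀ u v, v ≠ 0 → (∀ i, v * j ∣ u * f i) → v ∣ u) (m : ℕ) :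
    ∀ u v, v ≠ 0 → (∀ I : Fin m → ι, v * j ^ m ∣ u * ∏ i, f (I i)) → v ∣ u := by
  induction m with
  | zero => intro u v hv h; simpa using h Fin.elim0
  | succ m ih =>
    intro u v hv hI
    refine ih u v hv fun I => h _ _ (mul_ne_zero hv (pow_ne_zero _ hj)) fun i => ?_
    have := hI (Fin.cons i I)
    rw [Fin.prod_univ_succ] at this
    simp only [Fin.cons_zero, Fin.cons_succ] at this
    convert this using 1 <;> ring

namespace RatParam
variable {F : Poly4} (D : RatParam F)

theorem two_jacDer_of_pair (D : RatParam F) {G : Poly4} (hG : D.jacMat.det = G * D.ω) (i : Fin 4) {g e : Poly4}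
    {x : Option (Fin 4) → DRing F} (h : ∀ j, g * pderiv j e = D.pair j x) :
    g * (2 * D.jacDer i e) = G * D.Ψ (2 * DRing.W F * x (some i) + DRing.inc F (pderiv i F) * x none) := by
  have h1 : g * (2 * D.jacDer i e) = 2 * ∑ j, D.jacMat.adjugate j i * D.pair j x := by
    rw [jacDer_apply, Finset.mul_sum, Finset.mul_sum, Finset.mul_sum]
    refine Finset.sum_congr rfl fun j _ => ?_
    rw [← h]; ring
  have h2 := D.two_jacDer_Ψ hG i (DRing.W F)
  rw [DRing.evalHom_W] at h2
  have h3 : DRing.H i (DRing.W F) = DRing.inc F (pderiv i F) := by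
    have := DRing.H_W_mul_inc (F := F) i 1
    simpa using this
  rw [h1, sum_adjugate_mul_pair, Finset.sum_eq_single i]
  · rw [jacDer_ξ, if_pos rfl, hG]
    rw [h3] at h2
    simp only [map_add, map_mul, map_ofNat, DRing.evalHom_W]
    linear_combination D.Ψ (x none) * h2
  · intro k _ hk; rw [jacDer_ξ, if_neg hk, mul_zero]
  · simp

/-- Data describing the linear system of the parametrization on the double solid: the pullbacks of
forms of degree `M`, divided by their common part, are cut out by elements of degree `n`. -/
structure Mobile (D : RatParam F) (n : ℕ) (c : Poly4) : Prop where
  n_pos : 1 ≤ n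
  c_ne_zero : c ≠ 0
  hom_c : c.IsHomogeneous (n - 1)
  exists_eq : ∀ A : Poly4, A.IsHomogeneous D.M → ∃ q, (DRing.grading D.hF).Hom n q ∧ D.Ψ q = A * c ^ D.M
  dvd : ∀ u v : DRing F, v ≠ 0 →
    (∀ A : Poly4, A.IsHomogeneous D.M → ∀ q, D.Ψ q = A * c ^ D.M → v ∣ u * q) → v ∣ u

theorem exists_saturations (hsm : ∀ v : Fin 4 → ℂ, (∀ i, eval v (pderiv i F) = 0) → v = 0)
    {G : Poly4} (hG : D.jacMat.det = G * D.ω) {e e' : Poly4} {d : ℕ} (he : e.IsHomogeneous d)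
    (he0 : e ≠ 0) (h : DRing F) (hh : D.Ψ h = e * e') {Y : ℕ} (k : Fin 4)
    {x : Option (Fin 4) → DRing F} (hx : ∀ j, D.ξ k ^ Y * (e' * pderiv j e) = D.pair j x) :
    ∃ K q q', D.Ψ ((DRing.inc F (X k) * h) ^ K) * e ^ D.M = D.Ψ q ∧
      D.Ψ ((DRing.inc F (X k) * h) ^ K) = e ^ D.M * D.Ψ q' := by
  have := D.isDomain
  obtain ⟨r, q, hr, hq⟩ := D.exists_mul_pow_eq he
  let s := DRing.inc F (X k) ^ Y * h
  have hs : D.Ψ s = D.ξ k ^ Y * (e * e') := by simp [s, hh]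
  let z : Fin 4 → DRing F := fun i =>
    2 * DRing.W F * x (some i) + DRing.inc F (pderiv i F) * x none
  have hz : ∀ i, D.Ψ s * (2 * D.jacDer i (e ^ D.M)) = e ^ D.M * (G * D.Ψ (D.M * z i)) := by
    intro i
    have h1 := D.two_jacDer_of_pair hG i (g := D.ξ k ^ Y * e') (e := e) (x := x)
      (fun j => by rw [← hx]; ring)
    have h2 := Derivation.mul_pow_apply (D.jacDer i) e D.M
    rw [hs, map_mul, map_natCast]
    linear_combination (2 * D.ξ k ^ Y * e') * h2 + (D.M * e ^ D.M) * h1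
  have hone : ∀ i, D.Ψ s * (2 * D.jacDer i 1) = 1 * (G * D.Ψ 0) := by
    intro i; simp
  have hq0 : q ≠ 0 := by
    rintro rfl
    rw [map_zero] at hq
    exact mul_ne_zero (D.Ψ_ne_zero hr) (pow_ne_zero _ he0) hq
  obtain ⟨n, K, p, hp⟩ := D.exists_pow_mul_of_log_derivative hsm hG s (e ^ D.M) 1 _ _ hz hone hr
    (by rw [hq, one_mul]) k
  obtain ⟨n', K', p', hp'⟩ := D.exists_pow_mul_of_log_derivative hsm hG s 1 (e ^ D.M) _ _ hone hz hq0
    (q₀ := r) (by rw [← hq]; ring) k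
  have key : ∀ K n, ∃ B, ∀ B' ≥ B, s ^ K * DRing.inc F (X k) ^ n ∣ (DRing.inc F (X k) * h) ^ B' := by
    intro K n
    refine ⟨Y * K + n + K, fun B' hB => ?_⟩
    obtain ⟨b, rfl⟩ := Nat.exists_eq_add_of_le hB
    refine ⟨h ^ (Y * K + n + b) * DRing.inc F (X k) ^ (K + b), ?_⟩
    simp only [s, mul_pow, ← pow_mul]; ring
  obtain ⟨B, hB⟩ := key K n
  obtain ⟨B', hB'⟩ := key K' n'
  obtain ⟨t, ht⟩ := hB (max B B') (le_max_left _ _)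
  obtain ⟨t', ht'⟩ := hB' (max B B') (le_max_right _ _)
  refine ⟨max B B', p * t, p' * t', ?_, ?_⟩
  · rw [ht, map_mul _ _ t, map_mul _ p]; linear_combination D.Ψ t * hp
  · rw [ht', map_mul _ _ t', map_mul _ p']; linear_combination D.Ψ t' * hp'

theorem exists_mobile (hsm : ∀ v : Fin 4 → ℂ, (∀ i, eval v (pderiv i F) = 0) → v = 0) :
    ∃ n c, D.Mobile n c := by
  classical
  have := D.isDomain
  obtain ⟨G, hG⟩ := D.exists_det_eq hsm
  have hf0 : ∀ i, D.f i ≠ 0 := fun i h => mul_ne_zero (X_ne_zero i) D.c_ne_zero (by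
    rw [← D.eval_f, h, map_zero])
  obtain ⟨T, hT, hfT, hull, m, h, j, Y, l, hY, hjT, h0, j0, hdvd, hsum, hhom⟩ :=
    DRing.exists_divisorial_hull D.hF hsm D.f D.hom_f 0 (hf0 0)
  have hm : 0 < m := by
    rcases Nat.eq_zero_or_pos m with rfl | hm
    · have := congrArg D.Ψ (hsum 0)
      simp only [Finset.univ_eq_empty, Finset.sum_empty, map_zero, map_pow, DRing.evalHom_inc, aeval_X] at this
      exact absurd this (pow_ne_zero _ (D.ξ_ne_zero 0))
    · exact hm
  obtain ⟨φ, hφ0, hφ, hgcd⟩ := exists_gcd T (fun g => D.Ψ g) (hjT ⟨0, hm⟩) (D.Ψ_ne_zero (j0 _))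
  have he : ∀ a, ∃ e, D.Ψ (j a) = φ * e := fun a => hφ _ (hjT a)
  choose e he using he
  have he0 : ∀ a, e a ≠ 0 := fun a h1 => D.Ψ_ne_zero (j0 a) (by rw [he, h1, mul_zero])
  have he' : ∀ a, ∃ e', D.Ψ (h a) = e a * e' := by
    intro a
    have : φ * e a ∣ D.Ψ (h a) * φ := by
      apply hgcd
      intro g hg
      rw [← he, ← map_mul]
      exact map_dvd _ (hdvd a g hg)
    rw [mul_comm (D.Ψ (h a))] at this
    exact (mul_dvd_mul_iff_left hφ0).1 this
  choose e' he' using he'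
  have hr : ∀ a b, ∃ r, h a * j b = j a * r := fun a b => hdvd a _ (hjT b)
  choose r hr using hr
  have hr' : ∀ a b, D.Ψ (r a b) = e' a * e b := by
    intro a b
    have h1 := congrArg D.Ψ (hr a b)
    rw [map_mul, map_mul, he, he, he'] at h1
    apply mul_left_cancel₀ (mul_ne_zero hφ0 (he0 a))
    linear_combination -h1
  have hdeg : ∀ a, ∃ d, (e a).IsHomogeneous d := by
    intro a
    obtain ⟨n, hn⟩ := hT _ (hjT a)
    have h1 : (D.Ψ (j a)).IsHomogeneous (n * D.M) := DRing.Hom.evalHom hn D.hom_ξ D.hom_ω D.sq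
    obtain ⟨d, -, hd⟩ := h1.of_dvd (D.Ψ_ne_zero (j0 a)) ⟨φ, by rw [he, mul_comm]⟩
    exact ⟨d, hd⟩
  choose d hd using hdeg
  have hlog := D.exists_log_connection hsm h r hY l e e' he' hr' hsum hhom h0
  have hsat : ∀ a k, ∃ K q q', D.Ψ ((DRing.inc F (X k) * h a) ^ K) * e a ^ D.M = D.Ψ q ∧
      D.Ψ ((DRing.inc F (X k) * h a) ^ K) = e a ^ D.M * D.Ψ q' := by
    intro a k
    obtain ⟨x, hx⟩ := hlog a k
    exact D.exists_saturations hsm hG (hd a) (he0 a) (h a) (he' a) k hx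
  choose K q q' hq hq' using hsat
  obtain ⟨c', hc'⟩ : φ ∣ D.c := by
    apply dvd_of_forall_dvd_pow_mul (fun k => (X k : Poly4)) X_coprime 1 hφ0
    intro k
    rw [pow_one, ← D.eval_f]
    have h1 : Ideal.span (T : Set (DRing F)) ≤ Ideal.comap D.Ψ (Ideal.span {φ}) :=
      Ideal.span_le.2 fun g hg => Ideal.mem_comap.2 (Ideal.mem_span_singleton.2 (hφ g hg))
    exact Ideal.mem_span_singleton.1 (h1 (hfT k))
  have hfp : ∀ a i, ∃ p, h a * D.f i = j a * p := by
    intro a i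
    have h1 : Ideal.span (T : Set (DRing F)) ≤ colonIdeal (j a) {h a} :=
      Ideal.span_le.2 fun g hg => by
        intro t ht
        rw [Set.mem_singleton_iff.1 ht, mul_comm]
        exact hdvd a g hg
    have h2 := h1 (hfT i) (h a) rfl
    rwa [mul_comm] at h2
  choose p hp using hfp
  have ht : ∀ a (A : Poly4), A.IsHomogeneous D.M →
      h a ^ D.M * aeval D.f A = j a ^ D.M * aeval (p a) A := by
    intro a A hA
    have h1 := aeval_mul_of_isHomogeneous hA D.f (h a)
    have h2 := aeval_mul_of_isHomogeneous hA (p a) (j a)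
    rw [mul_comm, ← h1, mul_comm, ← h2]
    congr 2
    funext i
    rw [mul_comm, hp, mul_comm]
  have ht' : ∀ a (A : Poly4), A.IsHomogeneous D.M →
      e a ^ D.M * D.Ψ (aeval (p a) A) = D.Ψ (h a) ^ D.M * (A * c' ^ D.M) := by
    intro a A hA
    have h1 := congrArg D.Ψ (ht a A hA)
    rw [map_mul, map_mul, D.aeval_f hA, map_pow, map_pow, he, hc'] at h1
    apply mul_left_cancel₀ (pow_ne_zero D.M hφ0)
    rw [mul_pow, mul_pow] at h1
    linear_combination -h1
  have hrad : ∀ (I : Ideal (DRing F)), (∀ a k, DRing.inc F (X k) * h a ∈ I.radical) →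
      ∀ k, ∃ B, DRing.inc F (X k) ^ B ∈ I := by
    intro I hI k
    rw [← Ideal.mem_radical_iff, ← Ideal.radical_idem]
    refine ⟨1 + Y, ?_⟩
    rw [pow_add, pow_one, hsum, Finset.mul_sum]
    refine Ideal.sum_mem _ fun a _ => ?_
    rw [mul_left_comm]
    exact Ideal.mul_mem_left _ _ (hI a k)
  have hq_ex : ∀ A : Poly4, A.IsHomogeneous D.M → ∃ q, D.Ψ q = A * c' ^ D.M := by
    intro A hA
    apply D.mem_range_of_forall_radical
    let I : Ideal (DRing F) :=
      { carrier := {r | ∃ q, D.Ψ r * (A * c' ^ D.M) = D.Ψ q}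
        zero_mem' := ⟨0, by simp⟩
        add_mem' := by
          rintro a b ⟨q, h⟩ ⟨q', h'⟩
          exact ⟨q + q', by rw [map_add, map_add, add_mul, h, h']⟩
        smul_mem' := by
          rintro t a ⟨q, h⟩
          exact ⟨t * q, by rw [smul_eq_mul, map_mul, map_mul, mul_assoc, h]⟩ }
    refine hrad I fun a k => ⟨K a k + D.M, DRing.inc F (X k) ^ D.M * (q a k * aeval (p a) A), ?_⟩
    rw [pow_add, map_mul, map_mul, map_mul _ (q a k), ← hq, mul_pow _ _ D.M, map_mul _ _ (h a ^ D.M), map_pow _ (h a)]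
    linear_combination (-D.Ψ ((DRing.inc F (X k) * h a) ^ K a k) * D.Ψ (DRing.inc F (X k) ^ D.M)) *
      ht' a A hA
  have hc0 : c' ≠ 0 := by rintro rfl; exact D.c_ne_zero (by rw [hc', mul_zero])
  have hcdeg : ∃ n, c'.IsHomogeneous n := by
    have h1 : (X 0 * D.c).IsHomogeneous (D.N * D.M) := by
      rw [← D.eval_f]; exact DRing.Hom.evalHom (D.hom_f 0) D.hom_ξ D.hom_ω D.sq
    obtain ⟨n, -, hn⟩ := h1.of_dvd (mul_ne_zero (X_ne_zero 0) D.c_ne_zero)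
      ((Dvd.intro_left φ hc'.symm).trans (Dvd.intro_left _ rfl))
    exact ⟨n, hn⟩
  obtain ⟨n, hn⟩ := hcdeg
  refine ⟨n + 1, c', by omega, hc0, by simpa using hn, ?_, ?_⟩
  · intro A hA
    obtain ⟨q, hq⟩ := hq_ex A hA
    have h1 : (A * c' ^ D.M).IsHomogeneous ((n + 1) * D.M) := by
      have := hA.mul (hn.pow D.M)
      rwa [show D.M + n * D.M = (n + 1) * D.M by ring] at this
    have h2 := D.comp_Ψ q (n + 1)
    rw [hq, (grading_hom.2 h1).comp_self, ← hq] at h2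
    exact ⟨_, Coaction.hom_comp _ _, by rw [← h2, hq]⟩
  · intro u v hv hA
    apply D.dvd_of_forall_radical u v hv
    let I : Ideal (DRing F) :=
      { carrier := {r | v ∣ u * r}
        zero_mem' := by simp
        add_mem' := by
          intro a b ha hb
          simp only [Set.mem_ofPred_eq, mul_add] at *
          exact dvd_add ha hb
        smul_mem' := by
          intro t a ha
          simp only [Set.mem_ofPred_eq, smul_eq_mul] at *
          rw [mul_left_comm]
          exact ha.mul_left t }
    refine hrad I fun a k => ⟨K a k + D.M, ?_⟩
    show v ∣ u * _
    have key : v ∣ u * (DRing.inc F (X k) * h a) ^ K a k * h a ^ D.M := by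
      apply dvd_of_forall_dvd_mul_prod D.f (j a) (j0 a) (hull (j a) (hjT a) (j0 a)) D.M _ _ hv
      intro J
      let A : Poly4 := ∏ i, X (J i)
      have hAh : A.IsHomogeneous D.M := by
        have := IsHomogeneous.prod (Finset.univ : Finset (Fin D.M)) (fun i => (X (J i) : Poly4))
          (fun _ => 1) (fun i _ => isHomogeneous_X _ _)
        simpa using this
      obtain ⟨qA, hqA⟩ := hq_ex A hAh
      have h1 : q' a k * h a ^ D.M * qA = (DRing.inc F (X k) * h a) ^ K a k * aeval (p a) A := by
        apply D.inj
        have h2 := ht' a A hAh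
        apply mul_left_cancel₀ (pow_ne_zero D.M (he0 a))
        rw [map_mul, map_mul, map_mul, hqA, hq', map_pow _ (h a)]
        linear_combination (-(e a ^ D.M * D.Ψ (q' a k))) * h2
      have h3 : aeval D.f A = ∏ i, D.f (J i) := by simp [A]
      rw [← h3]
      obtain ⟨w, hw⟩ := hA A hAh qA hqA
      refine ⟨w * q' a k * h a ^ D.M, ?_⟩
      have h4 := ht a A hAh
      linear_combination (u * (DRing.inc F (X k) * h a) ^ K a k) * h4 - (u * j a ^ D.M) * h1 +
        (q' a k * h a ^ D.M * j a ^ D.M) * hw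
    obtain ⟨w, hw⟩ := key
    refine ⟨w * DRing.inc F (X k) ^ D.M, ?_⟩
    rw [pow_add, mul_pow _ _ D.M]
    linear_combination DRing.inc F (X k) ^ D.M * hw

end RatParam

namespace QuadraticAlgebra
variable {A : Type*} [CommRing A] {F : A}

theorem norm_eq (r : QuadraticAlgebra A F 0) : r.norm = r.re ^ 2 - F * r.im ^ 2 := by
  rw [norm_def]; ring

end QuadraticAlgebra

/-- A nonzero polynomial modulo a prime has finitely many constant roots. -/
theorem MvPolynomial.finite_setOf_dvd_eval {σ : Type*} {p : MvPolynomial σ ℂ} (hp : Prime p)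
    (f : Polynomial (MvPolynomial σ ℂ)) {k : ℕ} (hk : ¬ p ∣ f.coeff k) :
    {t : ℂ | p ∣ f.eval (C t)}.Finite := by
  have : (Ideal.span {p}).IsPrime := (Ideal.span_singleton_prime hp.ne_zero).2 hp
  by_contra hinf
  let φ := Ideal.Quotient.mk (Ideal.span {p})
  have h0 : f.map φ = 0 := by
    apply Polynomial.eq_zero_of_infinite_isRoot
    refine Set.Infinite.mono ?_ (Set.Infinite.image (f := fun t : ℂ => φ (C t)) ?_ hinf)
    · rintro _ ⟨t, ht, rfl⟩
      show (f.map φ).eval (φ (C t)) = 0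
      rw [Polynomial.eval_map, Polynomial.eval₂_hom]
      exact (Ideal.Quotient.eq_zero_iff_dvd _ _).2 ht
    · intro s _ t _ hst
      have := (φ.comp C).injective
      exact this hst
  apply hk
  have := congrArg (fun q => Polynomial.coeff q k) h0
  rw [Polynomial.coeff_map, Polynomial.coeff_zero] at this
  exact (Ideal.Quotient.eq_zero_iff_dvd _ _).1 this

namespace RatParam
variable {F : Poly4} {D : RatParam F} {n : ℕ} {c : Poly4}

/-- The mobile linear system. -/
def Mem (D : RatParam F) (c : Poly4) (q : DRing F) : Prop :=
  ∃ A : Poly4, A.IsHomogeneous D.M ∧ D.Ψ q = A * c ^ D.M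

theorem Mem.add {q q' : DRing F} (h : D.Mem c q) (h' : D.Mem c q') (t : ℂ) :
    D.Mem c (q + DRing.inc F (C t) * q') := by
  obtain ⟨A, hA, e⟩ := h
  obtain ⟨A', hA', e'⟩ := h'
  refine ⟨A + C t * A', hA.add (hA'.C_mul t), ?_⟩
  rw [map_add, map_mul, e, e', DRing.evalHom_inc, algHom_C, algebraMap_eq]; ring

theorem Mobile.hom (hm : D.Mobile n c) {q : DRing F} (h : D.Mem c q) :
    (DRing.grading D.hF).Hom n q := by
  obtain ⟨A, hA, e⟩ := h
  obtain ⟨q', h1, h2⟩ := hm.exists_eq A hA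
  rwa [D.inj (e.trans h2.symm)]

theorem Mobile.dvd_of_mem (hm : D.Mobile n c) {u v : DRing F} (hv : v ≠ 0)
    (h : ∀ q, D.Mem c q → v ∣ u * q) : v ∣ u :=
  hm.dvd u v hv fun A hA q hq => h q ⟨A, hA, hq⟩

theorem inc_dvd_iff {p : Poly4} {r : DRing F} : DRing.inc F p ∣ r ↔ p ∣ r.re ∧ p ∣ r.im :=
  QuadraticAlgebra.algebraMap_dvd_iff

theorem star_mul_eq (r : DRing F) : r * star r = DRing.inc F r.norm :=
  (QuadraticAlgebra.algebraMap_norm_eq_mul_star r).symm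

theorem Mobile.exists_not_dvd_norm (hm : D.Mobile n c) {p : Poly4} (hp : Prime p) :
    ∃ q, D.Mem c q ∧ ¬ p ∣ q.norm := by
  by_contra! hcon
  have hp0 : DRing.inc F p ≠ 0 := fun h => hp.ne_zero (by
    simpa using congrArg QuadraticAlgebra.re h)
  by_cases hpF : p ∣ F
  · have : DRing.inc F p ∣ DRing.W F := by
      refine hm.dvd_of_mem hp0 fun q hq => ?_
      have h1 := hcon q hq
      rw [QuadraticAlgebra.norm_eq] at h1
      have h2 : p ∣ q.re := hp.dvd_of_dvd_pow ((dvd_sub_left (hpF.mul_right _)).1 h1)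
      rw [inc_dvd_iff]
      constructor
      · simpa using hpF.mul_right _
      · simpa using h2
    have h3 := (inc_dvd_iff.1 this).2
    rw [DRing.W_im] at h3
    exact hp.not_isUnit (isUnit_of_dvd_one h3)
  · have key : ∀ q q', D.Mem c q → D.Mem c q' → DRing.inc F p ∣ star q' * q := by
      intro q q' hq hq'
      have h1 := hcon q hq
      have h2 := hcon q' hq'
      have h3 := hcon _ (hq.add hq' 1)
      have e : (q + DRing.inc F (C 1) * q').norm = q.norm + q'.norm + 2 * (star q' * q).re := by
        simp only [QuadraticAlgebra.norm_eq]
        simp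
        ring
      rw [e, dvd_add_right (dvd_add h1 h2)] at h3
      have h4 : p ∣ (star q' * q).re := by
        rcases hp.dvd_or_dvd h3 with h4 | h4
        · exact absurd (isUnit_of_dvd_unit h4 ((show (C 2 : Poly4) = 2 from map_ofNat _ 2) ▸
            (isUnit_iff_ne_zero.2 (two_ne_zero (α := ℂ))).map C)) hp.not_isUnit
        · exact h4
      have h5 : p ^ 2 ∣ (star q' * q).norm := by
        rw [map_mul, QuadraticAlgebra.norm_star, pow_two]
        exact mul_dvd_mul h2 h1
      have h6 : p ^ 2 ∣ F * (star q' * q).im ^ 2 := by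
        rw [QuadraticAlgebra.norm_eq] at h5
        exact (dvd_sub_right (pow_dvd_pow_of_dvd h4 2)).1 h5
      have h7 : p ∣ (star q' * q).im := by
        rcases hp.dvd_or_dvd ((dvd_pow_self p two_ne_zero).trans h6) with h | h
        · exact absurd h hpF
        · exact hp.dvd_of_dvd_pow h
      exact inc_dvd_iff.2 ⟨h4, h7⟩
    have h1 : ∀ q', D.Mem c q' → DRing.inc F p ∣ 1 * q' := by
      intro q' hq'
      have := hm.dvd_of_mem hp0 fun q hq => key q q' hq hq'
      rw [inc_dvd_iff] at this ⊢
      simpa using this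
    have h2 := inc_dvd_iff.1 (hm.dvd_of_mem hp0 h1)
    exact hp.not_isUnit (isUnit_of_dvd_one (by simpa [QuadraticAlgebra.re_one] using h2.1))

theorem Mobile.exists_forall_not_dvd_norm (hm : D.Mobile n c) (T : Multiset Poly4)
    (hT : ∀ p ∈ T, Prime p) : ∃ q, D.Mem c q ∧ ∀ p ∈ T, ¬ p ∣ q.norm := by
  induction T using Multiset.induction_on with
  | empty => exact ⟨0, ⟨0, isHomogeneous_zero _ _ _, by simp⟩, by simp⟩
  | cons p T ih =>
    obtain ⟨q, hq, hqT⟩ := ih fun p hp => hT p (Multiset.mem_cons_of_mem hp)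
    obtain ⟨q', hq', hqp⟩ := hm.exists_not_dvd_norm (hT p (Multiset.mem_cons_self _ _))
    let f : Polynomial Poly4 := Polynomial.C q.norm + Polynomial.C (2 * (star q' * q).re) * Polynomial.X +
      Polynomial.C q'.norm * Polynomial.X ^ 2
    have hf : ∀ t, f.eval (C t) = (q + DRing.inc F (C t) * q').norm := by
      intro t
      rw [QuadraticAlgebra.norm_eq, DRing.inc_mul]
      simp [f, QuadraticAlgebra.norm_eq]
      ring
    have hf0 : f.coeff 0 = q.norm := by simp [f]
    have hf2 : f.coeff 2 = q'.norm := by simp [f]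
    have hfin : {t : ℂ | ∃ p' ∈ p ::ₘ T, p' ∣ f.eval (C t)}.Finite := by
      have : {t : ℂ | ∃ p' ∈ p ::ₘ T, p' ∣ f.eval (C t)} =
          ⋃ p' ∈ {p' | p' ∈ p ::ₘ T}, {t : ℂ | p' ∣ f.eval (C t)} := by ext; simp
      rw [this]
      refine Set.Finite.biUnion (Multiset.finite_toSet _) fun p' hp' => ?_
      rcases Multiset.mem_cons.1 hp' with rfl | h
      · exact finite_setOf_dvd_eval (hT _ hp') f (k := 2) (by rwa [hf2])
      · exact finite_setOf_dvd_eval (hT _ hp') f (k := 0) (by rw [hf0]; exact hqT p' h)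
    obtain ⟨t, ht⟩ := hfin.infinite_compl.nonempty
    refine ⟨_, hq.add hq' t, fun p' hp' h => ht ⟨p', hp', by rwa [hf]⟩⟩

theorem Mobile.exists_coprime (hm : D.Mobile n c) : ∃ g₁ g₂, D.Mem c g₁ ∧ D.Mem c g₂ ∧
    IsRelPrime g₁.norm g₂.norm := by
  classical
  obtain ⟨g₁, hg₁, h0⟩ := hm.exists_not_dvd_norm (X_prime (i := (0 : Fin 4)) (R := ℂ))
  have hne : g₁.norm ≠ 0 := fun h => h0 (by rw [h]; exact dvd_zero _)
  obtain ⟨g₂, hg₂, h2⟩ := hm.exists_forall_not_dvd_norm (UniqueFactorizationMonoid.factors g₁.norm)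
    (fun p hp => UniqueFactorizationMonoid.prime_of_factor p hp)
  refine ⟨g₁, g₂, hg₁, hg₂, (UniqueFactorizationMonoid.isRelPrime_iff_no_prime_factors hne).2 ?_⟩
  intro d hd1 hd2 hd
  obtain ⟨p, hp, hdp⟩ := UniqueFactorizationMonoid.exists_mem_factors_of_dvd hne hd.irreducible hd1
  exact h2 p hp (hdp.symm.dvd.trans hd2)

theorem Mobile.M_lt (hm : D.Mobile n c) : D.M < 4 * n := by
  by_contra! hM
  let V := homogeneousSubmodule (Fin 4) ℂ n
  have : Module.Finite ℂ V := Module.Finite.iff_fg.2 (homogeneousSubmodule_fg _ _ n)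
  have hn := hm.n_pos
  let k := D.M - n
  have hk : n < k := by omega
  let A : V × V × ℂ →ₗ[ℂ] Poly4 :=
    { toFun := fun x => X 0 ^ k * x.1.1 + X 1 ^ k * x.2.1.1 + C x.2.2 * X 2 ^ D.M
      map_add' := fun x y => by simp; ring
      map_smul' := fun t x => by
        simp only [Prod.smul_fst, Prod.smul_snd, Submodule.coe_smul, smul_eq_C_mul, smul_eq_mul, C_mul,
          RingHom.id_apply]
        ring }
  have hA : ∀ x, (A x).IsHomogeneous D.M := by
    intro x
    refine IsHomogeneous.add (IsHomogeneous.add ?_ ?_) ?_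
    · have := ((isHomogeneous_X ℂ (0 : Fin 4)).pow k).mul x.1.2
      rwa [show 1 * k + n = D.M by omega] at this
    · have := ((isHomogeneous_X ℂ (1 : Fin 4)).pow k).mul x.2.1.2
      rwa [show 1 * k + n = D.M by omega] at this
    · have := ((isHomogeneous_X ℂ (2 : Fin 4)).pow D.M).C_mul x.2.2
      rwa [one_mul] at this
  have hAinj : ∀ x, A x = 0 → x = 0 := by
    rintro ⟨⟨p, hp⟩, ⟨q, hq⟩, t⟩ h
    replace h : X 0 ^ k * p + X 1 ^ k * q + C t * X 2 ^ D.M = 0 := h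
    have h1 := congrArg (eval (Pi.single (2 : Fin 4) (1 : ℂ))) h
    have ht : t = 0 := by
      simpa [zero_pow (show k ≠ 0 by omega)] using h1
    subst ht
    rw [C_0, zero_mul, add_zero] at h
    have hsmall : ∀ (r : Poly4), r.IsHomogeneous n → X 0 ^ k ∣ r → r = 0 := by
      rintro r hr ⟨s, rfl⟩
      by_contra hne
      have h3 := hr.totalDegree hne
      rw [totalDegree_mul_of_isDomain (left_ne_zero_of_mul hne) (right_ne_zero_of_mul hne),
        totalDegree_X_pow] at h3
      omega
    have hq0 : q = 0 := by
      apply hsmall q hq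
      have h2 : (X 0 : Poly4) ^ k ∣ X 1 ^ k * q := ⟨-p, by linear_combination h⟩
      refine (X_prime (i := (0 : Fin 4)) (R := ℂ)).pow_dvd_of_dvd_mul_left k ?_ h2
      intro h3
      have h4 := (X_prime (i := (0 : Fin 4)) (R := ℂ)).dvd_of_dvd_pow h3
      obtain ⟨s, hs⟩ := h4
      have := congrArg (eval (Pi.single (1 : Fin 4) (1 : ℂ))) hs
      simp at this
    have hp0 : p = 0 := by
      rw [hq0, mul_zero, add_zero] at h
      exact (mul_eq_zero.1 h).resolve_left (pow_ne_zero _ (X_ne_zero _))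
    subst hp0 hq0
    rfl
  choose q hq hΨ using fun x => hm.exists_eq (A x) (hA x)
  let B : V × V × ℂ →ₗ[ℂ] V × V :=
    { toFun := fun x => (⟨(q x).re, ((DRing.hom_iff D.hF).1 (hq x)).1⟩, ⟨X 0 ^ 3 * (q x).im, by
        rcases ((DRing.hom_iff D.hF).1 (hq x)).2 with h | ⟨m, hm, h⟩
        · rw [h, mul_zero]; exact isHomogeneous_zero _ _ _
        · have := ((isHomogeneous_X ℂ (0 : Fin 4)).pow 3).mul h
          rwa [show 1 * 3 + m = n by omega] at this⟩)
      map_add' := fun x y => by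
        have : q (x + y) = q x + q y := D.inj (by rw [map_add, hΨ, hΨ, hΨ, map_add, add_mul])
        ext1 <;> ext1 <;> simp [this, mul_add]
      map_smul' := fun t x => by
        have : q (t • x) = t • q x := D.inj (by rw [map_smul, hΨ, hΨ, map_smul, smul_mul_assoc])
        ext1 <;> ext1 <;> simp [this] }
  have hB : Function.Injective B := by
    rw [injective_iff_map_eq_zero]
    intro x hx
    have h1 : (q x).re = 0 := congrArg (fun y => (y.1 : Poly4)) hx
    have h2 : X 0 ^ 3 * (q x).im = 0 := congrArg (fun y => (y.2 : Poly4)) hx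
    have h3 := (mul_eq_zero.1 h2).resolve_left (pow_ne_zero _ (X_ne_zero _))
    have h4 : q x = 0 := by ext1 <;> assumption
    have h5 := hΨ x
    rw [h4, map_zero] at h5
    exact hAinj x ((mul_eq_zero.1 h5.symm).resolve_right (pow_ne_zero _ hm.c_ne_zero))
  have := LinearMap.finrank_le_finrank_of_injective hB
  simp only [Module.finrank_prod, Module.finrank_self] at this
  omega

end RatParam

/-- The numerical data of a maximal singularity of the linear system spanned by `g₁`, `g₂`: a prime
divisor `π` of discrepancy at most `a`, along which both vanish to order more than `n a`. -/
structure MaxSing (F : Poly4) (M n a : ℕ) (g₁ g₂ : DRing F) (ξ : Fin 4 → Poly4) (ω G π : Poly4) :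
    Prop where
  hF : F.IsHomogeneous 6
  smooth : ∀ v : Fin 4 → ℂ, (∀ i, eval v (pderiv i F) = 0) → v = 0
  n_pos : 1 ≤ n
  M_pos : 0 < M
  hom_ξ : ∀ i, (ξ i).IsHomogeneous M
  sq : ω ^ 2 = aeval ξ F
  det : (Matrix.of fun k j => pderiv j (ξ k)).det = G * ω
  ω_ne_zero : ω ≠ 0
  prime : Prime π
  hom_π : ∃ d, π.IsHomogeneous d
  not_dvd : ¬ π ^ (a + 1) ∣ G
  exists_not_dvd : ∃ k, ¬ π ∣ ξ k
  hom₁ : (DRing.grading hF).Hom n g₁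
  hom₂ : (DRing.grading hF).Hom n g₂
  coprime : IsRelPrime g₁.norm g₂.norm
  dvd₁ : π ^ (n * a + 1) ∣ DRing.evalHom ξ ω sq g₁
  dvd₂ : π ^ (n * a + 1) ∣ DRing.evalHom ξ ω sq g₂

/-- The Noether–Fano inequality. -/
theorem RatParam.exists_maxSing {F : Poly4} (D : RatParam F)
    (hsm : ∀ v : Fin 4 → ℂ, (∀ i, eval v (pderiv i F) = 0) → v = 0) :
    ∃ n a g₁ g₂ G π, MaxSing F D.M n a g₁ g₂ D.ξ D.ω G π := by
  obtain ⟨n, c, hm⟩ := D.exists_mobile hsm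
  obtain ⟨G, hG⟩ := D.exists_det_eq hsm
  have hG0 : G ≠ 0 := by rintro rfl; exact D.det_jacMat_ne_zero (by rw [hG, zero_mul])
  obtain ⟨g₁, g₂, hg₁, hg₂, hcop⟩ := hm.exists_coprime
  have hdet : D.jacMat.det.totalDegree ≤ 4 * (D.M - 1) := by
    rw [Matrix.det_apply]
    refine (totalDegree_finsetSum_le (d := 4 * (D.M - 1)) fun σ _ => ?_)
    have h1 : (∏ i, D.jacMat (σ i) i).IsHomogeneous (4 * (D.M - 1)) := by
      have := IsHomogeneous.prod Finset.univ (fun i => D.jacMat (σ i) i) (fun _ => D.M - 1)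
        (fun i _ => (D.hom_ξ (σ i)).pderiv)
      simpa using this
    rcases Int.units_eq_one_or (Equiv.Perm.sign σ) with h | h <;> rw [h]
    · rw [one_smul]; exact h1.totalDegree_le
    · rw [Units.neg_smul, one_smul, totalDegree_neg]; exact h1.totalDegree_le
  have hGdeg : G.totalDegree + 3 * D.M ≤ 4 * (D.M - 1) := by
    rw [hG, totalDegree_mul_of_isDomain hG0 D.ω_ne_zero, D.hom_ω.totalDegree D.ω_ne_zero] at hdet
    exact hdet
  have hnd : ¬ c ^ D.M ∣ G ^ n := by
    intro h
    have h1 := totalDegree_le_of_dvd_of_isDomain h (pow_ne_zero _ hG0)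
    rw [(hm.hom_c.pow D.M).totalDegree (pow_ne_zero _ hm.c_ne_zero)] at h1
    have h2 := totalDegree_pow G n
    have h3 := hm.M_lt
    have h4 := hm.n_pos
    have h5 : G.totalDegree + 4 ≤ D.M := by have := D.M_pos; omega
    obtain ⟨m, rfl⟩ : ∃ m, n = m + 1 := ⟨n - 1, by omega⟩
    rw [Nat.add_sub_cancel] at h1
    have h6 : (m + 1) * (G.totalDegree + 4) ≤ (m + 1) * D.M := Nat.mul_le_mul_left _ h5
    nlinarith
  rw [UniqueFactorizationMonoid.dvd_iff_emultiplicity_le (pow_ne_zero _ hm.c_ne_zero)] at hnd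
  push Not at hnd
  obtain ⟨π, hπ, hlt⟩ := hnd
  have hfin : FiniteMultiplicity π G := FiniteMultiplicity.of_prime_left hπ hG0
  have hmul : π ^ (n * multiplicity π G + 1) ∣ c ^ D.M := by
    rw [emultiplicity_pow hπ, hfin.emultiplicity_eq_multiplicity] at hlt
    apply pow_dvd_of_le_emultiplicity
    have := Order.add_one_le_of_lt hlt
    exact_mod_cast this
  refine ⟨n, multiplicity π G, g₁, g₂, G, π, D.hF, hsm, hm.n_pos, D.M_pos, D.hom_ξ, D.sq, hG,
    D.ω_ne_zero, hπ, ?_, hfin.not_pow_dvd_of_multiplicity_lt (Nat.lt_succ_self _), D.coprime π hπ,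
    hm.hom hg₁, hm.hom hg₂, hcop, ?_, ?_⟩
  · obtain ⟨d, -, hd⟩ := (hm.hom_c.pow D.M).of_dvd (pow_ne_zero _ hm.c_ne_zero)
      ((dvd_pow_self π (Nat.succ_ne_zero _)).trans hmul)
    exact ⟨d, hd⟩
  · obtain ⟨A, -, h⟩ := hg₁
    exact h ▸ hmul.mul_left A
  · obtain ⟨A, -, h⟩ := hg₂
    exact h ▸ hmul.mul_left A

/-! ### Elimination and algebraic dependence -/

/-- Relatively prime polynomials over a factorial domain admit a nonzero constant combination. -/
theorem Polynomial.exists_C_mem_span_pair {A : Type*} [CommRing A] [IsDomain A]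
    [UniqueFactorizationMonoid A] {p q : Polynomial A} (h : IsRelPrime p q) :
    ∃ ρ : A, ρ ≠ 0 ∧ Polynomial.C ρ ∈ Ideal.span {p, q} := by
  classical
  let I := Ideal.span {p, q}
  have hpI : p ∈ I := Ideal.subset_span (by simp)
  have hqI : q ∈ I := Ideal.subset_span (by simp)
  have hne : ∃ f ∈ I, f ≠ 0 := by
    by_contra! hcon
    have h1 := hcon p hpI
    have h2 := hcon q hqI
    rw [h1, h2] at h
    exact not_isUnit_zero (h (dvd_refl 0) (dvd_refl 0))
  have hex : ∃ d, ∃ f ∈ I, f ≠ 0 ∧ f.natDegree = d := by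
    obtain ⟨f, hf, h0⟩ := hne; exact ⟨_, f, hf, h0, rfl⟩
  obtain ⟨f, hf, hf0, hd⟩ := Nat.find_spec hex
  have hmin : ∀ g ∈ I, g ≠ 0 → f.natDegree ≤ g.natDegree := fun g hg h0 =>
    hd ▸ Nat.find_min' hex ⟨g, hg, h0, rfl⟩
  have hdiv : ∀ (m : ℕ) (g : Polynomial A), g.natDegree = m → g ∈ I →
      ∃ c : A, c ≠ 0 ∧ f ∣ Polynomial.C c * g := by
    intro m
    induction m using Nat.strong_induction_on with
    | _ m ih =>
      intro g hg hgI
      by_cases hg0 : g = 0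
      · exact ⟨1, one_ne_zero, by simp [hg0]⟩
      have hle := hmin g hgI hg0
      have hlc := Polynomial.leadingCoeff_ne_zero.2 hf0
      by_cases hz : g.natDegree = 0
      · refine ⟨f.coeff 0, ?_, ?_⟩
        · rw [Polynomial.leadingCoeff, show f.natDegree = 0 by omega] at hlc; exact hlc
        · have := Polynomial.eq_C_of_natDegree_eq_zero (show f.natDegree = 0 by omega)
          rw [← this]; exact dvd_mul_right _ _
      have hlt := Polynomial.natDegree_cancelLeads_lt_of_natDegree_le_natDegree hle
        (Nat.pos_of_ne_zero hz)
      have hcl : f.cancelLeads g = Polynomial.C f.leadingCoeff * g -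
          Polynomial.C g.leadingCoeff * Polynomial.X ^ (g.natDegree - f.natDegree) * f := by
        rw [Polynomial.cancelLeads, Nat.sub_eq_zero_of_le hle, pow_zero, mul_one]
      obtain ⟨c, hc, hc'⟩ := ih _ (hg ▸ hlt) (f.cancelLeads g) rfl (by
        rw [hcl]; exact I.sub_mem (I.mul_mem_left _ hgI) (I.mul_mem_left _ hf))
      refine ⟨c * f.leadingCoeff, mul_ne_zero hc hlc, ?_⟩
      rw [hcl, mul_sub] at hc'
      have := (dvd_sub_left ((dvd_mul_left f _).mul_left (Polynomial.C c))).1 hc'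
      rwa [Polynomial.C_mul, mul_assoc]
  by_cases hz : f.natDegree = 0
  · refine ⟨f.coeff 0, ?_, ?_⟩
    · intro h0
      exact hf0 (by rw [Polynomial.eq_C_of_natDegree_eq_zero hz, h0, Polynomial.C_0])
    · rw [← Polynomial.eq_C_of_natDegree_eq_zero hz]; exact hf
  exfalso
  have hfac : ∃ π, Prime π ∧ π ∣ f ∧ π.natDegree ≠ 0 := by
    by_contra! hcon
    have key : ∀ g : Polynomial A, g ≠ 0 → (∀ π, Prime π → π ∣ g → π.natDegree = 0) →
        g.natDegree = 0 := by
      intro g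
      induction g using UniqueFactorizationMonoid.induction_on_prime with
      | h₁ => intro h; exact absurd rfl h
      | h₂ u hu => intro _ _; exact Polynomial.natDegree_eq_zero_of_isUnit hu
      | h₃ a π ha hπ ih =>
        intro _ hh
        rw [Polynomial.natDegree_mul hπ.ne_zero ha, hh π hπ (dvd_mul_right _ _),
          ih ha fun π' h1 h2 => hh π' h1 (h2.mul_left _)]
    exact hz (key f hf0 hcon)
  obtain ⟨π, hπ, hπf, hπd⟩ := hfac
  have hdvd : ∀ g ∈ I, π ∣ g := by
    intro g hg
    obtain ⟨c, hc, hc'⟩ := hdiv _ g rfl hg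
    rcases hπ.dvd_or_dvd (hπf.trans hc') with h1 | h1
    · have := Polynomial.natDegree_le_of_dvd h1 (Polynomial.C_ne_zero.2 hc)
      rw [Polynomial.natDegree_C] at this
      omega
    · exact h1
  exact hπ.not_isUnit (h (hdvd p hpI) (hdvd q hqI))

theorem IsRelPrime.map_ringEquiv {A B : Type*} [CommRing A] [CommRing B] (e : A ≃+* B) {p q : A}
    (h : IsRelPrime p q) : IsRelPrime (e p) (e q) := by
  intro d hd1 hd2
  have h1 : e.symm d ∣ p := by simpa using map_dvd e.symm hd1
  have h2 : e.symm d ∣ q := by simpa using map_dvd e.symm hd2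
  have := (h h1 h2).map e
  simpa using this

/-- Elimination of the variable `Xᵢ`. -/
theorem MvPolynomial.exists_rename_mem_span_pair {m : ℕ} (i : Fin (m + 1))
    {p q : MvPolynomial (Fin (m + 1)) ℂ} (h : IsRelPrime p q) :
    ∃ ρ : MvPolynomial (Fin m) ℂ, ρ ≠ 0 ∧ rename i.succAbove ρ ∈ Ideal.span {p, q} := by
  let e : MvPolynomial (Fin (m + 1)) ℂ ≃ₐ[ℂ] Polynomial (MvPolynomial (Fin m) ℂ) :=
    (renameEquiv ℂ (finSuccEquiv' i)).trans (optionEquivLeft ℂ (Fin m))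
  have heX : ∀ j, e (X (i.succAbove j)) = Polynomial.C (X j) := by
    intro j
    rw [AlgEquiv.trans_apply, renameEquiv_apply, rename_X, finSuccEquiv'_succAbove,
      optionEquivLeft_X_some]
  have heC : ∀ a, e (C a) = Polynomial.C (C a) := by
    intro a
    rw [AlgEquiv.trans_apply, renameEquiv_apply, rename_C, optionEquivLeft_C]
  have he : ∀ ρ : MvPolynomial (Fin m) ℂ, e (rename i.succAbove ρ) = Polynomial.C ρ := by
    intro ρ
    induction ρ using MvPolynomial.induction_on with
    | C a =>
      rw [rename_C]
      exact heC a
    | add p q hp hq => rw [map_add, map_add, hp, hq, Polynomial.C_add]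
    | mul_X p j hp =>
      rw [map_mul, map_mul, hp, Polynomial.C_mul, rename_X, heX]
  obtain ⟨ρ, h0, hρ⟩ := Polynomial.exists_C_mem_span_pair (h.map_ringEquiv e.toRingEquiv)
  refine ⟨ρ, h0, ?_⟩
  rw [Ideal.mem_span_pair] at hρ ⊢
  obtain ⟨a, b, hab⟩ := hρ
  refine ⟨e.symm a, e.symm b, e.injective ?_⟩
  rw [he, ← hab, map_add, map_mul, map_mul, AlgEquiv.apply_symm_apply, AlgEquiv.apply_symm_apply]
  rfl

section
variable {B : Type} [CommRing B] [Algebra ℂ B]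

theorem not_algebraicIndependent_succAbove {m : ℕ} (i : Fin (m + 1)) (x : Fin (m + 1) → B)
    {p q : MvPolynomial (Fin (m + 1)) ℂ} (h : IsRelPrime p q) (hp : aeval x p = 0)
    (hq : aeval x q = 0) : ¬ AlgebraicIndependent ℂ (x ∘ i.succAbove) := by
  obtain ⟨ρ, h0, hρ⟩ := exists_rename_mem_span_pair i h
  intro hx
  apply h0
  apply hx
  rw [map_zero, ← aeval_rename]
  obtain ⟨a, b, hab⟩ := Ideal.mem_span_pair.1 hρ
  rw [← hab, map_add, map_mul, map_mul, hp, hq, mul_zero, mul_zero, add_zero]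

/-- The coordinate ring of a curve in projective space has transcendence degree at most two. -/
theorem not_algebraicIndependent_of_isRelPrime [IsDomain B] (x : Fin 4 → B)
    [Algebra.IsAlgebraic (Algebra.adjoin ℂ (Set.range x)) B]
    {p q : MvPolynomial (Fin 4) ℂ} (h : IsRelPrime p q) (hp : aeval x p = 0)
    (hq : aeval x q = 0) (z : Fin 3 → B) : ¬ AlgebraicIndependent ℂ z := by
  intro hz
  obtain ⟨t, ht, hb⟩ := exists_isTranscendenceBasis_subset (R := ℂ) (Set.range x)
  obtain ⟨e⟩ : Nonempty (Fin 3 ↪ t) := by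
    rw [← Cardinal.le_def, hb.cardinalMk_eq_trdeg]
    exact hz.cardinalMk_le_trdeg
  choose f hf using fun k => ht (e k).2
  have hfi : Function.Injective f := fun a b hab => e.injective (Subtype.ext (by
    rw [← hf a, ← hf b, hab]))
  obtain ⟨i, hi⟩ : ∃ i, ∀ k, f k ≠ i := by
    by_contra! hcon
    have := Fintype.card_le_of_surjective f hcon
    simp at this
  choose σ hσ using fun k => Fin.exists_succAbove_eq (hi k)
  have hσi : Function.Injective σ := fun a b hab => hfi (by rw [← hσ a, ← hσ b, hab])
  apply not_algebraicIndependent_succAbove i x h hp hq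
  have h1 : AlgebraicIndependent ℂ ((x ∘ i.succAbove) ∘ Equiv.ofBijective σ
      (Finite.injective_iff_bijective.1 hσi)) := by
    have h2 := hb.1.comp e e.injective
    convert h2 using 1
    funext k
    simp [hσ, hf]
  exact (algebraicIndependent_equiv _).1 h1

/-- If `z` is algebraically dependent modulo a prime `π` preserved by the derivations `θ`, then the
Jacobian determinant of `z` vanishes modulo `π`. -/
theorem dvd_det_of_not_algebraicIndependent {σ ι : Type} [Fintype ι] [DecidableEq ι]
    {π : MvPolynomial σ ℂ} (hπ : Prime π)
    (θ : ι → Derivation ℂ (MvPolynomial σ ℂ) (MvPolynomial σ ℂ)) (hθ : ∀ i, π ∣ θ i π)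
    (z : ι → MvPolynomial σ ℂ)
    (hz : ¬ AlgebraicIndependent ℂ fun i => Ideal.Quotient.mkₐ ℂ (Ideal.span {π}) (z i)) :
    π ∣ (Matrix.of fun i j => θ i (z j)).det := by
  classical
  have hpr : (Ideal.span {π}).IsPrime := (Ideal.span_singleton_prime hπ.ne_zero).2 hπ
  have hmk : ∀ p : MvPolynomial ι ℂ, aeval (fun i => Ideal.Quotient.mkₐ ℂ (Ideal.span {π}) (z i)) p = 0 ↔
      π ∣ aeval z p := by
    intro p
    rw [← Ideal.Quotient.eq_zero_iff_dvd]
    have : aeval (fun i => Ideal.Quotient.mkₐ ℂ (Ideal.span {π}) (z i)) p =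
      Ideal.Quotient.mkₐ ℂ (Ideal.span {π}) (aeval z p) := by
      rw [comp_aeval_apply]
    rw [this]; rfl
  have hex : ∃ d, ∃ p : MvPolynomial ι ℂ, p ≠ 0 ∧ π ∣ aeval z p ∧ p.totalDegree = d := by
    rw [algebraicIndependent_iff] at hz
    push Not at hz
    obtain ⟨p, h1, h2⟩ := hz
    exact ⟨_, p, h2, (hmk p).1 h1, rfl⟩
  obtain ⟨p, hp0, hp, hd⟩ := Nat.find_spec hex
  have hpos : p.totalDegree ≠ 0 := by
    intro h0
    rw [totalDegree_eq_zero_iff_eq_C] at h0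
    rw [h0, algHom_C, algebraMap_eq] at hp
    refine hπ.not_isUnit (isUnit_of_dvd_unit hp ((isUnit_iff_ne_zero.2 fun h => hp0 ?_).map C))
    rw [h0, h, C_0]
  obtain ⟨i, hi⟩ := exists_pderiv_ne_zero hpos
  have hi' : ¬ π ∣ aeval z (pderiv i p) := by
    intro h
    have := Nat.find_min' hex ⟨_, hi, h, rfl⟩
    have h2 := totalDegree_pderiv_lt hpos i
    omega
  have hpres : ∀ i, ∀ y, π ∣ y → π ∣ θ i y := by
    rintro i _ ⟨w, rfl⟩
    rw [Derivation.leibniz, smul_eq_mul, smul_eq_mul]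
    exact dvd_add (dvd_mul_right _ _) ((hθ i).mul_left _)
  let φ := Ideal.Quotient.mk (Ideal.span {π})
  have hdet : ((Matrix.of fun i j => θ i (z j)).map φ).det = 0 := by
    apply Matrix.exists_mulVec_eq_zero_iff.1
    refine ⟨fun j => φ (aeval z (pderiv j p)), fun h => hi' ?_, ?_⟩
    · exact (Ideal.Quotient.eq_zero_iff_dvd _ _).1 (congrFun h i)
    · funext k
      have h1 := hpres k _ hp
      rw [derivation_aeval] at h1
      have h2 := (Ideal.Quotient.eq_zero_iff_dvd _ _).2 h1
      rw [map_sum] at h2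
      rw [Pi.zero_apply, ← h2]
      refine Finset.sum_congr rfl fun j _ => ?_
      rw [map_mul, mul_comm]; rfl
  rw [← RingHom.mapMatrix_apply, ← RingHom.map_det] at hdet
  exact (Ideal.Quotient.eq_zero_iff_dvd _ _).1 hdet

end

/-! ### Differential powers -/

/-- `DiffPow δ Q k r`: all iterated derivatives of `r` of order less than `k` lie in `Q`. -/
def DiffPow {R ι : Type*} [CommRing R] [Algebra ℂ R] (δ : ι → Derivation ℂ R R) (Q : Ideal R) :
    ℕ → R → Prop
  | 0, _ => True
  | k + 1, r => r ∈ Q ∧ ∀ i, DiffPow δ Q k (δ i r)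

namespace DiffPow
variable {R ι : Type*} [CommRing R] [Algebra ℂ R] {δ : ι → Derivation ℂ R R} {Q : Ideal R}

theorem of_succ {k : ℕ} {r : R} (h : DiffPow δ Q (k + 1) r) : DiffPow δ Q k r := by
  induction k generalizing r with
  | zero => trivial
  | succ k ih => exact ⟨h.1, fun i => ih (h.2 i)⟩

theorem mono {k l : ℕ} (hkl : k ≤ l) {r : R} (h : DiffPow δ Q l r) : DiffPow δ Q k r := by
  induction hkl with
  | refl => exact h
  | step _ ih => exact ih h.of_succ

theorem zero (k : ℕ) : DiffPow δ Q k 0 := by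
  induction k with
  | zero => trivial
  | succ k ih => exact ⟨Q.zero_mem, fun i => by rwa [map_zero]⟩

theorem add {k : ℕ} {r s : R} (hr : DiffPow δ Q k r) (hs : DiffPow δ Q k s) :
    DiffPow δ Q k (r + s) := by
  induction k generalizing r s with
  | zero => trivial
  | succ k ih => exact ⟨Q.add_mem hr.1 hs.1, fun i => by rw [map_add]; exact ih (hr.2 i) (hs.2 i)⟩

theorem mul_left {k : ℕ} {r : R} (hr : DiffPow δ Q k r) (s : R) : DiffPow δ Q k (s * r) := by
  induction k generalizing r s with
  | zero => trivial
  | succ k ih =>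
    refine ⟨Q.mul_mem_left _ hr.1, fun i => ?_⟩
    rw [Derivation.leibniz, smul_eq_mul, smul_eq_mul, mul_comm r]
    exact (ih (hr.2 i) s).add (ih hr.of_succ _)

theorem neg {k : ℕ} {r : R} (hr : DiffPow δ Q k r) : DiffPow δ Q k (-r) := by
  have := hr.mul_left (-1); rwa [neg_one_mul] at this

theorem sub {k : ℕ} {r s : R} (hr : DiffPow δ Q k r) (hs : DiffPow δ Q k s) :
    DiffPow δ Q k (r - s) := by
  rw [sub_eq_add_neg]; exact hr.add hs.neg

theorem mul {k l : ℕ} {r s : R} (hr : DiffPow δ Q k r) (hs : DiffPow δ Q l s) :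
    DiffPow δ Q (k + l) (r * s) := by
  induction hm : k + l generalizing k l r s with
  | zero => trivial
  | succ m ih =>
    rcases k with _ | k
    · obtain rfl : l = m + 1 := by omega
      exact hs.mul_left r
    rcases l with _ | l
    · obtain rfl : k = m := by omega
      rw [mul_comm]; exact hr.mul_left s
    refine ⟨Q.mul_mem_right _ hr.1, fun i => ?_⟩
    rw [Derivation.leibniz, smul_eq_mul, smul_eq_mul]
    exact (ih hr (hs.2 i) (by omega)).add (ih hs (hr.2 i) (by omega))

theorem pow {k : ℕ} {r : R} (hr : DiffPow δ Q k r) (m : ℕ) : DiffPow δ Q (m * k) (r ^ m) := by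
  induction m with
  | zero => rw [Nat.zero_mul]; trivial
  | succ m ih => rw [pow_succ, Nat.succ_mul]; exact ih.mul hr

theorem of_mul (hQ : Q.IsPrime) {k : ℕ} {r s : R} (hs : s ∉ Q) (h : DiffPow δ Q k (s * r)) :
    DiffPow δ Q k r := by
  induction k generalizing r with
  | zero => trivial
  | succ k ih =>
    refine ⟨(hQ.mem_or_mem h.1).resolve_left hs, fun i => ih ?_⟩
    have h1 := h.2 i
    rw [Derivation.leibniz, smul_eq_mul, smul_eq_mul] at h1
    have h2 := (ih h.of_succ).mul_left (δ i s)
    have h3 := h1.sub h2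
    convert h3 using 1
    ring

end DiffPow

namespace DRing
variable {F : Poly4}

/-- The derivation `2W ∂ᵢ` as a derivation. -/
noncomputable def Hd (i : Fin 4) : Derivation ℂ (DRing F) (DRing F) :=
  Derivation.mk'
    { toFun := H i
      map_add' := H_add i
      map_smul' := fun t r => by
        ext1 <;> simp [H, smul_eq_C_mul] <;> ring }
    (fun r s => by simpa [smul_eq_mul] using H_mul i r s)

theorem Hd_apply (i : Fin 4) (r : DRing F) : Hd i r = H i r := rfl

theorem H_star (i : Fin 4) (r : DRing F) : H i (star r) = -star (H i r) := by
  ext1 <;> simp [H] <;> ring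

section
variable {Q : Ideal (DRing F)}

theorem diffPow_star (hst : ∀ r ∈ Q, star r ∈ Q) {k : ℕ} {r : DRing F} (h : DiffPow Hd Q k r) :
    DiffPow Hd Q k (star r) := by
  induction k generalizing r with
  | zero => trivial
  | succ k ih =>
    refine ⟨hst _ h.1, fun i => ?_⟩
    rw [Hd_apply, H_star]
    exact (ih (h.2 i)).neg

theorem two_not_mem (hQ : Q.IsPrime) : (2 : DRing F) ∉ Q := fun h =>
  hQ.ne_top ((Ideal.eq_top_iff_one _).2 (inc_mem_of_two_mul (by rwa [mul_one])))

theorem diffPow_pderiv (hQ : Q.IsPrime) (hW : W F ∉ Q) {k : ℕ} {p : Poly4}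
    (h : DiffPow Hd Q k (inc F p)) : DiffPow pderiv (Q.comap (inc F)) k p := by
  induction k generalizing p with
  | zero => trivial
  | succ k ih =>
    refine ⟨h.1, fun i => ih ?_⟩
    have := h.2 i
    rw [Hd_apply, H_inc] at this
    exact DiffPow.of_mul hQ (fun h1 => (hQ.mem_or_mem h1).elim (two_not_mem hQ) hW) this

theorem diffPow_of_W_mul (hQ : Q.IsPrime) (hW : W F ∈ Q) {i : Fin 4} (hi : inc F (pderiv i F) ∉ Q)
    {m : ℕ} {x : Poly4} (h : DiffPow Hd Q (m + 1) (W F * inc F x)) : DiffPow Hd Q m (inc F x) := by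
  have hW1 : DiffPow Hd Q 1 (W F) := ⟨hW, fun _ => trivial⟩
  have key : ∀ j : ℕ, ∃ e y, DiffPow Hd Q m (inc F (pderiv i F ^ e * x - F ^ j * y)) := by
    intro j
    induction j with
    | zero => exact ⟨0, x, by simpa using DiffPow.zero m⟩
    | succ j ih =>
      obtain ⟨e, y, hy⟩ := ih
      have h1 : DiffPow Hd Q (m + 1) (W F * inc F (F ^ j * y)) := by
        have h2 := (h.mul_left (inc F (pderiv i F ^ e))).sub ((add_comm 1 m) ▸ hW1.mul hy)
        convert h2 using 1
        simp only [map_sub, map_mul]; ring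
      have h2 := h1.2 i
      rw [Hd_apply, H_W_mul_inc] at h2
      have hj : (2 * (j : ℂ) + 1) ≠ 0 := by exact_mod_cast Nat.succ_ne_zero (2 * j)
      refine ⟨e + 1, -(C (2 * (j : ℂ) + 1)⁻¹ * (2 * pderiv i y)), ?_⟩
      have h3 := (hy.mul_left (inc F (pderiv i F))).add (h2.mul_left (inc F (C (2 * (j : ℂ) + 1)⁻¹)))
      convert h3 using 1
      rw [← map_mul, ← map_mul, ← map_add]
      congr 1
      have h4 : C (2 * (j : ℂ) + 1)⁻¹ * (2 * (j : Poly4) + 1) = 1 := by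
        have : (2 * j + 1 : Poly4) = C (2 * (j : ℂ) + 1) := by
          rw [C_add, C_mul, C_1, show (C 2 : Poly4) = 2 from map_ofNat _ 2]; simp
        rw [this, ← C_mul, inv_mul_cancel₀ hj, C_1]
      have h5 := Derivation.mul_pow_apply (pderiv i) F j
      rw [Derivation.leibniz, smul_eq_mul, smul_eq_mul]
      linear_combination (-(F ^ j * y * pderiv i F)) * h4 - (C (2 * (j : ℂ) + 1)⁻¹ * 2 * y) * h5
  obtain ⟨e, y, hy⟩ := key m
  have h1 : DiffPow Hd Q m (inc F (F ^ m * y)) := by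
    rw [map_mul, map_pow, ← W_sq, mul_comm, ← pow_mul]
    have := (hW1.pow (2 * m)).mono (k := m) (by omega)
    exact this.mul_left _
  have h2 := hy.add h1
  rw [← map_add, sub_add_cancel, map_mul, map_pow] at h2
  exact DiffPow.of_mul hQ (fun h3 => hi (hQ.mem_of_pow_mem _ h3)) h2

theorem diffPow_pderiv_of_ramified (hQ : Q.IsPrime) (hW : W F ∈ Q) {i : Fin 4}
    (hi : inc F (pderiv i F) ∉ Q) {k : ℕ} {p : Poly4}
    (h : DiffPow Hd Q (2 * k) (inc F p)) : DiffPow pderiv (Q.comap (inc F)) k p := by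
  induction k generalizing p with
  | zero => trivial
  | succ k ih =>
    refine ⟨h.1, fun j => ih (diffPow_of_W_mul hQ hW hi ?_)⟩
    have := h.2 j
    rw [Hd_apply, H_inc, mul_assoc] at this
    exact DiffPow.of_mul hQ (two_not_mem hQ) this

end

end DRing

/-! ### Logarithmic derivations along a prime divisor -/

theorem Prime.pow_dvd_of_pow_add_dvd_mul {A : Type*} [CommRing A] [IsDomain A] {π G z : A}
    (hπ : Prime π) {a k : ℕ} (hG : ¬ π ^ (a + 1) ∣ G) (h : π ^ (k + a) ∣ G * z) : π ^ k ∣ z := by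
  induction a generalizing G with
  | zero => exact hπ.pow_dvd_of_dvd_mul_left k (by simpa using hG) (by simpa using h)
  | succ a ih =>
    by_cases hd : π ∣ G
    · obtain ⟨G', rfl⟩ := hd
      refine ih (G := G') (fun h1 => hG ?_) ?_
      · rw [pow_succ']; exact mul_dvd_mul_left _ h1
      · rw [← add_assoc, pow_succ', mul_assoc] at h
        exact (mul_dvd_mul_iff_left hπ.ne_zero).1 h
    · exact (pow_dvd_pow _ (by omega)).trans (hπ.pow_dvd_of_dvd_mul_left _ hd h)

theorem Derivation.pow_dvd_apply {A : Type*} [CommRing A] [Algebra ℂ A] {π z : A}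
    (θ : Derivation ℂ A A) (hθ : π ∣ θ π) {k : ℕ} (h : π ^ k ∣ z) : π ^ k ∣ θ z := by
  induction k generalizing z with
  | zero => simp
  | succ k ih =>
    obtain ⟨w, rfl⟩ := h
    have h1 := ih (dvd_mul_right (π ^ k) w)
    rw [pow_succ', mul_assoc, Derivation.leibniz, smul_eq_mul, smul_eq_mul]
    refine dvd_add (mul_dvd_mul_left _ h1) ?_
    rw [mul_comm (π ^ k * w)]
    exact mul_dvd_mul hθ (dvd_mul_right _ _)

/-- A frame of derivations preserving a prime `π`, of determinant `π` up to a unit at `π`. -/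
theorem MvPolynomial.exists_log_frame {m : ℕ} {π : MvPolynomial (Fin (m + 1)) ℂ} (hπ : Prime π) :
    ∃ T : Matrix (Fin (m + 1)) (Fin (m + 1)) (MvPolynomial (Fin (m + 1)) ℂ),
      (∀ i, π ∣ ∑ j, T i j * pderiv j π) ∧ ∃ u, ¬ π ∣ u ∧ T.det = π * u := by
  have hdeg : π.totalDegree ≠ 0 := by
    intro h0
    rw [totalDegree_eq_zero_iff_eq_C] at h0
    have hc : coeff 0 π ≠ 0 := fun h => hπ.ne_zero (by rw [h0, h, C_0])
    exact hπ.not_isUnit (by rw [h0]; exact (isUnit_iff_ne_zero.2 hc).map C)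
  obtain ⟨i₀, hi₀⟩ := exists_pderiv_ne_zero hdeg
  have hnd : ¬ π ∣ pderiv i₀ π := by
    intro h
    have h1 := totalDegree_le_of_dvd_of_isDomain h hi₀
    have h2 := totalDegree_pderiv_lt hdeg i₀
    omega
  let T : Matrix (Fin (m + 1)) (Fin (m + 1)) (MvPolynomial (Fin (m + 1)) ℂ) := Matrix.of fun i j =>
    if i = i₀ then (if j = i₀ then π else 0) else
      (if j = i then pderiv i₀ π else 0) - (if j = i₀ then pderiv i π else 0)
  refine ⟨T, fun i => ?_, pderiv i₀ π ^ m, fun h => hnd (hπ.dvd_of_dvd_pow h), ?_⟩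
  · by_cases hi : i = i₀
    · simp [T, hi]
    · simp [T, hi, sub_mul, Finset.sum_sub_distrib, mul_comm (pderiv i π)]
  · rw [Matrix.det_succ_row T i₀, Finset.sum_eq_single i₀]
    · have h1 : T.submatrix i₀.succAbove i₀.succAbove = pderiv i₀ π • 1 := by
        ext1 a b
        simp only [T, Matrix.submatrix_apply, Matrix.of_apply, Fin.succAbove_ne, if_false, sub_zero,
          Matrix.smul_apply, Matrix.one_apply, smul_eq_mul, (Fin.succAbove_right_injective).eq_iff]
        by_cases hab : a = b
        · simp [hab]
        · simp [hab, Ne.symm hab]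
      rw [h1, Matrix.det_smul, Matrix.det_one, mul_one, Fintype.card_fin]
      simp [T, ← two_mul, pow_mul]
    · intro j _ hj; simp [T, hj]
    · simp

/-- Along a prime `π` on which the other coordinates are algebraically dependent, the Jacobian
determinant is at least as divisible as any of its entries. -/
theorem MvPolynomial.pow_dvd_jacobian {m : ℕ} {π : MvPolynomial (Fin (m + 1)) ℂ} (hπ : Prime π)
    (x : Fin (m + 1) → MvPolynomial (Fin (m + 1)) ℂ) (i : Fin (m + 1)) {k : ℕ} (hk : π ^ k ∣ x i)
    (hx : ¬ AlgebraicIndependent ℂ fun j =>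
      Ideal.Quotient.mkₐ ℂ (Ideal.span {π}) (x (i.succAbove j))) :
    π ^ k ∣ (Matrix.of fun l j => pderiv j (x l)).det := by
  obtain ⟨T, hT, u, hu, hdet⟩ := exists_log_frame hπ
  let θ : Fin (m + 1) → Derivation ℂ (MvPolynomial (Fin (m + 1)) ℂ) (MvPolynomial (Fin (m + 1)) ℂ) :=
    fun l => ∑ j, T l j • pderiv j
  have hθ : ∀ l z, θ l z = ∑ j, T l j * pderiv j z := fun l z => Derivation.sum_smul_apply _ _ _ _
  have hlog : ∀ l, π ∣ θ l π := fun l => by rw [hθ]; exact hT l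
  have hmul : (Matrix.of fun l j => θ l (x j)) = T * (Matrix.of fun l j => pderiv j (x l)).transpose := by
    ext1 l j
    rw [Matrix.mul_apply, Matrix.of_apply, hθ]; rfl
  have h1 : π ^ (k + 1) ∣ (Matrix.of fun l j => θ l (x j)).det := by
    rw [Matrix.det_succ_column _ i]
    refine Finset.dvd_sum fun l _ => ?_
    rw [mul_assoc]
    refine Dvd.dvd.mul_left ?_ _
    rw [pow_succ]
    refine mul_dvd_mul ((θ l).pow_dvd_apply (hlog l) hk) ?_
    exact dvd_det_of_not_algebraicIndependent hπ (fun a => θ (l.succAbove a)) (fun a => hlog _)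
      (fun b => x (i.succAbove b)) hx
  rw [hmul, Matrix.det_mul, Matrix.det_transpose, hdet, pow_succ', mul_assoc] at h1
  exact hπ.pow_dvd_of_dvd_mul_left k hu ((mul_dvd_mul_iff_left hπ.ne_zero).1 h1)

namespace MaxSing
variable {F : Poly4} {M n a : ℕ} {g₁ g₂ : DRing F} {ξ : Fin 4 → Poly4} {ω G π : Poly4}
  (S : MaxSing F M n a g₁ g₂ ξ ω G π)

/-- The parametrization. -/
noncomputable abbrev Ψ (S : MaxSing F M n a g₁ g₂ ξ ω G π) : DRing F →ₐ[ℂ] Poly4 :=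
  DRing.evalHom ξ ω S.sq

/-- The centre of `π` on the cone. -/
noncomputable def Q (S : MaxSing F M n a g₁ g₂ ξ ω G π) : Ideal (DRing F) :=
  Ideal.comap S.Ψ (Ideal.span {π})

theorem mem_Q {r : DRing F} : r ∈ S.Q ↔ π ∣ S.Ψ r := by
  rw [Q, Ideal.mem_comap, Ideal.mem_span_singleton]

theorem isPrime_span (S : MaxSing F M n a g₁ g₂ ξ ω G π) : (Ideal.span {π}).IsPrime :=
  (Ideal.span_singleton_prime S.prime.ne_zero).2 S.prime

theorem isPrime_Q : S.Q.IsPrime := have := S.isPrime_span; Ideal.comap_isPrime _ _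

theorem norm_mem (S : MaxSing F M n a g₁ g₂ ξ ω G π) {g : DRing F} (h : π ^ (n * a + 1) ∣ S.Ψ g) :
    π ∣ aeval ξ g.norm := by
  rw [← DRing.evalHom_inc ξ ω S.sq, ← RatParam.star_mul_eq, map_mul]
  exact ((dvd_pow_self π (Nat.succ_ne_zero _)).trans h).mul_right _

theorem not_algebraicIndependent (r : Fin 3 → DRing F) : ¬ AlgebraicIndependent ℂ fun k =>
    Ideal.Quotient.mkₐ ℂ (Ideal.span {π}) (S.Ψ (r k)) := by
  have hpr := S.isPrime_span
  let χ : DRing F →ₐ[ℂ] Poly4 ⧸ Ideal.span {π} := (Ideal.Quotient.mkₐ ℂ (Ideal.span {π})).comp S.Ψ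
  let x : Fin 4 → χ.range := fun i => χ.rangeRestrict (DRing.inc F (X i))
  let A := Algebra.adjoin ℂ (Set.range x)
  have hx : ∀ p : Poly4, aeval x p = χ.rangeRestrict (DRing.inc F p) := by
    intro p
    have := comp_aeval_apply (fun i => (X i : Poly4)) (χ.rangeRestrict.comp (DRing.inc F)) p
    rw [aeval_X_left_apply] at this
    exact this.symm
  have hA : ∀ p : Poly4, χ.rangeRestrict (DRing.inc F p) ∈ A := by
    intro p
    rw [← hx]
    have h1 : aeval x p ∈ (aeval x : Poly4 →ₐ[ℂ] χ.range).range := ⟨p, rfl⟩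
    rwa [← Algebra.adjoin_range_eq_range_aeval] at h1
  have hintegral : ∀ p : Poly4, IsIntegral A (χ.rangeRestrict (DRing.inc F p)) := fun p =>
    isIntegral_algebraMap (x := (⟨_, hA p⟩ : A))
  have : Algebra.IsAlgebraic A χ.range := ⟨by
    rintro ⟨_, r, rfl⟩
    have h1 : IsIntegral A (χ.rangeRestrict r) := by
      rw [DRing.eq_inc_add r, map_add, map_mul]
      refine (hintegral _).add (IsIntegral.mul ?_ (hintegral _))
      refine IsIntegral.of_pow (n := 2) (by norm_num) ?_
      rw [← map_pow, DRing.W_sq]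
      exact hintegral _
    exact h1.isAlgebraic⟩
  have hnorm : ∀ g : DRing F, π ^ (n * a + 1) ∣ S.Ψ g → aeval x g.norm = 0 := by
    intro g hg
    rw [hx]
    apply Subtype.ext
    show Ideal.Quotient.mk _ (S.Ψ (DRing.inc F g.norm)) = 0
    rw [Ideal.Quotient.eq_zero_iff_dvd, DRing.evalHom_inc]
    exact S.norm_mem hg
  have h := not_algebraicIndependent_of_isRelPrime x S.coprime (hnorm _ S.dvd₁) (hnorm _ S.dvd₂)
    (fun k => χ.rangeRestrict (r k))
  intro h2
  apply h
  rw [← AlgHom.algebraicIndependent_iff χ.range.val Subtype.val_injective]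
  exact h2

theorem two_ω_mul_pderiv (S : MaxSing F M n a g₁ g₂ ξ ω G π) (j : Fin 4) :
    2 * ω * pderiv j ω = ∑ k, aeval ξ (pderiv k F) * pderiv j (ξ k) := by
  rw [← derivation_aeval, ← S.sq, pow_two, Derivation.leibniz, smul_eq_mul]; ring

theorem two_ω_smul_row (r : DRing F) (j : Fin 4) :
    2 * ω * pderiv j (S.Ψ r) = ∑ k, S.Ψ (DRing.H k r) * pderiv j (ξ k) := by
  have h1 := S.two_ω_mul_pderiv j
  rw [DRing.evalHom_apply, map_add, Derivation.leibniz, derivation_aeval, derivation_aeval]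
  simp only [smul_eq_mul, DRing.evalHom_apply, DRing.H, map_add, map_mul, map_ofNat, ← S.sq]
  have h2 : 2 * ω * (∑ k, aeval ξ (pderiv k r.re) * pderiv j (ξ k) +
      (ω * ∑ k, aeval ξ (pderiv k r.im) * pderiv j (ξ k) + aeval ξ r.im * pderiv j ω)) =
      2 * ω * (∑ k, aeval ξ (pderiv k r.re) * pderiv j (ξ k)) +
      2 * ω ^ 2 * (∑ k, aeval ξ (pderiv k r.im) * pderiv j (ξ k)) + aeval ξ r.im *
        (∑ k, aeval ξ (pderiv k F) * pderiv j (ξ k)) := by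
    linear_combination (aeval ξ r.im) * h1
  rw [h2, Finset.mul_sum, Finset.mul_sum, Finset.mul_sum, ← Finset.sum_add_distrib,
    ← Finset.sum_add_distrib]
  exact Finset.sum_congr rfl fun k _ => by ring

theorem two_det_update (i : Fin 4) (r : DRing F) :
    2 * (Matrix.of fun l j => pderiv j (Function.update ξ i (S.Ψ r) l)).det = G * S.Ψ (DRing.H i r) := by
  let A : Matrix (Fin 4) (Fin 4) Poly4 := Matrix.of fun k j => pderiv j (ξ k)
  have hup : (Matrix.of fun l j => pderiv j (Function.update ξ i (S.Ψ r) l)) =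
      A.updateRow i (fun j => pderiv j (S.Ψ r)) := by
    ext1 l j
    by_cases hl : l = i
    · subst hl; simp
    · simp [hl, A]
  have hrow : (2 * ω) • (fun j => pderiv j (S.Ψ r)) = ∑ k, S.Ψ (DRing.H k r) • A k := by
    funext j
    rw [Finset.sum_apply]
    exact S.two_ω_smul_row r j
  rw [hup]
  apply mul_left_cancel₀ S.ω_ne_zero
  have h3 := Matrix.det_updateRow_sum A i (fun k => S.Ψ (DRing.H k r))
  rw [← hrow, Matrix.det_updateRow_smul, smul_eq_mul, S.det] at h3
  linear_combination h3

theorem pow_dvd_H {i : Fin 4} {k : ℕ} {r : DRing F} (h : π ^ (k + a) ∣ S.Ψ r) :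
    π ^ k ∣ S.Ψ (DRing.H i r) := by
  refine S.prime.pow_dvd_of_pow_add_dvd_mul S.not_dvd ?_
  rw [← S.two_det_update]
  refine Dvd.dvd.mul_left (pow_dvd_jacobian S.prime _ i (by simpa using h) ?_) _
  have h1 := S.not_algebraicIndependent fun j => DRing.inc F (X (i.succAbove j))
  simpa [Function.update_of_ne (Fin.succAbove_ne _ _)] using h1

theorem diffPow {k : ℕ} {r : DRing F} (h : π ^ (k * a + 1) ∣ S.Ψ r) : DiffPow DRing.Hd S.Q (k + 1) r := by
  induction k generalizing r with
  | zero => exact ⟨S.mem_Q.2 (by simpa using h), fun _ => trivial⟩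
  | succ k ih =>
    refine ⟨S.mem_Q.2 ((dvd_pow_self π (Nat.succ_ne_zero _)).trans h), fun i => ih (S.pow_dvd_H ?_)⟩
    rwa [show k * a + 1 + a = (k + 1) * a + 1 by ring]

theorem exists_X_not_mem (S : MaxSing F M n a g₁ g₂ ξ ω G π) : ∃ k, DRing.inc F (X k) ∉ S.Q := by
  obtain ⟨k, hk⟩ := S.exists_not_dvd
  exact ⟨k, fun h => hk (by simpa using S.mem_Q.1 h)⟩

theorem exists_pderiv_not_mem (S : MaxSing F M n a g₁ g₂ ξ ω G π) :
    ∃ i, DRing.inc F (pderiv i F) ∉ S.Q := by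
  by_contra! hcon
  obtain ⟨k, hk⟩ := S.exists_X_not_mem
  obtain ⟨Y, hY⟩ := exists_X_pow_mem_jacobian S.smooth
  apply hk
  apply S.isPrime_Q.mem_of_pow_mem Y
  rw [← map_pow]
  have : Ideal.span (Set.range fun i => pderiv i F) ≤ S.Q.comap (DRing.inc F) := by
    rw [Ideal.span_le]
    rintro _ ⟨i, rfl⟩
    exact hcon i
  exact this (hY k)

/-- The norms vanish to order `n + 1` along the centre. -/
theorem diffPow_norm (S : MaxSing F M n a g₁ g₂ ξ ω G π) {g : DRing F} (h : π ^ (n * a + 1) ∣ S.Ψ g) :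
    DiffPow pderiv (S.Q.comap (DRing.inc F)) (n + 1) g.norm := by
  have hg := S.diffPow h
  by_cases hW : DRing.W F ∈ S.Q
  · obtain ⟨i, hi⟩ := S.exists_pderiv_not_mem
    apply DRing.diffPow_pderiv_of_ramified S.isPrime_Q hW hi
    rw [← RatParam.star_mul_eq, two_mul]
    refine hg.mul (DRing.diffPow_star (fun r hr => ?_) hg)
    have h1 : star r = r - 2 * DRing.W F * DRing.inc F r.im := by
      ext1 <;> simp [QuadraticAlgebra.re_ofNat, QuadraticAlgebra.im_ofNat]; ring
    rw [h1]
    exact S.Q.sub_mem hr (S.Q.mul_mem_right _ (S.Q.mul_mem_left _ hW))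
  · apply DRing.diffPow_pderiv S.isPrime_Q hW
    rw [← RatParam.star_mul_eq, mul_comm]
    exact hg.mul_left _

end MaxSing

/-- The substitution `X i ↦ ∑ j, B i j X j`. -/
noncomputable def linSubst (B : Matrix (Fin 4) (Fin 4) ℂ) : Poly4 →ₐ[ℂ] Poly4 :=
  aeval fun i => ∑ j, C (B i j) * X j

theorem linSubst_X (B : Matrix (Fin 4) (Fin 4) ℂ) (i : Fin 4) :
    linSubst B (X i) = ∑ j, C (B i j) * X j := aeval_X _ _

theorem aeval_linSubst {R : Type*} [CommRing R] [Algebra ℂ R] {A B : Matrix (Fin 4) (Fin 4) ℂ}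
    (h : B * A = 1) (x : Fin 4 → R) (p : Poly4) :
    aeval (fun i => ∑ j, algebraMap ℂ R (A i j) * x j) (linSubst B p) = aeval x p := by
  rw [linSubst, ← AlgHom.comp_apply]
  congr 1
  ext i
  simp only [AlgHom.comp_apply, aeval_X, map_sum, map_mul, ← algebraMap_eq, AlgHom.commutes]
  simp only [Finset.mul_sum, ← mul_assoc, ← map_mul]
  rw [Finset.sum_comm]
  simp only [← Finset.sum_mul, ← map_sum, ← Matrix.mul_apply, h, Matrix.one_apply]
  simp

theorem linSubst_linSubst {A B : Matrix (Fin 4) (Fin 4) ℂ} (h : B * A = 1) (p : Poly4) :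
    linSubst A (linSubst B p) = p := by
  have := aeval_linSubst h (X : Fin 4 → Poly4) p
  rw [aeval_X_left_apply] at this
  exact this

/-- An invertible linear substitution as an automorphism. -/
noncomputable def linSubstEquiv {A B : Matrix (Fin 4) (Fin 4) ℂ} (hAB : A * B = 1) : Poly4 ≃ₐ[ℂ] Poly4 :=
  AlgEquiv.ofAlgHom (linSubst B) (linSubst A)
    (AlgHom.ext fun p => linSubst_linSubst hAB p)
    (AlgHom.ext fun p => linSubst_linSubst (mul_eq_one_comm.1 hAB) p)

theorem linSubst_isHomogeneous (B : Matrix (Fin 4) (Fin 4) ℂ) {p : Poly4} {d : ℕ}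
    (hp : p.IsHomogeneous d) : (linSubst B p).IsHomogeneous d := by
  have := hp.aeval (fun i => ∑ j, C (B i j) * X j) (n := 1) fun i =>
    IsHomogeneous.sum _ _ _ fun j _ => by
      simpa using (isHomogeneous_C (Fin 4) (B i j)).mul (isHomogeneous_X ℂ j)
  simpa [linSubst] using this

theorem pderiv_linSubst (B : Matrix (Fin 4) (Fin 4) ℂ) (i : Fin 4) (p : Poly4) :
    pderiv i (linSubst B p) = ∑ k, C (B k i) * linSubst B (pderiv k p) := by
  rw [linSubst, derivation_aeval]
  refine Finset.sum_congr rfl fun k _ => ?_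
  rw [mul_comm]
  congr 1
  simp [Pi.single_apply]

theorem eval_linSubst (B : Matrix (Fin 4) (Fin 4) ℂ) (v : Fin 4 → ℂ) (p : Poly4) :
    eval v (linSubst B p) = eval (B.mulVec v) p := by
  have : (aeval v : Poly4 →ₐ[ℂ] ℂ).comp (linSubst B) = aeval (B.mulVec v) := by
    ext i; simp [linSubst, Matrix.mulVec, dotProduct]
  simpa [coe_aeval_eq_eval] using AlgHom.congr_fun this p

/-- Maximal singularities are preserved by linear changes of coordinates. -/
theorem MaxSing.linear {F : Poly4} {M n a : ℕ} {g₁ g₂ : DRing F} {ξ : Fin 4 → Poly4} {ω G π : Poly4}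
    (S : MaxSing F M n a g₁ g₂ ξ ω G π) {A B : Matrix (Fin 4) (Fin 4) ℂ} (hAB : A * B = 1) :
    ∃ (g₁' g₂' : DRing (linSubst B F)) (G' : Poly4),
      MaxSing (linSubst B F) M n a g₁' g₂' (fun i => ∑ j, C (A i j) * ξ j) ω G' π ∧
      g₁'.norm = linSubst B g₁.norm ∧ g₂'.norm = linSubst B g₂.norm := by
  have hBA := mul_eq_one_comm.1 hAB
  have hnorm : ∀ g : DRing F, QuadraticAlgebra.norm (⟨linSubst B g.re, linSubst B g.im⟩ :
      DRing (linSubst B F)) = linSubst B g.norm := by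
    intro g
    rw [QuadraticAlgebra.norm_eq, QuadraticAlgebra.norm_eq]
    simp
  have hev : ∀ p, aeval (fun i => ∑ j, C (A i j) * ξ j) (linSubst B p) = aeval ξ p :=
    aeval_linSubst hBA ξ
  have hhom : ∀ g : DRing F, (DRing.grading S.hF).Hom n g →
      (DRing.grading (linSubst_isHomogeneous B S.hF)).Hom n ⟨linSubst B g.re, linSubst B g.im⟩ := by
    intro g hg
    rw [DRing.hom_iff] at hg ⊢
    obtain ⟨h1, h2⟩ := hg
    refine ⟨linSubst_isHomogeneous B h1, ?_⟩
    rcases h2 with h2 | ⟨k, hk, h2⟩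
    · left; simp [h2]
    · exact Or.inr ⟨k, hk, linSubst_isHomogeneous B h2⟩
  have hsq : ω ^ 2 = aeval (fun i => ∑ j, C (A i j) * ξ j) (linSubst B F) := by rw [hev, S.sq]
  have hΨ : ∀ g : DRing F, DRing.evalHom (fun i => ∑ j, C (A i j) * ξ j) ω hsq
      ⟨linSubst B g.re, linSubst B g.im⟩ = S.Ψ g := by
    intro g
    rw [DRing.evalHom_apply, DRing.evalHom_apply]
    simp only [hev]
  have hdetA : A.det ≠ 0 := by
    intro h
    have := congrArg Matrix.det hAB
    rw [Matrix.det_mul, h, zero_mul, Matrix.det_one] at this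
    exact zero_ne_one this
  refine ⟨⟨linSubst B g₁.re, linSubst B g₁.im⟩, ⟨linSubst B g₂.re, linSubst B g₂.im⟩, C A.det * G,
    { hF := linSubst_isHomogeneous B S.hF
      smooth := ?_
      n_pos := S.n_pos
      M_pos := S.M_pos
      hom_ξ := ?_
      sq := hsq
      det := ?_
      ω_ne_zero := S.ω_ne_zero
      prime := S.prime
      hom_π := S.hom_π
      not_dvd := ?_
      exists_not_dvd := ?_
      hom₁ := hhom _ S.hom₁
      hom₂ := hhom _ S.hom₂
      coprime := ?_
      dvd₁ := by rw [hΨ]; exact S.dvd₁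
      dvd₂ := by rw [hΨ]; exact S.dvd₂ }, hnorm _, hnorm _⟩
  · intro v hv
    have h1 : Matrix.vecMul (fun k => eval (B.mulVec v) (pderiv k F)) B = 0 := by
      funext i
      have := hv i
      rw [pderiv_linSubst, map_sum] at this
      simp only [map_mul, eval_C, eval_linSubst] at this
      simp only [Matrix.vecMul, dotProduct, Pi.zero_apply]
      rw [← this]
      exact Finset.sum_congr rfl fun k _ => mul_comm _ _
    have h2 : (fun k => eval (B.mulVec v) (pderiv k F)) = 0 := by
      have := congrArg (fun z => Matrix.vecMul z A) h1
      simpa [Matrix.vecMul_vecMul, hBA] using this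
    have h3 := S.smooth _ fun i => congrFun h2 i
    have := congrArg (A.mulVec) h3
    simpa [Matrix.mulVec_mulVec, hAB] using this
  · intro i
    exact IsHomogeneous.sum _ _ _ fun j _ => by
      simpa using (isHomogeneous_C (Fin 4) (A i j)).mul (S.hom_ξ j)
  · have : (Matrix.of fun k j => pderiv j (∑ l, C (A k l) * ξ l)) =
        (A.map C : Matrix (Fin 4) (Fin 4) Poly4) * Matrix.of fun k j => pderiv j (ξ k) := by
      ext1 k j
      simp [Matrix.mul_apply, Derivation.leibniz]
    rw [this, Matrix.det_mul, S.det, ← mul_assoc]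
    congr 2
    exact ((C : ℂ →+* Poly4).map_det A).symm
  · intro h
    apply S.not_dvd
    have : IsUnit (C A.det : Poly4) := (IsUnit.mk0 _ hdetA).map C
    exact (this.dvd_mul_left).1 h
  · by_contra! hcon
    obtain ⟨k, hk⟩ := S.exists_not_dvd
    apply hk
    have h1 : ξ k = ∑ i, C (B k i) * ∑ j, C (A i j) * ξ j := by
      have := hev (X k)
      rw [aeval_X, linSubst_X] at this
      rw [← this]
      simp [map_sum, algebraMap_eq]
    rw [h1]
    exact Finset.dvd_sum fun i _ => (hcon i).mul_left _
  · rw [hnorm, hnorm]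
    exact S.coprime.map_ringEquiv (linSubstEquiv hAB).toRingEquiv

/-- A linearly independent family of vectors extends to an invertible matrix. -/
theorem exists_matrix_rows {k : ℕ} (hk : k ≤ 4) (u : Fin k → Fin 4 → ℂ) (hu : LinearIndependent ℂ u)
    (σ : Fin 4 ≃ Fin 4) :
    ∃ A B : Matrix (Fin 4) (Fin 4) ℂ, A * B = 1 ∧ ∀ i, A (σ (Fin.castLE hk i)) = u i := by
  obtain ⟨d, hd⟩ := Nat.exists_eq_add_of_le hk
  induction d generalizing k with
  | zero =>
    obtain rfl : k = 4 := by omega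
    have h1 : IsUnit (Matrix.of u) := Matrix.linearIndependent_rows_iff_isUnit.1 hu
    obtain ⟨B, hB⟩ := h1.exists_right_inv
    refine ⟨(Matrix.of u).submatrix σ.symm id, B.submatrix id σ.symm, ?_, fun i => ?_⟩
    · rw [← Matrix.submatrix_mul _ _ _ id _ Function.bijective_id, hB]
      simp
    · funext j
      simp
  | succ d ih =>
    obtain ⟨x, hx⟩ := exists_linearIndependent_snoc_of_lt_finrank (R := ℂ) (M := Fin 4 → ℂ)
      hu (by simp; omega)
    obtain ⟨A, B, hAB, h⟩ := ih (by omega) _ hx (by omega)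
    refine ⟨A, B, hAB, fun i => ?_⟩
    have := h i.castSucc
    rwa [Fin.snoc_castSucc] at this

/-- A form divides the homogeneous components of its multiples. -/
theorem MvPolynomial.IsHomogeneous.dvd_homogeneousComponent {σ : Type*} {π f : MvPolynomial σ ℂ} {e : ℕ}
    (hπ : π.IsHomogeneous e) (h : π ∣ f) (d : ℕ) : π ∣ homogeneousComponent d f := by
  obtain ⟨g, rfl⟩ := h
  rw [mul_comm, ← grading_comp]
  rcases lt_or_ge d e with hd | hd
  · rw [Coaction.comp_mul_hom_of_lt (grading_hom.2 hπ) hd]; exact dvd_zero _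
  · obtain ⟨k, rfl⟩ := Nat.exists_eq_add_of_le' hd
    rw [Coaction.comp_mul_hom (grading_hom.2 hπ)]; exact dvd_mul_left _ _

theorem MvPolynomial.homogeneousComponent_aeval {σ τ : Type*} {x : σ → MvPolynomial τ ℂ} {M : ℕ} (hM : 0 < M)
    (hx : ∀ i, (x i).IsHomogeneous M) (p : MvPolynomial σ ℂ) (d : ℕ) :
    homogeneousComponent (M * d) (aeval x p) = aeval x (homogeneousComponent d p) := by
  conv_lhs => rw [← sum_homogeneousComponent p, map_sum, map_sum]
  have h1 : ∀ i, homogeneousComponent (M * d) (aeval x (homogeneousComponent i p)) =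
      if i = d then aeval x (homogeneousComponent d p) else 0 := by
    intro i
    have h2 := (homogeneousComponent_isHomogeneous i p).aeval x hx
    rw [homogeneousComponent_of_mem h2]
    by_cases h : i = d
    · subst h; simp
    · rw [if_neg h, if_neg]
      intro h3
      exact h (Nat.eq_of_mul_eq_mul_left hM h3).symm
  simp only [h1, Finset.sum_ite_eq', Finset.mem_range]
  split_ifs with h
  · rfl
  · rw [homogeneousComponent_eq_zero _ _ (by omega), map_zero]

/-- Two algebraically dependent forms of the same degree are proportional. -/
theorem exists_dvd_of_not_algebraicIndependent {x y π : Poly4} {M e : ℕ} (hM : 0 < M)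
    (hx : x.IsHomogeneous M) (hy : y.IsHomogeneous M) (hπ : Prime π) (hπe : π.IsHomogeneous e)
    (h : ¬ AlgebraicIndependent ℂ ![Ideal.Quotient.mkₐ ℂ (Ideal.span {π}) x,
      Ideal.Quotient.mkₐ ℂ (Ideal.span {π}) y]) (hy0 : ¬ π ∣ y) :
    ∃ c : ℂ, π ∣ x - C c * y := by
  have hpr : (Ideal.span {π}).IsPrime := (Ideal.span_singleton_prime hπ.ne_zero).2 hπ
  let κ := Ideal.Quotient.mkₐ ℂ (Ideal.span {π})
  have hκ : ∀ p, κ p = 0 ↔ π ∣ p := fun p => Ideal.Quotient.eq_zero_iff_dvd _ _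
  rw [algebraicIndependent_iff] at h
  push Not at h
  obtain ⟨Φ, hΦ, hΦ0⟩ := h
  obtain ⟨d, hd⟩ : ∃ d, homogeneousComponent d Φ ≠ 0 := by
    by_contra! hcon
    apply hΦ0
    rw [← sum_homogeneousComponent Φ]
    exact Finset.sum_eq_zero fun i _ => hcon i
  set p := homogeneousComponent d Φ with hp
  have hph : p.IsHomogeneous d := homogeneousComponent_isHomogeneous d Φ
  have hxy : ∀ i, (![x, y] i).IsHomogeneous M := by intro i; fin_cases i <;> assumption
  have hcomp : ∀ q : Poly2, aeval ![κ x, κ y] q = κ (aeval ![x, y] q) := by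
    intro q
    have h1 := comp_aeval_apply ![x, y] κ q
    rw [h1]
    congr 2
    funext i; fin_cases i <;> rfl
  have h1 : π ∣ aeval ![x, y] p := by
    rw [hp, ← homogeneousComponent_aeval hM hxy]
    apply hπe.dvd_homogeneousComponent
    rw [← hκ, ← hcomp]
    exact hΦ
  let L := FractionRing (Poly4 ⧸ Ideal.span {π})
  let ι : (Poly4 ⧸ Ideal.span {π}) →ₐ[ℂ] L := IsScalarTower.toAlgHom ℂ _ _
  have hι : Function.Injective ι := IsFractionRing.injective _ L
  have hy1 : ι (κ y) ≠ 0 := fun h => hy0 ((hκ y).1 (hι (h.trans (map_zero ι).symm)))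
  let r : L := ι (κ x) / ι (κ y)
  let f : Polynomial ℂ := aeval ![Polynomial.X, 1] p
  have hf0 : f ≠ 0 := by
    intro hf
    have h2 : X 1 * p = 0 := by
      apply MvPolynomial.funext
      intro v
      rw [map_mul, eval_X, map_zero]
      by_cases hv : v 1 = 0
      · rw [hv, zero_mul]
      · have h3 := aeval_mul_of_isHomogeneous hph ![v 0 / v 1, 1] (v 1)
        have h4 : (fun i => ![v 0 / v 1, 1] i * v 1) = v := by
          funext i; fin_cases i
          · simp [div_mul_cancel₀ _ hv]
          · simp
        have h5 : aeval ![v 0 / v 1, 1] p = Polynomial.aeval (v 0 / v 1) f := by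
          have := comp_aeval_apply ![Polynomial.X, (1 : Polynomial ℂ)] (Polynomial.aeval (v 0 / v 1)) p
          rw [this]
          congr 2
          funext i; fin_cases i <;> simp
        rw [h4, h5, hf, map_zero, zero_mul] at h3
        exact mul_eq_zero_of_right _ h3
    exact hd ((mul_eq_zero.1 h2).resolve_left (X_ne_zero 1))
  have hfr : Polynomial.aeval r f = 0 := by
    have h3 := aeval_mul_of_isHomogeneous hph ![r, 1] (ι (κ y))
    have h4 : (fun i => ![r, 1] i * ι (κ y)) = fun i => ι (![κ x, κ y] i) := by
      funext i; fin_cases i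
      · simp [r, div_mul_cancel₀ _ hy1]
      · simp
    rw [h4, ← comp_aeval_apply, hcomp, (hκ _).2 h1, map_zero, zero_eq_mul] at h3
    have h5 := h3.resolve_right (pow_ne_zero _ hy1)
    rw [← h5]
    have := comp_aeval_apply ![Polynomial.X, (1 : Polynomial ℂ)] (Polynomial.aeval r) p
    rw [this]
    congr 2
    funext i; fin_cases i <;> simp
  have hralg : IsAlgebraic ℂ r := ⟨f, hf0, hfr⟩
  obtain ⟨c, hc⟩ : ∃ c : ℂ, algebraMap ℂ L c = r := by
    have h5 := IsAlgClosed.degree_eq_one_of_irreducible ℂ (minpoly.irreducible hralg.isIntegral)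
    exact minpoly.mem_range_of_degree_eq_one ℂ r h5
  refine ⟨c, ?_⟩
  rw [← hκ]
  apply hι
  rw [map_zero, map_sub, map_sub, map_mul, map_mul, ← algebraMap_eq, AlgHom.commutes, AlgHom.commutes, hc,
    sub_eq_zero, div_mul_cancel₀ _ hy1]

/-- Adjoining a variable preserves algebraic independence. -/
theorem AlgebraicIndependent.cons_X {B : Type*} [CommRing B] [Algebra ℂ B] {m : ℕ} {z : Fin m → B}
    (hz : AlgebraicIndependent ℂ z) :
    AlgebraicIndependent ℂ (Fin.cons Polynomial.X (fun i => Polynomial.C (z i)) : Fin (m + 1) → Polynomial B) := by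
  have h : (aeval (Fin.cons Polynomial.X (fun i => Polynomial.C (z i)) : Fin (m + 1) → Polynomial B)) =
      (Polynomial.mapAlgHom (aeval z)).comp (finSuccEquiv ℂ m).toAlgHom := by
    ext1 i
    refine Fin.cases ?_ (fun j => ?_) i
    · simp [finSuccEquiv_X_zero]
    · simp [finSuccEquiv_X_succ]
  show Function.Injective _
  rw [h, AlgHom.coe_comp]
  exact (Polynomial.map_injective _ hz).comp (finSuccEquiv ℂ m).injective

theorem eval_single_of_isHomogeneous {h : Poly4} {d : ℕ} (hh : h.IsHomogeneous d) :
    eval (Pi.single 0 1) h = coeff (Finsupp.single 0 d) h := by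
  rw [eval_eq', Finset.sum_eq_single (Finsupp.single 0 d)]
  · rw [Fin.prod_univ_four]; simp
  · intro m hm hne
    have hdeg : m.degree = d := by
      by_contra hc
      exact (mem_support_iff.1 hm) (hh.coeff_eq_zero hc)
    obtain ⟨j, hj, hj0⟩ : ∃ j, j ≠ 0 ∧ m j ≠ 0 := by
      by_contra! hcon
      apply hne
      ext j
      by_cases hj : j = 0
      · subst hj
        rw [Finsupp.single_eq_same, ← hdeg, Finsupp.degree_eq_sum, Fin.sum_univ_four, hcon 1 (by decide),
          hcon 2 (by decide), hcon 3 (by decide)]; rfl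
      · rw [hcon j hj, Finsupp.single_eq_of_ne hj]
    apply mul_eq_zero_of_right
    exact Finset.prod_eq_zero (Finset.mem_univ j) (by simp [hj, hj0])
  · intro hm
    rw [notMem_support_iff.1 hm, zero_mul]

theorem support_lt_of_diffPow {I : Ideal Poly4} (hI : ∀ p ∈ I, eval (Pi.single 0 1) p = 0) {d k : ℕ} {h : Poly4}
    (hh : h.IsHomogeneous d) (hd : DiffPow pderiv I (k + 1) h) {m : Fin 4 →₀ ℕ} (hm : m ∈ h.support) :
    m 0 + k < d := by
  have hdeg : ∀ {h : Poly4} {d : ℕ} {m : Fin 4 →₀ ℕ}, h.IsHomogeneous d → m ∈ h.support → m.degree = d := by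
    intro h d m hh hm
    by_contra hc
    exact (mem_support_iff.1 hm) (hh.coeff_eq_zero hc)
  induction k generalizing h d m with
  | zero =>
    have h1 := hdeg hh hm
    rw [Finsupp.degree_eq_sum, Fin.sum_univ_four] at h1
    by_contra hcon
    have h2 : m = Finsupp.single 0 d := by
      ext j; fin_cases j <;> simp <;> omega
    have := hI _ hd.1
    rw [eval_single_of_isHomogeneous hh, ← h2] at this
    exact mem_support_iff.1 hm this
  | succ k ih =>
    have h0 := ih hh hd.of_succ hm
    have h1 := hdeg hh hm
    obtain ⟨j, hj, hj0⟩ : ∃ j, j ≠ 0 ∧ m j ≠ 0 := by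
      by_contra! hcon
      rw [Finsupp.degree_eq_sum, Fin.sum_univ_four, hcon 1 (by decide), hcon 2 (by decide),
        hcon 3 (by decide)] at h1
      omega
    have hle : Finsupp.single j 1 ≤ m := by
      rw [Finsupp.single_le_iff]; omega
    have h2 : m - Finsupp.single j 1 ∈ (pderiv j h).support := by
      rw [mem_support_iff, coeff_pderiv, tsub_add_cancel_of_le hle]
      exact mul_ne_zero (mem_support_iff.1 hm) (Nat.cast_add_one_ne_zero _)
    have h3 := ih hh.pderiv (hd.2 j) h2
    rw [Finsupp.tsub_apply, Finsupp.single_eq_of_ne hj.symm] at h3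
    omega

theorem DRing.Hom.norm {F : Poly4} (hF : F.IsHomogeneous 6) {n : ℕ} {g : DRing F}
    (hg : (DRing.grading hF).Hom n g) : g.norm.IsHomogeneous (2 * n) := by
  rw [DRing.hom_iff] at hg
  obtain ⟨h1, h2⟩ := hg
  rw [QuadraticAlgebra.norm_eq]
  refine IsHomogeneous.sub (by simpa [mul_comm] using h1.pow 2) ?_
  rcases h2 with h2 | ⟨k, rfl, h2⟩
  · simp [h2, isHomogeneous_zero]
  · rw [show 2 * (k + 3) = 6 + k * 2 by ring]
    exact hF.mul (h2.pow 2)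

/-- A form vanishing to high order at `ξ` and at the vertex `e₀` vanishes on the cone. -/
theorem aeval_cons_eq_zero {B : Type*} [CommRing B] [IsDomain B] [Algebra ℂ B] [CharZero B] {I : Ideal Poly4}
    (hI : ∀ p ∈ I, eval (Pi.single 0 1) p = 0) (z : Fin 4 → B) (hz : ∀ p ∈ I, aeval z p = 0) {n : ℕ} {h : Poly4}
    (hh : h.IsHomogeneous (2 * n)) (hd : DiffPow pderiv I (n + 1) h) :
    aeval (Fin.cons Polynomial.X (fun i => Polynomial.C (z i.succ)) : Fin 4 → Polynomial B) h = 0 := by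
  classical
  set y : Fin 4 → Polynomial B := Fin.cons Polynomial.X (fun i => Polynomial.C (z i.succ)) with hy
  by_contra hne
  have hder : ∀ p : Poly4, Polynomial.derivative (aeval y p) = aeval y (pderiv 0 p) := by
    intro p
    have h1 := derivation_aeval ((Polynomial.derivative' (R := B)).restrictScalars ℂ) y p
    rw [Fin.sum_univ_succ] at h1
    simpa [hy] using h1
  have hiter : ∀ m, ∀ p : Poly4, (Polynomial.derivative^[m]) (aeval y p) = aeval y ((pderiv 0)^[m] p) := by
    intro m
    induction m with
    | zero => intro p; rfl
    | succ m ih => intro p; rw [Function.iterate_succ_apply, hder, ih, Function.iterate_succ_apply]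
  have hev : ∀ p : Poly4, (aeval y p).eval (z 0) = aeval z p := by
    intro p
    have := comp_aeval_apply y ((Polynomial.aeval (z 0)).restrictScalars ℂ : Polynomial B →ₐ[ℂ] B) p
    simp only [AlgHom.restrictScalars_apply, Polynomial.coe_aeval_eq_eval] at this
    rw [this]
    congr 2
    funext i
    refine Fin.cases ?_ (fun j => ?_) i <;> simp [hy]
  have hmem : ∀ m, ∀ p : Poly4, ∀ k, DiffPow pderiv I (k + m + 1) p → (pderiv 0)^[m] p ∈ I := by
    intro m
    induction m with
    | zero => intro p k h; exact h.1
    | succ m ih => intro p k h; exact ih _ k (h.2 0)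
  have hroot : n < (aeval y h).rootMultiplicity (z 0) := by
    rw [Polynomial.lt_rootMultiplicity_iff_isRoot_iterate_derivative hne]
    intro m hm
    obtain ⟨k, rfl⟩ := Nat.exists_eq_add_of_le' hm
    rw [Polynomial.IsRoot, hiter, hev]
    exact hz _ (hmem m h k hd)
  have hdeg : (aeval y h).natDegree ≤ n := by
    rw [aeval_def, eval₂_eq']
    refine Polynomial.natDegree_sum_le_of_forall_le _ _ fun m hm => ?_
    have h1 := support_lt_of_diffPow hI hh hd hm
    rw [Fin.prod_univ_succ, IsScalarTower.algebraMap_apply ℂ B (Polynomial B), Polynomial.algebraMap_eq]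
    refine (Polynomial.natDegree_C_mul_le _ _).trans ?_
    simp only [hy, Fin.cons_zero, Fin.cons_succ, ← Polynomial.C_pow]
    rw [← map_prod, mul_comm]
    refine (Polynomial.natDegree_C_mul_le _ _).trans ?_
    rw [Polynomial.natDegree_X_pow]
    omega
  have := (Multiset.count_le_card (z 0) (aeval y h).roots).trans (Polynomial.card_roots' _)
  rw [Polynomial.count_roots] at this
  omega

namespace MaxSing
variable {F : Poly4} {M n a : ℕ} {g₁ g₂ : DRing F} {ξ : Fin 4 → Poly4} {ω G π : Poly4}
  (S : MaxSing F M n a g₁ g₂ ξ ω G π)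

theorem exists_point (S : MaxSing F M n a g₁ g₂ ξ ω G π) :
    ∃ b : Fin 4 → ℂ, b ≠ 0 ∧ ∀ p : Poly4, π ∣ aeval ξ p → eval b p = 0 := by
  by_contra! hcon
  obtain ⟨k, hk⟩ := S.exists_X_not_mem
  have h1 := DRing.exists_pow_mem_of_forall_point S.Q (fun a b hab ha => by
    obtain ⟨p, hp, hp0⟩ := hcon a ha
    refine ⟨DRing.inc F p, S.mem_Q.2 (by simpa using hp), ?_⟩
    rw [DRing.evalHom_inc]
    exact hp0) k
  obtain ⟨m, hm⟩ := h1
  exact hk (S.isPrime_Q.mem_of_pow_mem m hm)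

theorem aeval_cons_norm (S : MaxSing F M n a g₁ g₂ ξ ω G π) {B : Type} [CommRing B] [IsDomain B]
    [Algebra ℂ B] [CharZero B] (κ : Poly4 →ₐ[ℂ] B) (hκ : ∀ p, π ∣ p → κ p = 0)
    (h0 : ∀ p : Poly4, π ∣ aeval ξ p → eval (Pi.single 0 1) p = 0) {g : DRing F}
    (hg : (DRing.grading S.hF).Hom n g) (hgd : π ^ (n * a + 1) ∣ S.Ψ g) :
    aeval (Fin.cons Polynomial.X (fun i => Polynomial.C (κ (ξ (Fin.succ i)))) :
        Fin 4 → Polynomial B) g.norm = 0 := by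
  have hmem : ∀ p, p ∈ S.Q.comap (DRing.inc F) → π ∣ aeval ξ p := fun p hp => by
    simpa using S.mem_Q.1 hp
  refine aeval_cons_eq_zero (I := S.Q.comap (DRing.inc F)) (fun p hp => h0 p (hmem p hp))
    (fun i => κ (ξ i)) (fun p hp => ?_) (DRing.Hom.norm S.hF hg) (S.diffPow_norm hgd)
  rw [← comp_aeval_apply]
  exact hκ _ (hmem p hp)

theorem not_algebraicIndependent_pair (S : MaxSing F M n a g₁ g₂ ξ ω G π) {B : Type} [CommRing B] [IsDomain B]
    [Algebra ℂ B] [CharZero B] (κ : Poly4 →ₐ[ℂ] B) (hκ : ∀ p, π ∣ p → κ p = 0)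
    (h0 : ∀ p : Poly4, π ∣ aeval ξ p → eval (Pi.single 0 1) p = 0) (j : Fin 3) :
    ¬ AlgebraicIndependent ℂ ![κ (ξ (j.succAbove 0).succ), κ (ξ (j.succAbove 1).succ)] := by
  intro hind
  have h1 := not_algebraicIndependent_succAbove j.succ _ S.coprime
    (S.aeval_cons_norm κ hκ h0 S.hom₁ S.dvd₁) (S.aeval_cons_norm κ hκ h0 S.hom₂ S.dvd₂)
  apply h1
  have h2 := hind.cons_X
  convert h2 using 1
  funext i
  refine Fin.cases ?_ (fun l => ?_) i
  · simp
  · simp only [Function.comp_apply, Fin.succ_succAbove_succ, Fin.cons_succ]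
    fin_cases l <;> rfl

/-- If the vertex `e₀` lies on the cone over the centre, then the other three coordinates are pairwise
proportional. -/
theorem exists_dvd_sub (S : MaxSing F M n a g₁ g₂ ξ ω G π)
    (h0 : ∀ p : Poly4, π ∣ aeval ξ p → eval (Pi.single 0 1) p = 0) (j : Fin 3)
    (hy : ¬ π ∣ ξ (j.succAbove 1).succ) :
    ∃ c : ℂ, π ∣ ξ (j.succAbove 0).succ - C c * ξ (j.succAbove 1).succ := by
  have hpr := S.isPrime_span
  have hchar : CharZero (Poly4 ⧸ Ideal.span {π}) := algebraRat.charZero _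
  obtain ⟨e, he⟩ := S.hom_π
  exact exists_dvd_of_not_algebraicIndependent S.M_pos (S.hom_ξ _) (S.hom_ξ _) S.prime he
    (S.not_algebraicIndependent_pair (Ideal.Quotient.mkₐ ℂ (Ideal.span {π}))
      (fun p hp => (Ideal.Quotient.eq_zero_iff_dvd _ _).2 hp) h0 j) hy

/-- After a linear change of coordinates, the centre lies on the line `X₂ = X₃ = 0`. -/
theorem exists_linear_dvd (S : MaxSing F M n a g₁ g₂ ξ ω G π) :
    ∃ u : Fin 2 → Fin 4 → ℂ, LinearIndependent ℂ u ∧ ∀ i, π ∣ ∑ j, C (u i j) * ξ j := by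
  have key : ∀ {F : Poly4} {g₁ g₂ : DRing F} {ξ : Fin 4 → Poly4} {G : Poly4}
      (S : MaxSing F M n a g₁ g₂ ξ ω G π) (h0 : ∀ p : Poly4, π ∣ aeval ξ p → eval (Pi.single 0 1) p = 0),
      ∃ u : Fin 2 → Fin 4 → ℂ, LinearIndependent ℂ u ∧ ∀ i, π ∣ ∑ j, C (u i j) * ξ j := by
    intro F g₁ g₂ ξ G S h0
    have h := S.exists_dvd_sub h0
    have h10 := h 0
    have h11 := h 1
    have h12 := h 2
    simp only [show (0 : Fin 3).succAbove 0 = 1 from rfl, show (0 : Fin 3).succAbove 1 = 2 from rfl,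
      show (1 : Fin 3).succAbove 0 = 0 from rfl, show (1 : Fin 3).succAbove 1 = 2 from rfl,
      show (2 : Fin 3).succAbove 0 = 0 from rfl, show (2 : Fin 3).succAbove 1 = 1 from rfl,
      show (0 : Fin 3).succ = 1 from rfl, show (1 : Fin 3).succ = 2 from rfl,
      show (2 : Fin 3).succ = 3 from rfl] at h10 h11 h12
    have hsum : ∀ c₀ c₁ c₂ c₃ : ℂ, ∑ j, C (![c₀, c₁, c₂, c₃] j) * ξ j =
        C c₀ * ξ 0 + C c₁ * ξ 1 + C c₂ * ξ 2 + C c₃ * ξ 3 := fun _ _ _ _ => Fin.sum_univ_four _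
    by_cases h3 : π ∣ ξ 3
    · by_cases h2 : π ∣ ξ 2
      · refine ⟨![![0, 0, 1, 0], ![0, 0, 0, 1]], ?_, ?_⟩
        · rw [LinearIndependent.pair_iff]
          intro s t hst
          have e2 := congrFun hst 2
          have e3 := congrFun hst 3
          simp at e2 e3
          exact ⟨e2, e3⟩
        · intro i; fin_cases i
          · exact (hsum 0 0 1 0) ▸ (by simpa using h2)
          · exact (hsum 0 0 0 1) ▸ (by simpa using h3)
      · obtain ⟨c, hc⟩ := h12 h2
        refine ⟨![![0, 1, -c, 0], ![0, 0, 0, 1]], ?_, ?_⟩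
        · rw [LinearIndependent.pair_iff]
          intro s t hst
          have e2 := congrFun hst 1
          have e3 := congrFun hst 3
          simp at e2 e3
          exact ⟨e2, e3⟩
        · intro i; fin_cases i
          · refine (hsum 0 1 (-c) 0) ▸ ?_
            convert hc using 1
            simp; ring
          · exact (hsum 0 0 0 1) ▸ (by simpa using h3)
    · obtain ⟨c, hc⟩ := h10 h3
      obtain ⟨c', hc'⟩ := h11 h3
      refine ⟨![![0, 0, 1, -c], ![0, 1, 0, -c']], ?_, ?_⟩
      · rw [LinearIndependent.pair_iff]
        intro s t hst
        have e2 := congrFun hst 2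
        have e3 := congrFun hst 1
        simp at e2 e3
        exact ⟨e2, e3⟩
      · intro i; fin_cases i
        · refine (hsum 0 0 1 (-c)) ▸ ?_
          convert hc using 1
          simp; ring
        · refine (hsum 0 1 0 (-c')) ▸ ?_
          convert hc' using 1
          simp; ring
  obtain ⟨b, hb, h0⟩ := S.exists_point
  have hbind : LinearIndependent ℂ (fun _ : Fin 1 => b) := LinearIndependent.of_subsingleton 0 hb
  obtain ⟨A, B, hAB, hA⟩ := exists_matrix_rows (by norm_num) _ hbind (Equiv.refl _)
  have hBA := mul_eq_one_comm.1 hAB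
  have hAB' : B.transpose * A.transpose = 1 := by rw [← Matrix.transpose_mul, hAB, Matrix.transpose_one]
  have hA0 : A 0 = b := hA 0
  obtain ⟨g₁', g₂', G', S', -, -⟩ := S.linear hAB'
  have hcol : A.transpose.mulVec (Pi.single 0 1) = b := by
    rw [Matrix.mulVec_single_one]; exact hA0
  obtain ⟨u, hu, hdvd⟩ := key S' (fun p hp => by
    obtain ⟨q, rfl⟩ : ∃ q, linSubst A.transpose q = p :=
      ⟨linSubst B.transpose p, linSubst_linSubst hAB' p⟩
    rw [eval_linSubst, hcol]
    apply h0
    have := aeval_linSubst (mul_eq_one_comm.1 hAB') ξ q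
    rw [← this]
    exact hp)
  refine ⟨fun i => Matrix.vecMul (u i) B.transpose, ?_, fun i => ?_⟩
  · have hinj : Function.Injective (Matrix.vecMulLinear B.transpose) := by
      intro v w hvw
      have := congrArg (fun z => Matrix.vecMul z A.transpose) hvw
      simpa only [Matrix.vecMulLinear_apply, Matrix.vecMul_vecMul, hAB', Matrix.vecMul_one] using this
    exact hu.map' (Matrix.vecMulLinear B.transpose) (LinearMap.ker_eq_bot.2 hinj)
  · convert hdvd i using 1
    simp only [Matrix.vecMul, dotProduct, Finset.mul_sum, map_sum, map_mul, Finset.sum_mul, mul_assoc]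
    rw [Finset.sum_comm]

end MaxSing

/-- The derivation `F₃∂₂ - F₂∂₃`, which kills `W`. -/
noncomputable def DRing.Hkill {F : Poly4} : Derivation ℂ (DRing F) (DRing F) :=
  Derivation.mk'
    { toFun := fun r => ⟨pderiv 3 F * pderiv 2 r.re - pderiv 2 F * pderiv 3 r.re,
        pderiv 3 F * pderiv 2 r.im - pderiv 2 F * pderiv 3 r.im⟩
      map_add' := fun r s => by ext1 <;> simp <;> ring
      map_smul' := fun c r => by ext1 <;> simp [smul_sub] }
    fun r s => by
      ext1 <;> simp [Derivation.leibniz] <;> ring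

theorem DRing.Hkill_re {F : Poly4} (r : DRing F) :
    (Hkill r).re = pderiv 3 F * pderiv 2 r.re - pderiv 2 F * pderiv 3 r.re := rfl

theorem DRing.Hkill_im {F : Poly4} (r : DRing F) :
    (Hkill r).im = pderiv 3 F * pderiv 2 r.im - pderiv 2 F * pderiv 3 r.im := rfl

theorem DRing.two_W_mul_Hkill {F : Poly4} (r : DRing F) :
    2 * W F * Hkill r = inc F (pderiv 3 F) * H 2 r - inc F (pderiv 2 F) * H 3 r := by
  ext1 <;> simp [H, Hkill_re, Hkill_im, QuadraticAlgebra.re_ofNat, QuadraticAlgebra.im_ofNat] <;> ring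

/-- Derivations transverse to the line `X₂ = X₃ = 0`. -/
noncomputable def DRing.transverse {F : Poly4} : Fin 3 → Derivation ℂ (DRing F) (DRing F) :=
  ![Hd 2, Hd 3, Hkill]

theorem det_of_two_rows {A : Type*} [CommRing A] (c f : Fin 4 → A) :
    Matrix.det ![![1, 0, 0, 0], ![0, 1, 0, 0], c, f] = c 2 * f 3 - c 3 * f 2 := by
  have : Matrix.det (Matrix.of ![![1, 0, 0, 0], ![0, 1, 0, 0], c, f]) = c 2 * f 3 - c 3 * f 2 := by
    rw [Matrix.det_succ_row_zero]
    simp [Fin.sum_univ_succ, Matrix.det_fin_three]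
  exact this

namespace MaxSing
variable {F : Poly4} {M n a : ℕ} {g₁ g₂ : DRing F} {ξ : Fin 4 → Poly4} {ω G π : Poly4}
  (S : MaxSing F M n a g₁ g₂ ξ ω G π)

theorem two_det_kill (r : DRing F) :
    2 * (Matrix.of fun l j => pderiv j ((![ξ 0, ξ 1, S.Ψ r, ω] : Fin 4 → Poly4) l)).det =
      G * S.Ψ (DRing.Hkill r) := by
  let A : Matrix (Fin 4) (Fin 4) Poly4 := Matrix.of fun k j => pderiv j (ξ k)
  let c : Fin 4 → Poly4 := fun k => S.Ψ (DRing.H k r)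
  let f : Fin 4 → Poly4 := fun k => aeval ξ (pderiv k F)
  let N : Matrix (Fin 4) (Fin 4) Poly4 := ![![1, 0, 0, 0], ![0, 1, 0, 0], c, f]
  let D : Matrix (Fin 4) (Fin 4) Poly4 := ![![1, 0, 0, 0], ![0, 1, 0, 0], ![0, 0, 2 * ω, 0], ![0, 0, 0, 2 * ω]]
  have hf : ∀ j, 2 * ω * pderiv j ω = ∑ k, f k * pderiv j (ξ k) := S.two_ω_mul_pderiv
  have hc : ∀ j, 2 * ω * pderiv j (S.Ψ r) = ∑ k, c k * pderiv j (ξ k) := S.two_ω_smul_row r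
  have hmul : D * (Matrix.of fun l j => pderiv j ((![ξ 0, ξ 1, S.Ψ r, ω] : Fin 4 → Poly4) l)) = N * A := by
    refine Matrix.ext fun l j => ?_
    have h1 := hf j
    have h2 := hc j
    rw [Fin.sum_univ_four] at h1 h2
    rw [Matrix.mul_apply, Matrix.mul_apply, Fin.sum_univ_four, Fin.sum_univ_four]
    fin_cases l
    · simp [D, N, A]
    · simp [D, N, A]
    · simpa [D, N, A] using h2
    · simpa [D, N, A] using h1
  have hN : N.det = c 2 * f 3 - c 3 * f 2 := det_of_two_rows c f
  have hD : D.det = 4 * ω ^ 2 := (det_of_two_rows _ _).trans (by simp; ring)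
  have hdet := congrArg Matrix.det hmul
  rw [Matrix.det_mul, Matrix.det_mul, hN, hD, S.det] at hdet
  have hkill : 2 * ω * S.Ψ (DRing.Hkill r) = c 2 * f 3 - c 3 * f 2 := by
    have := congrArg S.Ψ (DRing.two_W_mul_Hkill r)
    simp only [map_mul, map_sub, DRing.evalHom_W, DRing.evalHom_inc, map_ofNat] at this
    rw [this]; ring
  rw [← hkill] at hdet
  apply mul_left_cancel₀ (pow_ne_zero 2 S.ω_ne_zero)
  apply mul_left_cancel₀ (two_ne_zero (α := Poly4))
  linear_combination hdet

theorem pow_dvd_kill {k : ℕ} {r : DRing F} (h : π ^ (k + a) ∣ S.Ψ r) :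
    π ^ k ∣ S.Ψ (DRing.Hkill r) := by
  refine S.prime.pow_dvd_of_pow_add_dvd_mul S.not_dvd ?_
  rw [← S.two_det_kill]
  refine Dvd.dvd.mul_left (pow_dvd_jacobian S.prime _ 2 h ?_) _
  have h1 := S.not_algebraicIndependent ![DRing.inc F (X 0), DRing.inc F (X 1), DRing.W F]
  convert h1 using 3 with j
  fin_cases j
  · simp [Fin.succAbove]
  · simp [Fin.succAbove]
  · simp [Fin.succAbove]

theorem diffPow_transverse {k : ℕ} {r : DRing F} (h : π ^ (k * a + 1) ∣ S.Ψ r) :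
    DiffPow DRing.transverse S.Q (k + 1) r := by
  induction k generalizing r with
  | zero => exact ⟨S.mem_Q.2 (by simpa using h), fun _ => trivial⟩
  | succ k ih =>
    have h' : π ^ (k * a + 1 + a) ∣ S.Ψ r := by rwa [show k * a + 1 + a = (k + 1) * a + 1 by ring]
    refine ⟨S.mem_Q.2 ((dvd_pow_self π (Nat.succ_ne_zero _)).trans h), fun i => ih ?_⟩
    fin_cases i
    · exact S.pow_dvd_H h'
    · exact S.pow_dvd_H h'
    · exact S.pow_dvd_kill h'

end MaxSing

section
variable {R ι : Type*} [CommRing R] [Algebra ℂ R] {δ : ι → Derivation ℂ R R} {Q : Ideal R}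
  {i₁ i₂ : ι} {u₁ u₂ σ : R}

theorem euler_mem_sq_of_span {s : Set R} (hs : Q = Ideal.span s) (h₁ : u₁ ∈ Q) (h₂ : u₂ ∈ Q)
    (h : ∀ y ∈ s, u₁ * δ i₁ y + u₂ * δ i₂ y - σ * y ∈ Q ^ 2) {y : R} (hy : y ∈ Q) :
    u₁ * δ i₁ y + u₂ * δ i₂ y - σ * y ∈ Q ^ 2 := by
  have hle : Ideal.span s ≤ Q := hs ▸ le_rfl
  have key : y ∈ Q ∧ u₁ * δ i₁ y + u₂ * δ i₂ y - σ * y ∈ Q ^ 2 := by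
    rw [hs] at hy
    induction hy using Submodule.span_induction with
    | mem y hy => exact ⟨hle (Ideal.subset_span hy), h y hy⟩
    | zero => simp
    | add x y _ _ hx hy =>
      refine ⟨Q.add_mem hx.1 hy.1, ?_⟩
      rw [map_add, map_add]
      convert (Q ^ 2).add_mem hx.2 hy.2 using 1
      ring
    | smul c y _ hy =>
      refine ⟨Q.mul_mem_left _ hy.1, ?_⟩
      rw [smul_eq_mul, Derivation.leibniz, Derivation.leibniz]
      simp only [smul_eq_mul]
      have h3 : (u₁ * δ i₁ c + u₂ * δ i₂ c) * y ∈ Q ^ 2 := by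
        rw [pow_two]
        exact Ideal.mul_mem_mul (Q.add_mem (Q.mul_mem_right _ h₁) (Q.mul_mem_right _ h₂)) hy.1
      convert (Q ^ 2).add_mem ((Q ^ 2).mul_mem_left c hy.2) h3 using 1
      ring
  exact key.2

theorem euler_mem_pow (hE : ∀ y ∈ Q, u₁ * δ i₁ y + u₂ * δ i₂ y - σ * y ∈ Q ^ 2) {m : ℕ} {x : R}
    (hx : x ∈ Q ^ m) (h₁ : u₁ ∈ Q) (h₂ : u₂ ∈ Q) :
    u₁ * δ i₁ x + u₂ * δ i₂ x - m * σ * x ∈ Q ^ (m + 1) := by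
  induction m generalizing x with
  | zero =>
    rw [zero_add, pow_one, Nat.cast_zero, zero_mul, zero_mul, sub_zero]
    exact Q.add_mem (Q.mul_mem_right _ h₁) (Q.mul_mem_right _ h₂)
  | succ m ih =>
    rw [pow_succ] at hx
    induction hx using Submodule.mul_induction_on' with
    | mem_mul_mem b hb c hc =>
      rw [Derivation.leibniz, Derivation.leibniz]
      simp only [smul_eq_mul]
      have h3 : b * (u₁ * δ i₁ c + u₂ * δ i₂ c - σ * c) ∈ Q ^ (m + 1 + 1) := by
        rw [show m + 1 + 1 = m + 2 from rfl, pow_add]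
        exact Ideal.mul_mem_mul hb (hE c hc)
      have h4 : (u₁ * δ i₁ b + u₂ * δ i₂ b - m * σ * b) * c ∈ Q ^ (m + 1 + 1) := by
        rw [pow_succ]
        exact Ideal.mul_mem_mul (ih hb) hc
      convert Ideal.add_mem _ h3 h4 using 1
      push_cast
      ring
    | add x _ y _ hx hy =>
      rw [map_add, map_add]
      convert Ideal.add_mem _ hx hy using 1
      ring

/-- Vanishing of derivatives up to a given order implies membership in the power of the ideal, up to a factor. -/
theorem DiffPow.exists_pow_mul_mem (hE : ∀ y ∈ Q, u₁ * δ i₁ y + u₂ * δ i₂ y - σ * y ∈ Q ^ 2) (h₁ : u₁ ∈ Q)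
    (h₂ : u₂ ∈ Q) {m : ℕ} {r : R} (hr : DiffPow δ Q m r) : ∃ k, σ ^ k * r ∈ Q ^ m := by
  induction m generalizing r with
  | zero => exact ⟨0, by simp⟩
  | succ m ih =>
    rcases Nat.eq_zero_or_pos m with rfl | hm
    · exact ⟨0, by simpa using hr.1⟩
    obtain ⟨k, hk⟩ := ih hr.of_succ
    have hx := hr.mul_left (σ ^ k)
    obtain ⟨k₁, hk₁⟩ := ih (hx.2 i₁)
    obtain ⟨k₂, hk₂⟩ := ih (hx.2 i₂)
    have hEx := euler_mem_pow hE hk h₁ h₂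
    set x := σ ^ k * r with hxdef
    have hEx1 : σ ^ (k₁ + k₂) * (u₁ * δ i₁ x + u₂ * δ i₂ x) ∈ Q ^ (m + 1) := by
      have e1 : u₁ * (σ ^ k₁ * δ i₁ x) ∈ Q ^ (m + 1) := by
        rw [pow_succ']; exact Ideal.mul_mem_mul h₁ hk₁
      have e2 : u₂ * (σ ^ k₂ * δ i₂ x) ∈ Q ^ (m + 1) := by
        rw [pow_succ']; exact Ideal.mul_mem_mul h₂ hk₂
      convert Ideal.add_mem _ (Ideal.mul_mem_left _ (σ ^ k₂) e1) (Ideal.mul_mem_left _ (σ ^ k₁) e2) using 1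
      ring
    refine ⟨k₁ + k₂ + 1 + k, ?_⟩
    have h5 := Ideal.sub_mem _ hEx1 (Ideal.mul_mem_left _ (σ ^ (k₁ + k₂)) hEx)
    have h6 := Ideal.mul_mem_left _ (algebraMap ℂ R ((m : ℂ)⁻¹)) h5
    have hm1 : algebraMap ℂ R ((m : ℂ)⁻¹) * (m : R) = 1 := by
      rw [← map_natCast (algebraMap ℂ R) m, ← map_mul, inv_mul_cancel₀ (by exact_mod_cast hm.ne'), map_one]
    convert h6 using 1
    calc σ ^ (k₁ + k₂ + 1 + k) * r = 1 * (σ ^ (k₁ + k₂) * σ * x) := by rw [hxdef]; ring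
      _ = algebraMap ℂ R ((m : ℂ)⁻¹) * (m : R) * (σ ^ (k₁ + k₂) * σ * x) := by rw [hm1]
      _ = _ := by ring

end

/-- A regular-sequence cancellation. -/
theorem exists_of_mul_eq_pow_mul_add {T T₀ : Type*} [CommRing T] [IsDomain T] [CommRing T₀] [IsDomain T₀]
    (ρ : T →+* T₀) (hρ : Function.Surjective ρ) {x : T} (hx : x ≠ 0) (hx0 : ρ x = 0)
    (hker : ∀ t, ρ t = 0 → x ∣ t) {q s : T} (hq : ρ q ≠ 0)
    (hcop : ∀ y, ρ q ∣ ρ s * y → ρ q ∣ y) (m : ℕ) {y c e : T} (h : s * y = x ^ m * c + q * e) :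
    ∃ c' e', y = x ^ m * c' + q * e' := by
  have hcan : ∀ m z, x ^ m ∣ q * z → x ^ m ∣ z := by
    intro m
    induction m with
    | zero => simp
    | succ m ih =>
      intro z hz
      obtain ⟨z', rfl⟩ := ih z ((pow_dvd_pow x (Nat.le_succ m)).trans hz)
      rw [pow_succ]
      apply mul_dvd_mul_left
      apply hker
      rw [mul_left_comm, pow_succ] at hz
      have h1 := (mul_dvd_mul_iff_left (pow_ne_zero m hx)).1 hz
      obtain ⟨w, hw⟩ := h1
      have := congrArg ρ hw
      rw [map_mul, map_mul, hx0, zero_mul] at this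
      exact (mul_eq_zero.1 this).resolve_left hq
  induction m generalizing y c e with
  | zero => exact ⟨y, 0, by simp⟩
  | succ m ih =>
    obtain ⟨y', e', rfl⟩ := ih (c := x * c) (e := e) (by rw [h, pow_succ]; ring)
    have h1 : x ^ m * (s * y' - x * c) = q * (e - s * e') := by
      rw [pow_succ] at h; linear_combination h
    obtain ⟨z, hz⟩ := hcan m _ ⟨_, h1.symm⟩
    have h2 : s * y' - x * c = q * z := by
      apply mul_left_cancel₀ (pow_ne_zero m hx)
      rw [h1, hz]; ring
    have h3 : ρ s * ρ y' = ρ q * ρ z := by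
      have := congrArg ρ h2
      rwa [map_sub, map_mul, map_mul, map_mul, hx0, zero_mul, sub_zero] at this
    obtain ⟨t₀, ht₀⟩ := hcop _ ⟨_, h3⟩
    obtain ⟨t, rfl⟩ := hρ t₀
    obtain ⟨t', ht'⟩ := hker (y' - q * t) (by rw [map_sub, map_mul, ht₀, sub_self])
    exact ⟨t', x ^ m * t + e', by rw [pow_succ]; linear_combination (x ^ m) * ht'⟩

theorem MvPolynomial.algHom_sub_mem {σ B : Type*} [CommRing B] [Algebra ℂ B] (f g : MvPolynomial σ ℂ →ₐ[ℂ] B)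
    (I : Ideal B) (h : ∀ i, f (X i) - g (X i) ∈ I) (p : MvPolynomial σ ℂ) : f p - g p ∈ I := by
  have : (Ideal.Quotient.mkₐ ℂ I).comp f = (Ideal.Quotient.mkₐ ℂ I).comp g := by
    ext i
    exact (Ideal.Quotient.mk_eq_mk_iff_sub_mem _ _).2 (h i)
  exact (Ideal.Quotient.mk_eq_mk_iff_sub_mem _ _).1 (AlgHom.congr_fun this p)

theorem MvPolynomial.IsHomogeneous.not_isUnit {σ : Type*} {p : MvPolynomial σ ℂ} {d : ℕ}
    (hp : p.IsHomogeneous d) (hd : d ≠ 0) : ¬ IsUnit p := by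
  intro h
  have h1 := h.map (eval (0 : σ → ℂ))
  have h2 : eval (0 : σ → ℂ) p = 0 := by
    have := aeval_mul_of_isHomogeneous hp (0 : σ → ℂ) 0
    simpa [zero_pow hd, coe_aeval_eq_eval, Function.comp_def] using this
  rw [h2] at h1
  exact not_isUnit_zero h1

/-- Restriction to the line `X₂ = X₃ = 0`. -/
noncomputable def lineRes : Poly4 →ₐ[ℂ] Poly2 := aeval ![X 0, X 1, 0, 0]

/-- The inclusion of binary forms. -/
noncomputable def lineInc : Poly2 →ₐ[ℂ] Poly4 := aeval ![X 0, X 1]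

/-- Restriction to the plane `X₃ = l X₂`. -/
noncomputable def planeRes (l : ℂ) : Poly4 →ₐ[ℂ] Poly3 := aeval ![X 0, X 1, X 2, C l * X 2]

/-- Restriction from the plane to the line. -/
noncomputable def planeLine : Poly3 →ₐ[ℂ] Poly2 := aeval ![X 0, X 1, 0]

theorem planeLine_planeRes (l : ℂ) (p : Poly4) : planeLine (planeRes l p) = lineRes p := by
  have : planeLine.comp (planeRes l) = lineRes := by
    ext1 i
    fin_cases i <;> simp [planeLine, planeRes, lineRes]
  exact AlgHom.congr_fun this p

theorem lineRes_lineInc (p : Poly2) : lineRes (lineInc p) = p := by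
  have : lineRes.comp lineInc = AlgHom.id ℂ _ := by
    ext1 i
    fin_cases i <;> simp [lineInc, lineRes]
  exact AlgHom.congr_fun this p

theorem sub_lineInc_lineRes_mem (p : Poly4) : p - lineInc (lineRes p) ∈ Ideal.span {X 2, (X 3 : Poly4)} := by
  refine algHom_sub_mem (AlgHom.id ℂ Poly4) (lineInc.comp lineRes) _ (fun i => ?_) p
  fin_cases i
  · simp [lineInc, lineRes]
  · simp [lineInc, lineRes]
  · simpa [lineInc, lineRes] using Ideal.subset_span (by simp)
  · simpa [lineInc, lineRes] using Ideal.subset_span (by simp)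

theorem X_dvd_of_planeLine_eq_zero {t : Poly3} (ht : planeLine t = 0) : X 2 ∣ t := by
  have h := algHom_sub_mem (AlgHom.id ℂ Poly3)
    ((aeval ![X 0, X 1]).comp planeLine) (Ideal.span {X 2}) (fun i => by
      fin_cases i
      · simp [planeLine]
      · simp [planeLine]
      · simp [planeLine]) t
  rw [AlgHom.comp_apply, ht, map_zero, sub_zero, Ideal.mem_span_singleton] at h
  exact h

theorem lineRes_isHomogeneous {p : Poly4} {d : ℕ} (hp : p.IsHomogeneous d) : (lineRes p).IsHomogeneous d := by
  have := hp.aeval ![X 0, X 1, 0, (0 : Poly2)] (n := 1) (fun i => by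
    fin_cases i
    · exact isHomogeneous_X _ _
    · exact isHomogeneous_X _ _
    · exact isHomogeneous_zero _ _ _
    · exact isHomogeneous_zero _ _ _)
  simpa [lineRes] using this

theorem planeRes_isHomogeneous {l : ℂ} {p : Poly4} {d : ℕ} (hp : p.IsHomogeneous d) :
    (planeRes l p).IsHomogeneous d := by
  have := hp.aeval (n := 1) ![(X 0 : Poly3), X 1, X 2, C l * X 2] (fun i => by
    fin_cases i
    · exact isHomogeneous_X _ _
    · exact isHomogeneous_X _ _
    · exact isHomogeneous_X _ _
    · exact (isHomogeneous_X _ _).C_mul l)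
  simpa [planeRes] using this

theorem X_sub_dvd_of_planeRes_eq_zero {l : ℂ} {p : Poly4} (hp : planeRes l p = 0) : X 3 - C l * X 2 ∣ p := by
  have h := algHom_sub_mem (AlgHom.id ℂ Poly4)
    ((aeval ![X 0, X 1, X 2]).comp (planeRes l)) (Ideal.span {X 3 - C l * X 2}) (fun i => by
      fin_cases i
      · simp [planeRes]
      · simp [planeRes]
      · simp [planeRes]
      · simp [planeRes, algebraMap_eq]) p
  rw [AlgHom.comp_apply, hp, map_zero, sub_zero, Ideal.mem_span_singleton] at h
  exact h

theorem planeLine_surjective : Function.Surjective planeLine := by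
  intro p
  refine ⟨aeval ![X 0, X 1] p, ?_⟩
  have : planeLine.comp (aeval ![X 0, X 1]) = AlgHom.id ℂ Poly2 := by
    ext1 i
    fin_cases i <;> simp [planeLine]
  exact AlgHom.congr_fun this p

theorem pderiv_lineInc (A : Poly2) {k : Fin 4} (hk : k ≠ 0) (hk' : k ≠ 1) :
    pderiv k (lineInc A) = 0 := by
  rw [lineInc, derivation_aeval, Fin.sum_univ_two]
  simp [pderiv_X_of_ne hk.symm, pderiv_X_of_ne hk'.symm]

theorem pderiv_planeRes (l : ℂ) (p : Poly4) :
    pderiv 2 (planeRes l p) = planeRes l (pderiv 2 p + C l * pderiv 3 p) := by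
  have h0 : pderiv 2 (X 0 : Poly3) = 0 := pderiv_X_of_ne (by decide)
  have h1 : pderiv 2 (X 1 : Poly3) = 0 := pderiv_X_of_ne (by decide)
  have hC : planeRes l (C l) = C l := by rw [← algebraMap_eq, AlgHom.commutes]; rfl
  rw [planeRes, derivation_aeval, Fin.sum_univ_four, ← planeRes, map_add, map_mul, hC]
  simp [h0, h1]
  ring

/-- The jacobian criterion along a line on which `F` restricts to a square. -/
theorem not_prime_dvd_of_smooth {F : Poly4}
    (hsm : ∀ v : Fin 4 → ℂ, (∀ i, eval v (pderiv i F) = 0) → v = 0) {A p : Poly2}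
    (hA : lineRes F = A ^ 2) (hp : Prime p) (hpA : p ∣ A) (h2 : p ∣ lineRes (pderiv 2 F))
    (h3 : p ∣ lineRes (pderiv 3 F)) : False := by
  have hres : ∀ i : Fin 2, lineRes (pderiv (Fin.castLE (by norm_num) i) F) = pderiv i (A ^ 2) := by
    intro i
    rw [← hA, lineRes, derivation_aeval, Fin.sum_univ_four]
    fin_cases i
    · have : pderiv (0 : Fin 2) (X 1 : Poly2) = 0 := pderiv_X_of_ne (by decide)
      simp [this]
    · have : pderiv (1 : Fin 2) (X 0 : Poly2) = 0 := pderiv_X_of_ne (by decide)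
      simp [this]
  have hAd : ∀ i, p ∣ pderiv i (A ^ 2) := by
    intro i
    rw [pow_two, Derivation.leibniz, smul_eq_mul]
    exact (hpA.mul_right _).add (hpA.mul_right _)
  have hall : ∀ i, p ∣ lineRes (pderiv i F) := by
    intro i
    fin_cases i
    · exact hres 0 ▸ hAd 0
    · exact hres 1 ▸ hAd 1
    · exact h2
    · exact h3
  obtain ⟨Y, hY⟩ := exists_X_pow_mem_jacobian hsm
  have hle : Ideal.span (Set.range fun i => pderiv i F) ≤ (Ideal.span {p}).comap lineRes := by
    rw [Ideal.span_le]
    rintro _ ⟨i, rfl⟩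
    exact Ideal.mem_span_singleton.2 (hall i)
  have hX : ∀ i : Fin 2, p ∣ X i := by
    intro i
    apply hp.dvd_of_dvd_pow (n := Y)
    have := Ideal.mem_span_singleton.1 (hle (hY (Fin.castLE (by norm_num) i)))
    rw [map_pow] at this
    convert this using 2
    fin_cases i <;> simp [lineRes]
  have h01 := (hp.irreducible.associated_of_dvd (X_prime (R := ℂ) (i := (0 : Fin 2))).irreducible (hX 0)).symm.dvd.trans
    (hX 1)
  rw [X_dvd_X] at h01
  simp at h01

namespace DRing
variable {F : Poly4}

/-- The ideal of a section of the double cover over the line `X₂ = X₃ = 0`. -/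
noncomputable def lineIdeal (F : Poly4) (A : Poly2) : Ideal (DRing F) :=
  Ideal.span {inc F (X 2), inc F (X 3), W F - inc F (lineInc A)}

theorem inc_mem_lineIdeal (A : Poly2) {p : Poly4} (hp : p ∈ Ideal.span {X 2, (X 3 : Poly4)}) :
    inc F p ∈ lineIdeal F A := by
  have : Ideal.span {X 2, (X 3 : Poly4)} ≤ (lineIdeal F A).comap (inc F) := by
    rw [Ideal.span_le]
    rintro _ (rfl | rfl)
    · exact Ideal.subset_span (by simp)
    · exact Ideal.subset_span (by simp)
  exact this hp

theorem sub_mem_lineIdeal (A : Poly2) (r : DRing F) :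
    r - inc F (lineInc (lineRes r.re + A * lineRes r.im)) ∈ lineIdeal F A := by
  have h1 := inc_mem_lineIdeal (F := F) A (sub_lineInc_lineRes_mem r.re)
  have h2 := inc_mem_lineIdeal (F := F) A (sub_lineInc_lineRes_mem r.im)
  have h3 : W F - inc F (lineInc A) ∈ lineIdeal F A := Ideal.subset_span (by simp)
  have h4 := Ideal.add_mem _ (Ideal.add_mem _ h1 (Ideal.mul_mem_left _ (W F) h2))
    (Ideal.mul_mem_right (inc F (lineInc (lineRes r.im))) _ h3)
  convert h4 using 1
  have hr := eq_inc_add r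
  simp only [map_sub, map_add, map_mul]
  linear_combination hr

/-- Contact of a section of the double cover with its plane curves of degree five. -/
theorem dvd_planeRes_norm (hF : F.IsHomogeneous 6) {A : Poly2} (hA : lineRes F = A ^ 2)
    (hA3 : A.IsHomogeneous 3) (l b : ℂ)
    {σ : DRing F} (hq0 : lineRes (pderiv 2 F + C l * pderiv 3 F) ≠ 0)
    (hcop : ∀ y, lineRes (pderiv 2 F + C l * pderiv 3 F) ∣ (lineRes σ.re + A * lineRes σ.im) * y →
      lineRes (pderiv 2 F + C l * pderiv 3 F) ∣ y) {g : DRing F} {n k : ℕ} (hg : (grading hF).Hom n g)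
    (hmem : σ ^ k * g ∈ lineIdeal F A ^ (n + 1)) :
    ∃ q, X 2 * q = planeRes l F - (aeval ![X 0, X 1] A + C b * X 2 ^ 3) ^ 2 ∧ q ∣ planeRes l g.norm := by
  obtain ⟨B, hB⟩ : ∃ B : Poly3, B = aeval ![X 0, X 1] A + C b * X 2 ^ 3 := ⟨_, rfl⟩
  rw [← hB]
  have hjA : planeRes l (lineInc A) = aeval ![X 0, X 1] A := by
    have : (planeRes l).comp lineInc = aeval ![X 0, X 1] := by
      ext1 i; fin_cases i <;> simp [planeRes, lineInc]
    exact AlgHom.congr_fun this A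
  have hjA' : planeLine (aeval ![X 0, X 1] A) = A := by
    rw [← hjA, planeLine_planeRes, lineRes_lineInc]
  have hX2 : planeLine (X 2) = 0 := by simp [planeLine]
  have hBA : planeLine B = A := by
    rw [hB, map_add, hjA', map_mul, map_pow, hX2]; simp
  have hB3 : B.IsHomogeneous 3 := by
    rw [hB]
    refine IsHomogeneous.add ?_ ?_
    · have := hA3.aeval ![X 0, (X 1 : Poly3)] (n := 1) (fun i => by
        fin_cases i <;> exact isHomogeneous_X _ _)
      simpa using this
    · have := (isHomogeneous_C (Fin 3) b).mul ((isHomogeneous_X ℂ (2 : Fin 3)).pow 3)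
      simpa using this
  obtain ⟨q, hq⟩ : X 2 ∣ planeRes l F - B ^ 2 := by
    apply X_dvd_of_planeLine_eq_zero
    rw [map_sub, map_pow, planeLine_planeRes, hBA, hA, sub_self]
  have hder : pderiv 2 (aeval ![X 0, X 1] A : Poly3) = 0 := by
    rw [derivation_aeval, Fin.sum_univ_two]
    have h0 : pderiv 2 (X 0 : Poly3) = 0 := pderiv_X_of_ne (by decide)
    have h1 : pderiv 2 (X 1 : Poly3) = 0 := pderiv_X_of_ne (by decide)
    simp [h0, h1]
  have hderB : planeLine (pderiv 2 B) = 0 := by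
    rw [hB, map_add, hder, zero_add, Derivation.leibniz, pderiv_C, smul_zero, add_zero, pow_succ,
      Derivation.leibniz, pderiv_X_self]
    simp [hX2, Derivation.leibniz_pow]
  have hρq : planeLine q = lineRes (pderiv 2 F + C l * pderiv 3 F) := by
    have h1 := congrArg (fun z => planeLine (pderiv 2 z)) hq
    simp only [map_sub, pderiv_planeRes, planeLine_planeRes] at h1
    rw [pow_two, Derivation.leibniz, Derivation.leibniz, pderiv_X_self] at h1
    simp only [smul_eq_mul, map_add, map_mul, hX2, hderB, mul_zero, zero_mul, add_zero, sub_zero, zero_add,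
      mul_one] at h1
    rw [← h1, map_add, map_mul]
  have hq5 : q.IsHomogeneous 5 := by
    have h1 : (X 2 * q).IsHomogeneous 6 := by
      rw [← hq]
      exact (planeRes_isHomogeneous hF).sub (hB3.pow 2)
    have hqne : q ≠ 0 := fun h => hq0 (by rw [← hρq, h, map_zero])
    obtain ⟨d, e, hde, hd, he⟩ := h1.of_mul (mul_ne_zero (X_ne_zero _) hqne)
    have := hd.inj_right (isHomogeneous_X ℂ (2 : Fin 3)) (X_ne_zero _)
    obtain rfl : e = 5 := by omega
    exact he
  refine ⟨q, hq.symm, ?_⟩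
  let mk := Ideal.Quotient.mkₐ ℂ (Ideal.span {q})
  have hmk : ∀ t, mk t = 0 ↔ q ∣ t := fun t => Ideal.Quotient.eq_zero_iff_dvd _ _
  have hcomp : ∀ p : Poly4, aeval (fun i => mk (planeRes l (X i))) p = mk (planeRes l p) := by
    intro p
    have := comp_aeval_apply (X : Fin 4 → Poly4) (mk.comp (planeRes l)) p
    rw [aeval_X_left_apply] at this
    exact this.symm
  have hsq : mk B ^ 2 = aeval (fun i => mk (planeRes l (X i))) F := by
    rw [hcomp, ← map_pow, ← sub_eq_zero, ← map_sub, hmk, ← dvd_neg, neg_sub, hq]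
    exact dvd_mul_left _ _
  let χ : DRing F →ₐ[ℂ] Poly3 ⧸ Ideal.span {q} := evalHom _ _ hsq
  have hχ : ∀ r, χ r = mk (planeRes l r.re + B * planeRes l r.im) := by
    intro r
    rw [evalHom_apply, hcomp, hcomp, map_add, map_mul]
  have hle : lineIdeal F A ≤ (Ideal.span {mk (X 2)}).comap χ := by
    rw [lineIdeal, Ideal.span_le]
    rintro _ (rfl | rfl | rfl)
    · rw [SetLike.mem_coe, Ideal.mem_comap, evalHom_inc, hcomp]
      simp [planeRes]
    · rw [SetLike.mem_coe, Ideal.mem_comap, evalHom_inc, hcomp]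
      simpa [planeRes] using Ideal.mul_mem_left _ _ (Ideal.mem_span_singleton_self _)
    · rw [SetLike.mem_coe, Ideal.mem_comap, map_sub, evalHom_W, evalHom_inc, hcomp, hjA, ← map_sub, hB, add_sub_cancel_left, map_mul, pow_succ,
        map_mul, ← mul_assoc]
      exact Ideal.mul_mem_left _ _ (Ideal.mem_span_singleton_self _)
  have h1 : χ (σ ^ k * g) ∈ Ideal.span {mk (X 2) ^ (n + 1)} := by
    rw [← Ideal.span_singleton_pow]
    have := (Ideal.pow_right_mono hle (n + 1)).trans (Ideal.le_comap_pow χ (n + 1))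
    exact this hmem
  set s := planeRes l σ.re + B * planeRes l σ.im with hs
  set Γ := planeRes l g.re + B * planeRes l g.im with hΓ
  obtain ⟨c, hc⟩ := Ideal.mem_span_singleton.1 h1
  obtain ⟨c, rfl⟩ : ∃ c', mk c' = c := Ideal.Quotient.mk_surjective c
  rw [map_mul, map_pow, hχ, hχ, ← map_pow, ← map_pow, ← map_mul, ← map_mul, ← sub_eq_zero, ← map_sub, hmk] at hc
  obtain ⟨e, he⟩ := hc
  have hρs : planeLine s = lineRes σ.re + A * lineRes σ.im := by
    rw [hs, map_add, map_mul, planeLine_planeRes, planeLine_planeRes, hBA]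
  have hcop' : ∀ k y, planeLine q ∣ planeLine s ^ k * y → planeLine q ∣ y := by
    intro k
    induction k with
    | zero => intro y hy; simpa using hy
    | succ k ih =>
      intro y hy
      rw [hρq, hρs] at *
      refine hcop y (ih _ ?_)
      convert hy using 1
      ring
  obtain ⟨c', e', h2⟩ := exists_of_mul_eq_pow_mul_add planeLine.toRingHom
    planeLine_surjective (X_ne_zero (2 : Fin 3)) hX2
    (fun t ht => X_dvd_of_planeLine_eq_zero ht) (q := q) (s := s ^ k)
    (by show planeLine q ≠ 0; rw [hρq]; exact hq0)
    (fun y hy => hcop' k y (by rw [← map_pow]; exact hy)) (n + 1) (y := Γ) (c := c) (e := e) (by linear_combination he)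
  have hΓn : Γ.IsHomogeneous n := by
    rw [hom_iff] at hg
    refine (planeRes_isHomogeneous hg.1).add ?_
    rcases hg.2 with h | ⟨j, rfl, h⟩
    · rw [h, map_zero, mul_zero]; exact isHomogeneous_zero _ _ _
    · rw [add_comm]; exact hB3.mul (planeRes_isHomogeneous h)
  have hqΓ : q ∣ Γ := by
    have h3 : homogeneousComponent n Γ = Γ := by rw [homogeneousComponent_of_mem hΓn, if_pos rfl]
    have h4 : homogeneousComponent n ((X 2 : Poly3) ^ (n + 1) * c') = 0 := by
      rw [mul_comm, ← MvPolynomial.grading_comp]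
      exact Coaction.comp_mul_hom_of_lt (grading_hom.2 (isHomogeneous_X_pow (2 : Fin 3) (n + 1))) (Nat.lt_succ_self n) _
    rw [← h3, h2, map_add, h4, zero_add]
    exact hq5.dvd_homogeneousComponent (dvd_mul_right _ _) n
  have h5 : planeRes l g.norm = Γ * (planeRes l g.re - B * planeRes l g.im) -
      q * (X 2 * planeRes l g.im ^ 2) := by
    rw [QuadraticAlgebra.norm_eq, map_sub, map_mul, map_pow, map_pow, hΓ]
    linear_combination (-planeRes l g.im ^ 2) * hq
  rw [h5]
  exact (hqΓ.mul_right _).sub (dvd_mul_right _ _)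

theorem planeRes_norm_eq_zero (hF : F.IsHomogeneous 6) {A : Poly2} (hA : lineRes F = A ^ 2)
    (hA3 : A.IsHomogeneous 3) (l : ℂ)
    {σ : DRing F} (hq0 : lineRes (pderiv 2 F + C l * pderiv 3 F) ≠ 0)
    (hcop : ∀ y, lineRes (pderiv 2 F + C l * pderiv 3 F) ∣ (lineRes σ.re + A * lineRes σ.im) * y →
      lineRes (pderiv 2 F + C l * pderiv 3 F) ∣ y) {g : DRing F} {n k : ℕ} (hg : (grading hF).Hom n g)
    (hmem : σ ^ k * g ∈ lineIdeal F A ^ (n + 1)) : planeRes l g.norm = 0 := by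
  have h : X 2 * planeRes l g.norm = 0 := by
    apply MvPolynomial.funext
    intro v
    rw [map_mul, map_zero, eval_X]
    by_cases hv : v 2 = 0
    · rw [hv, zero_mul]
    obtain ⟨w, hw⟩ := IsAlgClosed.exists_pow_nat_eq (eval v (planeRes l F)) (n := 2) two_pos
    obtain ⟨q, hq, hdvd⟩ := dvd_planeRes_norm hF hA hA3 l
      ((w - eval v (aeval ![X 0, X 1] A : Poly3)) / v 2 ^ 3) hq0 hcop hg hmem
    have h1 : eval v q = 0 := by
      have := congrArg (eval v) hq
      rw [map_mul, map_sub, map_pow, map_add, map_mul, eval_C, map_pow, eval_X,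
        div_mul_cancel₀ _ (pow_ne_zero 3 hv), add_sub_cancel, hw, sub_self] at this
      exact (mul_eq_zero.1 this).resolve_left hv
    obtain ⟨t, ht⟩ := hdvd
    rw [ht, map_mul, h1, zero_mul, mul_zero]
  exact (mul_eq_zero.1 h).resolve_left (X_ne_zero _)

end DRing

namespace DRing
variable {F : Poly4} {A : Poly2}

theorem H_lineInc {k : Fin 4} (hk : k ≠ 0) (hk' : k ≠ 1) (B : Poly2) :
    H k (inc F (lineInc B)) = 0 := by
  rw [H_inc, pderiv_lineInc B hk hk', map_zero, mul_zero]

theorem H_W (k : Fin 4) : H k (W F) = inc F (pderiv k F) := by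
  have := H_W_mul_inc (F := F) k 1
  simpa using this

theorem X2_mem_lineIdeal : inc F (X 2) ∈ lineIdeal F A := Ideal.subset_span (by simp)

theorem X3_mem_lineIdeal : inc F (X 3) ∈ lineIdeal F A := Ideal.subset_span (by simp)

theorem W_sub_mem_lineIdeal : W F - inc F (lineInc A) ∈ lineIdeal F A := Ideal.subset_span (by simp)

/-- Expansion along the line to first order. -/
theorem exists_expansion (hA : lineRes F = A ^ 2) :
    ∃ P₂ P₃ : Poly4, F = lineInc A ^ 2 + X 2 * P₂ + X 3 * P₃ := by
  have h := sub_lineInc_lineRes_mem F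
  rw [hA, map_pow, Ideal.mem_span_pair] at h
  obtain ⟨P₂, P₃, h⟩ := h
  exact ⟨P₂, P₃, by linear_combination -h⟩

theorem pderiv_expansion {P₂ P₃ : Poly4} (h : F = lineInc A ^ 2 + X 2 * P₂ + X 3 * P₃) :
    pderiv 2 F = P₂ + X 2 * pderiv 2 P₂ + X 3 * pderiv 2 P₃ ∧
    pderiv 3 F = P₃ + X 2 * pderiv 3 P₂ + X 3 * pderiv 3 P₃ := by
  have h2 := pderiv_lineInc A (k := 2) (by decide) (by decide)
  have h3 := pderiv_lineInc A (k := 3) (by decide) (by decide)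
  have e1 : pderiv 2 (X 3 : Poly4) = 0 := pderiv_X_of_ne (by decide)
  have e2 : pderiv 3 (X 2 : Poly4) = 0 := pderiv_X_of_ne (by decide)
  constructor
  · conv_lhs => rw [h]
    simp [Derivation.leibniz, pow_two, h2, e1]; ring
  · conv_lhs => rw [h]
    simp [Derivation.leibniz, pow_two, h3, e2]; ring

/-- The Euler field of the étale section. -/
theorem euler_etale (hA : lineRes F = A ^ 2) {y : DRing F} (hy : y ∈ lineIdeal F A) :
    inc F (X 2) * transverse 0 y + inc F (X 3) * transverse 1 y - 2 * W F * y ∈ lineIdeal F A ^ 2 := by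
  refine euler_mem_sq_of_span (s := {inc F (X 2), inc F (X 3), W F - inc F (lineInc A)}) rfl
    X2_mem_lineIdeal X3_mem_lineIdeal ?_ hy
  have e1 : pderiv 2 (X 3 : Poly4) = 0 := pderiv_X_of_ne (by decide)
  have e2 : pderiv 3 (X 2 : Poly4) = 0 := pderiv_X_of_ne (by decide)
  have t0 : ∀ z : DRing F, transverse 0 z = H 2 z := fun z => rfl
  have t1 : ∀ z : DRing F, transverse 1 z = H 3 z := fun z => rfl
  have hsub : ∀ k : Fin 4, ∀ z w : DRing F, H k (z - w) = H k z - H k w := fun k z w => (Hd k).map_sub z w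
  rintro _ (rfl | rfl | rfl)
  · rw [t0, t1, H_inc, H_inc, e2, pderiv_X_self, map_zero, map_one]
    convert Ideal.zero_mem _ using 1; ring
  · rw [t0, t1, H_inc, H_inc, e1, pderiv_X_self, map_zero, map_one]
    convert Ideal.zero_mem _ using 1; ring
  · rw [t0, t1, hsub, hsub, H_lineInc (by decide) (by decide), H_lineInc (by decide) (by decide), H_W, H_W]
    obtain ⟨P₂, P₃, h⟩ := exists_expansion hA
    obtain ⟨h2, h3⟩ := pderiv_expansion h
    rw [h2, h3]
    have hW := W_sq (F := F)
    have hinc := congrArg (inc F) h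
    simp only [map_add, map_mul, map_pow] at hinc ⊢
    have m1 : (inc F (X 2)) * (inc F (X 2) * inc F (pderiv 2 P₂)) ∈ lineIdeal F A ^ 2 := by
      rw [pow_two]; exact Ideal.mul_mem_mul X2_mem_lineIdeal (Ideal.mul_mem_right _ _ X2_mem_lineIdeal)
    have m2 : (inc F (X 2)) * (inc F (X 3) * inc F (pderiv 2 P₃)) ∈ lineIdeal F A ^ 2 := by
      rw [pow_two]; exact Ideal.mul_mem_mul X2_mem_lineIdeal (Ideal.mul_mem_right _ _ X3_mem_lineIdeal)
    have m3 : (inc F (X 3)) * (inc F (X 2) * inc F (pderiv 3 P₂)) ∈ lineIdeal F A ^ 2 := by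
      rw [pow_two]; exact Ideal.mul_mem_mul X3_mem_lineIdeal (Ideal.mul_mem_right _ _ X2_mem_lineIdeal)
    have m4 : (inc F (X 3)) * (inc F (X 3) * inc F (pderiv 3 P₃)) ∈ lineIdeal F A ^ 2 := by
      rw [pow_two]; exact Ideal.mul_mem_mul X3_mem_lineIdeal (Ideal.mul_mem_right _ _ X3_mem_lineIdeal)
    have m5 : (W F - inc F (lineInc A)) * (W F - inc F (lineInc A)) ∈ lineIdeal F A ^ 2 := by
      rw [pow_two]; exact Ideal.mul_mem_mul W_sub_mem_lineIdeal W_sub_mem_lineIdeal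
    refine Eq.subst (motive := fun z => z ∈ lineIdeal F A ^ 2) ?_
      (Ideal.sub_mem _ (Ideal.add_mem _ (Ideal.add_mem _ m1 m2) (Ideal.add_mem _ m3 m4)) m5)
    linear_combination hW + hinc

/-- The Euler field of the ramified section. -/
theorem euler_ramified (hA : lineRes F = 0) {y : DRing F} (hy : y ∈ lineIdeal F 0) :
    W F * transverse 1 y + inc F (X 2) * transverse 2 y - inc F (pderiv 3 F) * y ∈ lineIdeal F 0 ^ 2 := by
  have hWm : W F ∈ lineIdeal F 0 := by
    have := W_sub_mem_lineIdeal (F := F) (A := 0)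
    rwa [map_zero, map_zero, sub_zero] at this
  refine euler_mem_sq_of_span (s := {inc F (X 2), inc F (X 3), W F - inc F (lineInc 0)}) rfl
    hWm X2_mem_lineIdeal ?_ hy
  have e1 : pderiv 2 (X 3 : Poly4) = 0 := pderiv_X_of_ne (by decide)
  have e2 : pderiv 3 (X 2 : Poly4) = 0 := pderiv_X_of_ne (by decide)
  have t1 : ∀ z : DRing F, transverse 1 z = H 3 z := fun z => rfl
  have t2 : ∀ p : Poly4, transverse 2 (inc F p) =
      inc F (pderiv 3 F * pderiv 2 p - pderiv 2 F * pderiv 3 p) := fun p => by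
    show Hkill _ = _
    ext1 <;> simp [Hkill_re, Hkill_im]
  have t3 : transverse 2 (W F) = 0 := by
    show Hkill _ = _
    ext1 <;> simp [Hkill_re, Hkill_im]
  rintro _ (rfl | rfl | rfl)
  · rw [t1, t2, H_inc, e2, pderiv_X_self, map_zero]
    convert Ideal.zero_mem _ using 1
    simp only [mul_one, mul_zero, sub_zero, map_zero]; ring
  · rw [t1, t2, H_inc, e1, pderiv_X_self]
    obtain ⟨P₂, P₃, h⟩ := exists_expansion (A := 0) (F := F) (by rw [hA]; ring)
    obtain ⟨h2, h3⟩ := pderiv_expansion h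
    rw [h2, h3]
    have hW := W_sq (F := F)
    have h' := congrArg (inc F) h
    simp only [map_add, map_sub, map_mul, map_pow, map_zero, map_one] at h' ⊢
    have m1 : (inc F (X 2)) * (inc F (X 2) * inc F (pderiv 2 P₂)) ∈ lineIdeal F 0 ^ 2 := by
      rw [pow_two]; exact Ideal.mul_mem_mul X2_mem_lineIdeal (Ideal.mul_mem_right _ _ X2_mem_lineIdeal)
    have m2 : (inc F (X 2)) * (inc F (X 3) * inc F (pderiv 2 P₃)) ∈ lineIdeal F 0 ^ 2 := by
      rw [pow_two]; exact Ideal.mul_mem_mul X2_mem_lineIdeal (Ideal.mul_mem_right _ _ X3_mem_lineIdeal)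
    have m3 : (inc F (X 3)) * (inc F (X 2) * inc F (pderiv 3 P₂)) ∈ lineIdeal F 0 ^ 2 := by
      rw [pow_two]; exact Ideal.mul_mem_mul X3_mem_lineIdeal (Ideal.mul_mem_right _ _ X2_mem_lineIdeal)
    have m4 : (inc F (X 3)) * (inc F (X 3) * inc F (pderiv 3 P₃)) ∈ lineIdeal F 0 ^ 2 := by
      rw [pow_two]; exact Ideal.mul_mem_mul X3_mem_lineIdeal (Ideal.mul_mem_right _ _ X3_mem_lineIdeal)
    have m5 : W F * W F ∈ lineIdeal F 0 ^ 2 := by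
      rw [pow_two]; exact Ideal.mul_mem_mul hWm hWm
    refine Eq.subst (motive := fun z => z ∈ lineIdeal F 0 ^ 2) ?_
      (Ideal.sub_mem _ m5 (Ideal.add_mem _ (Ideal.add_mem _ m1 m2) (Ideal.add_mem _ m3 m4)))
    linear_combination (-1 : DRing F) * hW - h'
  · rw [map_zero, map_zero, sub_zero, t1, t3, H_W]
    convert Ideal.zero_mem _ using 1; ring

end DRing

namespace MaxSing
variable {F : Poly4} {M n a : ℕ} {g₁ g₂ : DRing F} {ξ : Fin 4 → Poly4} {ω G π : Poly4}

theorem dvd_aeval_sub_lineRes (h2 : π ∣ ξ 2) (h3 : π ∣ ξ 3) (p : Poly4) :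
    π ∣ aeval ξ p - aeval ![ξ 0, ξ 1] (lineRes p) := by
  rw [← Ideal.mem_span_singleton]
  refine algHom_sub_mem (aeval ξ) ((aeval ![ξ 0, ξ 1]).comp lineRes) _ (fun i => ?_) p
  rw [Ideal.mem_span_singleton]
  fin_cases i <;> simp [lineRes, h2, h3]

theorem dvd_lineRes_iff
    (hind : AlgebraicIndependent ℂ ![Ideal.Quotient.mkₐ ℂ (Ideal.span {π}) (ξ 0),
      Ideal.Quotient.mkₐ ℂ (Ideal.span {π}) (ξ 1)]) (p : Poly2) :
    π ∣ aeval ![ξ 0, ξ 1] p ↔ p = 0 := by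
  constructor
  · intro h
    apply hind
    rw [map_zero, ← (Ideal.Quotient.eq_zero_iff_dvd _ _).2 h]
    have := comp_aeval_apply ![ξ 0, ξ 1] (Ideal.Quotient.mkₐ ℂ (Ideal.span {π})) p
    refine Eq.trans ?_ this.symm
    congr 2
    funext i; fin_cases i <;> rfl
  · rintro rfl; simp

/-- If the line does not split, the system cannot be mobile. -/
theorem isSquare_lineRes (S : MaxSing F M n a g₁ g₂ ξ ω G π) (h2 : π ∣ ξ 2) (h3 : π ∣ ξ 3)
    (hz : ∀ p : Poly2, π ∣ aeval ![ξ 0, ξ 1] p ↔ p = 0) : ∃ A, lineRes F = A ^ 2 := by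
  by_contra! hcon
  have hinc : ∀ p : Poly4, π ∣ aeval ξ p ↔ lineRes p = 0 := fun p => by
    rw [← hz]; exact (dvd_iff_dvd_of_dvd_sub (dvd_aeval_sub_lineRes h2 h3 p))
  have hQ : ∀ r, r ∈ S.Q ↔ lineRes r.re = 0 ∧ lineRes r.im = 0 := by
    intro r
    rw [S.mem_Q, DRing.evalHom_apply]
    constructor
    · intro h
      have hsq : π ∣ aeval ξ (r.re ^ 2 - F * r.im ^ 2) := by
        rw [map_sub, map_mul, map_pow, map_pow, ← S.sq]
        have := h.mul_right (aeval ξ r.re - ω * aeval ξ r.im)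
        convert this using 1; ring
      rw [hinc, map_sub, map_mul, map_pow, map_pow, sub_eq_zero] at hsq
      by_cases hb : lineRes r.im = 0
      · rw [hb] at hsq
        exact ⟨pow_eq_zero_iff two_ne_zero |>.1 (by rw [hsq]; ring), hb⟩
      · exfalso
        have hd : lineRes r.im ^ 2 ∣ lineRes r.re ^ 2 := ⟨lineRes F, by rw [hsq]; ring⟩
        rw [IsIntegrallyClosed.pow_dvd_pow_iff two_ne_zero] at hd
        obtain ⟨c, hc⟩ := hd
        apply hcon c
        apply mul_left_cancel₀ (pow_ne_zero 2 hb)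
        rw [mul_comm, ← hsq, hc]; ring
    · rintro ⟨h, h'⟩
      exact ((hinc _).2 h).add (((hinc _).2 h').mul_left _)
  have hW : DRing.W F ∉ S.Q := by
    rw [hQ]; simp
  have hst : ∀ r ∈ S.Q, star r ∈ S.Q := by
    intro r hr
    rw [hQ] at hr ⊢
    simp [hr.1, hr.2]
  have hzero : ∀ g, (DRing.grading S.hF).Hom n g → π ^ (n * a + 1) ∣ S.Ψ g → g.norm = 0 := by
    intro g hg hgd
    have h4 := (S.diffPow hgd).mul (DRing.diffPow_star hst (S.diffPow hgd))
    rw [RatParam.star_mul_eq] at h4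
    have h5 := DRing.diffPow_pderiv S.isPrime_Q hW h4
    by_contra hne
    obtain ⟨m, hm⟩ := support_nonempty.2 hne
    have h6 := support_lt_of_diffPow (k := 2 * n + 1) (fun p hp => ?_) (DRing.Hom.norm S.hF hg)
      (by convert h5 using 1; ring) hm
    · omega
    · have h7 : lineRes p = 0 := by
        rw [← hinc]; simpa using S.mem_Q.1 hp
      have h8 : eval (Pi.single 0 1) p = eval ![1, 0] (lineRes p) := by
        have : (aeval (Pi.single 0 1 : Fin 4 → ℂ)) = (aeval ![(1 : ℂ), 0]).comp lineRes := by
          ext1 i; fin_cases i <;> simp [lineRes]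
        exact AlgHom.congr_fun this p
      rw [h8, h7, map_zero]
  have := S.coprime
  rw [hzero _ S.hom₁ S.dvd₁, hzero _ S.hom₂ S.dvd₂] at this
  exact not_isUnit_zero (this (dvd_refl 0) (dvd_refl 0))

theorem exists_sqrt_line (S : MaxSing F M n a g₁ g₂ ξ ω G π) (h2 : π ∣ ξ 2) (h3 : π ∣ ξ 3)
    (hz : ∀ p : Poly2, π ∣ aeval ![ξ 0, ξ 1] p ↔ p = 0) :
    ∃ A, lineRes F = A ^ 2 ∧ A.IsHomogeneous 3 ∧ S.Q = DRing.lineIdeal F A := by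
  obtain ⟨A, hA, hω⟩ : ∃ A, lineRes F = A ^ 2 ∧ π ∣ ω - aeval ![ξ 0, ξ 1] A := by
    obtain ⟨A, hA⟩ := S.isSquare_lineRes h2 h3 hz
    have h4 := dvd_aeval_sub_lineRes h2 h3 F
    rw [← S.sq, hA, map_pow, sq_sub_sq] at h4
    rcases S.prime.dvd_or_dvd h4 with h | h
    · exact ⟨-A, by rw [hA]; ring, by rw [map_neg, sub_neg_eq_add]; exact h⟩
    · exact ⟨A, hA, h⟩
  refine ⟨A, hA, ?_, le_antisymm (fun r hr => ?_) ?_⟩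
  · apply IsHomogeneous.of_pow two_ne_zero
    rw [← hA]
    exact lineRes_isHomogeneous S.hF
  · have h4 := DRing.sub_mem_lineIdeal A r
    suffices h : lineRes r.re + A * lineRes r.im = 0 by
      rwa [h, map_zero, map_zero, sub_zero] at h4
    rw [← hz, map_add, map_mul]
    rw [S.mem_Q, DRing.evalHom_apply] at hr
    have h5 := dvd_aeval_sub_lineRes h2 h3 r.re
    have h6 := dvd_aeval_sub_lineRes h2 h3 r.im
    have h7 := ((hr.sub h5).sub (h6.mul_left ω)).sub (hω.mul_left (aeval ![ξ 0, ξ 1] (lineRes r.im)))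
    convert h7 using 1
    ring
  · rw [DRing.lineIdeal, Ideal.span_le]
    rintro _ (rfl | rfl | rfl)
    · exact S.mem_Q.2 (by simpa using h2)
    · exact S.mem_Q.2 (by simpa using h3)
    · refine S.mem_Q.2 ?_
      rw [map_sub, DRing.evalHom_W, DRing.evalHom_inc]
      have h4 := dvd_aeval_sub_lineRes h2 h3 (lineInc A)
      rw [lineRes_lineInc] at h4
      convert hω.sub h4 using 1
      ring

theorem lineRes_add_C_mul (p q : Poly4) (l : ℂ) : lineRes (p + C l * q) = lineRes p + C l * lineRes q := by
  rw [map_add, map_mul, ← algebraMap_eq, AlgHom.commutes]; rfl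

theorem false_of_isRelPrime (S : MaxSing F M n a g₁ g₂ ξ ω G π) {A : Poly2}
    (hA : lineRes F = A ^ 2) (hA3 : A.IsHomogeneous 3) (l : ℂ) (σ : DRing F)
    (h0 : lineRes (pderiv 2 F + C l * pderiv 3 F) ≠ 0)
    (hrel : IsRelPrime (lineRes (pderiv 2 F + C l * pderiv 3 F)) (lineRes σ.re + A * lineRes σ.im))
    (hσ : ∀ r, DiffPow DRing.transverse S.Q (n + 1) r → ∃ k, σ ^ k * r ∈ DRing.lineIdeal F A ^ (n + 1)) :
    False := by
  have hres : ∀ g, (DRing.grading S.hF).Hom n g → π ^ (n * a + 1) ∣ S.Ψ g →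
      X 3 - C l * X 2 ∣ g.norm := by
    intro g hg hgd
    obtain ⟨k, hk⟩ := hσ g (S.diffPow_transverse hgd)
    exact X_sub_dvd_of_planeRes_eq_zero (DRing.planeRes_norm_eq_zero S.hF hA hA3 l h0
      (fun y hy => hrel.dvd_of_dvd_mul_left hy) hg hk)
  have hu := S.coprime (hres _ S.hom₁ S.dvd₁) (hres _ S.hom₂ S.dvd₂)
  have h1 : (X 3 - C l * X 2 : Poly4).IsHomogeneous 1 :=
    (isHomogeneous_X _ _).sub (by simpa using (isHomogeneous_C (Fin 4) l).mul (isHomogeneous_X ℂ (2 : Fin 4)))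
  exact h1.not_isUnit one_ne_zero hu

theorem false_of_ramified_line (S : MaxSing F M n a g₁ g₂ ξ ω G π) (hA : lineRes F = 0)
    (hQ : S.Q = DRing.lineIdeal F 0) : False := by
  have hA' : lineRes F = 0 ^ 2 := by rw [hA]; ring
  have hrel : IsRelPrime (lineRes (pderiv 2 F)) (lineRes (pderiv 3 F)) := by
    by_cases hne : lineRes (pderiv 2 F) = 0 ∧ lineRes (pderiv 3 F) = 0
    · exact (not_prime_dvd_of_smooth S.smooth hA' (X_prime (i := (0 : Fin 2)))
        (dvd_zero _) (hne.1 ▸ dvd_zero _) (hne.2 ▸ dvd_zero _)).elim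
    · refine WfDvdMonoid.isRelPrime_of_no_irreducible_factors hne fun z hz hz1 hz2 => ?_
      exact not_prime_dvd_of_smooth S.smooth hA' hz.prime (dvd_zero _) hz1 hz2
  have h0 : lineRes (pderiv 2 F) ≠ 0 := by
    intro h
    rw [h] at hrel
    exact (lineRes_isHomogeneous (S.hF.pderiv (i := 3))).not_isUnit (by norm_num) (hrel (dvd_zero _) dvd_rfl)
  have hl : lineRes (pderiv 2 F + C 0 * pderiv 3 F) = lineRes (pderiv 2 F) := by
    rw [C_0, zero_mul, add_zero]
  refine S.false_of_isRelPrime hA' (isHomogeneous_zero _ _ _) 0 (DRing.inc F (pderiv 3 F)) ?_ ?_ ?_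
  · rw [hl]; exact h0
  · rw [hl, DRing.inc_re, zero_mul, add_zero]; exact hrel
  · intro r hr
    rw [hQ] at hr
    have hWm : DRing.W F ∈ DRing.lineIdeal F 0 := by
      have := DRing.W_sub_mem_lineIdeal (F := F) (A := 0)
      rwa [map_zero, map_zero, sub_zero] at this
    exact hr.exists_pow_mul_mem (fun y hy => DRing.euler_ramified hA hy) hWm DRing.X2_mem_lineIdeal

/-- A general member of a pencil without fixed part along `A` is coprime to `A`. -/
theorem exists_isRelPrime_add_C_mul {τ : Type*} {A p q : MvPolynomial τ ℂ} (hA0 : A ≠ 0)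
    (h : ∀ z, Prime z → z ∣ A → z ∣ p → z ∣ q → False) : ∃ l : ℂ, IsRelPrime (p + C l * q) A := by
  classical
  have hfin : (⋃ z ∈ (UniqueFactorizationMonoid.factors A).toFinset, {l : ℂ | z ∣ p + C l * q}).Finite := by
    refine Set.Finite.biUnion (Finset.finite_toSet _) fun z hz => ?_
    have hz' := Multiset.mem_toFinset.1 (Finset.mem_coe.1 hz)
    have hzp := UniqueFactorizationMonoid.prime_of_factor z hz'
    let f : Polynomial (MvPolynomial τ ℂ) := Polynomial.C p + Polynomial.C q * Polynomial.X
    have hf : ∀ l : ℂ, f.eval (C l) = p + C l * q := by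
      intro l; simp [f]; ring
    obtain ⟨k, hk⟩ : ∃ k, ¬ z ∣ f.coeff k := by
      by_contra! hcon
      have c0 := hcon 0
      have c1 := hcon 1
      simp [f] at c0 c1
      exact h z hzp (UniqueFactorizationMonoid.dvd_of_mem_factors hz') c0 c1
    have := finite_setOf_dvd_eval hzp f hk
    simpa only [hf] using this
  obtain ⟨l, hl⟩ := hfin.infinite_compl.nonempty
  refine ⟨l, WfDvdMonoid.isRelPrime_of_no_irreducible_factors (fun h => hA0 h.2) fun z hz hz1 hz2 => ?_⟩
  obtain ⟨z', hz', hzz⟩ := UniqueFactorizationMonoid.exists_mem_factors_of_dvd hA0 hz hz2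
  exact hl (Set.mem_biUnion (Multiset.mem_toFinset.2 hz') (hzz.symm.dvd.trans hz1))

theorem false_of_etale_line (S : MaxSing F M n a g₁ g₂ ξ ω G π) {A : Poly2} (hA0 : A ≠ 0)
    (hA : lineRes F = A ^ 2) (hA3 : A.IsHomogeneous 3) (hQ : S.Q = DRing.lineIdeal F A) : False := by
  obtain ⟨l, hrel⟩ := exists_isRelPrime_add_C_mul (p := lineRes (pderiv 2 F)) (q := lineRes (pderiv 3 F)) hA0
    fun z hz h1 h2 h3 => not_prime_dvd_of_smooth S.smooth hA hz h1 h2 h3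
  rw [← lineRes_add_C_mul] at hrel
  have h0 : lineRes (pderiv 2 F + C l * pderiv 3 F) ≠ 0 := by
    intro h
    rw [h] at hrel
    exact hA3.not_isUnit (by norm_num) (hrel (dvd_zero _) dvd_rfl)
  refine S.false_of_isRelPrime hA hA3 l (2 * DRing.W F) h0 ?_ ?_
  · have h4 : (2 * DRing.W F).re = 0 := by simp [QuadraticAlgebra.re_ofNat, QuadraticAlgebra.im_ofNat]
    have h5 : (2 * DRing.W F).im = 2 := by simp [QuadraticAlgebra.re_ofNat, QuadraticAlgebra.im_ofNat]
    rw [h4, h5, map_zero, zero_add, map_ofNat]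
    have hu : IsUnit (2 : Poly2) := by
      rw [show (2 : Poly2) = C 2 from (map_ofNat C 2).symm]
      exact (IsUnit.mk0 (2 : ℂ) two_ne_zero).map C
    intro d hd1 hd2
    exact hrel hd1 ((hu.dvd_mul_right).1 hd2)
  · intro r hr
    rw [hQ] at hr
    exact hr.exists_pow_mul_mem (fun y hy => DRing.euler_etale hA hy) DRing.X2_mem_lineIdeal
      DRing.X3_mem_lineIdeal

/-- The centre of a maximal singularity is not a curve. -/
theorem false_of_line (S : MaxSing F M n a g₁ g₂ ξ ω G π) (h2 : π ∣ ξ 2) (h3 : π ∣ ξ 3)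
    (hz : ∀ p : Poly2, π ∣ aeval ![ξ 0, ξ 1] p ↔ p = 0) : False := by
  obtain ⟨A, hA, hA3, hQ⟩ := S.exists_sqrt_line h2 h3 hz
  by_cases hA0 : A = 0
  · subst hA0
    exact S.false_of_ramified_line (by rw [hA]; ring) hQ
  · exact S.false_of_etale_line hA0 hA hA3 hQ

theorem exists_dvd_of_line (S : MaxSing F M n a g₁ g₂ ξ ω G π) (h2 : π ∣ ξ 2) (h3 : π ∣ ξ 3)
    (h1 : ¬ π ∣ ξ 1) : ∃ c : ℂ, π ∣ ξ 0 - C c * ξ 1 := by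
  obtain ⟨e, he⟩ := S.hom_π
  by_cases hind : AlgebraicIndependent ℂ ![Ideal.Quotient.mkₐ ℂ (Ideal.span {π}) (ξ 0),
      Ideal.Quotient.mkₐ ℂ (Ideal.span {π}) (ξ 1)]
  · exact (S.false_of_line h2 h3 (dvd_lineRes_iff hind)).elim
  · exact exists_dvd_of_not_algebraicIndependent S.M_pos (S.hom_ξ 0) (S.hom_ξ 1) S.prime he hind h1

/-- The centre of a maximal singularity is a point. -/
theorem exists_linear_dvd_three (S : MaxSing F M n a g₁ g₂ ξ ω G π) :
    ∃ u : Fin 3 → Fin 4 → ℂ, LinearIndependent ℂ u ∧ ∀ i, π ∣ ∑ j, C (u i j) * ξ j := by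
  obtain ⟨u, hu, hd⟩ := S.exists_linear_dvd
  obtain ⟨A, B, hAB, hrow⟩ := exists_matrix_rows (by norm_num) u hu Fin.revPerm
  have hBA := mul_eq_one_comm.1 hAB
  obtain ⟨g₁', g₂', G', S', -, -⟩ := S.linear hAB
  have hA3 : A 3 = u 0 := hrow 0
  have hA2 : A 2 = u 1 := hrow 1
  obtain ⟨η, hη⟩ : ∃ η : Fin 4 → Poly4, η = fun i => ∑ j, C (A i j) * ξ j := ⟨_, rfl⟩
  have hη' : ∀ i, η i = ∑ j, C (A i j) * ξ j := fun i => congrFun hη i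
  rw [← hη] at S'
  have h2 : π ∣ η 2 := by rw [hη', hA2]; exact hd 1
  have h3 : π ∣ η 3 := by rw [hη', hA3]; exact hd 0
  have hrows : LinearIndependent ℂ (fun i j => A i j) := by
    have : IsUnit A := IsUnit.of_mul_eq_one B hAB
    exact Matrix.linearIndependent_rows_iff_isUnit.2 this
  by_cases h1 : π ∣ η 1
  · refine ⟨fun i => A i.succ, hrows.comp _ (Fin.succ_injective _), fun i => ?_⟩
    rw [← hη']
    fin_cases i
    · exact h1
    · exact h2
    · exact h3
  obtain ⟨c, hc⟩ := S'.exists_dvd_of_line h2 h3 h1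
  refine ⟨![A 0 - c • A 1, A 2, A 3], ?_, fun i => ?_⟩
  · refine Fintype.linearIndependent_iff.2 fun z hz => ?_
    have h4 := Fintype.linearIndependent_iff.1 hrows ![z 0, -(c * z 0), z 1, z 2] (by
      rw [Fin.sum_univ_three] at hz
      rw [Fin.sum_univ_four, ← hz]
      simp [smul_sub, smul_smul, mul_comm]
      abel)
    intro i
    fin_cases i
    · exact h4 0
    · exact h4 2
    · exact h4 3
  · fin_cases i
    · convert hc using 1
      simp only [hη', Finset.mul_sum, ← Finset.sum_sub_distrib]
      refine Finset.sum_congr rfl fun j _ => ?_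
      simp
      ring
    · exact hη' 2 ▸ h2
    · exact hη' 3 ▸ h3

end MaxSing

/-- A general plane of a pencil meets two coprime surfaces in curves without common component. -/
theorem exists_isRelPrime_plane {h₁ h₂ : Poly4} (hrel : IsRelPrime h₁ h₂) {d : ℕ} (hd : h₁.IsHomogeneous d)
    (h0 : eval (Pi.single 2 1) h₁ ≠ 0) :
    ∃ l : ℂ, IsRelPrime (aeval ![X 0, X 1, X 2, C l * X 1] h₁ : Poly3)
      (aeval ![X 0, X 1, X 2, C l * X 1] h₂) := by
  obtain ⟨ρ, hρ0, hρ⟩ := exists_rename_mem_span_pair 2 hrel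
  obtain ⟨l, hl⟩ : ∃ l : ℂ, (aeval ![X 0, X 1, C l * X 1] ρ : Poly2) ≠ 0 := by
    by_contra! hcon
    have h2 : X 1 * ρ = 0 := by
      apply MvPolynomial.funext
      intro v
      rw [map_mul, eval_X, map_zero]
      by_cases hv : v 1 = 0
      · rw [hv, zero_mul]
      · have h3 : (aeval v : Poly3 →ₐ[ℂ] ℂ) =
            (aeval ![v 0, v 1]).comp (aeval ![X 0, X 1, C (v 2 / v 1) * X 1]) := by
          ext1 i
          fin_cases i <;> simp [div_mul_cancel₀ _ hv]
        have h4 : eval v ρ = 0 := by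
          have := AlgHom.congr_fun h3 ρ
          rw [AlgHom.comp_apply, hcon, map_zero] at this
          exact this
        rw [h4, mul_zero]
    exact hρ0 ((mul_eq_zero.1 h2).resolve_left (X_ne_zero 1))
  refine ⟨l, fun z hz1 hz2 => ?_⟩
  set τ : Poly4 →ₐ[ℂ] Poly3 := aeval ![X 0, X 1, X 2, C l * X 1] with hτ
  have hev : eval (Pi.single 2 1) (τ h₁) = eval (Pi.single 2 1) h₁ := by
    have : (aeval (Pi.single 2 1 : Fin 3 → ℂ)).comp τ = aeval (Pi.single 2 1) := by
      ext1 i; fin_cases i <;> simp [hτ]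
    exact AlgHom.congr_fun this h₁
  have hτ0 : τ h₁ ≠ 0 := fun h => h0 (by rw [← hev, h, map_zero])
  have hτd : (τ h₁).IsHomogeneous d := by
    have := hd.aeval ![X 0, X 1, X 2, (C l * X 1 : Poly3)] (n := 1) (fun i => by
        fin_cases i
        · exact isHomogeneous_X _ _
        · exact isHomogeneous_X _ _
        · exact isHomogeneous_X _ _
        · simpa using (isHomogeneous_C (Fin 3) l).mul (isHomogeneous_X ℂ (1 : Fin 3)))
    simpa [hτ] using this
  obtain ⟨m, -, hm⟩ := hτd.of_dvd hτ0 hz1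
  have hz0 : z ≠ 0 := fun h => hτ0 (zero_dvd_iff.1 (h ▸ hz1))
  have hzρ : z ∣ rename Fin.castSucc (aeval ![X 0, X 1, C l * X 1] ρ : Poly2) := by
    have h1 : rename Fin.castSucc (aeval ![X 0, X 1, C l * X 1] ρ : Poly2) =
        τ (rename (Fin.succAbove 2) ρ) := by
      have : (rename (Fin.castSucc : Fin 2 → Fin 3)).comp (aeval ![X 0, X 1, C l * X 1]) =
          τ.comp (rename (Fin.succAbove 2)) := by
        ext1 i; fin_cases i <;> simp [hτ, Fin.succAbove]
      exact AlgHom.congr_fun this ρ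
    rw [h1]
    obtain ⟨b, c, hbc⟩ := Ideal.mem_span_pair.1 hρ
    rw [← hbc, map_add, map_mul, map_mul]
    exact (hz1.mul_left _).add (hz2.mul_left _)
  have hdeg : degreeOf 2 z = 0 := by
    obtain ⟨c, hc⟩ := hzρ
    have hne : rename Fin.castSucc (aeval ![X 0, X 1, C l * X 1] ρ : Poly2) ≠ 0 :=
      fun h => hl (rename_injective _ (Fin.castSucc_injective 2) (h.trans (map_zero _).symm))
    have hc0 : c ≠ 0 := by rintro rfl; exact hne (by rw [hc, mul_zero])
    have h1 := degreeOf_mul_eq (n := 2) hz0 hc0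
    rw [← hc] at h1
    have h2 : degreeOf 2 (rename Fin.castSucc
        (aeval ![X 0, X 1, C l * X 1] ρ : Poly2)) = 0 := by
      by_contra hcon
      have h3 : (2 : Fin 3) ∈ vars (rename Fin.castSucc
          (aeval ![X 0, X 1, C l * X 1] ρ : Poly2)) := by
        rw [vars_def, ← Multiset.one_le_count_iff_mem.trans Multiset.mem_toFinset.symm]
        rw [degreeOf_def] at hcon
        convert Nat.one_le_iff_ne_zero.2 hcon
      have h4 := vars_rename Fin.castSucc _ h3
      simp only [Finset.mem_image] at h4
      obtain ⟨i, -, hi⟩ := h4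
      fin_cases i <;> simp at hi
    omega
  have hz2' : eval (Pi.single 2 1) z = eval 0 z := by
    rw [eval_eq', eval_eq']
    refine Finset.sum_congr rfl fun e he => ?_
    have h1 : e 2 = 0 := by
      have := monomial_le_degreeOf 2 he
      omega
    rw [Fin.prod_univ_three, Fin.prod_univ_three]
    simp [h1]
  obtain ⟨c, hc⟩ := hz1
  have h5 : eval 0 z ≠ 0 := by
    rw [← hz2']
    intro h
    apply h0
    rw [← hev, hc, map_mul, h, zero_mul]
  rcases Nat.eq_zero_or_pos m with rfl | hm0
  · have h6 := hm.totalDegree hz0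
    rw [totalDegree_eq_zero_iff_eq_C] at h6
    rw [h6] at hz0 ⊢
    exact (IsUnit.mk0 _ (fun h => hz0 (by rw [h, C_0]))).map C
  · exfalso
    apply h5
    have := aeval_mul_of_isHomogeneous hm (0 : Fin 3 → ℂ) 0
    simpa [zero_pow hm0.ne', coe_aeval_eq_eval, Function.comp_def] using this

/-- Congruence modulo `π` at the vertex. -/
theorem dvd_aeval_sub_eval {ξ : Fin 4 → Poly4} {π : Poly4} (h1 : π ∣ ξ 1) (h2 : π ∣ ξ 2) (h3 : π ∣ ξ 3)
    {p : Poly4} {d : ℕ} (hp : p.IsHomogeneous d) :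
    π ∣ aeval ξ p - C (eval (Pi.single 0 1) p) * ξ 0 ^ d := by
  have h4 : aeval (fun i => algebraMap ℂ Poly4 ((Pi.single 0 1 : Fin 4 → ℂ) i) * ξ 0) p =
      C (eval (Pi.single 0 1) p) * ξ 0 ^ d := by
    rw [aeval_mul_of_isHomogeneous hp]
    congr 1
    exact (aeval_algebraMap_apply Poly4 (Pi.single 0 1 : Fin 4 → ℂ) p)
  rw [← h4, ← Ideal.mem_span_singleton]
  refine algHom_sub_mem (aeval ξ) (aeval fun i => algebraMap ℂ Poly4 ((Pi.single 0 1 : Fin 4 → ℂ) i) * ξ 0)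
    _ (fun i => ?_) p
  rw [Ideal.mem_span_singleton]
  fin_cases i <;> simp [h1, h2, h3]

namespace MaxSing
variable {F : Poly4} {M n a : ℕ} {g₁ g₂ : DRing F} {ξ : Fin 4 → Poly4} {ω G π : Poly4}

theorem dvd_linear {ξ : Fin 4 → Poly4} {A B : Matrix (Fin 4) (Fin 4) ℂ} (hAB : A * B = 1)
    (hB : B.mulVec (Pi.single 0 1) = Pi.single 0 1) (hξ : ∀ i, i ≠ 0 → π ∣ ξ i) :
    ∀ i, i ≠ 0 → π ∣ ∑ j, C (A i j) * ξ j := by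
  intro i hi
  have hA : A.mulVec (Pi.single 0 1) = Pi.single 0 1 := by
    conv_lhs => rw [← hB]
    rw [Matrix.mulVec_mulVec, hAB, Matrix.one_mulVec]
  have h0 : A i 0 = 0 := by
    have := congrFun hA i
    rwa [Matrix.mulVec_single_one, Pi.single_eq_of_ne hi] at this
  refine Finset.dvd_sum fun j _ => ?_
  by_cases hj : j = 0
  · rw [hj, h0, C_0, zero_mul]; exact dvd_zero _
  · exact (hξ j hj).mul_left _

theorem eval_pderiv_linSubst {B : Matrix (Fin 4) (Fin 4) ℂ} (hB : B.mulVec (Pi.single 0 1) = Pi.single 0 1)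
    (F : Poly4) : eval (Pi.single 0 1) (pderiv 2 (linSubst B F)) =
      ∑ k, B k 2 * eval (Pi.single 0 1) (pderiv k F) := by
  rw [pderiv_linSubst, map_sum]
  simp only [map_mul, eval_C, eval_linSubst, hB]

theorem exists_point_coordinates_of_eval_ne_zero (S : MaxSing F M n a g₁ g₂ ξ ω G π)
    (hξ : ∀ i, i ≠ 0 → π ∣ ξ i) (hk0 : eval (Pi.single 2 1) g₁.norm ≠ 0)
    (hF2 : eval (Pi.single 0 1) (pderiv 2 F) ≠ 0) :
    ∃ (F' : Poly4) (g₁' g₂' : DRing F') (ξ' : Fin 4 → Poly4) (G' : Poly4),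
      MaxSing F' M n a g₁' g₂' ξ' ω G' π ∧ (∀ i, i ≠ 0 → π ∣ ξ' i) ∧
      IsRelPrime (planeRes 0 g₁'.norm) (planeRes 0 g₂'.norm) ∧ eval (Pi.single 0 1) (pderiv 2 F') ≠ 0 := by
  obtain ⟨l, hl⟩ := exists_isRelPrime_plane S.coprime (DRing.Hom.norm S.hF S.hom₁) hk0
  let B₃ : Matrix (Fin 4) (Fin 4) ℂ := !![1, 0, 0, 0; 0, 1, 0, 0; 0, 0, 1, 0; 0, l, 0, 1]
  let A₃ : Matrix (Fin 4) (Fin 4) ℂ := !![1, 0, 0, 0; 0, 1, 0, 0; 0, 0, 1, 0; 0, -l, 0, 1]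
  have hAB₃ : A₃ * B₃ = 1 := by
    ext i j; fin_cases i <;> fin_cases j <;> simp [A₃, B₃, Matrix.mul_apply, Fin.sum_univ_four]
  have hB₃ : B₃.mulVec (Pi.single 0 1) = Pi.single 0 1 := by
    rw [Matrix.mulVec_single_one]
    funext i; fin_cases i <;> simp [B₃, Matrix.col]
  obtain ⟨m₁, m₂, G₃, S₃, hm₁, hm₂⟩ := S.linear hAB₃
  refine ⟨_, m₁, m₂, _, G₃, S₃, dvd_linear hAB₃ hB₃ hξ, ?_, ?_⟩
  · have : (planeRes 0).comp (linSubst B₃) = aeval ![X 0, X 1, X 2, C l * X 1] := by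
      ext1 i
      rw [AlgHom.comp_apply, linSubst_X, Fin.sum_univ_four]
      fin_cases i <;> simp [planeRes, B₃, algebraMap_eq]
    rw [hm₁, hm₂, ← AlgHom.comp_apply, ← AlgHom.comp_apply, this]
    exact hl
  · rw [eval_pderiv_linSubst hB₃, Fin.sum_univ_four]
    simpa [B₃] using hF2

theorem exists_point_coordinates_of_dvd (S : MaxSing F M n a g₁ g₂ ξ ω G π)
    (hξ : ∀ i, i ≠ 0 → π ∣ ξ i) :
    ∃ (F' : Poly4) (g₁' g₂' : DRing F') (ξ' : Fin 4 → Poly4) (G' : Poly4),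
      MaxSing F' M n a g₁' g₂' ξ' ω G' π ∧ (∀ i, i ≠ 0 → π ∣ ξ' i) ∧
      IsRelPrime (planeRes 0 g₁'.norm) (planeRes 0 g₂'.norm) ∧ eval (Pi.single 0 1) (pderiv 2 F') ≠ 0 := by
  have hξ0 : ¬ π ∣ ξ 0 := by
    intro h
    obtain ⟨k, hk⟩ := S.exists_not_dvd
    by_cases h0 : k = 0
    · exact hk (h0 ▸ h)
    · exact hk (hξ k h0)
  have hn : g₁.norm.IsHomogeneous (2 * n) := DRing.Hom.norm S.hF S.hom₁
  have hzero : eval (Pi.single 0 1) g₁.norm = 0 := by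
    by_contra hne
    have h1 := dvd_aeval_sub_eval (hξ 1 (by decide)) (hξ 2 (by decide)) (hξ 3 (by decide)) hn
    have h2 := (dvd_sub_right (S.norm_mem S.dvd₁)).1 h1
    rcases S.prime.dvd_or_dvd h2 with h | h
    · exact S.prime.not_isUnit (isUnit_of_dvd_unit h ((IsUnit.mk0 _ hne).map C))
    · exact hξ0 (S.prime.dvd_of_dvd_pow h)
  have hn0 : g₁.norm ≠ 0 := by
    intro h
    have h1 := S.coprime
    rw [h] at h1
    have := S.n_pos
    exact (DRing.Hom.norm S.hF S.hom₂).not_isUnit (by omega) (h1 (dvd_zero _) dvd_rfl)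
  obtain ⟨v, hv⟩ : ∃ v, eval v (g₁.norm * ∑ k, C (eval (Pi.single 0 1) (pderiv k F)) * X k) ≠ 0 := by
    by_contra! hcon
    have h1 : g₁.norm * ∑ k, C (eval (Pi.single 0 1) (pderiv k F)) * X k = 0 :=
      MvPolynomial.funext fun v => by rw [hcon, map_zero]
    have h2 := (mul_eq_zero.1 h1).resolve_left hn0
    have h3 := S.smooth (Pi.single 0 1) fun i => by
      have := congrArg (eval (Pi.single i 1)) h2
      simpa [map_sum, Pi.single_apply] using this
    have := congrFun h3 0
    simp at this
  rw [map_mul] at hv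
  have hv1 := left_ne_zero_of_mul hv
  have hv2 := right_ne_zero_of_mul hv
  have hlin : LinearIndependent ℂ ![(Pi.single 0 1 : Fin 4 → ℂ), v] := by
    rw [LinearIndependent.pair_iff' (by intro h; have := congrFun h 0; simp at this)]
    rintro c rfl
    apply hv1
    have := aeval_mul_of_isHomogeneous hn (Pi.single 0 1 : Fin 4 → ℂ) c
    have e : (fun i => (Pi.single 0 1 : Fin 4 → ℂ) i * c) = c • Pi.single 0 1 := by
      funext i; simp [mul_comm]
    rw [e] at this
    refine this.trans ?_
    rw [show aeval (Pi.single 0 1 : Fin 4 → ℂ) g₁.norm = 0 from hzero, zero_mul]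
  obtain ⟨B₂, A₂, hBA₂, hcol⟩ := exists_matrix_rows (by norm_num) _ hlin (Equiv.swap 1 2)
  have hAB₂ : A₂.transpose * B₂.transpose = 1 := by rw [← Matrix.transpose_mul, hBA₂, Matrix.transpose_one]
  have hB0 : B₂.transpose.mulVec (Pi.single 0 1) = Pi.single 0 1 := by
    rw [Matrix.mulVec_single_one]; exact hcol 0
  have hB2 : B₂.transpose.mulVec (Pi.single 2 1) = v := by
    rw [Matrix.mulVec_single_one]; exact hcol 1
  obtain ⟨k₁, k₂, G₂, S₂, hk₁, hk₂⟩ := S.linear hAB₂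
  have hξ₂ := dvd_linear hAB₂ hB0 hξ
  have hF2 : eval (Pi.single 0 1) (pderiv 2 (linSubst B₂.transpose F)) ≠ 0 := by
    rw [eval_pderiv_linSubst hB0]
    have hcol2 : ∀ k, B₂ 2 k = v k := fun k => congrFun (hcol 1) k
    convert hv2 using 1
    simp [hcol2, mul_comm]
  have hk0 : eval (Pi.single 2 1) k₁.norm ≠ 0 := by rw [hk₁, eval_linSubst, hB2]; exact hv1
  exact S₂.exists_point_coordinates_of_eval_ne_zero hξ₂ hk0 hF2

/-- Good coordinates at the centre. -/
theorem exists_point_coordinates (S : MaxSing F M n a g₁ g₂ ξ ω G π) :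
    ∃ (F' : Poly4) (g₁' g₂' : DRing F') (ξ' : Fin 4 → Poly4) (G' : Poly4),
      MaxSing F' M n a g₁' g₂' ξ' ω G' π ∧ (∀ i, i ≠ 0 → π ∣ ξ' i) ∧
      IsRelPrime (planeRes 0 g₁'.norm) (planeRes 0 g₂'.norm) ∧ eval (Pi.single 0 1) (pderiv 2 F') ≠ 0 := by
  obtain ⟨u, hu, hd⟩ := S.exists_linear_dvd_three
  obtain ⟨A, B, hAB, hrow⟩ := exists_matrix_rows (by norm_num) u hu Fin.revPerm
  obtain ⟨g₁', g₂', G', S', -, -⟩ := S.linear hAB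
  refine S'.exists_point_coordinates_of_dvd fun i hi => ?_
  have h1 : A 1 = u 2 := hrow 2
  have h2 : A 2 = u 1 := hrow 1
  have h3 : A 3 = u 0 := hrow 0
  fin_cases i
  · exact absurd rfl hi
  · show π ∣ ∑ j, C (A 1 j) * ξ j
    rw [h1]; exact hd 2
  · show π ∣ ∑ j, C (A 2 j) * ξ j
    rw [h2]; exact hd 1
  · show π ∣ ∑ j, C (A 3 j) * ξ j
    rw [h3]; exact hd 0

end MaxSing

/-! ### Triangular frames of logarithmic derivations -/

section
variable {A : Type*} [CommRing A] [IsDomain A] [UniqueFactorizationMonoid A] {π : A}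

theorem Prime.exists_pow_mul_eq (hπ : Prime π) {ι : Type*} (x : ι → A) {i : ι} (hi : x i ≠ 0) :
    ∃ (e : ℕ) (b : ι → A) (i₀ : ι), (∀ i, x i = π ^ e * b i) ∧ ¬ π ∣ b i₀ := by
  classical
  have hex : ∃ e, ¬ ∀ i, π ^ e ∣ x i := by
    obtain ⟨e, he⟩ := FiniteMultiplicity.of_prime_left hπ hi
    exact ⟨e + 1, fun h => he (h i)⟩
  obtain ⟨e, he⟩ : ∃ e, Nat.find hex = e + 1 := Nat.exists_eq_succ_of_ne_zero fun h0 => by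
    have := Nat.find_spec hex
    rw [h0] at this
    simp at this
  have h1 : ∀ i, π ^ e ∣ x i := not_not.1 (Nat.find_min hex (by omega))
  choose b hb using h1
  have h2 := Nat.find_spec hex
  rw [he] at h2
  push Not at h2
  obtain ⟨i₀, hi₀⟩ := h2
  refine ⟨e, b, i₀, hb, fun h => hi₀ ?_⟩
  rw [hb i₀, pow_succ]
  exact mul_dvd_mul_left _ h

theorem Prime.exists_clear_column (hπ : Prime π) {m : ℕ} (B : Matrix (Fin (m + 1)) (Fin (m + 1)) A) :
    ∃ U : Matrix (Fin (m + 1)) (Fin (m + 1)) A, ¬ π ∣ U.det ∧ ∀ i, (U * B) (Fin.succ i) 0 = 0 := by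
  by_cases h0 : ∀ i, B i 0 = 0
  · exact ⟨1, by rw [Matrix.det_one]; exact hπ.not_dvd_one, fun i => by rw [one_mul]; exact h0 _⟩
  push Not at h0
  obtain ⟨i, hi⟩ := h0
  obtain ⟨e, b, i₀, hb, hb0⟩ := hπ.exists_pow_mul_eq (fun i => B i 0) hi
  let σ := Equiv.swap 0 i₀
  let L : Matrix (Fin (m + 1)) (Fin (m + 1)) A := Matrix.of fun i j =>
    if i = 0 then (if j = 0 then 1 else 0) else
      (if j = i then b i₀ else 0) - (if j = 0 then b (σ i) else 0)
  have hL : L.det = b i₀ ^ m := by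
    rw [Matrix.det_of_isLowerTriangular, Fin.prod_univ_succ]
    · simp [L]
    · intro i j hij
      have hij' : i < j := hij
      have hj : j ≠ 0 := (Fin.zero_le i).trans_lt hij' |>.ne'
      simp [L, hj, hij'.ne']
  refine ⟨L.submatrix id σ, ?_, fun i => ?_⟩
  · rw [Matrix.det_permute', hL]
    intro h
    rcases hπ.dvd_or_dvd h with h1 | h1
    · exact hπ.not_isUnit (isUnit_of_dvd_unit h1 ((Units.isUnit _).map (Int.castRingHom A)))
    · exact hb0 (hπ.dvd_of_dvd_pow h1)
  · rw [Matrix.mul_apply, ← Equiv.sum_comp σ]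
    simp only [Matrix.submatrix_apply, id, hb]
    simp [L, sub_mul, σ, Finset.sum_sub_distrib]
    ring

/-- Triangularization by row operations invertible at `π`. -/
theorem Prime.exists_mul_blockTriangular (hπ : Prime π) {m : ℕ} (B : Matrix (Fin m) (Fin m) A) :
    ∃ U : Matrix (Fin m) (Fin m) A, ¬ π ∣ U.det ∧ (U * B).BlockTriangular id := by
  induction m with
  | zero => exact ⟨1, by rw [Matrix.det_one]; exact hπ.not_dvd_one, fun i => i.elim0⟩
  | succ m ih =>
    obtain ⟨U₀, hU₀, h0⟩ := hπ.exists_clear_column B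
    obtain ⟨U₁, hU₁, h1⟩ := ih ((U₀ * B).submatrix Fin.succ Fin.succ)
    let D : Matrix (Fin (m + 1)) (Fin (m + 1)) A := Matrix.of
      (Fin.cons (Fin.cons 1 fun _ => 0) fun i => Fin.cons 0 (U₁ i))
    have hD : D.det = U₁.det := by
      rw [Matrix.det_succ_row_zero, Fin.sum_univ_succ]
      simp [D]
      rfl
    refine ⟨D * U₀, ?_, ?_⟩
    · rw [Matrix.det_mul, hD]
      exact fun h => (hπ.dvd_or_dvd h).elim hU₁ hU₀
    · rw [Matrix.mul_assoc]
      intro i j hij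
      obtain ⟨i, rfl⟩ := Fin.exists_succ_eq.2 (((Fin.zero_le j).trans_lt hij).ne')
      have hrow : ∀ j, (D * (U₀ * B)) i.succ j = ∑ k, U₁ i k * (U₀ * B) k.succ j := by
        intro j
        rw [Matrix.mul_apply, Fin.sum_univ_succ]
        simp [D]
      rw [hrow]
      refine Fin.cases ?_ (fun j hij => ?_) j hij
      · intro _; exact Finset.sum_eq_zero fun k _ => by rw [h0, mul_zero]
      · exact h1 (Fin.succ_lt_succ_iff.1 hij)

end

namespace MaxSing
variable {F : Poly4} {M n a : ℕ} {g₁ g₂ : DRing F} {ξ : Fin 4 → Poly4} {ω G π : Poly4}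

/-- A triangular pair of logarithmic derivations in the coordinates `ξ₁`, `ω` of the plane section
`ξ₃ = 0`, computing the discrepancy. -/
theorem exists_log_pair (S : MaxSing F M n a g₁ g₂ ξ ω G π) (h3 : π ∣ ξ 3)
    (hF2 : ¬ π ∣ aeval ξ (pderiv 2 F)) :
    ∃ E₁ E₂ : Derivation ℂ Poly4 Poly4, π ∣ E₁ π ∧ π ∣ E₂ π ∧ E₁ (ξ 0) = 0 ∧ E₁ (ξ 3) = 0 ∧
      E₂ (ξ 0) = 0 ∧ E₂ (ξ 3) = 0 ∧ E₂ (ξ 1) = 0 ∧ ¬ π ^ (a + 1) ∣ E₁ (ξ 1) * E₂ ω := by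
  obtain ⟨T, hT, u, hu, hdet⟩ := exists_log_frame S.prime
  let y : Fin 4 → Poly4 := Function.update ξ 2 (S.Ψ (DRing.W F))
  let J : Matrix (Fin 4) (Fin 4) Poly4 := Matrix.of fun l j => pderiv j (y l)
  have hJ : 2 * J.det = G * aeval ξ (pderiv 2 F) := by
    rw [S.two_det_update 2 (DRing.W F), DRing.evalHom_apply]
    simp [DRing.H]
  let σ : Equiv.Perm (Fin 4) := ⟨![0, 3, 1, 2], ![0, 2, 3, 1], by decide, by decide⟩
  obtain ⟨U, hU, htri⟩ := S.prime.exists_mul_blockTriangular (T * (J.submatrix σ id).transpose)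
  let E : Fin 4 → Derivation ℂ Poly4 Poly4 := fun i => ∑ j, (U * T) i j • pderiv j
  have hE : ∀ i z, E i z = ∑ j, (U * T) i j * pderiv j z := fun i z => Derivation.sum_smul_apply _ _ _ _
  have hval : ∀ i l, (U * (T * (J.submatrix σ id).transpose)) i l = E i (y (σ l)) := by
    intro i l
    rw [← Matrix.mul_assoc, Matrix.mul_apply, hE]
    rfl
  have hlog : ∀ i, π ∣ E i π := by
    intro i
    have : E i π = ∑ k, U i k * ∑ j, T k j * pderiv j π := by
      rw [hE]
      simp only [Matrix.mul_apply, Finset.sum_mul, Finset.mul_sum, mul_assoc]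
      exact Finset.sum_comm
    rw [this]
    exact Finset.dvd_sum fun k _ => (hT k).mul_left _
  have hzero : ∀ i l, l < i → E i (y (σ l)) = 0 := fun i l h => by rw [← hval]; exact htri h
  have y0 : y (σ 0) = ξ 0 := rfl
  have y1 : y (σ 1) = ξ 3 := rfl
  have y2 : y (σ 2) = ξ 1 := rfl
  have y3 : y (σ 3) = ω := (by simp [y] : y 2 = ω)
  refine ⟨E 2, E 3, hlog 2, hlog 3, y0 ▸ hzero 2 0 (by decide), y1 ▸ hzero 2 1 (by decide),
    y0 ▸ hzero 3 0 (by decide), y1 ▸ hzero 3 1 (by decide), y2 ▸ hzero 3 2 (by decide), fun hd => S.not_dvd ?_⟩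
  have hprod := Matrix.det_of_isUpperTriangular htri
  rw [Fin.prod_univ_four, Matrix.det_mul, Matrix.det_mul, Matrix.det_transpose, Matrix.det_permute, hdet,
    hval, hval, hval, hval, y0, y1, y2, y3] at hprod
  have hd3 : π ∣ E 1 (ξ 3) := by simpa using (E 1).pow_dvd_apply (hlog 1) (k := 1) (by simpa using h3)
  have h1 : π * π ^ (a + 1) ∣ U.det * (π * u * (((Equiv.Perm.sign σ : ℤ) : Poly4) * J.det)) := by
    rw [hprod, mul_assoc, mul_assoc, mul_left_comm]
    exact mul_dvd_mul hd3 ((hd.mul_left _))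
  have h2 : π ^ (a + 1) ∣ U.det * (u * (((Equiv.Perm.sign σ : ℤ) : Poly4) * J.det)) := by
    rw [mul_assoc π, mul_left_comm _ π] at h1
    exact (mul_dvd_mul_iff_left S.prime.ne_zero).1 h1
  have h3 := S.prime.pow_dvd_of_dvd_mul_left _ hu (S.prime.pow_dvd_of_dvd_mul_left _ hU h2)
  have h4 : π ^ (a + 1) ∣ J.det := by
    rcases Int.units_eq_one_or (Equiv.Perm.sign σ) with h | h <;> simpa [h] using h3
  refine S.prime.pow_dvd_of_dvd_mul_right _ hF2 ?_
  rw [← hJ]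
  exact h4.mul_left _

end MaxSing

/-! ### Determinants of iterated derivatives -/

theorem Matrix.det_eq_prod_mul_det_of_sub_mem_span {I A : Type*} [LinearOrder I] [hd : DecidableEq I] [Fintype I]
    [CommRing A] (W V : I → I → A) (κ : I → A)
    (h : ∀ x, W x - κ x • V x ∈ Submodule.span A (V '' Set.Iio x)) :
    (Matrix.of W).det = (∏ x, κ x) * (Matrix.of V).det := by
  obtain rfl : hd = LinearOrder.toDecidableEq := Subsingleton.elim _ _
  have h1 : ∀ x, ∃ c : I → A, (∀ y, x ≤ y → c y = 0) ∧ W x - κ x • V x = ∑ y, c y • V y := by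
    intro x
    obtain ⟨l, hl, he⟩ := (Finsupp.mem_span_image_iff_linearCombination A).1 (h x)
    refine ⟨l, fun y hy => ?_, ?_⟩
    · by_contra h0
      have := (Finsupp.mem_supported A l).1 hl (Finsupp.mem_support_iff.2 h0)
      exact absurd this (not_lt.2 hy)
    · rw [← he, Finsupp.linearCombination_apply, Finsupp.sum_fintype _ _ (by simp)]
  choose c hc he using h1
  let L : Matrix I I A := Matrix.of fun x y => c x y + if y = x then κ x else 0
  have hW : Matrix.of W = L * Matrix.of V := by
    ext1 x k
    rw [Matrix.mul_apply]
    have := congrFun (he x) k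
    simp only [Pi.sub_apply, Pi.smul_apply, Finset.sum_apply, smul_eq_mul] at this
    simp only [L, Matrix.of_apply, add_mul, Finset.sum_add_distrib, ite_mul, zero_mul, Finset.sum_ite_eq',
      Finset.mem_univ, if_true, ← this]
    ring
  rw [hW, Matrix.det_mul, Matrix.det_of_isLowerTriangular]
  · congr 1
    exact Finset.prod_congr rfl fun x _ => by simp [L, hc x x le_rfl]
  · intro x y hxy
    have hxy' : x < y := hxy
    simp [L, hc x y hxy'.le, hxy'.ne']

section
variable {R P : Type*} [CommRing R] [Algebra ℂ R] [CommRing P] [Algebra ℂ P]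
  (d₁ d₂ : Derivation ℂ R R) (Ψ : R →ₐ[ℂ] P)

/-- The functions `Ψ ∘ d₁ⁱ d₂ʲ` with `(i + j, i)` lexicographically smaller than `(s, l)` span this module. -/
def lowerSpan (s l : ℕ) : Submodule P (R → P) :=
  Submodule.span P {φ | ∃ i j, (i + j < s ∨ i + j = s ∧ i < l) ∧ φ = fun r => Ψ (d₁^[i] (d₂^[j] r))}

variable {d₁ d₂ Ψ}

theorem lowerSpan_mono {s l s' l' : ℕ} (h : s < s' ∨ s = s' ∧ l ≤ l') :
    lowerSpan d₁ d₂ Ψ s l ≤ lowerSpan d₁ d₂ Ψ s' l' := by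
  refine Submodule.span_mono ?_
  rintro φ ⟨i, j, hij, rfl⟩
  exact ⟨i, j, by omega, rfl⟩

theorem mem_lowerSpan {s l i j : ℕ} (h : i + j < s ∨ i + j = s ∧ i < l) :
    (fun r => Ψ (d₁^[i] (d₂^[j] r))) ∈ lowerSpan d₁ d₂ Ψ s l :=
  Submodule.subset_span ⟨i, j, h, rfl⟩

theorem comp_mem_lowerSpan {s l : ℕ} {φ : R → R} (h : φ ∈ lowerSpan d₁ d₂ (AlgHom.id ℂ R) s l) :
    (fun r => Ψ (φ r)) ∈ lowerSpan d₁ d₂ Ψ s l := by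
  induction h using Submodule.span_induction with
  | mem φ h =>
    obtain ⟨i, j, hij, rfl⟩ := h
    exact mem_lowerSpan hij
  | zero => simp only [Pi.zero_apply, map_zero]; exact Submodule.zero_mem _
  | add φ ψ _ _ h1 h2 => simp only [Pi.add_apply, map_add]; exact Submodule.add_mem _ h1 h2
  | smul c φ _ h1 => simp only [Pi.smul_apply, smul_eq_mul, map_mul]; exact Submodule.smul_mem _ (Ψ c) h1

theorem derivation_mem_lowerSpan {E : Derivation ℂ P P} {s l s' l' : ℕ}
    (hle : lowerSpan d₁ d₂ Ψ s l ≤ lowerSpan d₁ d₂ Ψ s' l')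
    (hE : ∀ i j, (i + j < s ∨ i + j = s ∧ i < l) →
      (fun r => E (Ψ (d₁^[i] (d₂^[j] r)))) ∈ lowerSpan d₁ d₂ Ψ s' l')
    {φ : R → P} (h : φ ∈ lowerSpan d₁ d₂ Ψ s l) : (fun r => E (φ r)) ∈ lowerSpan d₁ d₂ Ψ s' l' := by
  induction h using Submodule.span_induction with
  | mem φ h =>
    obtain ⟨i, j, hij, rfl⟩ := h
    exact hE i j hij
  | zero => simp only [Pi.zero_apply, map_zero]; exact Submodule.zero_mem _
  | add φ ψ _ _ h1 h2 => simp only [Pi.add_apply, map_add]; exact Submodule.add_mem _ h1 h2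
  | smul c φ h h1 =>
    simp only [Pi.smul_apply, smul_eq_mul, Derivation.leibniz]
    refine Submodule.add_mem _ (Submodule.smul_mem _ c h1) ?_
    have := Submodule.smul_mem _ (E c) (hle h)
    convert this using 1
    funext r
    simp [mul_comm]

variable {b₁ b₂ : R} {E₁ E₂ : Derivation ℂ P P} {κ₁ κ₂ μ : P}

theorem commutator_mem_lowerSpan (hcomm : ∀ r, d₂ (d₁ r) = d₁ (d₂ r) + b₁ * d₁ r + b₂ * d₂ r) (i j : ℕ) :
    (fun r => d₂ (d₁^[i] (d₂^[j] r)) - d₁^[i] (d₂^[j + 1] r)) ∈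
      lowerSpan d₁ d₂ (AlgHom.id ℂ R) (i + j + 1) 0 := by
  induction i with
  | zero =>
    convert Submodule.zero_mem _ using 1
    funext r
    simp [Function.iterate_succ_apply']
  | succ i ih =>
    have h1 : (fun r => d₁ (d₂ (d₁^[i] (d₂^[j] r)) - d₁^[i] (d₂^[j + 1] r))) ∈
        lowerSpan d₁ d₂ (AlgHom.id ℂ R) (i + 1 + j + 1) 0 := by
      refine derivation_mem_lowerSpan (lowerSpan_mono (by omega)) (fun k l h => ?_) ih
      have := mem_lowerSpan (d₁ := d₁) (d₂ := d₂) (Ψ := AlgHom.id ℂ R) (s := i + 1 + j + 1) (l := 0)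
        (i := k + 1) (j := l) (by omega)
      simp only [Function.iterate_succ_apply'] at this
      exact this
    have h2 := Submodule.smul_mem _ b₁ (mem_lowerSpan (d₁ := d₁) (d₂ := d₂) (Ψ := AlgHom.id ℂ R)
      (s := i + 1 + j + 1) (l := 0) (i := i + 1) (j := j) (by omega))
    have h3 := Submodule.smul_mem _ b₂ (Submodule.add_mem _ (lowerSpan_mono
      (s' := i + 1 + j + 1) (l' := 0) (by omega) ih)
      (mem_lowerSpan (d₁ := d₁) (d₂ := d₂) (Ψ := AlgHom.id ℂ R)
      (s := i + 1 + j + 1) (l := 0) (i := i) (j := j + 1) (by omega)))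
    convert Submodule.add_mem _ (Submodule.add_mem _ h1 h2) h3 using 1
    funext r
    simp only [Pi.add_apply, Pi.smul_apply, smul_eq_mul, AlgHom.coe_id, id, Function.iterate_succ_apply',
      hcomm, map_sub]
    ring

theorem iterate_sub_mem_lowerSpan (hcomm : ∀ r, d₂ (d₁ r) = d₁ (d₂ r) + b₁ * d₁ r + b₂ * d₂ r)
    (hE₁ : ∀ r, E₁ (Ψ r) = κ₁ * Ψ (d₁ r) + μ * Ψ (d₂ r)) (hE₂ : ∀ r, E₂ (Ψ r) = κ₂ * Ψ (d₂ r)) (i j : ℕ) :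
    (fun r => E₁^[i] (E₂^[j] (Ψ r)) - κ₁ ^ i * κ₂ ^ j * Ψ (d₁^[i] (d₂^[j] r))) ∈
      lowerSpan d₁ d₂ Ψ (i + j) i := by
  have hd₂ : ∀ i j s l, (i + j + 1 < s ∨ i + j + 1 = s ∧ i < l) →
      (fun r => Ψ (d₂ (d₁^[i] (d₂^[j] r)))) ∈ lowerSpan d₁ d₂ Ψ s l := by
    intro i j s l h
    have h1 := lowerSpan_mono (s' := s) (l' := l) (by omega)
      (comp_mem_lowerSpan (Ψ := Ψ) (commutator_mem_lowerSpan hcomm i j))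
    convert Submodule.add_mem _ h1 (mem_lowerSpan (d₁ := d₁) (d₂ := d₂) (Ψ := Ψ) (s := s) (l := l)
      (i := i) (j := j + 1) (by omega)) using 1
    funext r
    simp
  induction i with
  | zero =>
    induction j with
    | zero =>
      convert Submodule.zero_mem _ using 1
      funext r
      simp
    | succ j ih =>
      have h1 : (fun r => E₂ (E₁^[0] (E₂^[j] (Ψ r)) - κ₁ ^ 0 * κ₂ ^ j * Ψ (d₁^[0] (d₂^[j] r)))) ∈
          lowerSpan d₁ d₂ Ψ (0 + (j + 1)) 0 := by
        refine derivation_mem_lowerSpan (lowerSpan_mono (by omega)) (fun k l h => ?_) ih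
        simp only [hE₂]
        exact Submodule.smul_mem _ κ₂ (hd₂ _ _ _ _ (by omega))
      have h2 := Submodule.smul_mem _ (E₂ (κ₂ ^ j)) (mem_lowerSpan (d₁ := d₁) (d₂ := d₂) (Ψ := Ψ)
        (s := 0 + (j + 1)) (l := 0) (i := 0) (j := j) (by omega))
      convert Submodule.add_mem _ h1 h2 using 1
      funext r
      simp only [Pi.add_apply, Pi.smul_apply, smul_eq_mul, Function.iterate_succ_apply',
        Function.iterate_zero, id, map_sub, Derivation.leibniz, hE₂, pow_zero, one_mul]
      ring
  | succ i ih =>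
    have h1 : (fun r => E₁ (E₁^[i] (E₂^[j] (Ψ r)) - κ₁ ^ i * κ₂ ^ j * Ψ (d₁^[i] (d₂^[j] r)))) ∈
        lowerSpan d₁ d₂ Ψ (i + 1 + j) (i + 1) := by
      refine derivation_mem_lowerSpan (lowerSpan_mono (by omega)) (fun k l h => ?_) ih
      simp only [hE₁]
      refine Submodule.add_mem _ (Submodule.smul_mem _ κ₁ ?_) (Submodule.smul_mem _ μ (hd₂ _ _ _ _ (by omega)))
      have := mem_lowerSpan (d₁ := d₁) (d₂ := d₂) (Ψ := Ψ) (s := i + 1 + j) (l := i + 1)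
        (i := k + 1) (j := l) (by omega)
      simpa only [Function.iterate_succ_apply'] using this
    have h2 := Submodule.smul_mem _ (E₁ (κ₁ ^ i * κ₂ ^ j)) (mem_lowerSpan (d₁ := d₁) (d₂ := d₂) (Ψ := Ψ)
      (s := i + 1 + j) (l := i + 1) (i := i) (j := j) (by omega))
    have h3 := Submodule.smul_mem _ (κ₁ ^ i * κ₂ ^ j * μ) (hd₂ i j (i + 1 + j) (i + 1) (by omega))
    convert Submodule.add_mem _ (Submodule.add_mem _ h1 h2) h3 using 1
    funext r
    simp only [Pi.add_apply, Pi.smul_apply, smul_eq_mul, Function.iterate_succ_apply', map_sub,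
      Derivation.leibniz (E₁) (κ₁ ^ i * κ₂ ^ j) (Ψ _), hE₁]
    ring

end

/-- The index set of ordered monomials of order at most `r` in two derivations. -/
abbrev JetIndex (r : ℕ) := Σₗ s : Fin (r + 1), Fin (s + 1)

theorem JetIndex.lt_iff {r : ℕ} {x y : JetIndex r} : x < y ↔
    ((ofLex x).1 : ℕ) < (ofLex y).1 ∨ ((ofLex x).1 : ℕ) = (ofLex y).1 ∧ ((ofLex x).2 : ℕ) < (ofLex y).2 := by
  obtain ⟨s, i⟩ := x
  obtain ⟨t, j⟩ := y
  refine Sigma.Lex.lt_def.trans (or_congr Iff.rfl ⟨?_, ?_⟩)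
  · rintro ⟨h, hlt⟩
    obtain rfl : s = t := h
    exact ⟨rfl, hlt⟩
  · rintro ⟨h, hlt⟩
    obtain rfl : s = t := Fin.ext h
    exact ⟨rfl, hlt⟩

/-- The ordered monomial in two derivations. -/
def jetOp {R : Type*} [CommRing R] [Algebra ℂ R] (d₁ d₂ : Derivation ℂ R R) {r : ℕ} (x : JetIndex r) (f : R) : R :=
  d₁^[(ofLex x).2] (d₂^[(ofLex x).1 - (ofLex x).2] f)

/-- The total order of vanishing of a family whose jets are independent is bounded by the discrepancy. -/
theorem pow_sum_dvd_of_jets {R P : Type*} [CommRing R] [Algebra ℂ R] [CommRing P] [IsDomain P] [Algebra ℂ P]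
    {d₁ d₂ : Derivation ℂ R R} {Ψ : R →ₐ[ℂ] P} {b₁ b₂ : R} {E₁ E₂ : Derivation ℂ P P} {κ₁ κ₂ μ π : P}
    (hcomm : ∀ r, d₂ (d₁ r) = d₁ (d₂ r) + b₁ * d₁ r + b₂ * d₂ r)
    (hE₁ : ∀ r, E₁ (Ψ r) = κ₁ * Ψ (d₁ r) + μ * Ψ (d₂ r)) (hE₂ : ∀ r, E₂ (Ψ r) = κ₂ * Ψ (d₂ r))
    (hπ : Prime π) (h₁ : π ∣ E₁ π) (h₂ : π ∣ E₂ π) {r : ℕ} (f : JetIndex r → R) (v : JetIndex r → ℕ)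
    (hv : ∀ k, π ^ v k ∣ Ψ (f k))
    (hV : ¬ π ∣ (Matrix.of fun x k => Ψ (jetOp d₁ d₂ x (f k)) : Matrix (JetIndex r) (JetIndex r) P).det) :
    π ^ (∑ k, v k) ∣ (κ₁ * κ₂) ^ (∑ s ∈ Finset.range (r + 1), ∑ i ∈ Finset.range (s + 1), i) := by
  let V : JetIndex r → JetIndex r → P := fun x k => Ψ (jetOp d₁ d₂ x (f k))
  let W : JetIndex r → JetIndex r → P := fun x k =>
    E₁^[(ofLex x).2] (E₂^[(ofLex x).1 - (ofLex x).2] (Ψ (f k)))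
  have hdet := Matrix.det_eq_prod_mul_det_of_sub_mem_span W V
    (fun x => κ₁ ^ ((ofLex x).2 : ℕ) * κ₂ ^ ((ofLex x).1 - (ofLex x).2 : ℕ)) (by
      intro x
      have h := iterate_sub_mem_lowerSpan hcomm hE₁ hE₂ (ofLex x).2 ((ofLex x).1 - (ofLex x).2)
      have h3 := Submodule.mem_map_of_mem (f := LinearMap.funLeft P P f) h
      rw [lowerSpan, Submodule.map_span] at h3
      refine Submodule.span_mono ?_ h3
      rintro _ ⟨_, ⟨i, j, hij, rfl⟩, rfl⟩
      have hx := (ofLex x).2.2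
      have hs := (ofLex x).1.2
      exact ⟨toLex ⟨⟨i + j, by omega⟩, ⟨i, by simp⟩⟩, JetIndex.lt_iff.2 (by simp; omega), by
        funext k
        simp [V, jetOp, LinearMap.funLeft_apply]⟩)
  have hW : π ^ (∑ k, v k) ∣ (Matrix.of W).det := by
    rw [Matrix.det_apply]
    refine Finset.dvd_sum fun σ _ => ?_
    have : π ^ (∑ k, v k) ∣ ∏ k, W (σ k) k := by
      rw [← Finset.prod_pow_eq_pow_sum]
      refine Finset.prod_dvd_prod_of_dvd _ _ fun k _ => ?_
      have hit : ∀ (E : Derivation ℂ P P), π ∣ E π → ∀ m z, π ^ v k ∣ z → π ^ v k ∣ E^[m] z := by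
        intro E hE m
        induction m with
        | zero => exact fun z h => h
        | succ m ih => exact fun z h => ih _ (E.pow_dvd_apply hE h)
      exact hit E₁ h₁ _ _ (hit E₂ h₂ _ _ (hv k))
    rw [Units.smul_def, zsmul_eq_mul]
    exact this.mul_left _
  have hκ : ∏ x : JetIndex r, (κ₁ ^ ((ofLex x).2 : ℕ) * κ₂ ^ ((ofLex x).1 - (ofLex x).2 : ℕ)) =
      (κ₁ * κ₂) ^ (∑ s ∈ Finset.range (r + 1), ∑ i ∈ Finset.range (s + 1), i) := by
    rw [← Finset.prod_pow_eq_pow_sum, ← Fin.prod_univ_eq_prod_range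
      (fun s => (κ₁ * κ₂) ^ (∑ i ∈ Finset.range (s + 1), i))]
    refine (Fintype.prod_sigma (fun x : Σ s : Fin (r + 1), Fin (s + 1) => κ₁ ^ (x.2 : ℕ) * κ₂ ^ (x.1 - x.2 : ℕ))).trans ?_
    refine Finset.prod_congr rfl fun s _ => ?_
    rw [Finset.prod_mul_distrib, mul_pow, ← Finset.prod_pow_eq_pow_sum, ← Finset.prod_pow_eq_pow_sum,
      ← Fin.prod_univ_eq_prod_range, ← Fin.prod_univ_eq_prod_range]
    congr 1
    rw [← Equiv.prod_comp Fin.revPerm]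
    refine Finset.prod_congr rfl fun i _ => ?_
    congr 1
    simp [Fin.val_rev]
    omega
  rw [hdet, hκ] at hW
  exact hπ.pow_dvd_of_dvd_mul_right _ hV hW

/-! ### Surjectivity on jets -/

namespace DiffPow
variable {R ι : Type*} [CommRing R] [Algebra ℂ R] {δ : ι → Derivation ℂ R R} {Q : Ideal R}

theorem iterate {i : ι} {k j : ℕ} {f : R} (h : DiffPow δ Q (k + j) f) : DiffPow δ Q k ((δ i)^[j] f) := by
  induction j generalizing f with
  | zero => exact h
  | succ j ih => exact ih (h.2 i)

theorem iterate_mul {k : ℕ} {f : R} (h : DiffPow δ Q k f) (y : R) (i : ι) (j : ℕ) (hj : j ≤ k + 1) :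
    DiffPow δ Q (k + 2 - j) ((δ i)^[j] (y * f) - y * (δ i)^[j] f - j * δ i y * (δ i)^[j - 1] f) := by
  induction j with
  | zero => simpa using DiffPow.zero _
  | succ j ih =>
    have h1 := ih (by omega)
    rw [show k + 2 - j = k + 2 - (j + 1) + 1 by omega] at h1
    have h2 := h1.2 i
    rcases j with _ | j
    · convert DiffPow.zero _ using 1
      simp [Derivation.leibniz, mul_comm]
    have h3 : DiffPow δ Q (k + 2 - (j + 1 + 1)) ((δ i)^[j] f) :=
      DiffPow.iterate (h.mono (by omega))
    have h4 := h3.mul_left ((j + 1 : ℕ) * δ i (δ i y))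
    convert h2.add h4 using 1
    simp only [map_sub, Derivation.leibniz, smul_eq_mul, Function.iterate_succ_apply', Nat.add_sub_cancel,
      Derivation.map_natCast]
    push_cast
    ring

end DiffPow

section
variable {R : Type*} [CommRing R] [Algebra ℂ R] {d₁ d₂ : Derivation ℂ R R} {e : R →ₐ[ℂ] ℂ}

/-- The leading jets of a product with a function vanishing at the point. -/
theorem eval_jet_mul {k : ℕ} {f : R} (h : DiffPow ![d₁, d₂] (RingHom.ker e) k f) {y : R} (hy : e y = 0)
    {i j : ℕ} (hij : i + j = k + 1) :
    e (d₁^[i] (d₂^[j] (y * f))) =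
      i * e (d₁ y) * e (d₁^[i - 1] (d₂^[j] f)) + j * e (d₂ y) * e (d₁^[i] (d₂^[j - 1] f)) := by
  have hQ : ∀ {z}, DiffPow ![d₁, d₂] (RingHom.ker e) 1 z → e z = 0 := fun h => h.1
  have h1 := h.iterate_mul y 1 j (by omega)
  rcases i with _ | i
  · have h2 := hQ (h1.mono (by omega))
    simp only [map_sub, map_mul, hy, map_natCast] at h2
    simp only [Function.iterate_zero, id, Nat.cast_zero, zero_mul, zero_add, sub_zero] at h2 ⊢
    exact sub_eq_zero.1 h2
  have hjk : j ≤ k := by omega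
  have h2 := hQ (DiffPow.iterate (i := 0) (j := i + 1) (h1.mono (by omega)))
  have h3 := hQ ((((h.mono (by omega)).iterate (i := 1) (k := k - j) (j := j)).iterate_mul y 0 (i + 1)
    (by omega)).mono (by omega))
  have h4 : j * e (d₁^[i + 1] (d₂ y * d₂^[j - 1] f)) = j * (e (d₂ y) * e (d₁^[i + 1] (d₂^[j - 1] f))) := by
    rcases j with _ | j
    · simp
    have h5 : DiffPow ![d₁, d₂] (RingHom.ker e) (i + 1) (d₂^[j] f) := (h.mono (by omega)).iterate (i := 1)
    have h6 := hQ ((h5.iterate_mul (d₂ y) 0 (i + 1) (by omega)).mono (by omega))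
    have h7 := hQ ((h5.mono (by omega)).iterate (i := 0) (k := 1) (j := i))
    simp only [Matrix.cons_val_zero, map_sub, map_mul, Nat.add_sub_cancel] at h6 h7 ⊢
    rw [h7, mul_zero, sub_zero] at h6
    rw [sub_eq_zero.1 h6]
  obtain ⟨L, hL⟩ : ∃ L : R →ₗ[ℂ] R, ∀ x, d₁^[i + 1] x = L x :=
    ⟨(d₁ : R →ₗ[ℂ] R) ^ (i + 1), fun x => (Module.End.pow_apply _ _ _).symm⟩
  simp only [Matrix.cons_val_zero, Matrix.cons_val_one, hL, smul_mul_assoc, ← nsmul_eq_mul, map_sub, map_nsmul,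
    map_mul, hy, zero_mul, sub_zero] at h2 h3 h4 ⊢
  rw [← h4]
  linear_combination (exp := 1) h2 + h3

theorem eval_jet_monomial {y₀ y₁ y₂ : R} (h₀ : e y₀ ≠ 0) (h₁ : e y₁ = 0) (h₂ : e y₂ = 0) (h₁₁ : e (d₁ y₁) ≠ 0)
    (h₂₁ : e (d₂ y₁) = 0) (h₁₂ : e (d₁ y₂) = 0) (h₂₂ : e (d₂ y₂) ≠ 0) (p q : ℕ) :
    DiffPow ![d₁, d₂] (RingHom.ker e) (p + q) (y₁ ^ p * (y₂ ^ q * y₀)) ∧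
    ∀ i j, i + j = p + q → (e (d₁^[i] (d₂^[j] (y₁ ^ p * (y₂ ^ q * y₀)))) ≠ 0 ↔ i = p) := by
  have hd : ∀ {y}, e y = 0 → ∀ {k f}, DiffPow ![d₁, d₂] (RingHom.ker e) k f →
      DiffPow ![d₁, d₂] (RingHom.ker e) (k + 1) (y * f) := fun {y} hy {k f} hf =>
    (add_comm 1 k) ▸ (show DiffPow ![d₁, d₂] (RingHom.ker e) 1 y from ⟨hy, fun _ => trivial⟩).mul hf
  induction p with
  | zero =>
    induction q with
    | zero =>
      refine ⟨trivial, fun i j hij => ?_⟩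
      obtain rfl : i = 0 := by omega
      obtain rfl : j = 0 := by omega
      simpa using h₀
    | succ q ih =>
      have he : y₁ ^ 0 * (y₂ ^ (q + 1) * y₀) = y₂ * (y₁ ^ 0 * (y₂ ^ q * y₀)) := by ring
      rw [he]
      refine ⟨hd h₂ ih.1, fun i j hij => ?_⟩
      rw [eval_jet_mul ih.1 h₂ (by omega), h₁₂]
      rcases j with _ | j
      · simp; omega
      · have := ih.2 i j (by omega)
        rw [← this, Nat.add_sub_cancel]
        have hj : ((j + 1 : ℕ) : ℂ) ≠ 0 := Nat.cast_ne_zero.2 (Nat.succ_ne_zero j)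
        simp [h₂₂, hj, -Nat.cast_add]
  | succ p ih =>
    have he : y₁ ^ (p + 1) * (y₂ ^ q * y₀) = y₁ * (y₁ ^ p * (y₂ ^ q * y₀)) := by ring
    rw [he, show p + 1 + q = p + q + 1 by ring]
    refine ⟨hd h₁ ih.1, fun i j hij => ?_⟩
    rw [eval_jet_mul ih.1 h₁ (by omega), h₂₁]
    rcases i with _ | i
    · simp
    · have := ih.2 i j (by omega)
      rw [Nat.add_right_cancel_iff, ← this, Nat.add_sub_cancel]
      have hi : ((i + 1 : ℕ) : ℂ) ≠ 0 := Nat.cast_ne_zero.2 (Nat.succ_ne_zero i)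
      simp [h₁₁, hi, -Nat.cast_add]

/-- Jets of order at most `r` are attained on monomials in local parameters. -/
theorem span_jets_eq_top {y₁ y₂ : R} (y₀ : ℕ → ℕ → R) (h₀ : ∀ p q, e (y₀ p q) ≠ 0) (h₁ : e y₁ = 0) (h₂ : e y₂ = 0)
    (h₁₁ : e (d₁ y₁) ≠ 0) (h₂₁ : e (d₂ y₁) = 0) (h₁₂ : e (d₁ y₂) = 0) (h₂₂ : e (d₂ y₂) ≠ 0) (r : ℕ) :
    Submodule.span ℂ ((fun f (x : JetIndex r) => e (jetOp d₁ d₂ x f)) ''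
      {f | ∃ p q, p + q ≤ r ∧ f = y₁ ^ p * (y₂ ^ q * y₀ p q)}) = ⊤ := by
  let f : JetIndex r → R := fun x => y₁ ^ ((ofLex x).2 : ℕ) *
    (y₂ ^ ((ofLex x).1 - (ofLex x).2 : ℕ) * y₀ (ofLex x).2 ((ofLex x).1 - (ofLex x).2))
  let B : Matrix (JetIndex r) (JetIndex r) ℂ := Matrix.of fun x y => e (jetOp d₁ d₂ y (f x))
  have hm := fun p q => eval_jet_monomial (d₁ := d₁) (d₂ := d₂) (h₀ p q) h₁ h₂ h₁₁ h₂₁ h₁₂ h₂₂ p q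
  have hlt : ∀ x : JetIndex r, ((ofLex x).2 : ℕ) ≤ (ofLex x).1 := fun x => Nat.lt_succ_iff.1 (ofLex x).2.2
  have hB : B.det ≠ 0 := by
    have htri : B.BlockTriangular id := by
      intro x y hxy
      have hx := hlt x
      have hy := hlt y
      have hxy' : y < x := hxy
      rcases JetIndex.lt_iff.1 hxy' with h | ⟨h, h'⟩
      · have h3 := (hm (ofLex x).2 ((ofLex x).1 - (ofLex x).2)).1
        exact (DiffPow.iterate (i := 0) (k := 1) (DiffPow.iterate (i := 1)
          (j := (ofLex y).1 - (ofLex y).2) (h3.mono (by omega)))).1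
      · by_contra h0
        have := ((hm (ofLex x).2 ((ofLex x).1 - (ofLex x).2)).2 (ofLex y).2 ((ofLex y).1 - (ofLex y).2)
          (by omega)).1 h0
        omega
    have h1 := Matrix.det_of_isUpperTriangular htri
    have h2 : B.det = ∏ x, B x x := by convert h1
    rw [h2]
    exact Finset.prod_ne_zero_iff.2 fun x _ => ((hm _ _).2 _ _ rfl).2 rfl
  have hli := Matrix.linearIndependent_rows_of_det_ne_zero hB
  have htop := hli.span_eq_top_of_card_eq_finrank' (by simp)
  rw [eq_top_iff, ← htop]
  refine Submodule.span_mono ?_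
  rintro _ ⟨x, rfl⟩
  have := hlt x
  have := (ofLex x).1.2
  exact ⟨f x, ⟨_, _, by omega, rfl⟩, rfl⟩

end

/-! ### Derivations along the plane section through the centre -/

theorem MvPolynomial.pderiv_comm {σ : Type*} (i j : σ) (p : MvPolynomial σ ℂ) :
    pderiv i (pderiv j p) = pderiv j (pderiv i p) := by
  have h : ⁅pderiv (R := ℂ) i, pderiv j⁆ = (0 : Derivation ℂ (MvPolynomial σ ℂ) (MvPolynomial σ ℂ)) := by
    classical
    refine MvPolynomial.derivation_ext fun k => ?_
    simp [Derivation.commutator_apply, pderiv_X, Pi.single_apply, apply_ite]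
  exact sub_eq_zero.1 (by rw [← Derivation.commutator_apply, h]; rfl)

theorem MvPolynomial.IsHomogeneous.mul_pderiv {σ : Type*} {p q : MvPolynomial σ ℂ} {n k m : ℕ}
    (hq : q.IsHomogeneous (k + 1)) (hp : p.IsHomogeneous n) (hm : m = n + k) (i : σ) :
    (q * pderiv i p).IsHomogeneous m := by
  subst hm
  rcases n with _ | n
  · have : pderiv i p = 0 := by
      rw [totalDegree_eq_zero_iff_eq_C.1 (Nat.le_zero.1 hp.totalDegree_le), pderiv_C]
    rw [this, mul_zero]; exact isHomogeneous_zero _ _ _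
  · have := hq.mul (hp.pderiv (i := i))
    rwa [Nat.add_sub_cancel, show k + 1 + n = n + 1 + k by ring] at this

namespace DRing
variable {F : Poly4}

/-- The derivation `F₂ (F₂∂₁ - F₁∂₂)`, which kills `W`. -/
noncomputable def planeDer₁ : Derivation ℂ (DRing F) (DRing F) :=
  Derivation.mk'
    { toFun := fun r => ⟨pderiv 2 F * pderiv 2 F * pderiv 1 r.re - pderiv 2 F * pderiv 1 F * pderiv 2 r.re,
        pderiv 2 F * pderiv 2 F * pderiv 1 r.im - pderiv 2 F * pderiv 1 F * pderiv 2 r.im⟩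
      map_add' := fun r s => by ext1 <;> simp <;> ring
      map_smul' := fun c r => by ext1 <;> simp [smul_sub] }
    fun r s => by ext1 <;> simp [Derivation.leibniz] <;> ring

/-- The derivation `2 W F₂ ∂₂`. -/
noncomputable def planeDer₂ : Derivation ℂ (DRing F) (DRing F) :=
  inc F (pderiv 2 F) • Hd 2

theorem planeDer₁_apply (r : DRing F) : planeDer₁ r =
    ⟨pderiv 2 F * pderiv 2 F * pderiv 1 r.re - pderiv 2 F * pderiv 1 F * pderiv 2 r.re,
        pderiv 2 F * pderiv 2 F * pderiv 1 r.im - pderiv 2 F * pderiv 1 F * pderiv 2 r.im⟩ := rfl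

theorem planeDer₂_apply (r : DRing F) : planeDer₂ r =
    ⟨pderiv 2 F * (2 * F) * pderiv 2 r.im + pderiv 2 F * pderiv 2 F * r.im,
      2 * pderiv 2 F * pderiv 2 r.re⟩ := by
  change inc F (pderiv 2 F) * H 2 r = _
  ext1 <;> simp [H] <;> ring

theorem planeDer₂_planeDer₁ (r : DRing F) : planeDer₂ (planeDer₁ r) = planeDer₁ (planeDer₂ r) +
    (4 * W F * inc F (pderiv 2 (pderiv 2 F))) * planeDer₁ r +
    inc F (2 * (pderiv 1 F * pderiv 2 (pderiv 2 F) - pderiv 2 F * pderiv 1 (pderiv 2 F))) * planeDer₂ r := by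
  have h := fun p : Poly4 => pderiv_comm 2 1 p
  have h2 : ∀ i, pderiv i (2 : Poly4) = 0 := fun i => by rw [← map_ofNat C 2, pderiv_C]
  ext1 <;> simp [planeDer₁_apply, planeDer₂_apply, Derivation.leibniz, h, h2,
    QuadraticAlgebra.re_ofNat, QuadraticAlgebra.im_ofNat] <;> ring

theorem hom_planeDer₁ {hF : F.IsHomogeneous 6} {r : DRing F} {m : ℕ} (h : (grading hF).Hom m r) :
    (grading hF).Hom (m + 9) (planeDer₁ r) := by
  obtain ⟨h1, h2⟩ := (hom_iff hF).1 h
  have hq : ∀ i, (pderiv 2 F * pderiv i F).IsHomogeneous (9 + 1) := fun i => hF.pderiv.mul hF.pderiv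
  refine (hom_iff hF).2 ⟨((hq 2).mul_pderiv h1 rfl 1).sub ((hq 1).mul_pderiv h1 rfl 2), ?_⟩
  rcases h2 with h2 | ⟨k, rfl, h2⟩
  · left; simp [planeDer₁_apply, h2]
  · exact Or.inr ⟨k + 9, by ring, ((hq 2).mul_pderiv h2 rfl 1).sub ((hq 1).mul_pderiv h2 rfl 2)⟩

theorem hom_planeDer₂ {hF : F.IsHomogeneous 6} {r : DRing F} {m : ℕ} (h : (grading hF).Hom m r) :
    (grading hF).Hom (m + 7) (planeDer₂ r) := by
  obtain ⟨h1, h3⟩ := (hom_iff hF).1 h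
  have hq : (pderiv 2 F).IsHomogeneous 5 := hF.pderiv
  have h2 : (2 : Poly4).IsHomogeneous 0 := by rw [← map_ofNat C 2]; exact isHomogeneous_C _ _
  have hF2 : (pderiv 2 F * (2 * F)).IsHomogeneous (10 + 1) := hq.mul (h2.mul hF)
  have hq2 : (2 * pderiv 2 F).IsHomogeneous (4 + 1) := h2.mul hq
  rw [planeDer₂_apply]
  refine (hom_iff hF).2 ⟨?_, Or.inr ⟨m + 4, by ring, hq2.mul_pderiv h1 rfl 2⟩⟩
  rcases h3 with h3 | ⟨k, rfl, h3⟩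
  · simpa [h3] using isHomogeneous_zero _ _ _
  · refine (hF2.mul_pderiv h3 (by ring) 2).add ?_
    have := (hq.mul hq).mul h3
    rwa [show 5 + 5 + k = k + 3 + 7 by ring] at this

theorem hom_jetOp {hF : F.IsHomogeneous 6} (m : ℕ) {r : ℕ}
    (x : JetIndex r) : ∃ d, ∀ f : DRing F, (grading hF).Hom m f → (grading hF).Hom d (jetOp planeDer₁ planeDer₂ x f) := by
  have h1 : ∀ i m (f : DRing F), (grading hF).Hom m f → (grading hF).Hom (m + i * 9) (planeDer₁^[i] f) := by
    intro i
    induction i with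
    | zero => intro m f h; simpa using h
    | succ i ih =>
      intro m f h
      have := ih _ _ (hom_planeDer₁ h)
      rwa [show m + 9 + i * 9 = m + (i + 1) * 9 by ring] at this
  have h2 : ∀ i m (f : DRing F), (grading hF).Hom m f → (grading hF).Hom (m + i * 7) (planeDer₂^[i] f) := by
    intro i
    induction i with
    | zero => intro m f h; simpa using h
    | succ i ih =>
      intro m f h
      have := ih _ _ (hom_planeDer₂ h)
      rwa [show m + 7 + i * 7 = m + (i + 1) * 7 by ring] at this
  exact ⟨_, fun f h => h1 _ _ _ (h2 _ _ _ h)⟩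

end DRing

namespace MaxSing
variable {F : Poly4} {M n a : ℕ} {g₁ g₂ : DRing F} {ξ : Fin 4 → Poly4} {ω G π : Poly4}

theorem sq_mul_derivation (S : MaxSing F M n a g₁ g₂ ξ ω G π) {E : Derivation ℂ Poly4 Poly4} (h0 : E (ξ 0) = 0)
    (h3 : E (ξ 3) = 0) (r : DRing F) : aeval ξ (pderiv 2 F) ^ 2 * E (S.Ψ r) =
      E (ξ 1) * S.Ψ (DRing.planeDer₁ r) + E ω * S.Ψ (DRing.planeDer₂ r) := by
  have h1 : 2 * ω * E ω = aeval ξ (pderiv 1 F) * E (ξ 1) + aeval ξ (pderiv 2 F) * E (ξ 2) := by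
    have h2 := derivation_aeval E ξ F
    rw [← S.sq, pow_two, Derivation.leibniz, Fin.sum_univ_four, h0, h3, smul_eq_mul] at h2
    linear_combination h2
  have hsq := S.sq
  rw [DRing.evalHom_apply, map_add, Derivation.leibniz, derivation_aeval, derivation_aeval]
  simp only [Fin.sum_univ_four, h0, h3, DRing.evalHom_apply, DRing.planeDer₁_apply, DRing.planeDer₂_apply,
    smul_eq_mul, map_sub, map_mul, map_add, map_ofNat, ← hsq]
  linear_combination (-(aeval ξ (pderiv 2 F)) * (aeval ξ (pderiv 2 r.re) + ω * aeval ξ (pderiv 2 r.im))) * h1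

end MaxSing

/-! ### Counting forms on the plane section -/

theorem MvPolynomial.finrank_homogeneousSubmodule_three (k : ℕ) :
    Module.finrank ℂ (homogeneousSubmodule (Fin 3) ℂ k) = (k + 2).choose 2 := by
  let s := (Finset.univ : Finset (Fin 3)).finsuppAntidiag k
  let _ : Fintype {d : Fin 3 →₀ ℕ | d.degree = k} := Fintype.ofFinset s fun d => by
    simp [s, Finset.mem_finsuppAntidiag, Finsupp.degree_eq_sum]
  rw [homogeneousSubmodule_eq_finsupp_supported]
  refine (AddMonoidAlgebra.supportedEquivFinsupp _).finrank_eq.trans ?_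
  rw [Module.finrank_finsupp_self, Fintype.card_ofFinset, Finset.card_finsuppAntidiag_nat_eq_choose,
    Finset.card_univ, Fintype.card_fin, show 3 + k - 1 = k + 2 by omega, Nat.choose_symm_add]

theorem Submodule.exists_fin_span_add {V : Type*} [AddCommGroup V] [Module ℂ V] [FiniteDimensional ℂ V]
    (U : Submodule ℂ V) {d : ℕ} (h : Module.finrank ℂ V ≤ Module.finrank ℂ U + d) :
    ∃ c : Fin d → V, ∀ v, ∃ s ∈ Submodule.span ℂ (Set.range c), ∃ u ∈ U, v = s + u := by
  obtain ⟨U', hU'⟩ := U.exists_isCompl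
  have h1 := Submodule.finrank_add_eq_of_isCompl hU'
  let b := Module.finBasis ℂ U'
  refine ⟨fun i => if hi : (i : ℕ) < Module.finrank ℂ U' then (b ⟨i, hi⟩ : V) else 0, fun v => ?_⟩
  obtain ⟨u, hu, s, hs, rfl⟩ := Submodule.mem_sup.1 (hU'.sup_eq_top ▸ Submodule.mem_top : v ∈ U ⊔ U')
  refine ⟨s, ?_, u, hu, add_comm _ _⟩
  have h2 : ((∑ i, b.repr ⟨s, hs⟩ i • b i : U') : V) = s := congrArg Subtype.val (b.sum_repr ⟨s, hs⟩)
  rw [← h2, Submodule.coe_sum]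
  refine Submodule.sum_mem _ fun i _ => ?_
  rw [Submodule.coe_smul]
  refine Submodule.smul_mem _ _ (Submodule.subset_span ⟨⟨i, by omega⟩, by simp⟩)

namespace DRing
variable {F : Poly4}

/-- Pairs of forms representing the elements of degree `k + 3` of the plane section `X₃ = 0`. -/
abbrev PlaneForms (k : ℕ) :=
  homogeneousSubmodule (Fin 3) ℂ (k + 3) × homogeneousSubmodule (Fin 3) ℂ k

instance (k : ℕ) : Module.Finite ℂ (homogeneousSubmodule (Fin 3) ℂ k) :=
  Module.Finite.iff_fg.2 (homogeneousSubmodule_fg _ _ k)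

theorem finrank_planeForms (k : ℕ) : Module.finrank ℂ (PlaneForms k) = (k + 3) ^ 2 + 2 := by
  rw [Module.finrank_prod, finrank_homogeneousSubmodule_three, finrank_homogeneousSubmodule_three]
  induction k with
  | zero => decide
  | succ k ih =>
    rw [Nat.choose_succ_succ' (k + 1 + 3 + 1), Nat.choose_succ_succ' (k + 1 + 1), Nat.choose_one_right,
      Nat.choose_one_right]
    rw [show k + 1 + 3 + 1 = k + 3 + 2 by ring, show k + 1 + 1 = k + 2 by ring]
    linarith

variable (F) in
/-- The restriction to the plane section. -/
noncomputable def planeMap : DRing F →+* QuadraticAlgebra Poly3 (planeRes 0 F) 0 where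
  toFun r := ⟨planeRes 0 r.re, planeRes 0 r.im⟩
  map_one' := by ext1 <;> simp [QuadraticAlgebra.re_one, QuadraticAlgebra.im_one]
  map_mul' r s := by ext1 <;> simp
  map_zero' := by ext1 <;> simp
  map_add' r s := by ext1 <;> simp

theorem dvd_of_planeMap_eq_zero {r : DRing F} (h : planeMap F r = 0) : ∃ x, r = inc F (X 3) * x := by
  obtain ⟨p, hp⟩ := X_sub_dvd_of_planeRes_eq_zero (congrArg QuadraticAlgebra.re h)
  obtain ⟨q, hq⟩ := X_sub_dvd_of_planeRes_eq_zero (congrArg QuadraticAlgebra.im h)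
  rw [C_0, zero_mul, sub_zero] at hp hq
  exact ⟨⟨p, q⟩, by ext1 <;> simp [hp, hq]⟩

variable (F) in
/-- The lift of a form on the plane section. -/
noncomputable def planeLift (k : ℕ) : PlaneForms k →ₗ[ℂ] DRing F :=
  { toFun := fun u => ⟨rename Fin.castSucc u.1.1, rename Fin.castSucc u.2.1⟩
    map_add' := fun u v => by ext1 <;> simp
    map_smul' := fun c u => by ext1 <;> simp }

theorem planeRes_rename (p : Poly3) : planeRes 0 (rename Fin.castSucc p) = p := by
  rw [planeRes, aeval_rename]
  conv_rhs => rw [← aeval_X_left_apply p]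
  congr 2
  funext i
  fin_cases i <;> simp

theorem planeMap_planeLift {k : ℕ} (u : PlaneForms k) : planeMap F (planeLift F k u) = ⟨u.1.1, u.2.1⟩ := by
  ext1
  · exact planeRes_rename _
  · exact planeRes_rename _

theorem hom_planeLift (hF : F.IsHomogeneous 6) {k : ℕ} (u : PlaneForms k) :
    (grading hF).Hom (k + 3) (planeLift F k u) :=
  (hom_iff hF).2 ⟨u.1.2.rename_isHomogeneous, Or.inr ⟨k, rfl, u.2.2.rename_isHomogeneous⟩⟩

/-- The form on the plane section of a homogeneous element. -/
theorem exists_planeForm {hF : F.IsHomogeneous 6} {k : ℕ} {r : DRing F} (h : (grading hF).Hom (k + 3) r) :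
    (planeMap F r).re.IsHomogeneous (k + 3) ∧ (planeMap F r).im.IsHomogeneous k := by
  obtain ⟨h1, h2⟩ := (hom_iff hF).1 h
  refine ⟨planeRes_isHomogeneous h1, ?_⟩
  rcases h2 with h2 | ⟨l, hl, h2⟩
  · have : (planeMap F r).im = planeRes 0 r.im := rfl
    rw [this, h2, map_zero]; exact isHomogeneous_zero _ _ _
  · obtain rfl : l = k := by omega
    exact planeRes_isHomogeneous h2

end DRing

theorem QuadraticAlgebra.star_mul_self_eq {T : Type*} [CommRing T] {f : T} (q x : QuadraticAlgebra T f 0) :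
    q * (star q * x) = q.norm • x := by
  ext1 <;> simp [QuadraticAlgebra.norm_eq] <;> ring

/-- The Koszul relation for two elements with coprime norms. -/
theorem QuadraticAlgebra.exists_of_mul_add_eq_zero {T : Type*} [CommRing T] [IsDomain T]
    [UniqueFactorizationMonoid T] {f : T} {p q u v : QuadraticAlgebra T f 0} (h : p * u + q * v = 0)
    (hcop : IsRelPrime p.norm q.norm) (hq : q.norm ≠ 0) :
    ∃ z, q.norm • z = star q * u ∧ u = q * z ∧ v = -(p * z) := by
  have hcan : ∀ x : QuadraticAlgebra T f 0, q.norm • x = 0 → x = 0 := fun x hx => by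
    ext1
    · exact (mul_eq_zero.1 (congrArg QuadraticAlgebra.re hx)).resolve_left hq
    · exact (mul_eq_zero.1 (congrArg QuadraticAlgebra.im hx)).resolve_left hq
  have h1 : p.norm • (star q * u) = q.norm • (-(star p * v)) := by
    rw [← star_mul_self_eq, ← star_mul_self_eq]
    linear_combination (star p * star q) * h
  have hre : q.norm ∣ (star q * u).re := hcop.symm.dvd_of_dvd_mul_left
    ⟨_, congrArg QuadraticAlgebra.re h1⟩
  have him : q.norm ∣ (star q * u).im := hcop.symm.dvd_of_dvd_mul_left
    ⟨_, congrArg QuadraticAlgebra.im h1⟩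
  obtain ⟨z₁, hz₁⟩ := hre
  obtain ⟨z₂, hz₂⟩ := him
  have hz : q.norm • (⟨z₁, z₂⟩ : QuadraticAlgebra T f 0) = star q * u := by
    ext1
    · exact hz₁.symm
    · exact hz₂.symm
  have hu : u = q * ⟨z₁, z₂⟩ := by
    refine sub_eq_zero.1 (hcan _ ?_)
    rw [smul_sub, ← mul_smul_comm, hz, star_mul_self_eq, sub_self]
  refine ⟨⟨z₁, z₂⟩, hz, hu, eq_neg_of_add_eq_zero_right (hcan _ ?_)⟩
  rw [← star_mul_self_eq]
  rw [hu] at h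
  linear_combination (star q) * h

theorem MvPolynomial.IsHomogeneous.of_mul_left {σ : Type*} {p q : MvPolynomial σ ℂ} {m n : ℕ} (hp0 : p ≠ 0)
    (hp : p.IsHomogeneous m) (h : (p * q).IsHomogeneous (m + n)) : q.IsHomogeneous n := by
  by_cases hq : q = 0
  · rw [hq]; exact isHomogeneous_zero _ _ _
  obtain ⟨k, l, hkl, h1, h2⟩ := h.of_mul (mul_ne_zero hp0 hq)
  have := h1.inj_right hp hp0
  obtain rfl : l = n := by omega
  exact h2

namespace DRing
variable {F : Poly4}

theorem planeMap_re (r : DRing F) : (planeMap F r).re = planeRes 0 r.re := rfl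
theorem planeMap_im (r : DRing F) : (planeMap F r).im = planeRes 0 r.im := rfl

theorem planeMap_smul (c : ℂ) (r : DRing F) : planeMap F (c • r) = c • planeMap F r := by
  ext1 <;> simp [planeMap_re, planeMap_im]

theorem planeMap_star (r : DRing F) : planeMap F (star r) = star (planeMap F r) := by
  ext1 <;> simp [planeMap_re, planeMap_im]

theorem norm_planeMap (r : DRing F) : (planeMap F r).norm = planeRes 0 r.norm := by
  simp [QuadraticAlgebra.norm_eq, planeMap_re, planeMap_im]

theorem hom_star {hF : F.IsHomogeneous 6} {r : DRing F} {n : ℕ} (h : (grading hF).Hom n r) :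
    (grading hF).Hom n (star r) := by
  obtain ⟨h1, h2⟩ := (hom_iff hF).1 h
  refine (hom_iff hF).2 ⟨by simpa using h1, ?_⟩
  rcases h2 with h2 | ⟨k, hk, h2⟩
  · left; simp [h2]
  · exact Or.inr ⟨k, hk, by simpa using h2.neg⟩

/-- Multiplication by a homogeneous element on the plane section. -/
noncomputable def planeMul {hF : F.IsHomogeneous 6} {n : ℕ} {g : DRing F} (hg : (grading hF).Hom n g) (k : ℕ) :
    PlaneForms k →ₗ[ℂ] PlaneForms (k + n) :=
  have h (u) : (grading hF).Hom (k + n + 3) (g * planeLift F k u) := by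
    have := hg.mul (hom_planeLift hF u)
    rwa [show n + (k + 3) = k + n + 3 by ring] at this
  { toFun := fun u => (⟨(planeMap F (g * planeLift F k u)).re, (exists_planeForm (h u)).1⟩,
      ⟨(planeMap F (g * planeLift F k u)).im, (exists_planeForm (h u)).2⟩)
    map_add' := fun u v => by
      ext1 <;> ext1 <;> simp only [map_add, mul_add] <;> rfl
    map_smul' := fun c u => by
      ext1 <;> ext1 <;> simp only [map_smul, mul_smul_comm, planeMap_smul] <;> rfl }

theorem planeMap_planeLift_planeMul {hF : F.IsHomogeneous 6} {n : ℕ} {g : DRing F} (hg : (grading hF).Hom n g)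
    {k : ℕ} (u : PlaneForms k) : planeMap F (planeLift F _ (planeMul hg k u)) =
      planeMap F g * planeMap F (planeLift F k u) := by
  rw [planeMap_planeLift, ← map_mul]; rfl

theorem planeForms_ext {k : ℕ} {u v : PlaneForms k}
    (h : planeMap F (planeLift F k u) = planeMap F (planeLift F k v)) : u = v := by
  rw [planeMap_planeLift, planeMap_planeLift] at h
  exact Prod.ext (Subtype.ext (congrArg QuadraticAlgebra.re h)) (Subtype.ext (congrArg QuadraticAlgebra.im h))

theorem finrank_ker_le {hF : F.IsHomogeneous 6} {n : ℕ} (hn : 0 < n) {g₁ g₂ : DRing F}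
    (h₁ : (grading hF).Hom n g₁) (h₂ : (grading hF).Hom n g₂)
    (hcop : IsRelPrime (planeRes 0 g₁.norm) (planeRes 0 g₂.norm)) (b : ℕ) :
    Module.finrank ℂ (LinearMap.ker ((planeMul h₁ (b + n)).coprod (planeMul h₂ (b + n)))) ≤
      Module.finrank ℂ (PlaneForms b) := by
  have hN2 : (planeRes 0 g₂.norm).IsHomogeneous (2 * n) := planeRes_isHomogeneous (Hom.norm hF h₂)
  have hN1 : (planeRes 0 g₁.norm).IsHomogeneous (2 * n) := planeRes_isHomogeneous (Hom.norm hF h₁)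
  have hne : planeRes 0 g₂.norm ≠ 0 := by
    intro h0
    rw [h0, isRelPrime_zero_right] at hcop
    exact hN1.not_isUnit (by omega) hcop
  let ν : PlaneForms b →ₗ[ℂ] PlaneForms (b + n) × PlaneForms (b + n) :=
    (planeMul h₂ b).prod (-planeMul h₁ b)
  refine le_trans (Submodule.finrank_mono ?_) (LinearMap.finrank_range_le ν)
  rintro ⟨u, v⟩ huv
  rw [LinearMap.mem_ker, LinearMap.coprod_apply] at huv
  have h := congrArg (fun w => planeMap F (planeLift F _ w)) huv
  simp only [map_add, map_zero, planeMap_planeLift_planeMul] at h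
  obtain ⟨z, hz, hu, hv⟩ := QuadraticAlgebra.exists_of_mul_add_eq_zero h (by rwa [norm_planeMap, norm_planeMap])
    (by rwa [norm_planeMap])
  rw [norm_planeMap, ← planeMap_star, ← map_mul] at hz
  have hh : (grading hF).Hom (b + 2 * n + 3) (star g₂ * planeLift F (b + n) u) := by
    have := (hom_star h₂).mul (hom_planeLift hF u)
    rwa [show n + (b + n + 3) = b + 2 * n + 3 by ring] at this
  obtain ⟨e1, e2⟩ := exists_planeForm hh
  rw [← hz] at e1 e2
  have hz1 : z.re.IsHomogeneous (b + 3) := hN2.of_mul_left hne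
    (by rw [show 2 * n + (b + 3) = b + 2 * n + 3 by ring]; exact e1)
  have hz2 : z.im.IsHomogeneous b := hN2.of_mul_left hne (by rw [add_comm]; exact e2)
  refine ⟨(⟨z.re, hz1⟩, ⟨z.im, hz2⟩), Prod.ext ?_ ?_⟩
  · apply planeForms_ext (F := F)
    rw [hu]
    exact (planeMap_planeLift_planeMul h₂ _).trans (by rw [planeMap_planeLift])
  · apply planeForms_ext (F := F)
    rw [hv]
    have := planeMap_planeLift_planeMul h₁ (⟨z.re, hz1⟩, ⟨z.im, hz2⟩)
    rw [planeMap_planeLift (F := F) (k := b)] at this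
    rw [← this, ← map_neg, ← map_neg]
    rfl

/-- Modulo two coprime elements and `X₃`, forms of given degree are spanned by `2n²` elements. -/
theorem exists_fin_span_plane {hF : F.IsHomogeneous 6} {n : ℕ} (hn : 0 < n) {g₁ g₂ : DRing F}
    (h₁ : (grading hF).Hom n g₁) (h₂ : (grading hF).Hom n g₂)
    (hcop : IsRelPrime (planeRes 0 g₁.norm) (planeRes 0 g₂.norm)) {m : ℕ} (hm : 2 * n + 3 ≤ m) :
    ∃ c : Fin (2 * n ^ 2) → DRing F, (∀ b, (grading hF).Hom m (c b)) ∧ ∀ r, (grading hF).Hom m r →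
      ∃ s ∈ Submodule.span ℂ (Set.range c), ∃ u v x, (grading hF).Hom (m - n) u ∧ (grading hF).Hom (m - n) v ∧
        r = s + g₁ * u + g₂ * v + inc F (X 3) * x := by
  obtain ⟨b, rfl⟩ : ∃ b, m = b + n + n + 3 := ⟨m - (2 * n + 3), by omega⟩
  let μ := (planeMul h₁ (b + n)).coprod (planeMul h₂ (b + n))
  have hk := finrank_ker_le hn h₁ h₂ hcop b
  have hr := LinearMap.finrank_range_add_finrank_ker μ
  rw [Module.finrank_prod, finrank_planeForms] at hr
  rw [finrank_planeForms] at hk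
  obtain ⟨c, hc⟩ := Submodule.exists_fin_span_add (LinearMap.range μ) (d := 2 * n ^ 2) (by
    rw [finrank_planeForms]
    nlinarith)
  refine ⟨fun i => planeLift F _ (c i), fun i => hom_planeLift hF _, fun r hr => ?_⟩
  obtain ⟨e1, e2⟩ := exists_planeForm hr
  obtain ⟨s, hs, _, ⟨⟨u, v⟩, rfl⟩, he⟩ := hc (⟨_, e1⟩, ⟨_, e2⟩)
  have hsub : b + n + n + 3 - n = b + n + 3 := by omega
  have hzero : planeMap F (r - planeLift F _ s - g₁ * planeLift F _ u - g₂ * planeLift F _ v) = 0 := by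
    have h := congrArg (fun w => planeMap F (planeLift F _ w)) he
    simp only [μ, LinearMap.coprod_apply, map_add, planeMap_planeLift_planeMul] at h
    rw [planeMap_planeLift] at h
    have h' : planeMap F r = _ := h
    rw [map_sub, map_sub, map_sub, map_mul, map_mul, h']
    ring
  obtain ⟨x, hx⟩ := dvd_of_planeMap_eq_zero hzero
  refine ⟨planeLift F _ s, ?_, planeLift F _ u, planeLift F _ v, x, by rw [hsub]; exact hom_planeLift hF u,
    by rw [hsub]; exact hom_planeLift hF v, by linear_combination hx⟩
  have := Submodule.mem_map_of_mem (f := planeLift F _) hs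
  rw [Submodule.map_span, ← Set.range_comp] at this
  exact this

end DRing

/-! ### Exclusion of point centres -/

theorem Prime.le_mul_of_pow_dvd_pow {A : Type*} [CommRing A] [IsDomain A] {π x : A} (hπ : Prime π) {a t N : ℕ}
    (hx : ¬ π ^ (a + 1) ∣ x) (h : π ^ N ∣ x ^ t) : N ≤ a * t := by
  induction t generalizing N with
  | zero =>
    by_contra hN
    rw [pow_zero] at h
    exact hπ.not_isUnit (isUnit_of_dvd_one ((dvd_pow_self π (by omega)).trans h))
  | succ t ih =>
    rcases le_or_gt N a with hN | hN
    · exact hN.trans (Nat.le_mul_of_pos_right a (Nat.succ_pos t))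
    · rw [pow_succ', ← Nat.sub_add_cancel hN.le] at h
      have := ih (hπ.pow_dvd_of_pow_add_dvd_mul hx h)
      rw [Nat.mul_succ]; omega

theorem sum_elim_le_of_injective {κ α β : Type*} [Fintype κ] [Fintype α] (i : κ → α ⊕ β)
    (hi : Function.Injective i) (h : α → ℕ) : ∑ k, Sum.elim h (fun _ => 0) (i k) ≤ ∑ x, h x := by
  classical
  have h1 : ∀ k, Sum.elim h (fun _ => 0) (i k) = ∑ x, if i k = Sum.inl x then h x else 0 := by
    intro k
    rcases hk : i k with x | y <;> simp
  simp only [h1]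
  rw [Finset.sum_comm]
  refine Finset.sum_le_sum fun x _ => ?_
  rw [← Finset.sum_filter, Finset.sum_const, smul_eq_mul]
  refine (Nat.mul_le_mul_right _ ?_).trans_eq (one_mul _)
  refine Finset.card_le_one.2 fun k hk l hl => hi ?_
  rw [(Finset.mem_filter.1 hk).2, (Finset.mem_filter.1 hl).2]

theorem sum_triangle (r : ℕ) :
    6 * ∑ s ∈ Finset.range (r + 1), ∑ i ∈ Finset.range (s + 1), i = r * (r + 1) * (r + 2) := by
  induction r with
  | zero => simp
  | succ r ih =>
    rw [Finset.sum_range_succ, mul_add, ih]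
    have := Finset.sum_range_id_mul_two (r + 1 + 1)
    rw [Nat.add_sub_cancel] at this
    linarith

theorem two_mul_card_jetIndex (r : ℕ) : 2 * Fintype.card (JetIndex r) = (r + 1) * (r + 2) := by
  have : Fintype.card (JetIndex r) = ∑ s : Fin (r + 1), (s + 1 : ℕ) :=
    (Fintype.card_sigma (α := fun s : Fin (r + 1) => Fin (s + 1))).trans (by simp)
  rw [this, Fin.sum_univ_eq_sum_range (fun s => s + 1), Finset.sum_add_distrib, mul_add, mul_comm,
    Finset.sum_range_id_mul_two]
  simp
  ring

namespace MaxSing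
variable {F : Poly4} {M n a : ℕ} {g₁ g₂ : DRing F} {ξ : Fin 4 → Poly4} {ω G π : Poly4}

/-- The value of `W` at the centre. -/
theorem exists_dvd_ω_sub (S : MaxSing F M n a g₁ g₂ ξ ω G π) (hξ : ∀ i, i ≠ 0 → π ∣ ξ i) :
    ∃ w : ℂ, w ^ 2 = aeval (Pi.single 0 1 : Fin 4 → ℂ) F ∧ π ∣ ω - C w * ξ 0 ^ 3 := by
  obtain ⟨w, hw⟩ := IsAlgClosed.exists_pow_nat_eq (eval (Pi.single 0 1 : Fin 4 → ℂ) F) (n := 2) (by norm_num)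
  have h := dvd_aeval_sub_eval (hξ 1 (by decide)) (hξ 2 (by decide)) (hξ 3 (by decide)) S.hF
  rw [← S.sq, ← hw, C_pow] at h
  have h1 : π ∣ (ω - C w * ξ 0 ^ 3) * (ω - C (-w) * ξ 0 ^ 3) := by
    convert h using 1
    rw [C_neg]; ring
  rcases S.prime.dvd_or_dvd h1 with h2 | h2
  · exact ⟨w, hw, h2⟩
  · exact ⟨-w, by rw [neg_sq]; exact hw, h2⟩

theorem dvd_Ψ_sub (S : MaxSing F M n a g₁ g₂ ξ ω G π) (hξ : ∀ i, i ≠ 0 → π ∣ ξ i) {w : ℂ}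
    (hw : w ^ 2 = aeval (Pi.single 0 1 : Fin 4 → ℂ) F) (hω : π ∣ ω - C w * ξ 0 ^ 3) {r : DRing F} {d : ℕ}
    (hr : (DRing.grading S.hF).Hom d r) :
    π ∣ S.Ψ r - C (DRing.evalHom _ w hw r) * ξ 0 ^ d := by
  have h := fun {p : Poly4} {d : ℕ} (hp : p.IsHomogeneous d) =>
    dvd_aeval_sub_eval (hξ 1 (by decide)) (hξ 2 (by decide)) (hξ 3 (by decide)) hp
  have hae : ∀ p, aeval (Pi.single 0 1 : Fin 4 → ℂ) p = eval (Pi.single 0 1) p := fun p => rfl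
  obtain ⟨h1, h2⟩ := (DRing.hom_iff S.hF).1 hr
  rw [DRing.evalHom_apply, DRing.evalHom_apply, hae, hae]
  rcases h2 with h2 | ⟨k, rfl, h2⟩
  · simpa [h2] using h h1
  · have e := dvd_add (h h1) (dvd_add ((h h2).mul_left ω) (hω.mul_right (C (eval (Pi.single 0 1) r.im) * ξ 0 ^ k)))
    convert e using 1
    rw [C_add, C_mul]
    ring

theorem not_dvd_ξ_zero (S : MaxSing F M n a g₁ g₂ ξ ω G π) (hξ : ∀ i, i ≠ 0 → π ∣ ξ i) : ¬ π ∣ ξ 0 := by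
  intro h
  obtain ⟨k, hk⟩ := S.exists_not_dvd
  by_cases h0 : k = 0
  · exact hk (h0 ▸ h)
  · exact hk (hξ k h0)

/-- Independent jets have a determinant prime to `π`. -/
theorem not_dvd_det_jets (S : MaxSing F M n a g₁ g₂ ξ ω G π) (hξ : ∀ i, i ≠ 0 → π ∣ ξ i) {w : ℂ}
    (hw : w ^ 2 = aeval (Pi.single 0 1 : Fin 4 → ℂ) F) (hω : π ∣ ω - C w * ξ 0 ^ 3) {r m : ℕ}
    (f : JetIndex r → DRing F) (hf : ∀ k, (DRing.grading S.hF).Hom m (f k))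
    (hli : LinearIndependent ℂ fun k (x : JetIndex r) =>
      DRing.evalHom _ w hw (jetOp DRing.planeDer₁ DRing.planeDer₂ x (f k))) :
    ¬ π ∣ (Matrix.of fun x k => S.Ψ (jetOp DRing.planeDer₁ DRing.planeDer₂ x (f k)) :
      Matrix (JetIndex r) (JetIndex r) Poly4).det := by
  have hpr := S.isPrime_span
  choose d hd using fun x : JetIndex r => DRing.hom_jetOp (hF := S.hF) m x
  let A : Matrix (JetIndex r) (JetIndex r) ℂ := Matrix.of fun x k =>
    DRing.evalHom _ w hw (jetOp DRing.planeDer₁ DRing.planeDer₂ x (f k))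
  have hA : A.det ≠ 0 := by
    have h1 : IsUnit A := (Matrix.linearIndependent_cols_iff_isUnit (A := A)).1 hli
    exact ((Matrix.isUnit_iff_isUnit_det A).1 h1).ne_zero
  let q := Ideal.Quotient.mk (Ideal.span {π})
  intro h
  rw [← Ideal.Quotient.eq_zero_iff_dvd, RingHom.map_det] at h
  have hmat : q.mapMatrix (Matrix.of fun x k => S.Ψ (jetOp DRing.planeDer₁ DRing.planeDer₂ x (f k))) =
      Matrix.diagonal (fun x => q (ξ 0 ^ d x)) * (q.comp C).mapMatrix A := by
    ext1 x k
    rw [Matrix.diagonal_mul]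
    have h2 := S.dvd_Ψ_sub hξ hw hω (hd x (f k) (hf k))
    rw [← Ideal.Quotient.eq_zero_iff_dvd, map_sub, sub_eq_zero] at h2
    refine h2.trans ?_
    rw [map_mul, mul_comm]; rfl
  rw [hmat, Matrix.det_mul, Matrix.det_diagonal, ← RingHom.map_det] at h
  rcases mul_eq_zero.1 h with h2 | h2
  · obtain ⟨x, -, hx⟩ := Finset.prod_eq_zero_iff.1 h2
    rw [Ideal.Quotient.eq_zero_iff_dvd] at hx
    exact S.not_dvd_ξ_zero hξ (S.prime.dvd_of_dvd_pow hx)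
  · exact hA ((q.comp C).injective (h2.trans (map_zero _).symm))

end MaxSing

namespace DRing
variable {F : Poly4}

/-- Forms of degree `24n` are spanned, modulo `X₃` and products of four of the `gᵢ`, by products of
fewer `gᵢ` with few other forms. -/
theorem mem_span_products {hF : F.IsHomogeneous 6} {n : ℕ} (hn : 0 < n) {g₁ g₂ : DRing F}
    (h₁ : (grading hF).Hom n g₁) (h₂ : (grading hF).Hom n g₂)
    (hcop : IsRelPrime (planeRes 0 g₁.norm) (planeRes 0 g₂.norm)) :
    ∃ c : Fin 4 → Fin (2 * n ^ 2) → DRing F, (∀ (j : Fin 4) b, (grading hF).Hom (24 * n - j * n) (c j b)) ∧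
      ∀ r, (grading hF).Hom (24 * n) r → r ∈ Submodule.span ℂ (Set.range
          fun x : (Σ j : Fin 4, Fin (j + 1) × Fin (2 * n ^ 2)) =>
            g₁ ^ (x.2.1 : ℕ) * g₂ ^ (x.1 - x.2.1 : ℕ) * c x.1 x.2.2) ⊔
        (Ideal.span {inc F (X 3)}).restrictScalars ℂ ⊔
        Submodule.span ℂ {f | ∃ p q u, p + q = 4 ∧ (grading hF).Hom (24 * n - 4 * n) u ∧ f = g₁ ^ p * g₂ ^ q * u} := by
  choose c hc hspan using fun j : Fin 4 => exists_fin_span_plane hn h₁ h₂ hcop (m := 24 * n - j * n) (by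
    have : (j : ℕ) * n ≤ 3 * n := Nat.mul_le_mul_right n (Nat.lt_succ_iff.1 j.2)
    omega)
  refine ⟨c, hc, fun r hr => ?_⟩
  set U := Submodule.span ℂ (Set.range fun x : (Σ j : Fin 4, Fin (j + 1) × Fin (2 * n ^ 2)) =>
    g₁ ^ (x.2.1 : ℕ) * g₂ ^ (x.1 - x.2.1 : ℕ) * c x.1 x.2.2) ⊔
    (Ideal.span {inc F (X 3)}).restrictScalars ℂ with hU
  have key : ∀ i, i ≤ 4 → r ∈ U ⊔ Submodule.span ℂ
      {f | ∃ p q u, p + q = i ∧ (grading hF).Hom (24 * n - i * n) u ∧ f = g₁ ^ p * g₂ ^ q * u} := by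
    intro i hi
    induction i with
    | zero => exact Submodule.mem_sup_right (Submodule.subset_span ⟨0, 0, r, rfl, by simpa using hr, by simp⟩)
    | succ i ih =>
      refine (sup_le le_sup_left (Submodule.span_le.2 ?_) : U ⊔ _ ≤ _) (ih (by omega))
      rintro _ ⟨p, q, u, hpq, hu, rfl⟩
      obtain ⟨s, hs, u', v', x, hu', hv', rfl⟩ := hspan ⟨i, by omega⟩ u hu
      have hdeg : 24 * n - i * n - n = 24 * n - (i + 1) * n := by
        rw [Nat.add_mul, one_mul]; omega
      simp only [hdeg] at hu' hv'
      have e1 : g₁ ^ p * g₂ ^ q * s ∈ U := by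
        refine Submodule.mem_sup_left ?_
        have := Submodule.mem_map_of_mem (f := LinearMap.mulLeft ℂ (g₁ ^ p * g₂ ^ q)) hs
        rw [Submodule.map_span, ← Set.range_comp] at this
        refine Submodule.span_mono ?_ this
        rintro _ ⟨b, rfl⟩
        refine ⟨⟨⟨i, by omega⟩, ⟨p, by simp; omega⟩, b⟩, ?_⟩
        simp [← hpq, mul_assoc]
      have e2 : inc F (X 3) * (g₁ ^ p * g₂ ^ q * x) ∈ U :=
        Submodule.mem_sup_right (Ideal.mul_mem_right _ _ (Ideal.mem_span_singleton_self _))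
      have e3 : g₁ ^ (p + 1) * g₂ ^ q * u' ∈ Submodule.span ℂ {f | ∃ p q u, p + q = i + 1 ∧
          (grading hF).Hom (24 * n - (i + 1) * n) u ∧ f = g₁ ^ p * g₂ ^ q * u} :=
        Submodule.subset_span ⟨p + 1, q, u', by omega, hu', rfl⟩
      have e4 : g₁ ^ p * g₂ ^ (q + 1) * v' ∈ Submodule.span ℂ {f | ∃ p q u, p + q = i + 1 ∧
          (grading hF).Hom (24 * n - (i + 1) * n) u ∧ f = g₁ ^ p * g₂ ^ q * u} :=
        Submodule.subset_span ⟨p, q + 1, v', by omega, hv', rfl⟩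
      have := Submodule.add_mem _ (Submodule.mem_sup_left (Submodule.add_mem _ e1 e2))
        (Submodule.mem_sup_right (Submodule.add_mem _ e3 e4))
      have e5 : g₁ ^ p * g₂ ^ q * (s + g₁ * u' + g₂ * v' + inc F (X 3) * x) =
          g₁ ^ p * g₂ ^ q * s + inc F (X 3) * (g₁ ^ p * g₂ ^ q * x) +
            (g₁ ^ (p + 1) * g₂ ^ q * u' + g₁ ^ p * g₂ ^ (q + 1) * v') := by ring
      rw [SetLike.mem_coe, e5]
      exact this
  exact key 4 le_rfl

/-- The jet of an element at a point of the plane section. -/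
noncomputable def jetMap (e : DRing F →ₐ[ℂ] ℂ) (r : ℕ) : DRing F →ₗ[ℂ] (JetIndex r → ℂ) :=
  LinearMap.pi fun x => e.toLinearMap ∘ₗ
    (((planeDer₁ (F := F)).toLinearMap ^ ((ofLex x).2 : ℕ)) ∘ₗ
      ((planeDer₂ (F := F)).toLinearMap ^ ((ofLex x).1 - (ofLex x).2 : ℕ)))

theorem jetMap_apply (e : DRing F →ₐ[ℂ] ℂ) (r : ℕ) (f : DRing F) :
    jetMap e r f = fun x => e (jetOp planeDer₁ planeDer₂ x f) := by
  funext x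
  simp [jetMap, jetOp, Module.End.pow_apply]

theorem jetMap_X_three_mul {e : DRing F →ₐ[ℂ] ℂ} (he : e (inc F (X 3)) = 0) (r : ℕ) (f : DRing F) :
    jetMap e r (inc F (X 3) * f) = 0 := by
  have hD : ∀ (D : Derivation ℂ (DRing F) (DRing F)), D (inc F (X 3)) = 0 → ∀ m f,
      D^[m] (inc F (X 3) * f) = inc F (X 3) * D^[m] f := by
    intro D h0 m
    induction m with
    | zero => intro f; rfl
    | succ m ih =>
      intro f
      rw [Function.iterate_succ_apply, Derivation.leibniz, h0, smul_zero, add_zero, smul_eq_mul, ih]; rfl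
  rw [jetMap_apply]
  funext x
  rw [jetOp, hD _ (by ext1 <;> simp [planeDer₂_apply, pderiv_X]), hD _ (by ext1 <;> simp [planeDer₁_apply, pderiv_X]),
    map_mul, he, zero_mul]
  rfl

/-- Jets at a point where `F₂` does not vanish are attained by forms. -/
theorem span_jetMap_eq_top (hF : F.IsHomogeneous 6) {w : ℂ} (hw : w ^ 2 = aeval (Pi.single 0 1 : Fin 4 → ℂ) F)
    (hF2 : eval (Pi.single 0 1) (pderiv 2 F) ≠ 0) {r m : ℕ} (hm : 3 * r ≤ m) :
    Submodule.span ℂ (jetMap (evalHom _ w hw) r '' {f | (grading hF).Hom m f}) = ⊤ := by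
  have htop := span_jets_eq_top (d₁ := planeDer₁) (d₂ := planeDer₂) (e := evalHom _ w hw)
    (y₁ := inc F (X 1)) (y₂ := W F - w • inc F (X 0 ^ 3)) (fun p q => inc F (X 0 ^ (m - p - 3 * q)))
    (fun p q => by simp) (by simp) (by simp) (by simp [evalHom_apply, planeDer₁_apply, pderiv_X, hF2])
    (by simp [evalHom_apply, planeDer₂_apply, pderiv_X])
    (by simp [evalHom_apply, planeDer₁_apply, pderiv_X, Derivation.leibniz_pow, -map_pow])
    (by simp [evalHom_apply, planeDer₂_apply, pderiv_X, Derivation.leibniz_pow, hF2, -map_pow]) r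
  rw [eq_top_iff, ← htop]
  refine Submodule.span_mono ?_
  rintro _ ⟨f, ⟨p, q, hpq, rfl⟩, rfl⟩
  refine ⟨_, ?_, jetMap_apply _ _ _⟩
  have h1 : (grading hF).Hom 1 (inc F (X 1)) := hom_inc hF (isHomogeneous_X _ _)
  have h2 : (grading hF).Hom 3 (W F - w • inc F (X 0 ^ 3)) := by
    refine (hom_W hF).sub ?_
    rw [← map_smul, smul_eq_C_mul]
    exact hom_inc hF ((isHomogeneous_X_pow _ _).C_mul w)
  have := (h1.pow p).mul ((h2.pow q).mul (hom_inc hF (isHomogeneous_X_pow (0 : Fin 4) (m - p - 3 * q))))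
  rwa [show p * 1 + (q * 3 + (m - p - 3 * q)) = m by omega] at this

end DRing

namespace MaxSing
variable {F : Poly4} {M n a : ℕ} {g₁ g₂ : DRing F} {ξ : Fin 4 → Poly4} {ω G π : Poly4}

/-- A family of forms with independent jets and high total order of vanishing. -/
theorem exists_jet_family (S : MaxSing F M n a g₁ g₂ ξ ω G π)
    (hcop : IsRelPrime (planeRes 0 g₁.norm) (planeRes 0 g₂.norm)) {w : ℂ}
    (hw : w ^ 2 = aeval (Pi.single 0 1 : Fin 4 → ℂ) F) (hF2 : eval (Pi.single 0 1) (pderiv 2 F) ≠ 0) :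
    ∃ (f : JetIndex (8 * n) → DRing F) (v : JetIndex (8 * n) → ℕ),
      (∀ k, (DRing.grading S.hF).Hom (24 * n) (f k)) ∧ (∀ k, π ^ (v k * (n * a + 1)) ∣ S.Ψ (f k)) ∧
      LinearIndependent ℂ (fun k (x : JetIndex (8 * n)) =>
        DRing.evalHom _ w hw (jetOp DRing.planeDer₁ DRing.planeDer₂ x (f k))) ∧
      4 * Fintype.card (JetIndex (8 * n)) ≤ ∑ k, v k + 40 * n ^ 2 := by
  obtain ⟨c, hc, hspan⟩ := DRing.mem_span_products S.n_pos S.hom₁ S.hom₂ hcop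
  let J := DRing.jetMap (DRing.evalHom _ w hw) (8 * n)
  let ι := Σ j : Fin 4, Fin (j + 1) × Fin (2 * n ^ 2)
  let β := {b : DRing F // (DRing.grading S.hF).Hom (24 * n) b ∧ π ^ (4 * (n * a + 1)) ∣ S.Ψ b}
  let φ : ι ⊕ β → DRing F := Sum.elim
    (fun x => g₁ ^ (x.2.1 : ℕ) * g₂ ^ (x.1 - x.2.1 : ℕ) * c x.1 x.2.2) Subtype.val
  let wt : ι ⊕ β → ℕ := Sum.elim (fun x => x.1) fun _ => 4
  have hprod : ∀ p q u, (DRing.grading S.hF).Hom (24 * n - (p + q) * n) u → p + q ≤ 4 →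
      (DRing.grading S.hF).Hom (24 * n) (g₁ ^ p * g₂ ^ q * u) ∧
      π ^ ((p + q) * (n * a + 1)) ∣ S.Ψ (g₁ ^ p * g₂ ^ q * u) := by
    intro p q u hu hpq
    have h4 := Nat.mul_le_mul_right n hpq
    refine ⟨?_, ?_⟩
    · have := ((S.hom₁.pow p).mul (S.hom₂.pow q)).mul hu
      rwa [← add_mul, Nat.add_sub_cancel' (by omega)] at this
    · rw [map_mul, map_mul, map_pow, map_pow, add_mul, pow_add, mul_comm p, mul_comm q, pow_mul, pow_mul]
      exact (mul_dvd_mul (pow_dvd_pow_of_dvd S.dvd₁ p) (pow_dvd_pow_of_dvd S.dvd₂ q)).mul_right _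
  have hφ : ∀ i, (DRing.grading S.hF).Hom (24 * n) (φ i) ∧ π ^ (wt i * (n * a + 1)) ∣ S.Ψ (φ i) := by
    rintro (⟨j, α, b⟩ | b)
    · have hα := Nat.lt_succ_iff.1 α.2
      have e : (α : ℕ) + (j - α : ℕ) = j := by omega
      have := hprod α (j - α) (c j b) (by rw [e]; exact hc j b) (by omega)
      rwa [e] at this
    · exact b.2
  have hJ : Submodule.span ℂ (Set.range (J ∘ φ)) = ⊤ := by
    rw [eq_top_iff, ← DRing.span_jetMap_eq_top S.hF hw hF2 (r := 8 * n) (m := 24 * n) (by omega), Submodule.span_le]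
    rintro _ ⟨f, hf, rfl⟩
    refine (?_ : Submodule.map J _ ≤ _) (Submodule.mem_map_of_mem (hspan f hf))
    rw [Submodule.map_sup, Submodule.map_sup, Submodule.map_span, Submodule.map_span]
    refine sup_le (sup_le (Submodule.span_mono ?_) ?_) (Submodule.span_mono ?_)
    · rintro _ ⟨_, ⟨x, rfl⟩, rfl⟩
      exact ⟨Sum.inl x, rfl⟩
    · rintro _ ⟨x, hx, rfl⟩
      obtain ⟨y, rfl⟩ := Ideal.mem_span_singleton.1 hx
      rw [DRing.jetMap_X_three_mul (by simp)]
      exact Submodule.zero_mem _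
    · rintro _ ⟨_, ⟨p, q, u, hpq, hu, rfl⟩, rfl⟩
      have := hprod p q u (by rw [hpq]; exact hu) hpq.le
      rw [hpq] at this
      exact ⟨Sum.inr ⟨_, this⟩, rfl⟩
  obtain ⟨κ, i, hi, hsp, hli⟩ := exists_linearIndependent' ℂ (J ∘ φ)
  let b := Module.Basis.mk hli (by rw [hsp, hJ])
  let ε : JetIndex (8 * n) ≃ κ := (Pi.basisFun ℂ _).indexEquiv b
  refine ⟨fun k => φ (i (ε k)), fun k => wt (i (ε k)), fun k => (hφ _).1, fun k => (hφ _).2, ?_, ?_⟩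
  · have := hli.comp ε ε.injective
    simp only [Function.comp_def, J, DRing.jetMap_apply] at this
    exact this
  · have h1 := sum_elim_le_of_injective (fun k => i (ε k)) (hi.comp ε.injective) (fun x : ι => 4 - (x.1 : ℕ))
    have h2 : ∑ x : ι, (4 - (x.1 : ℕ)) = 40 * n ^ 2 := by
      rw [Fintype.sum_sigma]
      simp [Fin.sum_univ_four]
      ring
    rw [h2] at h1
    refine le_trans ?_ (Nat.add_le_add_left h1 _)
    rw [← Finset.sum_add_distrib, mul_comm, ← smul_eq_mul, ← Finset.card_univ, ← Finset.sum_const]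
    refine Finset.sum_le_sum fun k _ => ?_
    rcases i (ε k) with x | y
    · simp [wt]
    · simp [wt]

/-- No divisor is centred at a point. -/
theorem false_of_point (S : MaxSing F M n a g₁ g₂ ξ ω G π) (hξ : ∀ i, i ≠ 0 → π ∣ ξ i)
    (hcop : IsRelPrime (planeRes 0 g₁.norm) (planeRes 0 g₂.norm))
    (hF2 : eval (Pi.single 0 1) (pderiv 2 F) ≠ 0) : False := by
  obtain ⟨w, hw, hω⟩ := S.exists_dvd_ω_sub hξ
  have hF2' : ¬ π ∣ aeval ξ (pderiv 2 F) := by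
    intro h
    have h1 := dvd_aeval_sub_eval (hξ 1 (by decide)) (hξ 2 (by decide)) (hξ 3 (by decide)) (S.hF.pderiv (i := 2))
    rcases S.prime.dvd_or_dvd ((dvd_sub_right h).1 h1) with h2 | h2
    · exact S.prime.not_isUnit (isUnit_of_dvd_unit h2 ((IsUnit.mk0 _ hF2).map C))
    · exact S.not_dvd_ξ_zero hξ (S.prime.dvd_of_dvd_pow h2)
  obtain ⟨E₁, E₂, hl₁, hl₂, h10, h13, h20, h23, h21, hκ⟩ := S.exists_log_pair (hξ 3 (by decide)) hF2'
  obtain ⟨f, v, hf, hv, hli, hcard⟩ := S.exists_jet_family hcop hw hF2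
  let s := aeval ξ (pderiv 2 F) ^ 2
  have hd := pow_sum_dvd_of_jets (Ψ := S.Ψ) (E₁ := s • E₁) (E₂ := s • E₂) (κ₁ := E₁ (ξ 1)) (κ₂ := E₂ ω)
    (μ := E₁ ω) DRing.planeDer₂_planeDer₁ (S.sq_mul_derivation h10 h13)
    (fun r => (S.sq_mul_derivation h20 h23 r).trans (by rw [h21, zero_mul, zero_add])) S.prime
    (hl₁.mul_left s) (hl₂.mul_left s) f (fun k => v k * (n * a + 1)) hv (S.not_dvd_det_jets hξ hw hω f hf hli)
  have h1 := S.prime.le_mul_of_pow_dvd_pow hκ hd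
  rw [← Finset.sum_mul] at h1
  have h2 := sum_triangle (8 * n)
  have h3 := two_mul_card_jetIndex (8 * n)
  have hn := S.n_pos
  generalize (∑ s ∈ Finset.range (8 * n + 1), ∑ i ∈ Finset.range (s + 1), i) = t at *
  generalize (∑ k, v k) = V at *
  generalize Fintype.card (JetIndex (8 * n)) = N at *
  have h4 : 88 * n ^ 2 + 48 * n + 4 ≤ V := by nlinarith
  have h5 : (88 * n ^ 2 + 48 * n + 4) * (n * a + 1) ≤ a * t := (Nat.mul_le_mul_right _ h4).trans h1
  have h6 : 6 * (a * t) = a * (8 * n * (8 * n + 1) * (8 * n + 2)) := by rw [← h2]; ring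
  have h7 : 6 * ((88 * n ^ 2 + 48 * n + 4) * (n * a + 1)) =
      a * (8 * n * (8 * n + 1) * (8 * n + 2)) + (16 * n ^ 3 * a + 96 * n ^ 2 * a + 8 * n * a +
        6 * (88 * n ^ 2 + 48 * n + 4)) := by ring
  omega

end MaxSing

theorem RatParam.false_of_smooth {F : Poly4} (D : RatParam F)
    (hsm : ∀ v : Fin 4 → ℂ, (∀ i, eval v (pderiv i F) = 0) → v = 0) : False := by
  obtain ⟨n, a, g₁, g₂, G, π, S⟩ := D.exists_maxSing hsm
  obtain ⟨F', g₁', g₂', ξ', G', S', hξ, hcop, hF2⟩ := S.exists_point_coordinates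
  exact S'.false_of_point hξ hcop hF2

/-! ### Rational parametrizations from isomorphisms of function fields -/

/-- Dehomogenization as a homomorphism. -/
noncomputable def dehomHom : Poly4 →ₐ[ℂ] Poly3 := aeval (Fin.cases 1 X)

theorem aeval_dehomHom {A : Type*} [CommRing A] [Algebra ℂ A] (x : Fin 3 → A) (p : Poly4) :
    aeval x (dehomHom p) = aeval (Fin.cons 1 x : Fin 4 → A) p := by
  rw [dehomHom, comp_aeval_apply]
  congr 2
  funext i
  refine Fin.cases ?_ (fun i => ?_) i <;> simp

theorem eq_zero_of_dehomHom {p : Poly4} {d : ℕ} (hp : p.IsHomogeneous d) (h : dehomHom p = 0) : p = 0 := by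
  let K := FractionRing Poly4
  let τ : Fin 4 → K := fun i => algebraMap Poly4 K (X i)
  have h0 : τ 0 ≠ 0 := (map_ne_zero_iff _ (IsFractionRing.injective Poly4 K)).2 (X_ne_zero 0)
  have h1 := aeval_mul_of_isHomogeneous hp (Fin.cons 1 (fun i => τ (Fin.succ i) / τ 0) : Fin 4 → K) (τ 0)
  rw [← aeval_dehomHom, h, map_zero, zero_mul] at h1
  have h2 : (fun i => (Fin.cons 1 (fun i => τ (Fin.succ i) / τ 0) : Fin 4 → K) i * τ 0) = τ := by
    funext i
    refine Fin.cases ?_ (fun i => ?_) i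
    · simp
    · simp [div_mul_cancel₀ _ h0]
  rw [h2] at h1
  have h3 := aeval_algebraMap_apply K (X : Fin 4 → Poly4) p
  rw [aeval_X_left_apply] at h3
  exact (map_eq_zero_iff _ (IsFractionRing.injective Poly4 K)).1 (h3.symm.trans h1)

theorem exists_homogenization (p : Poly3) :
    ∃ N₀, ∀ N ≥ N₀, ∃ q : Poly4, q.IsHomogeneous N ∧ dehomHom q = p := by
  induction p using MvPolynomial.induction_on with
  | C c => exact ⟨0, fun N _ => ⟨C c * X 0 ^ N, (isHomogeneous_X_pow _ _).C_mul c, by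
      simp [dehomHom, algHom_C, algebraMap_eq]⟩⟩
  | add p q hp hq =>
    obtain ⟨a, ha⟩ := hp
    obtain ⟨b, hb⟩ := hq
    refine ⟨max a b, fun N hN => ?_⟩
    obtain ⟨p', hp', rfl⟩ := ha N (le_of_max_le_left hN)
    obtain ⟨q', hq', rfl⟩ := hb N (le_of_max_le_right hN)
    exact ⟨p' + q', hp'.add hq', map_add _ _ _⟩
  | mul_X p i hp =>
    obtain ⟨a, ha⟩ := hp
    refine ⟨a + 1, fun N hN => ?_⟩
    obtain ⟨p', hp', rfl⟩ := ha (N - 1) (by omega)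
    refine ⟨p' * X i.succ, ?_, by simp [dehomHom]⟩
    have := hp'.mul (isHomogeneous_X ℂ i.succ)
    rwa [Nat.sub_add_cancel (by omega)] at this

namespace DRing
variable {F : Poly4} {L : Type*} [Field L] [Algebra ℂ L] {x : Fin 3 → L} {w : L}

theorem exists_hom_evalHom_eq (hF : F.IsHomogeneous 6) (hw : w ^ 2 = aeval (Fin.cons 1 x : Fin 4 → L) F) (p : Poly4) :
    ∃ N₀, ∀ N ≥ N₀, ∃ r : DRing F, (grading hF).Hom N r ∧
      evalHom _ w hw r = aeval (Fin.snoc x w : Fin 4 → L) p := by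
  induction p using MvPolynomial.induction_on with
  | C c => exact ⟨0, fun N _ => ⟨inc F (C c * X 0 ^ N), hom_inc hF ((isHomogeneous_X_pow _ _).C_mul c), by
      rw [evalHom_inc]; simp⟩⟩
  | add p q hp hq =>
    obtain ⟨a, ha⟩ := hp
    obtain ⟨b, hb⟩ := hq
    refine ⟨max a b, fun N hN => ?_⟩
    obtain ⟨p', hp', h1⟩ := ha N (le_of_max_le_left hN)
    obtain ⟨q', hq', h2⟩ := hb N (le_of_max_le_right hN)
    exact ⟨p' + q', hp'.add hq', by rw [map_add, map_add, h1, h2]⟩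
  | mul_X p i hp =>
    obtain ⟨a, ha⟩ := hp
    refine ⟨a + 3, fun N hN => ?_⟩
    refine Fin.lastCases ?_ (fun i => ?_) i
    · obtain ⟨p', hp', h⟩ := ha (N - 3) (by omega)
      have := hp'.mul (hom_W hF)
      rw [Nat.sub_add_cancel (by omega)] at this
      exact ⟨_, this, by rw [map_mul, map_mul, h, evalHom_W, aeval_X, Fin.snoc_last]⟩
    · obtain ⟨p', hp', h⟩ := ha (N - 1) (by omega)
      have := hp'.mul (hom_inc hF (isHomogeneous_X ℂ i.succ))
      rw [Nat.sub_add_cancel (by omega)] at this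
      exact ⟨_, this, by rw [map_mul, map_mul, h, evalHom_inc, aeval_X, aeval_X, Fin.snoc_castSucc, Fin.cons_succ]⟩

theorem evalHom_scale (hF : F.IsHomogeneous 6) {y y' : Fin 4 → L} {w' s : L} (hw : w ^ 2 = aeval y F)
    (hw' : w' ^ 2 = aeval y' F) (hy : ∀ i, y' i = y i * s) (hs : w' = w * s ^ 3) {r : DRing F} {d : ℕ}
    (hr : (grading hF).Hom d r) : evalHom y' w' hw' r = evalHom y w hw r * s ^ d := by
  obtain rfl : y' = fun i => y i * s := funext hy
  obtain ⟨h1, h2⟩ := (hom_iff hF).1 hr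
  rw [evalHom_apply, evalHom_apply, aeval_mul_of_isHomogeneous h1, hs]
  rcases h2 with h2 | ⟨k, rfl, h2⟩
  · simp [h2]
  · rw [aeval_mul_of_isHomogeneous h2]; ring

end DRing

/-- A homogeneous parametrization without common factors. -/
theorem exists_homogeneous_param {F : Poly4} (hF : F.IsHomogeneous 6) {x : Fin 3 → CRatFunc 3} {w : CRatFunc 3}
    (hw : w ^ 2 = aeval (Fin.cons 1 x : Fin 4 → CRatFunc 3) F) :
    ∃ (M : ℕ) (ξ : Fin 4 → Poly4) (ω : Poly4) (s : CRatFunc 3), s ≠ 0 ∧ (∀ i, (ξ i).IsHomogeneous M) ∧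
      ω.IsHomogeneous (3 * M) ∧ ω ^ 2 = aeval ξ F ∧ (∀ p, Prime p → ∃ k, ¬ p ∣ ξ k) ∧
      (∀ i, algebraMap _ (CRatFunc 3) (dehomHom (ξ i)) = (Fin.cons 1 x : Fin 4 → CRatFunc 3) i * s) ∧
      algebraMap _ (CRatFunc 3) (dehomHom ω) = w * s ^ 3 := by
  let T := Poly3
  let ι := algebraMap T (CRatFunc 3)
  have hι : Function.Injective ι := IsFractionRing.injective T (CRatFunc 3)
  let y : Fin 4 → CRatFunc 3 := Fin.cons 1 x
  obtain ⟨⟨p₀, hp₀⟩, hp⟩ := IsLocalization.exist_integer_multiples_of_finite (nonZeroDivisors T) y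
  choose p hp using hp
  replace hp : ∀ i, ι (p i) = y i * ι p₀ := fun i => by
    rw [mul_comm, ← Algebra.smul_def]; exact hp i
  have hp₀0 : ι p₀ ≠ 0 := (map_ne_zero_iff _ hι).2 (nonZeroDivisors.ne_zero hp₀)
  have hpF : ι (aeval p F) = (w * ι p₀ ^ 3) ^ 2 := by
    have h1 : ι (aeval p F) = aeval (fun i => ι (p i)) F := (aeval_algebraMap_apply (CRatFunc 3) p F).symm
    rw [h1, funext hp, aeval_mul_of_isHomogeneous hF, ← hw]; ring
  obtain ⟨q, hq⟩ : ∃ q, ι q = w * ι p₀ ^ 3 :=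
    IsIntegrallyClosed.exists_algebraMap_eq_of_isIntegral_pow (n := 2) (by norm_num)
      (by rw [← hpF]; exact isIntegral_algebraMap)
  have hqF : q ^ 2 = aeval p F := hι (by rw [map_pow, hq, hpF])
  choose N₀ hN₀ using fun i => exists_homogenization (p i)
  obtain ⟨Nq, hNq⟩ := exists_homogenization q
  let N := N₀ 0 + N₀ 1 + N₀ 2 + N₀ 3 + Nq
  choose ξ' hξ' hdξ using fun i => hN₀ i N (by fin_cases i <;> simp [N] <;> omega)
  obtain ⟨ω', hω', hdω⟩ := hNq (3 * N) (by omega)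
  have hsq : ω' ^ 2 = aeval ξ' F := by
    refine sub_eq_zero.1 (eq_zero_of_dehomHom (d := N * 6) (IsHomogeneous.sub ?_ (hF.aeval ξ' hξ')) ?_)
    · rw [show N * 6 = 3 * N * 2 by ring]; exact hω'.pow 2
    · rw [map_sub, map_pow, hdω, hqF, comp_aeval_apply, sub_eq_zero]
      simp only [hdξ]
  have hξ0 : ξ' 0 ≠ 0 := by
    intro h0
    have h1 := hp 0
    rw [← hdξ, h0, map_zero, map_zero] at h1
    exact hp₀0 (by simpa [y] using h1.symm)
  obtain ⟨g, hg0, hg, hgcd⟩ := RatParam.exists_gcd Finset.univ ξ' (Finset.mem_univ 0) hξ0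
  choose ξ hξ using fun i => hg i (Finset.mem_univ i)
  obtain ⟨e, M, heM, hge, -⟩ := IsHomogeneous.of_mul (hξ 0 ▸ hξ' 0) (hξ 0 ▸ hξ0)
  have hdvd : g ^ 3 ∣ ω' := by
    rw [← IsIntegrallyClosed.pow_dvd_pow_iff (n := 2) (by norm_num), hsq, funext fun i => (hξ i).trans (mul_comm _ _),
      aeval_mul_of_isHomogeneous hF]
    exact ⟨aeval ξ F, by ring⟩
  obtain ⟨ω, rfl⟩ := hdvd
  have hgd : ι (dehomHom g) ≠ 0 := (map_ne_zero_iff _ hι).2 fun h => hg0 (eq_zero_of_dehomHom hge h)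
  refine ⟨M, ξ, ω, ι p₀ / ι (dehomHom g), div_ne_zero hp₀0 hgd, fun i => ?_, ?_, ?_, ?_, fun i => ?_, ?_⟩
  · exact hge.of_mul_left hg0 (by rw [heM, ← hξ]; exact hξ' i)
  · exact (hge.pow 3).of_mul_left (pow_ne_zero 3 hg0) (by rwa [show e * 3 + 3 * M = 3 * N by omega])
  · rw [funext fun i => (hξ i).trans (mul_comm _ _), aeval_mul_of_isHomogeneous hF] at hsq
    refine mul_right_cancel₀ (pow_ne_zero 6 hg0) ?_
    rw [← hsq]; ring
  · intro p hp
    by_contra! h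
    have h1 := hgcd (g * p) 1 fun i _ => by rw [one_mul, hξ]; exact mul_dvd_mul_left g (h i)
    rw [one_mul] at h1
    exact hp.not_isUnit (isUnit_of_dvd_one ((mul_dvd_mul_iff_left hg0).1 (by simpa using h1)))
  · have h1 := hp i
    rw [← hdξ, hξ, map_mul, map_mul] at h1
    rw [mul_div_assoc', eq_div_iff hgd, ← h1, mul_comm]
  · rw [map_mul, map_pow] at hdω
    rw [div_pow, mul_div_assoc', eq_div_iff (pow_ne_zero 3 hgd), ← hq, ← hdω, map_mul, map_pow, mul_comm]

/-- Birational parametrizations give homogeneous ones. -/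
theorem nonempty_ratParam {F : Poly4} (hF : F.IsHomogeneous 6) {x : Fin 3 → CRatFunc 3} {w : CRatFunc 3}
    (hw : w ^ 2 = aeval x (dehomHom F))
    (hlin : ∀ a b : Poly3, aeval x a + w * aeval x b = 0 → a = 0 ∧ b = 0)
    {u : Fin 3 → Poly4} {v : Poly4} (hv : aeval (Fin.snoc x w : Fin 4 → CRatFunc 3) v ≠ 0)
    (huv : ∀ i, algebraMap _ (CRatFunc 3) (X i : Poly3) * aeval (Fin.snoc x w : Fin 4 → CRatFunc 3) v =
      aeval (Fin.snoc x w : Fin 4 → CRatFunc 3) (u i)) :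
    Nonempty (RatParam F) := by
  have hw' : w ^ 2 = aeval (Fin.cons 1 x : Fin 4 → CRatFunc 3) F := by rw [hw, aeval_dehomHom]
  obtain ⟨M, ξ, ω, s, hs, hξ, hω, hsq, hcop, hdξ, hdω⟩ := exists_homogeneous_param hF hw'
  let ρ : Poly4 →ₐ[ℂ] CRatFunc 3 := (IsScalarTower.toAlgHom ℂ Poly3 (CRatFunc 3)).comp dehomHom
  have hρ0 : ∀ {p : Poly4} {d : ℕ}, p.IsHomogeneous d → ρ p = 0 → p = 0 := fun hp h =>
    eq_zero_of_dehomHom hp ((map_eq_zero_iff _ (IsFractionRing.injective _ (CRatFunc 3))).1 h)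
  have hρsq : ρ ω ^ 2 = aeval (fun i => ρ (ξ i)) F := by rw [← map_pow, hsq, comp_aeval_apply]
  have key : ∀ (r : DRing F) (d : ℕ), (DRing.grading hF).Hom d r →
      ρ (DRing.evalHom ξ ω hsq r) = DRing.evalHom _ w hw' r * s ^ d := by
    intro r d hr
    rw [← DRing.evalHom_scale hF hw' hρsq hdξ hdω hr, DRing.evalHom_apply, DRing.evalHom_apply, map_add, map_mul,
      comp_aeval_apply, comp_aeval_apply]
  have hM : 0 < M := by
    by_contra h0
    obtain rfl : M = 0 := by omega
    have hC : ∀ i, ξ i = C (coeff 0 (ξ i)) := fun i =>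
      totalDegree_eq_zero_iff_eq_C.1 (Nat.le_zero.1 (hξ i).totalDegree_le)
    have hρC : ∀ i, ρ (ξ i) = algebraMap ℂ _ (coeff 0 (ξ i)) := fun i => by
      conv_lhs => rw [hC i]
      exact ρ.commutes _
    have h1 : algebraMap ℂ (CRatFunc 3) (coeff 0 (ξ 0)) = s := by
      rw [← hρC]; exact (hdξ 0).trans (by simp)
    have h2 : algebraMap ℂ (CRatFunc 3) (coeff 0 (ξ 1)) = x 0 * s := by
      rw [← hρC]; exact hdξ 1
    have h3 := (hlin (X 0 * C (coeff 0 (ξ 0)) - C (coeff 0 (ξ 1))) 0 (by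
      rw [map_zero, mul_zero, add_zero, map_sub, map_mul, aeval_X, algHom_C, algHom_C, h1, h2, sub_self])).1
    have h4 := congrArg (eval (0 : Fin 3 → ℂ)) h3
    have h5 := congrArg (eval (1 : Fin 3 → ℂ)) h3
    simp at h4 h5
    rw [h4, sub_zero] at h5
    exact hs (by rw [← h1, h5, map_zero])
  have hind : ∀ p : Poly4, aeval ξ p = 0 → p = 0 := by
    intro p hp
    rw [← sum_homogeneousComponent p]
    refine Finset.sum_eq_zero fun d _ => ?_
    have hd := homogeneousComponent_isHomogeneous d p
    have h1 := homogeneousComponent_aeval hM hξ p d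
    rw [hp, map_zero, ← DRing.evalHom_inc ξ ω hsq] at h1
    have h2 := key _ d (DRing.hom_inc hF hd)
    rw [← h1, map_zero, DRing.evalHom_inc, ← aeval_dehomHom] at h2
    have h3 := (mul_eq_zero.1 h2.symm).resolve_right (pow_ne_zero d hs)
    exact eq_zero_of_dehomHom hd (hlin _ 0 (by rw [h3, map_zero, mul_zero, add_zero])).1
  have hinj : Function.Injective (DRing.evalHom ξ ω hsq) := by
    rw [injective_iff_map_eq_zero]
    intro r hr
    have h1 : r.norm = 0 := hind _ (by
      rw [← DRing.evalHom_inc ξ ω hsq, ← RatParam.star_mul_eq, map_mul, hr, zero_mul])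
    rw [QuadraticAlgebra.norm_eq] at h1
    by_cases him : r.im = 0
    · ext1
      · simpa [him] using h1
      · exact him
    exfalso
    obtain ⟨h, hh⟩ : r.im ∣ r.re := by
      rw [← IsIntegrallyClosed.pow_dvd_pow_iff (n := 2) (by norm_num)]
      exact ⟨F, by linear_combination h1⟩
    have hFh : F = h ^ 2 := mul_right_cancel₀ (pow_ne_zero 2 him) (by rw [hh] at h1; linear_combination -h1)
    rw [hFh, map_pow, map_pow] at hw
    rcases sq_eq_sq_iff_eq_or_eq_neg.1 hw with h2 | h2
    · exact one_ne_zero (hlin (-dehomHom h) 1 (by rw [map_neg, h2, map_one]; ring)).2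
    · exact one_ne_zero (hlin (dehomHom h) 1 (by rw [h2, map_one]; ring)).2
  obtain ⟨N₀, hN₀⟩ := DRing.exists_hom_evalHom_eq hF hw' v
  choose N₁ hN₁ using fun i => DRing.exists_hom_evalHom_eq hF hw' (u i)
  let N := N₀ + N₁ 0 + N₁ 1 + N₁ 2
  obtain ⟨f₀, hf₀, he₀⟩ := hN₀ N (by omega)
  choose f hf he using fun i => hN₁ i N (by fin_cases i <;> simp [N] <;> omega)
  let Ψ := DRing.evalHom ξ ω hsq
  have hrel : ∀ i : Fin 3, X 0 * Ψ (f i) = X i.succ * Ψ f₀ := by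
    intro i
    have hhom : ∀ (j : Fin 4) (r : DRing F), (DRing.grading hF).Hom N r → (X j * Ψ r).IsHomogeneous (1 + N * M) :=
      fun j r hr => (isHomogeneous_X ℂ j).mul (DRing.Hom.evalHom hr hξ hω hsq)
    refine sub_eq_zero.1 (hρ0 ((hhom 0 _ (hf i)).sub (hhom i.succ _ hf₀)) ?_)
    have hX0 : ρ (X 0) = 1 := by simp [ρ, dehomHom]
    have hXi : ρ (X i.succ) = algebraMap _ (CRatFunc 3) (X i : Poly3) := by simp [ρ, dehomHom]
    rw [map_sub, map_mul, map_mul, hX0, hXi, key _ N (hf i), key _ N hf₀, he, he₀, ← huv]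
    ring
  have hdvd : (X 0 : Poly4) ∣ Ψ f₀ := by
    refine ((X_prime (R := ℂ) (i := (0 : Fin 4))).dvd_or_dvd ⟨_, (hrel 0).symm⟩).resolve_left ?_
    rintro ⟨t, ht⟩
    simpa using congrArg (eval (Pi.single (Fin.succ (0 : Fin 3)) (1 : ℂ))) ht
  obtain ⟨c, hc⟩ := hdvd
  refine ⟨⟨M, ξ, ω, hM, hξ, hω, hsq, hinj, hcop, N, Fin.cons f₀ f, c, hF, fun i => ?_, ?_, fun i => ?_⟩⟩
  · exact Fin.cases hf₀ hf i
  · rintro rfl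
    have := key _ N hf₀
    change ρ (Ψ f₀) = _ at this
    rw [hc, mul_zero, map_zero, he₀] at this
    exact (mul_ne_zero hv (pow_ne_zero N hs)) this.symm
  · refine Fin.cases hc (fun i => ?_) i
    have := hrel i
    rw [hc] at this
    exact mul_left_cancel₀ (X_ne_zero (0 : Fin 4)) (this.trans (by ring))

theorem card_le_of_isAlgebraic_adjoin {L : Type} [Field L] [Algebra ℂ L] {k m : ℕ} {x : Fin k → L} {t : Fin m → L}
    (ht : AlgebraicIndependent ℂ t)
    (h : ∀ l : L, ∃ u v, v ≠ 0 ∧ l * v = u ∧ IsAlgebraic (Algebra.adjoin ℂ (Set.range x)) u ∧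
      IsAlgebraic (Algebra.adjoin ℂ (Set.range x)) v) : m ≤ k := by
  have : Algebra.IsAlgebraic (Algebra.adjoin ℂ (Set.range x)) L := ⟨fun l => by
    obtain ⟨u, v, hv, he, h1, h2⟩ := h l
    rw [eq_div_of_mul_eq hv he, div_eq_mul_inv]
    exact h1.mul h2.inv⟩
  have h1 := ht.cardinalMk_le_trdeg.trans
    ((Algebra.IsAlgebraic.trdeg_le_cardinalMk ℂ (Set.range x)).trans Cardinal.mk_range_le)
  simpa using h1

theorem eq_three_of_isIntegral {m : ℕ} {x : Fin 3 → CRatFunc m} {w : CRatFunc m} {G : Poly3}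
    (hw : w ^ 2 = aeval x G) (hx : AlgebraicIndependent ℂ x)
    (hfrac : ∀ l, ∃ u v : Poly4, aeval (Fin.snoc x w : Fin 4 → CRatFunc m) v ≠ 0 ∧
      l * aeval (Fin.snoc x w : Fin 4 → CRatFunc m) v = aeval (Fin.snoc x w : Fin 4 → CRatFunc m) u) : m = 3 := by
  let t : Fin m → CRatFunc m := fun i => algebraMap (MvPolynomial (Fin m) ℂ) _ (X i)
  have ht : ∀ p : MvPolynomial (Fin m) ℂ, aeval t p = algebraMap _ (CRatFunc m) p := fun p =>
    (aeval_algebraMap_apply (CRatFunc m) (X : Fin m → MvPolynomial (Fin m) ℂ) p).trans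
      (by rw [aeval_X_left_apply])
  have hti : AlgebraicIndependent ℂ t := fun p q h => by
    rw [ht, ht] at h
    exact IsFractionRing.injective _ (CRatFunc m) h
  have hmem : ∀ {k : ℕ} (y : Fin k → CRatFunc m) (p : MvPolynomial (Fin k) ℂ),
      aeval y p ∈ Algebra.adjoin ℂ (Set.range y) := fun y p => by
    rw [Algebra.adjoin_range_eq_range_aeval]; exact ⟨p, rfl⟩
  refine le_antisymm (card_le_of_isAlgebraic_adjoin (x := x) hti fun l => ?_)
    (card_le_of_isAlgebraic_adjoin (x := t) hx fun l => ?_)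
  · obtain ⟨u, v, hv, he⟩ := hfrac l
    have hintegral : ∀ p : Poly4, IsIntegral (Algebra.adjoin ℂ (Set.range x)) (aeval (Fin.snoc x w : Fin 4 → CRatFunc m) p) := by
      intro p
      induction p using MvPolynomial.induction_on with
      | C c =>
        rw [algHom_C]
        exact isIntegral_algebraMap (x := (⟨_, Subalgebra.algebraMap_mem _ c⟩ : Algebra.adjoin ℂ (Set.range x)))
      | add p q hp hq => rw [map_add]; exact hp.add hq
      | mul_X p i hp =>
        rw [map_mul, aeval_X]
        refine hp.mul (Fin.lastCases ?_ (fun i => ?_) i)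
        · rw [Fin.snoc_last]
          refine IsIntegral.of_pow two_pos ?_
          rw [hw]
          exact isIntegral_algebraMap (x := (⟨_, hmem x G⟩ : Algebra.adjoin ℂ (Set.range x)))
        · rw [Fin.snoc_castSucc]
          exact isIntegral_algebraMap
            (x := (⟨_, Algebra.subset_adjoin ⟨i, rfl⟩⟩ : Algebra.adjoin ℂ (Set.range x)))
    exact ⟨_, _, hv, he, (hintegral u).isAlgebraic, (hintegral v).isAlgebraic⟩
  · obtain ⟨⟨u, v⟩, he⟩ := IsLocalization.surj (nonZeroDivisors (MvPolynomial (Fin m) ℂ)) l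
    have halg : ∀ p : MvPolynomial (Fin m) ℂ, IsAlgebraic (Algebra.adjoin ℂ (Set.range t)) (algebraMap _ (CRatFunc m) p) := fun p => by
      rw [← ht]
      exact isAlgebraic_algebraMap (⟨_, hmem t p⟩ : Algebra.adjoin ℂ (Set.range t))
    exact ⟨_, _, IsFractionRing.to_map_ne_zero_of_mem_nonZeroDivisors v.2, he, halg u, halg v⟩

theorem false_of_smooth_of_parametrization {F : Poly4} (hF : F.IsHomogeneous 6)
    (hsm : ∀ v : Fin 4 → ℂ, (∀ i, eval v (pderiv i F) = 0) → v = 0)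
    {m : ℕ} {x : Fin 3 → CRatFunc m} {w : CRatFunc m} (hw : w ^ 2 = aeval x (dehomHom F))
    (hlin : ∀ a b : Poly3, aeval x a + w * aeval x b = 0 → a = 0 ∧ b = 0)
    (hfrac : ∀ {k : ℕ} (l : Fin k → CRatFunc m), ∃ (u : Fin k → Poly4) (v : Poly4),
      aeval (Fin.snoc x w : Fin 4 → CRatFunc m) v ≠ 0 ∧
      ∀ i, l i * aeval (Fin.snoc x w : Fin 4 → CRatFunc m) v = aeval (Fin.snoc x w : Fin 4 → CRatFunc m) (u i)) :
    False := by
  obtain rfl : m = 3 := by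
    refine eq_three_of_isIntegral hw ?_ fun l => ?_
    · refine (injective_iff_map_eq_zero _).2 fun p hp => (hlin p 0 ?_).1
      rw [hp, map_zero, mul_zero, add_zero]
    · obtain ⟨u, v, hv, h⟩ := hfrac (fun _ : Fin 1 => l)
      exact ⟨u 0, v, hv, h 0⟩
  obtain ⟨u, v, hv, h⟩ := hfrac fun i : Fin 3 => algebraMap _ (CRatFunc 3) (X i : Poly3)
  exact (nonempty_ratParam hF hw hlin hv h).elim fun D => D.false_of_smooth hsm

/-- **Iskovskikh–Manin: non-rationality of smooth sextic double solids, field version.** If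
`F ∈ ℂ[X₀,…,X₃]` is homogeneous of degree 6 and the only common zero of its partial
derivatives is the origin, then the field of fractions of
`ℂ[x₁,x₂,x₃,w]/(w² − F(1,x₁,x₂,x₃))` is not purely transcendental over `ℂ`. -/
theorem sextic_double_solid_not_rational (F : MvPolynomial (Fin 4) ℂ)
    (hdeg : F.IsHomogeneous 6)
    (hsm : ∀ v : Fin 4 → ℂ, (∀ i, eval v (pderiv i F) = 0) → v = 0) :
    ¬ IsPurelyTranscendental
      (FractionRing (MvPolynomial (Fin 4) ℂ ⧸
        (Ideal.span {X 3 ^ 2 - rename Fin.castSucc (dehom F)}))) := by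
  rintro ⟨m, ⟨φ⟩⟩
  let I : Ideal Poly4 := Ideal.span {X 3 ^ 2 - rename Fin.castSucc (dehom F)}
  let A := Poly4 ⧸ I
  let K := FractionRing A
  let mk : Poly4 →ₐ[ℂ] A := Ideal.Quotient.mkₐ ℂ I
  let ψ : A →ₐ[ℂ] CRatFunc m := φ.toAlgHom.comp (IsScalarTower.toAlgHom ℂ A K)
  have hψ : Function.Injective ψ := φ.injective.comp (IsFractionRing.injective A K)
  have hA : Nontrivial A := ψ.toRingHom.domain_nontrivial
  let x : Fin 3 → CRatFunc m := fun i => ψ (mk (X i.castSucc))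
  let w : CRatFunc m := ψ (mk (X 3))
  have hmk : mk (X 3 ^ 2 - rename Fin.castSucc (dehom F)) = 0 :=
    Ideal.Quotient.eq_zero_iff_mem.2 (Ideal.mem_span_singleton_self _)
  have hsnoc : ∀ p, aeval (Fin.snoc x w : Fin 4 → CRatFunc m) p = ψ (mk p) := by
    intro p
    have := comp_aeval_apply (X : Fin 4 → Poly4) (ψ.comp mk) p
    rw [aeval_X_left_apply] at this
    rw [← AlgHom.comp_apply, this]
    congr 2
    funext i
    refine Fin.lastCases ?_ (fun i => ?_) i
    · rw [Fin.snoc_last]; rfl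
    · rw [Fin.snoc_castSucc]; rfl
  have hx : ∀ p, aeval x p = ψ (mk (rename Fin.castSucc p)) := by
    intro p
    rw [← hsnoc, aeval_rename]
    congr 2
    funext i
    exact (Fin.snoc_castSucc (α := fun _ => CRatFunc m) w x i).symm
  have hw : w ^ 2 = aeval x (dehomHom F) := by
    rw [hx, ← map_pow, ← map_pow, ← sub_eq_zero, ← map_sub, ← map_sub]
    exact (congrArg ψ hmk).trans (map_zero _)
  have hlin : ∀ a b : Poly3, aeval x a + w * aeval x b = 0 → a = 0 ∧ b = 0 := by
    intro a b h
    rw [hx, hx, ← map_mul, ← map_mul, ← map_add, ← map_add, map_eq_zero_iff _ hψ] at h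
    obtain ⟨z, hz⟩ := Ideal.mem_span_singleton.1 (Ideal.Quotient.eq_zero_iff_mem.1 h)
    let χ : Poly4 →ₐ[ℂ] QuadraticAlgebra Poly3 (dehom F) 0 :=
      aeval (Fin.snoc (fun i => ⟨X i, 0⟩) ⟨0, 1⟩)
    have hχ : ∀ p, χ (rename Fin.castSucc p) = ⟨p, 0⟩ := by
      intro p
      have h1 := comp_aeval_apply (X : Fin 3 → Poly3)
        (IsScalarTower.toAlgHom ℂ Poly3 (QuadraticAlgebra Poly3 (dehom F) 0)) p
      rw [aeval_X_left_apply] at h1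
      refine Eq.trans ?_ h1.symm
      rw [aeval_rename]
      congr 2
      funext i
      exact Fin.snoc_castSucc (α := fun _ => QuadraticAlgebra Poly3 (dehom F) 0) _ _ i
    have hχ3 : χ (X 3) = ⟨0, 1⟩ := (aeval_X _ _).trans
      (Fin.snoc_last (α := fun _ => QuadraticAlgebra Poly3 (dehom F) 0) _ _)
    have h1 := congrArg χ hz
    have h0 : χ (X 3 ^ 2 - rename Fin.castSucc (dehom F)) = 0 := by
      rw [map_sub, map_pow, hχ, hχ3, pow_two]
      ext1 <;> simp
    rw [map_mul, h0, zero_mul, map_add, map_mul, hχ, hχ, hχ3] at h1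
    have h2 := congrArg QuadraticAlgebra.re h1
    have h3 := congrArg QuadraticAlgebra.im h1
    simp at h2 h3
    exact ⟨h2, h3⟩
  refine false_of_smooth_of_parametrization hdeg hsm hw hlin fun {k} l => ?_
  obtain ⟨b, hb⟩ := IsLocalization.exist_integer_multiples_of_finite (nonZeroDivisors A) fun i => φ.symm (l i)
  choose a ha using hb
  choose u hu using fun i => Ideal.Quotient.mk_surjective (a i)
  obtain ⟨v, hv⟩ := Ideal.Quotient.mk_surjective (b : A)
  refine ⟨u, v, ?_, fun i => ?_⟩
  · rw [hsnoc]
    refine (map_ne_zero_iff ψ hψ).2 ?_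
    change Ideal.Quotient.mk I v ≠ 0
    rw [hv]
    exact nonZeroDivisors.ne_zero b.2
  · have h1 := congrArg φ (ha i)
    rw [Algebra.smul_def, map_mul, φ.apply_symm_apply] at h1
    rw [hsnoc, hsnoc, mul_comm]
    change φ (algebraMap A K (Ideal.Quotient.mk I v)) * _ = φ (algebraMap A K (Ideal.Quotient.mk I (u i)))
    rw [hu, hv]
    exact h1.symm
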